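/- Every planar graph of girth at least 5 is 3-choosable: if G is planar with no cycle of length less than 5, then for every list assignment L with |L(v)| ≥ 3 for all v, G has a proper L-colouring (Thomassen's girth-5 theorem). -/

import Mathlib

structure PlaneEmbedding {V : Type} (G : SimpleGraph V) where
  pos : V → ℝ × ℝ
  arc : V → V → Set.Icc (0:ℝ) 1 → ℝ × ℝ
  pos_inj : Function.Injective pos
  arc_cont : ∀ u v, G.Adj u v → Continuous (arc u v)
  arc_inj : ∀ u v, G.Adj u v → Function.Injective (arc u v)
  arc_start : ∀ u v, G.Adj u v → arc u v ⟨0, by norm_num⟩ = pos u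
  arc_end : ∀ u v, G.Adj u v → arc u v ⟨1, by norm_num⟩ = pos v
  arc_symm : ∀ u v, G.Adj u v → Set.range (arc u v) = Set.range (arc v u)
  arc_avoid : ∀ u v w, G.Adj u v → w ≠ u → w ≠ v → pos w ∉ Set.range (arc u v)
  arcs_meet_only_at_endpoints : ∀ u v x y, G.Adj u v → G.Adj x y →
    ({u, v} : Set V) ≠ {x, y} →
    Set.range (arc u v) ∩ Set.range (arc x y) ⊆ pos '' (({u, v} : Set V) ∩ {x, y})

/-- A graph is planar if it admits a drawing in the plane. -/
def SimpleGraph.IsPlanar {V : Type} (G : SimpleGraph V) : Prop := Nonempty (PlaneEmbedding G)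
/-- A proper colouring of `G` from the lists `L`. -/
def ProperListColoring {V : Type} (G : SimpleGraph V) (L : V → Finset ℕ) (φ : V → ℕ) : Prop :=
  (∀ v, φ v ∈ L v) ∧ ∀ u v, G.Adj u v → φ u ≠ φ v

open Complex in
theorem exists_continuous_log {X : Type} [TopologicalSpace X] [LocallyPathConnectedSpace X]
    [ContractibleSpace X] (g : X → ℂ) (hg : Continuous g) (h0 : ∀ x, g x ≠ 0) :
    ∃ f : X → ℂ, Continuous f ∧ ∀ x, exp (f x) = g x := by
  obtain ⟨f, hf, hf'⟩ := exists_continuousOn_eqOn_exp_comp (U := (Set.univ : Set X)) (g := g)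
    (by
      have := (Homeomorph.Set.univ X).contractibleSpace
      unfold IsSimplyConnected
      infer_instance) isOpen_univ hg.continuousOn (by
        rintro ⟨x, -, hx⟩; exact h0 x hx)
  exact ⟨f, by simpa [← continuousOn_univ] using hf, fun x => hf' (Set.mem_univ x)⟩

/-- The change of argument of `γ - p` along `[0, 1]`. -/
noncomputable def argChange (γ : ℝ → ℂ) (p : ℂ) : ℝ :=
  open Classical in
  if h : ∃ f : ℝ → ℂ, Continuous f ∧ ∀ t, Complex.exp (f t) = γ t - p then
    (h.choose 1 - h.choose 0).im else 0

theorem exp_lift_sub_eq {f g : ℝ → ℂ} (hf : Continuous f) (hg : Continuous g)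
    (h : ∀ t, Complex.exp (f t) = Complex.exp (g t)) : f 1 - f 0 = g 1 - g 0 := by
  have hd : Continuous fun t => (f t - g t) / (2 * Real.pi * Complex.I) := by fun_prop
  have hn : ∀ t, ∃ n : ℤ, (f t - g t) / (2 * Real.pi * Complex.I) = n := by
    intro t
    obtain ⟨n, hn⟩ := Complex.exp_eq_exp_iff_exists_int.1 (h t)
    refine ⟨n, ?_⟩
    have : (2 * Real.pi * Complex.I : ℂ) ≠ 0 := by simp [Real.pi_ne_zero]
    rw [hn]; field_simp; ring
  choose n hn using hn
  have hc : Continuous n := by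
    have h2 : Continuous fun t => (n t : ℂ) := by simpa only [hn] using hd
    have h3 : Topology.IsClosedEmbedding ((↑) : ℤ → ℂ) := by
      exact Complex.isClosedEmbedding_intCast
    exact h3.continuous_iff.2 h2
  have e : n 1 = n 0 := (PreconnectedSpace.constant inferInstance hc)
  have h1 := hn 1
  have h0 := hn 0
  rw [e, ← h0] at h1
  have : (2 * Real.pi * Complex.I : ℂ) ≠ 0 := by simp [Real.pi_ne_zero]
  field_simp at h1
  linear_combination h1

theorem argChange_eq {γ : ℝ → ℂ} {p : ℂ} {f : ℝ → ℂ} (hf : Continuous f)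
    (h : ∀ t, Complex.exp (f t) = γ t - p) : argChange γ p = (f 1 - f 0).im := by
  have hex : ∃ f : ℝ → ℂ, Continuous f ∧ ∀ t, Complex.exp (f t) = γ t - p := ⟨f, hf, h⟩
  rw [argChange, dif_pos hex, exp_lift_sub_eq hex.choose_spec.1 hf
    (fun t => by rw [hex.choose_spec.2, h])]

theorem argChange_exchange {γ δ : ℝ → ℂ} (hγ : Continuous γ) (hδ : Continuous δ)
    (h : ∀ s t, γ s ≠ δ t) :
    argChange γ (δ 1) - argChange γ (δ 0) = argChange δ (γ 1) - argChange δ (γ 0) := by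
  obtain ⟨f, hf, hf'⟩ := exists_continuous_log (fun x : ℝ × ℝ => γ x.1 - δ x.2) (by fun_prop)
    (fun t => sub_ne_zero.2 (h _ _))
  have h1 : ∀ t, argChange γ (δ t) = (f (1, t) - f (0, t)).im := fun t =>
    argChange_eq (f := fun s => f (s, t)) (by fun_prop) (fun s => hf' (s, t))
  have h2 : ∀ s, argChange δ (γ s) = (f (s, 1) - f (s, 0)).im := fun s => by
    rw [argChange_eq (f := fun t => f (s, t) + Real.pi * Complex.I) (by fun_prop) (fun t => by
      rw [Complex.exp_add, hf', Complex.exp_pi_mul_I]; ring)]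
    simp
  rw [h1, h1, h2, h2]
  simp; ring

/-- The integer winding of `γ` about `p` relative to the principal argument. -/
noncomputable def turn (γ : ℝ → ℂ) (p : ℂ) : ℤ :=
  round ((argChange γ p - (Complex.arg (γ 1 - p) - Complex.arg (γ 0 - p))) / (2 * Real.pi))

theorem argChange_eq_turn {γ : ℝ → ℂ} {p : ℂ} (hγ : Continuous γ) (h : ∀ t, γ t ≠ p) :
    argChange γ p = Complex.arg (γ 1 - p) - Complex.arg (γ 0 - p) + 2 * Real.pi * turn γ p := by
  obtain ⟨f, hf, hf'⟩ := exists_continuous_log (fun t => γ t - p) (by fun_prop)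
    (fun t => sub_ne_zero.2 (h t))
  have key : ∀ t, ∃ n : ℤ, (f t).im = Complex.arg (γ t - p) + 2 * Real.pi * n := by
    intro t
    have : Complex.exp (f t) = Complex.exp (Complex.log (γ t - p)) := by
      rw [hf', Complex.exp_log (sub_ne_zero.2 (h t))]
    obtain ⟨n, hn⟩ := Complex.exp_eq_exp_iff_exists_int.1 this
    refine ⟨n, ?_⟩
    rw [hn]; simp [Complex.log_im]; ring
  obtain ⟨n, hn⟩ := key 1
  obtain ⟨m, hm⟩ := key 0
  have e : argChange γ p = Complex.arg (γ 1 - p) - Complex.arg (γ 0 - p) + 2 * Real.pi * (n - m : ℤ) := by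
    rw [argChange_eq hf hf', Complex.sub_im, hn, hm]; push_cast; ring
  have : turn γ p = n - m := by
    rw [turn, e]
    have : (Complex.arg (γ 1 - p) - Complex.arg (γ 0 - p) + 2 * Real.pi * (n - m : ℤ) - (Complex.arg (γ 1 - p) - Complex.arg (γ 0 - p))) / (2 * Real.pi) = ((n - m : ℤ) : ℝ) := by
      field_simp [Real.pi_ne_zero]; ring
    rw [this, round_intCast]
  rw [e, this]

/-- Whether `x - z` has positive argument, as an integer. -/
noncomputable def argSign (x z : ℂ) : ℤ :=
  open Classical in if 0 < Complex.arg (x - z) then 1 else 0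

theorem arg_sub_eq {x z : ℂ} (h : x ≠ z) :
    Complex.arg (x - z) = Complex.arg (z - x) + Real.pi * (2 * argSign x z - 1) := by
  have h' : x - z ≠ 0 := sub_ne_zero.2 h
  have e : z - x = - (x - z) := by ring
  unfold argSign
  split_ifs with hp
  · rw [e, Complex.arg_neg_eq_arg_sub_pi_iff.2]
    · push_cast; ring
    · by_contra hc
      rw [← Complex.arg_neg_eq_arg_sub_pi_iff] at hc
      have := Complex.arg_neg_eq_arg_add_pi_iff (x := x - z)
      rcases Complex.arg_nonneg_iff.1 hp.le |>.lt_or_eq with h1 | h1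
      · exact hc (Complex.arg_neg_eq_arg_sub_pi_of_im_pos h1)
      · apply hc
        rw [Complex.arg_neg_eq_arg_sub_pi_iff]
        right
        refine ⟨h1.symm, ?_⟩
        by_contra h2
        have : Complex.arg (x - z) = 0 := Complex.arg_eq_zero_iff.2 ⟨not_lt.1 h2, h1.symm⟩
        linarith
  · rw [e, Complex.arg_neg_eq_arg_add_pi_iff.2]
    · push_cast; ring
    · rcases lt_trichotomy (x - z).im 0 with h1 | h1 | h1
      · exact Or.inl h1
      · right
        refine ⟨h1, ?_⟩
        by_contra h2
        rcases lt_or_eq_of_le (not_lt.1 h2) with h3 | h3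
        · exact hp (by rw [Complex.arg_eq_pi_iff.2 ⟨h3, h1⟩]; exact Real.pi_pos)
        · exact h' (Complex.ext h3 h1)
      · exfalso
        apply hp
        rcases (Complex.arg_nonneg_iff.2 h1.le).lt_or_eq with h2 | h2
        · exact h2
        · have := (Complex.arg_eq_zero_iff.1 h2.symm).2; linarith

theorem argSign_add_swap {x z : ℂ} (h : x ≠ z) : argSign x z + argSign z x = 1 := by
  have h1 := arg_sub_eq h
  have h2 := arg_sub_eq h.symm
  have : Real.pi * ((argSign x z + argSign z x : ℤ) - 1 : ℝ) = 0 := by push_cast; linarith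
  rcases mul_eq_zero.1 this with h3 | h3
  · exact absurd h3 Real.pi_ne_zero
  · have : ((argSign x z + argSign z x : ℤ) : ℝ) = 1 := by linarith
    exact_mod_cast this

theorem turn_exchange {γ δ : ℝ → ℂ} (hγ : Continuous γ) (hδ : Continuous δ)
    (h : ∀ s t, γ s ≠ δ t) :
    turn γ (δ 1) - turn γ (δ 0) - (turn δ (γ 1) - turn δ (γ 0)) =
      argSign (δ 1) (γ 1) - argSign (δ 0) (γ 1) - argSign (δ 1) (γ 0) + argSign (δ 0) (γ 0) := by
  have h1 := argChange_exchange hγ hδ h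
  rw [argChange_eq_turn hγ (fun t => h t 1), argChange_eq_turn hγ (fun t => h t 0),
    argChange_eq_turn hδ (fun t => (h 1 t).symm), argChange_eq_turn hδ (fun t => (h 0 t).symm),
    arg_sub_eq (h 1 1).symm, arg_sub_eq (h 1 0).symm, arg_sub_eq (h 0 1).symm,
    arg_sub_eq (h 0 0).symm] at h1
  have h2 : 2 * Real.pi * ((turn γ (δ 1) - turn γ (δ 0) - (turn δ (γ 1) - turn δ (γ 0)) : ℤ) -
      (argSign (δ 1) (γ 1) - argSign (δ 0) (γ 1) - argSign (δ 1) (γ 0) + argSign (δ 0) (γ 0) : ℤ) : ℝ)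
      = 0 := by push_cast; linarith
  rcases mul_eq_zero.1 h2 with h3 | h3
  · exact absurd h3 (by positivity)
  · exact_mod_cast sub_eq_zero.1 h3

namespace PlaneEmbedding

variable {V : Type} {G : SimpleGraph V} (E : PlaneEmbedding G)

/-- The drawing of the edge `e`, as a curve in `ℂ` parametrized by `[0, 1]`. -/
noncomputable def edgeCurve (e : Sym2 V) (t : ℝ) : ℂ :=
  Complex.equivRealProdCLM.symm (E.arc e.out.1 e.out.2 (Set.projIcc 0 1 zero_le_one t))

/-- The point of the plane that represents a vertex or the midpoint of an edge. -/
noncomputable def point : V ⊕ Sym2 V → ℂ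
  | .inl v => Complex.equivRealProdCLM.symm (E.pos v)
  | .inr e => E.edgeCurve e (1 / 2)

open Classical in
/-- The half of the edge `e` that runs from its end `v` to its midpoint. -/
noncomputable def halfEdge (v : V) (e : Sym2 V) (t : ℝ) : ℂ :=
  if v = e.out.1 then E.edgeCurve e (Set.projIcc (0 : ℝ) 1 zero_le_one t / 2)
  else E.edgeCurve e (1 - Set.projIcc (0 : ℝ) 1 zero_le_one t / 2)

theorem adj_out {e : Sym2 V} (he : e ∈ G.edgeSet) : G.Adj e.out.1 e.out.2 := by
  have : s(e.out.1, e.out.2) = e := e.out_eq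
  rw [← this] at he
  exact he

theorem mem_out {e : Sym2 V} {v : V} : v ∈ e ↔ v = e.out.1 ∨ v = e.out.2 := by
  conv_lhs => rw [show e = s(e.out.1, e.out.2) from e.out_eq.symm]
  exact Sym2.mem_iff

theorem continuous_edgeCurve {e : Sym2 V} (he : e ∈ G.edgeSet) : Continuous (E.edgeCurve e) :=
  Complex.equivRealProdCLM.symm.continuous.comp
    ((E.arc_cont _ _ (adj_out he)).comp continuous_projIcc)

theorem edgeCurve_zero {e : Sym2 V} (he : e ∈ G.edgeSet) :
    E.edgeCurve e 0 = E.point (.inl e.out.1) := by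
  simp only [edgeCurve, point, Set.projIcc_left]
  rw [E.arc_start _ _ (adj_out he)]

theorem edgeCurve_one {e : Sym2 V} (he : e ∈ G.edgeSet) :
    E.edgeCurve e 1 = E.point (.inl e.out.2) := by
  simp only [edgeCurve, point, Set.projIcc_right]
  rw [E.arc_end _ _ (adj_out he)]

theorem edgeCurve_inj {e : Sym2 V} (he : e ∈ G.edgeSet) {s t : ℝ} (hs : s ∈ Set.Icc (0 : ℝ) 1)
    (ht : t ∈ Set.Icc (0 : ℝ) 1) (h : E.edgeCurve e s = E.edgeCurve e t) : s = t := by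
  have := E.arc_inj _ _ (adj_out he) (Complex.equivRealProdCLM.symm.injective h)
  rw [Set.projIcc_of_mem _ hs, Set.projIcc_of_mem _ ht] at this
  simpa using this

theorem edgeCurve_ne_vertex {e : Sym2 V} (he : e ∈ G.edgeSet) {z : V} (hz : z ∉ e) (t : ℝ) :
    E.edgeCurve e t ≠ E.point (.inl z) := by
  intro h
  rw [mem_out, not_or] at hz
  exact E.arc_avoid _ _ z (adj_out he) hz.1 hz.2 ⟨_, Complex.equivRealProdCLM.symm.injective h⟩

theorem edgeCurve_meet {e f : Sym2 V} (he : e ∈ G.edgeSet) (hf : f ∈ G.edgeSet) (hef : e ≠ f)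
    {s t : ℝ} (h : E.edgeCurve e s = E.edgeCurve f t) :
    ∃ v, v ∈ e ∧ v ∈ f ∧ E.edgeCurve e s = E.point (.inl v) := by
  have hne : ({e.out.1, e.out.2} : Set V) ≠ {f.out.1, f.out.2} := by
    intro hc
    apply hef
    rw [show e = s(e.out.1, e.out.2) from e.out_eq.symm,
      show f = s(f.out.1, f.out.2) from f.out_eq.symm]
    ext x
    simpa using Set.ext_iff.1 hc x
  obtain ⟨v, ⟨hv1, hv2⟩, hv⟩ := E.arcs_meet_only_at_endpoints _ _ _ _ (adj_out he) (adj_out hf) hne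
    ⟨⟨_, rfl⟩, ⟨_, (Complex.equivRealProdCLM.symm.injective h).symm⟩⟩
  exact ⟨v, mem_out.2 hv1, mem_out.2 hv2, by rw [edgeCurve, ← hv]; rfl⟩

theorem point_inl_inj {u v : V} (h : E.point (.inl u) = E.point (.inl v)) : u = v :=
  E.pos_inj (Complex.equivRealProdCLM.symm.injective h)

theorem edgeCurve_ne_point {e : Sym2 V} (he : e ∈ G.edgeSet) {t : ℝ} (h0 : 0 < t) (h1 : t < 1)
    (z : V) : E.edgeCurve e t ≠ E.point (.inl z) := by
  intro h
  by_cases hz : z ∈ e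
  · rcases mem_out.1 hz with rfl | rfl
    · rw [← E.edgeCurve_zero he] at h
      have := E.edgeCurve_inj he ⟨h0.le, h1.le⟩ (by simp) h
      linarith
    · rw [← E.edgeCurve_one he] at h
      have := E.edgeCurve_inj he ⟨h0.le, h1.le⟩ (by simp) h
      linarith
  · exact E.edgeCurve_ne_vertex he hz t h

theorem edgeCurve_ne_edgeCurve {e f : Sym2 V} (he : e ∈ G.edgeSet) (hf : f ∈ G.edgeSet)
    (hef : e ≠ f) {s : ℝ} (h0 : 0 < s) (h1 : s < 1) (t : ℝ) :
    E.edgeCurve e s ≠ E.edgeCurve f t := by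
  intro h
  obtain ⟨v, -, -, hv⟩ := E.edgeCurve_meet he hf hef h
  exact E.edgeCurve_ne_point he h0 h1 v hv

theorem continuous_halfEdge {e : Sym2 V} (he : e ∈ G.edgeSet) (v : V) :
    Continuous (E.halfEdge v e) := by
  have hc : Continuous fun t : ℝ => ((Set.projIcc (0 : ℝ) 1 zero_le_one t : Set.Icc (0:ℝ) 1) : ℝ) :=
    continuous_subtype_val.comp continuous_projIcc
  have := E.continuous_edgeCurve he
  unfold halfEdge
  split_ifs
  · exact this.comp (hc.div_const 2)
  · exact this.comp (continuous_const.sub (hc.div_const 2))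

theorem halfEdge_zero {e : Sym2 V} (he : e ∈ G.edgeSet) {v : V} (hv : v ∈ e) :
    E.halfEdge v e 0 = E.point (.inl v) := by
  unfold halfEdge
  split_ifs with h
  · simp [h, E.edgeCurve_zero he]
  · obtain rfl := (mem_out.1 hv).resolve_left h
    simp [E.edgeCurve_one he]

theorem halfEdge_one (v : V) (e : Sym2 V) : E.halfEdge v e 1 = E.point (.inr e) := by
  unfold halfEdge point
  split_ifs with h
  · simp
  · simp; norm_num

/-- Every point of a half-edge is its vertex or an inner point of the edge. -/
theorem halfEdge_cases {e : Sym2 V} (he : e ∈ G.edgeSet) {v : V} (hv : v ∈ e) (t : ℝ) :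
    E.halfEdge v e t = E.point (.inl v) ∨ ∃ s, 0 < s ∧ s < 1 ∧ E.halfEdge v e t = E.edgeCurve e s := by
  have hp := (Set.projIcc (0 : ℝ) 1 zero_le_one t).2
  rcases hp.1.eq_or_lt with h0 | h0
  · left
    rw [← E.halfEdge_zero he hv]
    simp [halfEdge, ← h0]
  · right
    have h1 := hp.2
    unfold halfEdge
    split_ifs with h
    · exact ⟨_, by linarith, by linarith, rfl⟩
    · exact ⟨_, by linarith, by linarith, rfl⟩

theorem point_inr_ne_inl {e : Sym2 V} (he : e ∈ G.edgeSet) (v : V) :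
    E.point (.inr e) ≠ E.point (.inl v) :=
  E.edgeCurve_ne_point he (by norm_num) (by norm_num) v

theorem halfEdge_ne_inl {e : Sym2 V} (he : e ∈ G.edgeSet) {v : V} (hv : v ∈ e) {z : V}
    (hz : z ≠ v) (t : ℝ) : E.halfEdge v e t ≠ E.point (.inl z) := by
  intro h
  rcases E.halfEdge_cases he hv t with h1 | ⟨s, h0, h1, hs⟩
  · exact hz (E.point_inl_inj (h.symm.trans h1))
  · exact E.edgeCurve_ne_point he h0 h1 z (hs.symm.trans h)

theorem halfEdge_ne_halfEdge {e f : Sym2 V} (he : e ∈ G.edgeSet) (hf : f ∈ G.edgeSet) {u v : V}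
    (hu : u ∈ e) (hv : v ∈ f) (huv : u ≠ v) (hef : e ≠ f) (s t : ℝ) :
    E.halfEdge u e s ≠ E.halfEdge v f t := by
  intro h
  rcases E.halfEdge_cases he hu s with h1 | ⟨a, h0, h1, ha⟩
  · exact E.halfEdge_ne_inl hf hv huv t (h.symm.trans h1)
  · rcases E.halfEdge_cases hf hv t with h2 | ⟨b, h2, h3, hb⟩
    · exact E.edgeCurve_ne_point he h0 h1 v (ha.symm.trans (h.trans h2))
    · exact E.edgeCurve_ne_edgeCurve he hf hef h0 h1 b (ha.symm.trans (h.trans hb))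

theorem point_ne {x z : V ⊕ Sym2 V} (hx : ∀ e, x = .inr e → e ∈ G.edgeSet)
    (hz : ∀ e, z = .inr e → e ∈ G.edgeSet) (h : x ≠ z) : E.point x ≠ E.point z := by
  rcases x with u | e <;> rcases z with v | f
  · exact fun h' => h (by rw [E.point_inl_inj h'])
  · exact (E.point_inr_ne_inl (hz f rfl) u).symm
  · exact E.point_inr_ne_inl (hx e rfl) v
  · exact E.edgeCurve_ne_edgeCurve (hx e rfl) (hz f rfl) (fun h' => h (by rw [h'])) (by norm_num)
      (by norm_num) _

/-- The parity of the winding of the half-edge from `v` to the midpoint of `e` about `z`. -/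
noncomputable def halfTurn (v : V) (e : Sym2 V) (z : V ⊕ Sym2 V) : ZMod 2 :=
  (turn (E.halfEdge v e) (E.point z) : ℤ)

/-- Parity version of `argSign` for points of the drawing. -/
noncomputable def side (x z : V ⊕ Sym2 V) : ZMod 2 := (argSign (E.point x) (E.point z) : ℤ)

theorem side_add_swap {x z : V ⊕ Sym2 V} (hx : ∀ e, x = .inr e → e ∈ G.edgeSet)
    (hz : ∀ e, z = .inr e → e ∈ G.edgeSet) (h : x ≠ z) : E.side x z + E.side z x = 1 := by
  unfold side
  rw [← Int.cast_add, argSign_add_swap (E.point_ne hx hz h), Int.cast_one]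

theorem halfTurn_exchange {e f : Sym2 V} (he : e ∈ G.edgeSet) (hf : f ∈ G.edgeSet) {u v : V}
    (hu : u ∈ e) (hv : v ∈ f) (huv : u ≠ v) (hef : e ≠ f) :
    E.halfTurn u e (.inl v) + E.halfTurn u e (.inr f) + E.halfTurn v f (.inl u) +
        E.halfTurn v f (.inr e) =
      E.side (.inl u) (.inl v) + E.side (.inl u) (.inr f) + E.side (.inr e) (.inl v) +
        E.side (.inr e) (.inr f) := by
  have h := turn_exchange (E.continuous_halfEdge hf v) (E.continuous_halfEdge he u)
    (E.halfEdge_ne_halfEdge hf he hv hu huv.symm hef.symm)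
  rw [E.halfEdge_zero he hu, E.halfEdge_zero hf hv, E.halfEdge_one, E.halfEdge_one] at h
  have h2 := congrArg (fun n : ℤ => (n : ZMod 2)) h
  simp only [Int.cast_sub, Int.cast_add, CharTwo.sub_eq_add] at h2
  unfold halfTurn side
  linear_combination h2

end PlaneEmbedding

/-- The sum of `f a b` over the consecutive entries `a, b` of a list. -/
def chainSum {α M : Type*} [AddCommMonoid M] (f : α → α → M) : List α → M
  | [] => 0
  | [_] => 0
  | a :: b :: l => f a b + chainSum f (b :: l)

section chainSum

variable {α M : Type*} [AddCommMonoid M] (f : α → α → M)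

@[simp] theorem chainSum_nil : chainSum f [] = 0 := rfl
@[simp] theorem chainSum_singleton (a : α) : chainSum f [a] = 0 := rfl
@[simp] theorem chainSum_cons_cons (a b : α) (l : List α) :
    chainSum f (a :: b :: l) = f a b + chainSum f (b :: l) := rfl

theorem chainSum_append (l₁ : List α) (a : α) (l₂ : List α) :
    chainSum f (l₁ ++ a :: l₂) = chainSum f (l₁ ++ [a]) + chainSum f (a :: l₂) := by
  induction l₁ with
  | nil => simp
  | cons b l ih =>
    cases l with
    | nil => simp
    | cons c l => simp only [List.cons_append, chainSum_cons_cons] at ih ⊢; rw [ih, add_assoc]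

theorem chainSum_reverse (hf : ∀ a b, f a b = f b a) (l : List α) :
    chainSum f l.reverse = chainSum f l := by
  induction l with
  | nil => rfl
  | cons a l ih =>
    cases l with
    | nil => rfl
    | cons b l =>
      rw [List.reverse_cons, List.reverse_cons, List.append_assoc, List.singleton_append,
        chainSum_append, ← List.reverse_cons, ih]
      simp [hf, add_comm]

end chainSum

/-- The edges between consecutive entries of a list of vertices. -/
def listEdges {V : Type*} : List V → List (Sym2 V)
  | [] => []
  | [_] => []
  | a :: b :: l => s(a, b) :: listEdges (b :: l)

namespace PlaneEmbedding

variable {V : Type} {G : SimpleGraph V} (E : PlaneEmbedding G)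

/-- The change of argument about `p` along a walk, given as the list of its vertices. -/
noncomputable def walkArgChange (l : List V) (p : ℂ) : ℝ :=
  chainSum (fun u v => argChange (E.halfEdge u s(u, v)) p - argChange (E.halfEdge v s(u, v)) p) l

/-- The parity of the winding of the edge `uv` about `z`. -/
noncomputable def edgeTurn (u v : V) (z : V ⊕ Sym2 V) : ZMod 2 :=
  E.halfTurn u s(u, v) z + E.halfTurn v s(u, v) z

/-- The parity of the winding of a walk about `z`. -/
noncomputable def walkTurn (l : List V) (z : V ⊕ Sym2 V) : ZMod 2 :=
  chainSum (fun u v => E.edgeTurn u v z) l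

theorem walkArgChange_eq (l : List V) (a : V) (z : V ⊕ Sym2 V)
    (hl : ∀ e ∈ listEdges (a :: l), e ∈ G.edgeSet ∧ ∀ v ∈ e, ∀ t, E.halfEdge v e t ≠ E.point z) :
    ∃ n : ℤ, E.walkArgChange (a :: l) (E.point z) =
      Complex.arg (E.point (.inl (l.getLastD a)) - E.point z)
        - Complex.arg (E.point (.inl a) - E.point z) + 2 * Real.pi * n ∧
      E.walkTurn (a :: l) z = n := by
  induction l generalizing a with
  | nil => exact ⟨0, by simp [walkArgChange, walkTurn]⟩
  | cons b l ih =>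
    obtain ⟨n, hn, hn'⟩ := ih b (fun e he => hl e (List.mem_cons_of_mem _ he))
    obtain ⟨he, hz⟩ := hl s(a, b) (by simp [listEdges])
    have ha := argChange_eq_turn (E.continuous_halfEdge he a) (hz a (by simp))
    have hb := argChange_eq_turn (E.continuous_halfEdge he b) (hz b (by simp))
    rw [E.halfEdge_one, E.halfEdge_zero he (by simp)] at ha hb
    refine ⟨turn (E.halfEdge a s(a, b)) (E.point z) - turn (E.halfEdge b s(a, b)) (E.point z) + n,
      ?_, ?_⟩
    · rw [List.getLastD_cons]
      unfold walkArgChange at hn ⊢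
      rw [chainSum_cons_cons, hn, ha, hb]
      push_cast
      ring
    · unfold walkTurn at hn' ⊢
      rw [chainSum_cons_cons, hn', edgeTurn, halfTurn, halfTurn]
      push_cast
      rw [CharTwo.sub_eq_add]

theorem walkArgChange_sub (l : List V) (a : V) {δ : ℝ → ℂ} (hδ : Continuous δ)
    (hl : ∀ e ∈ listEdges (a :: l), e ∈ G.edgeSet ∧ ∀ v ∈ e, ∀ s t, E.halfEdge v e s ≠ δ t) :
    E.walkArgChange (a :: l) (δ 1) - E.walkArgChange (a :: l) (δ 0) =
      argChange δ (E.point (.inl (l.getLastD a))) - argChange δ (E.point (.inl a)) := by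
  induction l generalizing a with
  | nil => simp [walkArgChange]
  | cons b l ih =>
    have hn := ih b (fun e he => hl e (List.mem_cons_of_mem _ he))
    obtain ⟨he, hz⟩ := hl s(a, b) (by simp [listEdges])
    have ha := argChange_exchange (E.continuous_halfEdge he a) hδ (hz a (by simp))
    have hb := argChange_exchange (E.continuous_halfEdge he b) hδ (hz b (by simp))
    rw [E.halfEdge_one, E.halfEdge_zero he (by simp)] at ha hb
    rw [List.getLastD_cons]
    unfold walkArgChange at hn ⊢
    rw [chainSum_cons_cons, chainSum_cons_cons]
    linarith

end PlaneEmbedding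

theorem argChange_of_norm_lt {γ : ℝ → ℂ} (hγ : Continuous γ) {q : ℂ} (h : ∀ t, ‖γ t‖ < ‖q‖) :
    argChange γ q = (Complex.log (1 - γ 1 / q) - Complex.log (1 - γ 0 / q)).im := by
  have hq : q ≠ 0 := by
    rintro rfl
    have := (norm_nonneg _).trans_lt (h 0)
    simp at this
  have hs : ∀ t, 1 - γ t / q ∈ Complex.slitPlane := by
    intro t
    left
    have h1 : ‖γ t / q‖ < 1 := by
      rw [norm_div, div_lt_one (norm_pos_iff.2 hq)]; exact h t
    have h2 := (Complex.re_le_norm (γ t / q))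
    simp only [Complex.sub_re, Complex.one_re]
    linarith
  rw [argChange_eq (f := fun t => Complex.log (1 - γ t / q) + Complex.log (-q))]
  · simp
  · have : Continuous fun t => 1 - γ t / q := by fun_prop
    exact (this.clog hs).add continuous_const
  · intro t
    rw [Complex.exp_add, Complex.exp_log (Complex.slitPlane_ne_zero (hs t)),
      Complex.exp_log (neg_ne_zero.2 hq)]
    field_simp
    ring

namespace PlaneEmbedding

variable {V : Type} {G : SimpleGraph V} (E : PlaneEmbedding G)

theorem walkArgChange_of_norm_lt (l : List V) (a : V) {q : ℂ}
    (hl : ∀ e ∈ listEdges (a :: l), e ∈ G.edgeSet ∧ ∀ v ∈ e, ∀ t, ‖E.halfEdge v e t‖ < ‖q‖) :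
    E.walkArgChange (a :: l) q =
      (Complex.log (1 - E.point (.inl (l.getLastD a)) / q)
        - Complex.log (1 - E.point (.inl a) / q)).im := by
  induction l generalizing a with
  | nil => simp [walkArgChange]
  | cons b l ih =>
    have hn := ih b (fun e he => hl e (List.mem_cons_of_mem _ he))
    obtain ⟨he, hz⟩ := hl s(a, b) (by simp [listEdges])
    have ha := argChange_of_norm_lt (E.continuous_halfEdge he a) (hz a (by simp))
    have hb := argChange_of_norm_lt (E.continuous_halfEdge he b) (hz b (by simp))
    rw [E.halfEdge_one, E.halfEdge_zero he (by simp)] at ha hb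
    rw [List.getLastD_cons]
    unfold walkArgChange at hn ⊢
    rw [chainSum_cons_cons, hn, ha, hb]
    simp only [Complex.sub_im]
    ring

theorem halfEdge_mem_range (v : V) (e : Sym2 V) (t : ℝ) :
    E.halfEdge v e t ∈ Set.range (E.edgeCurve e) := by
  unfold halfEdge
  split_ifs <;> exact ⟨_, rfl⟩

theorem isCompact_range_edgeCurve {e : Sym2 V} (he : e ∈ G.edgeSet) :
    IsCompact (Set.range (E.edgeCurve e)) := by
  have : Set.range (E.edgeCurve e) = E.edgeCurve e '' Set.Icc 0 1 := by
    ext x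
    constructor
    · rintro ⟨t, rfl⟩
      refine ⟨Set.projIcc (0 : ℝ) 1 zero_le_one t, Subtype.coe_prop _, ?_⟩
      simp [edgeCurve]
    · rintro ⟨t, -, rfl⟩
      exact ⟨t, rfl⟩
  rw [this]
  exact isCompact_Icc.image (E.continuous_edgeCurve he)

/-- Some edge of a nonempty finite set of edges meets the boundary of the face around the point
`q`. -/
theorem exists_edge_closure_face [Finite V] {F : Set (Sym2 V)} (hF : F ⊆ G.edgeSet)
    (hne : F.Nonempty) {q : ℂ} (hq : ∀ e ∈ F, q ∉ Set.range (E.edgeCurve e)) :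
    ∃ e ∈ F, ∃ s : ℝ, 0 < s ∧ s < 1 ∧
      E.edgeCurve e s ∈ closure (pathComponentIn (⋃ e ∈ F, Set.range (E.edgeCurve e))ᶜ q) := by
  by_contra! hcon
  set X := ⋃ e ∈ F, Set.range (E.edgeCurve e) with hX
  have hXc : IsClosed X :=
    (F.toFinite.isCompact_biUnion fun e he => E.isCompact_range_edgeCurve (hF he)).isClosed
  have hqX : q ∈ Xᶜ := by simpa [hX] using hq
  set U := pathComponentIn Xᶜ q with hU
  have hUo : IsOpen U := hXc.isOpen_compl.pathComponentIn q
  set S : Set ℂ := X ∩ Set.range (fun v => E.point (.inl v)) with hS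
  have hSf : S.Countable := ((Set.finite_range _).subset Set.inter_subset_right).countable
  have hconn : IsPreconnected Sᶜ :=
    (hSf.isConnected_compl_of_one_lt_rank (by rw [Complex.rank_real_complex]; norm_num)).isPreconnected
  have hUX : U ⊆ Xᶜ := pathComponentIn_subset
  have hSX : Xᶜ ⊆ Sᶜ := Set.compl_subset_compl.2 Set.inter_subset_left
  have hcover : Sᶜ ⊆ U ∪ (closure U)ᶜ := by
    intro y hy
    by_cases hyU : y ∈ closure U
    · left
      by_cases hyX : y ∈ X
      · exfalso
        simp only [hX, Set.mem_iUnion] at hyX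
        obtain ⟨e, he, t, rfl⟩ := hyX
        have ht : E.edgeCurve e t = E.edgeCurve e (Set.projIcc (0 : ℝ) 1 zero_le_one t) := by
          simp [edgeCurve]
        have hmem : E.edgeCurve e t ∈ X := Set.mem_biUnion he ⟨t, rfl⟩
        have hp := (Set.projIcc (0 : ℝ) 1 zero_le_one t).2
        rcases hp.1.eq_or_lt with h0 | h0
        · refine hy ⟨hmem, e.out.1, ?_⟩
          rw [ht, ← h0, E.edgeCurve_zero (hF he)]
        rcases hp.2.eq_or_lt with h1 | h1
        · refine hy ⟨hmem, e.out.2, ?_⟩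
          rw [ht, h1, E.edgeCurve_one (hF he)]
        exact hcon e he _ h0 h1 (ht ▸ hyU)
      · have ho : IsOpen (pathComponentIn Xᶜ y) := hXc.isOpen_compl.pathComponentIn y
        obtain ⟨z, hz1, hz2⟩ := mem_closure_iff.1 hyU _ ho (mem_pathComponentIn_self hyX)
        exact JoinedIn.trans hz2 (JoinedIn.symm hz1)
    · exact Or.inr hyU
  obtain ⟨e, he⟩ := hne
  obtain ⟨y, -, hy1, hy2⟩ := hconn U (closure U)ᶜ hUo isClosed_closure.isOpen_compl hcover
    ⟨q, hSX hqX, mem_pathComponentIn_self hqX⟩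
    ⟨E.edgeCurve e (1 / 2), fun h => by
      obtain ⟨-, v, hv⟩ := h
      exact E.edgeCurve_ne_point (hF he) (by norm_num) (by norm_num) v hv.symm,
      hcon e he _ (by norm_num) (by norm_num)⟩
  exact hy2 (subset_closure hy1)

/-- The point `q` and the midpoint of some edge in `F` have the same winding with respect to all
closed walks through the other edges of `F`. -/
theorem exists_edge_walkArgChange_eq [Finite V] {F : Set (Sym2 V)} (hF : F ⊆ G.edgeSet)
    (hne : F.Nonempty) {q : ℂ} (hq : ∀ e ∈ F, q ∉ Set.range (E.edgeCurve e)) :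
    ∃ e ∈ F, ∀ (a : V) (l : List V), l.getLastD a = a →
      (∀ f ∈ listEdges (a :: l), f ∈ F ∧ f ≠ e) →
      E.walkArgChange (a :: l) (E.point (.inr e)) = E.walkArgChange (a :: l) q := by
  obtain ⟨e, he, s, h0, h1, hs⟩ := E.exists_edge_closure_face hF hne hq
  refine ⟨e, he, fun a l hlast hl => ?_⟩
  set X := ⋃ f ∈ F \ {e}, Set.range (E.edgeCurve f) with hX
  have hXc : IsClosed X :=
    ((F \ {e}).toFinite.isCompact_biUnion fun f hf =>
      E.isCompact_range_edgeCurve (hF hf.1)).isClosed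
  have hin : ∀ s : ℝ, 0 < s → s < 1 → E.edgeCurve e s ∈ Xᶜ := by
    intro s h0 h1 h
    simp only [hX, Set.mem_iUnion] at h
    obtain ⟨f, hf, t, ht⟩ := h
    exact E.edgeCurve_ne_edgeCurve (hF he) (hF hf.1) (Ne.symm hf.2) h0 h1 t ht.symm
  have hj1 : JoinedIn Xᶜ (E.point (.inr e)) (E.edgeCurve e s) := by
    refine JoinedIn.ofLine (f := fun t => E.edgeCurve e (1 / 2 + t * (s - 1 / 2))) ?_ ?_ ?_ ?_
    · exact ((E.continuous_edgeCurve (hF he)).comp (by fun_prop)).continuousOn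
    · simp [point]
    · simp
    · rintro _ ⟨t, ⟨ht0, ht1⟩, rfl⟩
      apply hin <;> nlinarith
  obtain ⟨ε, hε, hball⟩ := Metric.isOpen_iff.1 hXc.isOpen_compl _ (hin s h0 h1)
  obtain ⟨u, hu1, hu2⟩ := mem_closure_iff.1 hs _ Metric.isOpen_ball (Metric.mem_ball_self hε)
  have hj2 : JoinedIn Xᶜ (E.edgeCurve e s) u := by
    have := (convex_ball (E.edgeCurve e s) ε).isPathConnected ⟨u, hu1⟩
    exact (this.joinedIn _ (Metric.mem_ball_self hε) _ hu1).mono hball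
  have hj3 : JoinedIn Xᶜ u q := by
    refine (JoinedIn.symm hu2).mono (Set.compl_subset_compl.2 ?_)
    exact Set.biUnion_subset_biUnion_left Set.sdiff_subset
  obtain ⟨γ, hγ⟩ := (hj1.trans hj2).trans hj3
  have hγ' : ∀ t, γ.extend t ∈ Xᶜ := fun t => hγ _
  have hA := E.walkArgChange_sub l a γ.continuous_extend fun f hf => by
    obtain ⟨hfF, hfe⟩ := hl f hf
    refine ⟨hF hfF, fun v _ s t h => hγ' t ?_⟩
    rw [← h]
    exact Set.mem_biUnion (show f ∈ F \ {e} from ⟨hfF, hfe⟩) (E.halfEdge_mem_range v f s)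
  rw [γ.extend_zero, γ.extend_one, hlast, sub_self] at hA
  exact (sub_eq_zero.1 hA).symm

theorem walkTurn_eq_of_walkArgChange_eq {a : V} {l : List V} (hc : l.getLastD a = a)
    {z : V ⊕ Sym2 V} {n : ℤ} (h : E.walkArgChange (a :: l) (E.point z) = 2 * Real.pi * n)
    (hl : ∀ e ∈ listEdges (a :: l), e ∈ G.edgeSet ∧ E.point z ∉ Set.range (E.edgeCurve e)) :
    E.walkTurn (a :: l) z = n := by
  obtain ⟨m, hm, hm'⟩ := E.walkArgChange_eq l a z (fun f hf => ⟨(hl f hf).1,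
    fun v _ t h => (hl f hf).2 (h ▸ E.halfEdge_mem_range v f t)⟩)
  rw [hc, sub_self, zero_add, h] at hm
  have h1 : 2 * Real.pi * ((n : ℝ) - m) = 0 := by linarith
  rcases mul_eq_zero.1 h1 with h3 | h3
  · exact absurd h3 (by positivity)
  · have : n = m := by exact_mod_cast sub_eq_zero.1 h3
    rw [hm', this]

theorem walkArgChange_eq_walkTurn {a : V} {l : List V} (hc : l.getLastD a = a)
    {z : V ⊕ Sym2 V}
    (hl : ∀ e ∈ listEdges (a :: l), e ∈ G.edgeSet ∧ E.point z ∉ Set.range (E.edgeCurve e)) :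
    ∃ n : ℤ, E.walkArgChange (a :: l) (E.point z) = 2 * Real.pi * n ∧ E.walkTurn (a :: l) z = n := by
  obtain ⟨m, hm, hm'⟩ := E.walkArgChange_eq l a z (fun f hf => ⟨(hl f hf).1,
    fun v _ t h => (hl f hf).2 (h ▸ E.halfEdge_mem_range v f t)⟩)
  rw [hc, sub_self, zero_add] at hm
  exact ⟨m, hm, hm'⟩

theorem inr_notMem_range {e f : Sym2 V} (he : e ∈ G.edgeSet) (hf : f ∈ G.edgeSet) (h : e ≠ f) :
    E.point (.inr e) ∉ Set.range (E.edgeCurve f) := by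
  rintro ⟨t, ht⟩
  exact E.edgeCurve_ne_edgeCurve he hf h (by norm_num) (by norm_num) t ht.symm

/-- Every nonempty finite set of edges contains an edge that is not separated from infinity by
the others. -/
theorem exists_outer_edge [Finite V] {F : Set (Sym2 V)} (hF : F ⊆ G.edgeSet) (hne : F.Nonempty) :
    ∃ e ∈ F, ∀ (a : V) (l : List V), l.getLastD a = a →
      (∀ f ∈ listEdges (a :: l), f ∈ F ∧ f ≠ e) → E.walkTurn (a :: l) (.inr e) = 0 := by
  have hbdd : Bornology.IsBounded (⋃ e ∈ F, Set.range (E.edgeCurve e)) :=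
    (F.toFinite.isCompact_biUnion fun e he => E.isCompact_range_edgeCurve (hF he)).isBounded
  obtain ⟨R, hR⟩ := hbdd.exists_norm_le
  set q : ℂ := ((|R| + 1 : ℝ) : ℂ) with hq
  have hqn : ‖q‖ = |R| + 1 := by rw [hq, Complex.norm_real, Real.norm_of_nonneg (by positivity)]
  have hfar : ∀ e ∈ F, ∀ t, ‖E.edgeCurve e t‖ < ‖q‖ := by
    intro e he t
    have := hR _ (Set.mem_biUnion he ⟨t, rfl⟩)
    rw [hqn]
    linarith [le_abs_self R]
  obtain ⟨e, he, h⟩ := E.exists_edge_walkArgChange_eq hF hne (q := q) (by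
    rintro e he ⟨t, ht⟩
    have := hfar e he t
    rw [ht] at this
    exact lt_irrefl _ this)
  refine ⟨e, he, fun a l hlast hl => ?_⟩
  have hB := E.walkArgChange_of_norm_lt l a (q := q) (fun f hf => ⟨hF (hl f hf).1, fun v _ t => by
    obtain ⟨s, hs⟩ := E.halfEdge_mem_range v f t
    rw [← hs]
    exact hfar f (hl f hf).1 s⟩)
  rw [hlast, sub_self, Complex.zero_im] at hB
  have := E.walkTurn_eq_of_walkArgChange_eq (n := 0) hlast (z := .inr e)
    (by rw [h a l hlast hl, hB]; simp)
    (fun f hf => ⟨hF (hl f hf).1, E.inr_notMem_range (hF he) (hF (hl f hf).1) (hl f hf).2.symm⟩)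
  simpa using this

/-- For every point `z` off a nonempty finite set of edges, some edge of the set is separated from
`z` by no closed walk through the other edges. -/
theorem exists_face_edge [Finite V] {F : Set (Sym2 V)} (hF : F ⊆ G.edgeSet) (hne : F.Nonempty)
    {z : V ⊕ Sym2 V} (hz : ∀ e ∈ F, E.point z ∉ Set.range (E.edgeCurve e)) :
    ∃ e ∈ F, ∀ (a : V) (l : List V), l.getLastD a = a →
      (∀ f ∈ listEdges (a :: l), f ∈ F ∧ f ≠ e) →
      E.walkTurn (a :: l) z = E.walkTurn (a :: l) (.inr e) := by
  obtain ⟨e, he, h⟩ := E.exists_edge_walkArgChange_eq hF hne hz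
  refine ⟨e, he, fun a l hlast hl => ?_⟩
  obtain ⟨n, hn, hn'⟩ := E.walkArgChange_eq_walkTurn hlast (z := z)
    (fun f hf => ⟨hF (hl f hf).1, hz f (hl f hf).1⟩)
  rw [← h a l hlast hl] at hn
  rw [hn', E.walkTurn_eq_of_walkArgChange_eq hlast hn
    (fun f hf => ⟨hF (hl f hf).1, E.inr_notMem_range (hF he) (hF (hl f hf).1) (hl f hf).2.symm⟩)]

end PlaneEmbedding

namespace PlaneEmbedding

variable {V : Type} {G : SimpleGraph V} (E : PlaneEmbedding G)

/-- Incidence between vertices and midpoints of edges. -/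
def Incident (G : SimpleGraph V) : V ⊕ Sym2 V → V ⊕ Sym2 V → Prop
  | .inl v, .inr e => e ∈ G.edgeSet ∧ v ∈ e
  | .inr e, .inl v => e ∈ G.edgeSet ∧ v ∈ e
  | _, _ => False

/-- `halfTurn` as a symmetric function of the two ends of the half-edge. -/
noncomputable def nodeTurn : V ⊕ Sym2 V → V ⊕ Sym2 V → V ⊕ Sym2 V → ZMod 2
  | .inl v, .inr e => E.halfTurn v e
  | .inr e, .inl v => E.halfTurn v e
  | _, _ => 0

theorem nodeTurn_exchange {x y z t : V ⊕ Sym2 V} (h : Incident G x y) (h' : Incident G z t)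
    (hxz : x ≠ z) (hxt : x ≠ t) (hyz : y ≠ z) (hyt : y ≠ t) :
    E.nodeTurn x y z + E.nodeTurn x y t + E.nodeTurn z t x + E.nodeTurn z t y =
      E.side x z + E.side x t + E.side y z + E.side y t := by
  rcases x with u | e <;> rcases y with u' | e' <;> rcases z with v | f <;> rcases t with v' | f' <;>
    simp only [Incident] at h h'
  · have := E.halfTurn_exchange h.1 h'.1 h.2 h'.2 (fun h => hxz (by rw [h])) (fun h => hyt (by rw [h]))
    simp only [nodeTurn]
    linear_combination this
  · have := E.halfTurn_exchange h.1 h'.1 h.2 h'.2 (fun h => hxt (by rw [h])) (fun h => hyz (by rw [h]))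
    simp only [nodeTurn]
    linear_combination this
  · have := E.halfTurn_exchange h.1 h'.1 h.2 h'.2 (fun h => hyz (by rw [h])) (fun h => hxt (by rw [h]))
    simp only [nodeTurn]
    linear_combination this
  · have := E.halfTurn_exchange h.1 h'.1 h.2 h'.2 (fun h => hyt (by rw [h])) (fun h => hxz (by rw [h]))
    simp only [nodeTurn]
    linear_combination this

theorem zmod_two : (2 : ZMod 2) = 0 := rfl

theorem nodeTurn_exchange_list {x y : V ⊕ Sym2 V} (h : Incident G x y) (z : V ⊕ Sym2 V)
    (l : List (V ⊕ Sym2 V)) (hl : (z :: l).IsChain (Incident G)) (hx : x ∉ z :: l)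
    (hy : y ∉ z :: l) :
    E.nodeTurn x y z + E.nodeTurn x y (l.getLastD z) +
        chainSum (fun p q => E.nodeTurn p q x) (z :: l) +
        chainSum (fun p q => E.nodeTurn p q y) (z :: l) =
      E.side x z + E.side x (l.getLastD z) + E.side y z + E.side y (l.getLastD z) := by
  induction l generalizing z with
  | nil =>
    simp only [List.getLastD_nil, chainSum_singleton]
    linear_combination (E.nodeTurn x y z - E.side x z - E.side y z) * zmod_two
  | cons t l ih =>
    simp only [List.mem_cons, not_or] at hx hy
    have h1 := ih t hl.tail (by simp [hx]) (by simp [hy])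
    have h2 := E.nodeTurn_exchange h (List.isChain_cons_cons.1 hl).1 hx.1 hx.2.1 hy.1 hy.2.1
    simp only [List.getLastD_cons, chainSum_cons_cons]
    linear_combination h1 + h2 + (E.side x t + E.side y t - E.nodeTurn x y t) * zmod_two

theorem chainSum_nodeTurn_exchange (x : V ⊕ Sym2 V) (l : List (V ⊕ Sym2 V)) (z : V ⊕ Sym2 V)
    (l' : List (V ⊕ Sym2 V)) (hl : (x :: l).IsChain (Incident G))
    (hl' : (z :: l').IsChain (Incident G)) (hd : ∀ p ∈ x :: l, p ∉ z :: l') :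
    chainSum (fun p q => E.nodeTurn p q z) (x :: l) +
        chainSum (fun p q => E.nodeTurn p q (l'.getLastD z)) (x :: l) +
        chainSum (fun p q => E.nodeTurn p q x) (z :: l') +
        chainSum (fun p q => E.nodeTurn p q (l.getLastD x)) (z :: l') =
      E.side x z + E.side x (l'.getLastD z) + E.side (l.getLastD x) z +
        E.side (l.getLastD x) (l'.getLastD z) := by
  induction l generalizing x with
  | nil =>
    simp only [List.getLastD_nil, chainSum_singleton]
    linear_combination (chainSum (fun p q => E.nodeTurn p q x) (z :: l') -
      E.side x z - E.side x (l'.getLastD z)) * zmod_two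
  | cons y l ih =>
    have h1 := ih y hl.tail (fun p hp => hd p (List.mem_cons_of_mem _ hp))
    have h2 := E.nodeTurn_exchange_list (List.isChain_cons_cons.1 hl).1 z l' hl'
      (hd x (by simp)) (hd y (by simp))
    simp only [List.getLastD_cons, chainSum_cons_cons]
    linear_combination h1 + h2 + (E.side y z + E.side y (l'.getLastD z) -
      chainSum (fun p q => E.nodeTurn p q y) (z :: l')) * zmod_two

/-- The list of vertices and midpoints of edges along a walk, after its first vertex `a`. -/
def subdivide (a : V) : List V → List (V ⊕ Sym2 V)
  | [] => []
  | b :: l => .inr s(a, b) :: .inl b :: subdivide b l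

theorem chainSum_subdivide (a : V) (l : List V) (z : V ⊕ Sym2 V) :
    chainSum (fun p q => E.nodeTurn p q z) (.inl a :: subdivide a l) = E.walkTurn (a :: l) z := by
  induction l generalizing a with
  | nil => rfl
  | cons b l ih =>
    simp only [subdivide, chainSum_cons_cons, ih]
    unfold walkTurn
    rw [chainSum_cons_cons, ← add_assoc]
    rfl

theorem isChain_subdivide (a : V) (l : List V) (h : (a :: l).IsChain G.Adj) :
    (.inl a :: subdivide a l : List (V ⊕ Sym2 V)).IsChain (Incident G) := by
  induction l generalizing a with
  | nil => simp [subdivide]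
  | cons b l ih =>
    rw [List.isChain_cons_cons] at h
    simp only [subdivide, List.isChain_cons_cons]
    exact ⟨⟨h.1, by simp⟩, ⟨h.1, by simp⟩, ih b h.2⟩

theorem getLastD_subdivide (a : V) (l : List V) :
    (subdivide a l).getLastD (.inl a) = .inl (l.getLastD a) := by
  induction l generalizing a with
  | nil => rfl
  | cons b l ih => simp only [subdivide, List.getLastD_cons, ih]

theorem inl_mem_subdivide {a v : V} {l : List V} : .inl v ∈ subdivide a l ↔ v ∈ l := by
  induction l generalizing a with
  | nil => simp [subdivide]
  | cons b l ih => simp [subdivide, ih]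

theorem inr_mem_subdivide {a : V} {e : Sym2 V} {l : List V} (h : .inr e ∈ subdivide a l) :
    e ∈ listEdges (a :: l) := by
  induction l generalizing a with
  | nil => simp [subdivide] at h
  | cons b l ih =>
    simp only [subdivide, List.mem_cons, Sum.inr.injEq, reduceCtorEq, false_or] at h
    rw [listEdges, List.mem_cons]
    exact h.imp_right ih

theorem mem_of_mem_listEdges {l : List V} {e : Sym2 V} (h : e ∈ listEdges l) {v : V} (hv : v ∈ e) :
    v ∈ l := by
  induction l with
  | nil => simp [listEdges] at h
  | cons a l ih =>
    cases l with
    | nil => simp [listEdges] at h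
    | cons b l =>
      rcases List.mem_cons.1 h with rfl | h
      · rcases Sym2.mem_iff.1 hv with rfl | rfl <;> simp
      · exact List.mem_cons_of_mem _ (ih h)

theorem adj_of_mem_listEdges {l : List V} (hl : l.IsChain G.Adj) {e : Sym2 V}
    (h : e ∈ listEdges l) : e ∈ G.edgeSet := by
  induction l with
  | nil => simp [listEdges] at h
  | cons a l ih =>
    cases l with
    | nil => simp [listEdges] at h
    | cons b l =>
      rw [List.isChain_cons_cons] at hl
      rcases List.mem_cons.1 h with rfl | h
      · exact hl.1
      · exact ih hl.2 h

/-- The winding parity of a closed walk is constant along half-edges at vertices off it. -/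
theorem walkTurn_inl_eq_inr {a : V} {l : List V} (hl : (a :: l).IsChain G.Adj)
    (hc : l.getLastD a = a) {x y : V} (hx : x ∉ a :: l) (hxy : G.Adj x y) :
    E.walkTurn (a :: l) (.inl x) = E.walkTurn (a :: l) (.inr s(x, y)) := by
  have h := E.chainSum_nodeTurn_exchange (.inl a) (subdivide a l) (.inl x) [.inr s(x, y)]
    (isChain_subdivide a l hl) (by simpa [Incident] using hxy) (by
      rintro (v | e) hp hp'
      · simp only [List.mem_cons, Sum.inl.injEq, inl_mem_subdivide] at hp
        simp only [List.mem_cons, Sum.inl.injEq, reduceCtorEq, List.not_mem_nil, or_false] at hp'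
        exact hx (hp' ▸ List.mem_cons.2 hp)
      · have h1 := inr_mem_subdivide ((List.mem_cons.1 hp).resolve_left (by simp))
        simp only [List.mem_cons, Sum.inr.injEq, reduceCtorEq, List.not_mem_nil, or_false,
          false_or] at hp'
        exact hx (mem_of_mem_listEdges h1 (by simp [hp'])))
  simp only [getLastD_subdivide, chainSum_subdivide, hc, List.getLastD_cons, List.getLastD_nil,
    chainSum_cons_cons, chainSum_singleton] at h
  linear_combination h + (E.side (.inl a) (.inl x) + E.side (.inl a) (.inr s(x, y)) -
    E.walkTurn (a :: l) (.inr s(x, y)) - E.nodeTurn (.inl x) (.inr s(x, y)) (.inl a)) * zmod_two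

/-- Parity of a theta graph: three walks from `a` to `b` with distinct first edges `a cᵢ`. -/
theorem theta_parity {a b : V} (c₁ c₂ c₃ : V) (s₁ s₂ s₃ : List V)
    (hc₁ : (a :: c₁ :: s₁).IsChain G.Adj) (hc₂ : (a :: c₂ :: s₂).IsChain G.Adj)
    (hc₃ : (a :: c₃ :: s₃).IsChain G.Adj) (h₁₂ : c₁ ≠ c₂) (h₁₃ : c₁ ≠ c₃) (h₂₃ : c₂ ≠ c₃)
    (ha₁ : a ∉ c₁ :: s₁) (ha₂ : a ∉ c₂ :: s₂) (ha₃ : a ∉ c₃ :: s₃)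
    (hb₁ : s₁.getLastD c₁ = b) (hb₂ : s₂.getLastD c₂ = b) (hb₃ : s₃.getLastD c₃ = b) :
    (E.walkTurn (a :: c₂ :: s₂) (.inr s(a, c₁)) + E.walkTurn (a :: c₃ :: s₃) (.inr s(a, c₁))) +
    (E.walkTurn (a :: c₁ :: s₁) (.inr s(a, c₂)) + E.walkTurn (a :: c₃ :: s₃) (.inr s(a, c₂))) +
    (E.walkTurn (a :: c₁ :: s₁) (.inr s(a, c₃)) + E.walkTurn (a :: c₂ :: s₂) (.inr s(a, c₃))) =
      1 := by
  have key : ∀ (c d : V) (s : List V), (a :: c :: []).IsChain G.Adj → (a :: d :: s).IsChain G.Adj →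
      a ∉ d :: s → c ≠ d → s.getLastD d = b →
      E.halfTurn a s(a, c) (.inr s(a, d)) + E.halfTurn a s(a, c) (.inl b) +
        chainSum (fun p q => E.nodeTurn p q (.inl a)) (.inr s(a, d) :: .inl d :: subdivide d s) +
        chainSum (fun p q => E.nodeTurn p q (.inr s(a, c)))
          (.inr s(a, d) :: .inl d :: subdivide d s) =
      E.side (.inl a) (.inr s(a, d)) + E.side (.inl a) (.inl b) +
        E.side (.inr s(a, c)) (.inr s(a, d)) + E.side (.inr s(a, c)) (.inl b) := by
    intro c d s hc hd had hcd hb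
    have hac : s(a, c) ≠ s(a, d) := fun h => hcd (Sym2.congr_right.1 h)
    have h := E.nodeTurn_exchange_list (x := .inl a) (y := .inr s(a, c))
      ⟨(List.isChain_cons_cons.1 hc).1, by simp⟩ (.inr s(a, d)) (.inl d :: subdivide d s)
      (isChain_subdivide a (d :: s) hd).tail
      (by simpa [inl_mem_subdivide] using had)
      (by
        simp only [List.mem_cons, Sum.inr.injEq, reduceCtorEq, false_or, not_or]
        exact ⟨hac, fun h => had (mem_of_mem_listEdges (inr_mem_subdivide h) (by simp))⟩)
    rw [List.getLastD_cons, getLastD_subdivide, hb] at h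
    exact h
  have walk : ∀ (d : V) (s : List V) (z : V ⊕ Sym2 V), E.walkTurn (a :: d :: s) z =
      E.halfTurn a s(a, d) z +
        chainSum (fun p q => E.nodeTurn p q z) (.inr s(a, d) :: .inl d :: subdivide d s) := by
    intro d s z
    rw [← chainSum_subdivide]
    rfl
  have swap : ∀ c d : V, G.Adj a c → G.Adj a d → c ≠ d →
      E.side (.inr s(a, c)) (.inr s(a, d)) + E.side (.inr s(a, d)) (.inr s(a, c)) = 1 := by
    intro c d hc hd hcd
    refine E.side_add_swap ?_ ?_ (fun h => hcd (Sym2.congr_right.1 (Sum.inr.inj h)))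
    · rintro e he; obtain rfl := Sum.inr.inj he; exact hc
    · rintro e he; obtain rfl := Sum.inr.inj he; exact hd
  have e₁ := (List.isChain_cons_cons.1 hc₁).1
  have e₂ := (List.isChain_cons_cons.1 hc₂).1
  have e₃ := (List.isChain_cons_cons.1 hc₃).1
  have k₁₂ := key c₁ c₂ s₂ (by simpa) hc₂ ha₂ h₁₂ hb₂
  have k₁₃ := key c₁ c₃ s₃ (by simpa) hc₃ ha₃ h₁₃ hb₃
  have k₂₁ := key c₂ c₁ s₁ (by simpa) hc₁ ha₁ h₁₂.symm hb₁
  have k₂₃ := key c₂ c₃ s₃ (by simpa) hc₃ ha₃ h₂₃ hb₃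
  have k₃₁ := key c₃ c₁ s₁ (by simpa) hc₁ ha₁ h₁₃.symm hb₁
  have k₃₂ := key c₃ c₂ s₂ (by simpa) hc₂ ha₂ h₂₃.symm hb₂
  have w₁₂ := swap c₁ c₂ e₁ e₂ h₁₂
  have w₁₃ := swap c₁ c₃ e₁ e₃ h₁₃
  have w₂₃ := swap c₂ c₃ e₂ e₃ h₂₃
  simp only [walk]
  grind

end PlaneEmbedding

theorem listEdges_append {V : Type*} (l₁ : List V) (a : V) (l₂ : List V) :
    listEdges (l₁ ++ a :: l₂) = listEdges (l₁ ++ [a]) ++ listEdges (a :: l₂) := by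
  induction l₁ with
  | nil => simp [listEdges]
  | cons b l₁ ih =>
    cases l₁ with
    | nil => simp [listEdges]
    | cons c l₁ => simpa [listEdges] using ih

theorem mem_listEdges_reverse {V : Type*} {l : List V} {e : Sym2 V} :
    e ∈ listEdges l.reverse ↔ e ∈ listEdges l := by
  induction l with
  | nil => simp
  | cons b l ih =>
    cases l with
    | nil => simp
    | cons c l =>
      rw [List.reverse_cons, List.reverse_cons, List.append_assoc, List.singleton_append,
        listEdges_append, List.mem_append, ← List.reverse_cons, ih]
      simp [listEdges, Sym2.eq_swap, or_comm]

/-- The closed list of vertices traversed by a cycle given by the list of its vertices. -/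
def closedList {V : Type*} (K : List V) : List V := K ++ K.take 1

@[simp] theorem closedList_cons {V : Type*} (a : V) (l : List V) :
    closedList (a :: l) = a :: (l ++ [a]) := by simp [closedList]

/-- The edges of a cycle given by the list of its vertices. -/
def cycleEdges {V : Type*} (K : List V) : List (Sym2 V) := listEdges (closedList K)

/-- The list `K` lists the vertices of a cycle of `G`, in cyclic order. -/
structure IsCyc {V : Type*} (G : SimpleGraph V) (K : List V) : Prop where
  three_le : 3 ≤ K.length
  nodup : K.Nodup
  isChain : (closedList K).IsChain G.Adj

/-- There is a path of `G` from `u` to `w ≠ u` whose list of interior vertices is `A`. -/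
structure IsPath {V : Type*} (G : SimpleGraph V) (u : V) (A : List V) (w : V) : Prop where
  nodup : (u :: (A ++ [w])).Nodup
  isChain : (u :: (A ++ [w])).IsChain G.Adj

/-- The closed list of vertices formed by two paths from `u` to `w`. -/
def biList {V : Type*} (u : V) (A : List V) (w : V) (B : List V) : List V :=
  u :: (A ++ w :: B.reverse)

section lists

variable {V : Type} {G : SimpleGraph V}

theorem mem_cycleEdges_rotate {l₁ l₂ : List V} {e : Sym2 V} :
    e ∈ cycleEdges (l₁ ++ l₂) ↔ e ∈ cycleEdges (l₂ ++ l₁) := by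
  cases l₁ with
  | nil => simp
  | cons a s =>
    cases l₂ with
    | nil => simp
    | cons b t =>
      simp only [cycleEdges, List.cons_append, closedList_cons, List.append_assoc]
      have h₁ := listEdges_append (a :: s) b (t ++ [a])
      have h₂ := listEdges_append (b :: t) a (s ++ [b])
      simp only [List.cons_append] at h₁ h₂ ⊢
      rw [h₁, h₂, List.mem_append, List.mem_append, or_comm]

theorem IsCyc.rotate {l₁ l₂ : List V} (h : IsCyc G (l₁ ++ l₂)) : IsCyc G (l₂ ++ l₁) := by
  obtain ⟨h1, h2, h3⟩ := h
  refine ⟨by simp at h1 ⊢; omega, List.nodup_append_comm.1 h2, ?_⟩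
  cases l₁ with
  | nil => simpa using h3
  | cons a s =>
    cases l₂ with
    | nil => simpa using h3
    | cons b t =>
      simp only [List.cons_append, closedList_cons, List.append_assoc] at h3 ⊢
      rw [← List.cons_append, List.isChain_split] at h3 ⊢
      simpa using h3.symm

theorem isPath_comm {u w : V} {A : List V} : IsPath G u A w → IsPath G w A.reverse u := by
  rintro ⟨h1, h2⟩
  have e : w :: (A.reverse ++ [u]) = (u :: (A ++ [w])).reverse := by simp
  refine ⟨by rwa [e, List.nodup_reverse], ?_⟩
  rw [e, List.isChain_reverse]
  exact h2.imp fun a b h => h.symm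

theorem IsPath.ne {u w : V} {A : List V} (h : IsPath G u A w) : u ≠ w := by
  have := h.nodup
  simp only [List.nodup_cons, List.mem_append, List.mem_singleton, not_or] at this
  exact this.1.2

theorem IsPath.notMem_left {u w : V} {A : List V} (h : IsPath G u A w) : u ∉ A := by
  have := h.nodup
  simp only [List.nodup_cons, List.mem_append, List.mem_singleton, not_or] at this
  exact this.1.1

theorem IsPath.notMem_right {u w : V} {A : List V} (h : IsPath G u A w) : w ∉ A := by
  have := (isPath_comm h).notMem_left
  simpa using this

theorem IsPath.adj {u w : V} (h : IsPath G u [] w) : G.Adj u w := by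
  simpa using h.isChain

theorem isPath_nil {u w : V} (h : G.Adj u w) : IsPath G u [] w :=
  ⟨by simpa using h.ne, by simpa using h⟩

theorem isCyc_biList {u w : V} {A B : List V} :
    IsCyc G (biList u A w B) ↔
      IsPath G u A w ∧ IsPath G u B w ∧ A.Disjoint B ∧ (A ≠ [] ∨ B ≠ []) := by
  have hc : (closedList (biList u A w B)).IsChain G.Adj ↔
      (u :: (A ++ [w])).IsChain G.Adj ∧ (u :: (B ++ [w])).IsChain G.Adj := by
    rw [biList, closedList_cons, List.append_assoc, List.cons_append, ← List.cons_append,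
      List.isChain_split, List.cons_append]
    have e : w :: (B.reverse ++ [u]) = (u :: (B ++ [w])).reverse := by simp
    rw [e, List.isChain_reverse]
    have : (flip G.Adj) = G.Adj := by ext a b; exact G.adj_comm b a
    simp only [show (fun a b => G.Adj b a) = G.Adj from this]
  have hn : (biList u A w B).Nodup ↔
      (u :: (A ++ [w])).Nodup ∧ (u :: (B ++ [w])).Nodup ∧ A.Disjoint B := by
    simp only [biList, List.nodup_cons, List.nodup_append, List.mem_append, List.mem_cons,
      List.mem_reverse, List.nodup_reverse, List.Disjoint]
    simp
    grind
  have hl : 3 ≤ (biList u A w B).length ↔ A ≠ [] ∨ B ≠ [] := by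
    cases A <;> cases B <;> simp [biList]
    omega
  constructor
  · rintro ⟨h1, h2, h3⟩
    rw [hc] at h3; rw [hn] at h2; rw [hl] at h1
    exact ⟨⟨h2.1, h3.1⟩, ⟨h2.2.1, h3.2⟩, h2.2.2, h1⟩
  · rintro ⟨h1, h2, h3, h4⟩
    exact ⟨hl.2 h4, hn.2 ⟨h1.1, h2.1, h3⟩, hc.2 ⟨h1.2, h2.2⟩⟩

theorem mem_cycleEdges_biList {u w : V} {A B : List V} {e : Sym2 V} :
    e ∈ cycleEdges (biList u A w B) ↔
      e ∈ listEdges (u :: (A ++ [w])) ∨ e ∈ listEdges (u :: (B ++ [w])) := by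
  rw [cycleEdges, biList, closedList_cons, List.append_assoc, List.cons_append,
    ← List.cons_append, listEdges_append, List.mem_append, List.cons_append,
    ← mem_listEdges_reverse (l := u :: (B ++ [w]))]
  simp

@[simp] theorem mem_biList {u w x : V} {A B : List V} :
    x ∈ biList u A w B ↔ x = u ∨ x = w ∨ x ∈ A ∨ x ∈ B := by
  simp [biList]; tauto

@[simp] theorem length_biList {u w : V} {A B : List V} :
    (biList u A w B).length = A.length + B.length + 2 := by
  simp [biList]; omega

/-- Two vertices of a list cut it, up to rotation, into two paths. -/
theorem exists_biList {K : List V} {u w : V} (hu : u ∈ K) (hw : w ∈ K) (h : u ≠ w) :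
    ∃ A B l₁ l₂, K = l₁ ++ l₂ ∧ l₂ ++ l₁ = biList u A w B := by
  obtain ⟨l₁, l₂, rfl⟩ := List.append_of_mem hu
  have hw' : w ∈ l₂ ++ l₁ := by
    simp only [List.mem_append, List.mem_cons] at hw ⊢
    grind
  obtain ⟨A, B, hAB⟩ := List.append_of_mem hw'
  exact ⟨A, B.reverse, l₁, u :: l₂, rfl, by simp [biList, hAB]⟩

theorem eq_nil_of_ends_mem_listEdges {u w : V} {A : List V} (h : (u :: (A ++ [w])).Nodup)
    (he : s(u, w) ∈ listEdges (u :: (A ++ [w]))) : A = [] := by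
  cases A with
  | nil => rfl
  | cons c A =>
    exfalso
    simp only [List.cons_append, listEdges, List.mem_cons] at he
    simp only [List.cons_append, List.nodup_cons] at h
    rcases he with he | he
    · rw [Sym2.congr_right] at he
      exact h.2.1 (by simp [he])
    · exact h.1 (PlaneEmbedding.mem_of_mem_listEdges he (by simp))

end lists

namespace PlaneEmbedding

variable {V : Type} {G : SimpleGraph V} (E : PlaneEmbedding G)

theorem edgeTurn_comm (u v : V) (z : V ⊕ Sym2 V) : E.edgeTurn u v z = E.edgeTurn v u z := by
  unfold edgeTurn
  rw [Sym2.eq_swap, add_comm]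

theorem walkTurn_append (l₁ : List V) (a : V) (l₂ : List V) (z : V ⊕ Sym2 V) :
    E.walkTurn (l₁ ++ a :: l₂) z = E.walkTurn (l₁ ++ [a]) z + E.walkTurn (a :: l₂) z :=
  chainSum_append _ _ _ _

theorem walkTurn_reverse (l : List V) (z : V ⊕ Sym2 V) :
    E.walkTurn l.reverse z = E.walkTurn l z :=
  chainSum_reverse _ (fun _ _ => E.edgeTurn_comm _ _ _) _

/-- The winding parity of a cycle about a point: it is `1` inside the cycle and `0` outside. -/
noncomputable def ins (K : List V) (z : V ⊕ Sym2 V) : ZMod 2 := E.walkTurn (closedList K) z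

/-- The turn along the path from `u` to `w` with interior vertices `A`. -/
noncomputable def pathTurn (u : V) (A : List V) (w : V) (z : V ⊕ Sym2 V) : ZMod 2 :=
  E.walkTurn (u :: (A ++ [w])) z

theorem ins_rotate (l₁ l₂ : List V) (z : V ⊕ Sym2 V) :
    E.ins (l₁ ++ l₂) z = E.ins (l₂ ++ l₁) z := by
  cases l₁ with
  | nil => simp
  | cons a s =>
    cases l₂ with
    | nil => simp
    | cons b t =>
      have h₁ := E.walkTurn_append (a :: s) b (t ++ [a]) z
      have h₂ := E.walkTurn_append (b :: t) a (s ++ [b]) z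
      simp only [ins, List.cons_append, closedList_cons, List.append_assoc] at h₁ h₂ ⊢
      rw [h₁, h₂, add_comm]

theorem pathTurn_reverse (u : V) (A : List V) (w : V) (z : V ⊕ Sym2 V) :
    E.pathTurn w A.reverse u z = E.pathTurn u A w z := by
  rw [pathTurn, pathTurn, ← walkTurn_reverse]
  simp

theorem ins_biList (u : V) (A : List V) (w : V) (B : List V) (z : V ⊕ Sym2 V) :
    E.ins (biList u A w B) z = E.pathTurn u A w z + E.pathTurn u B w z := by
  have h := E.walkTurn_append (u :: A) w (B.reverse ++ [u]) z
  have h' := E.pathTurn_reverse u B w z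
  simp only [ins, biList, closedList_cons, pathTurn, List.append_assoc, List.cons_append] at h h' ⊢
  rw [h, h']

theorem ins_biList_comm (u : V) (A : List V) (w : V) (B : List V) :
    E.ins (biList u A w B) = E.ins (biList u B w A) := by
  ext z; rw [ins_biList, ins_biList, add_comm]

theorem ins_inl_eq_inr {K : List V} (hK : IsCyc G K) {x y : V} (hx : x ∉ K) (hxy : G.Adj x y) :
    E.ins K (.inl x) = E.ins K (.inr s(x, y)) := by
  obtain ⟨h1, h2, h3⟩ := hK
  cases K with
  | nil => simp at h1
  | cons a l =>
    rw [closedList_cons] at h3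
    rw [ins, closedList_cons]
    exact E.walkTurn_inl_eq_inr h3 (by simp) (by simpa [or_comm] using hx) hxy

theorem ins_adj {K : List V} (hK : IsCyc G K) {x y : V} (hx : x ∉ K) (hy : y ∉ K)
    (hxy : G.Adj x y) : E.ins K (.inl x) = E.ins K (.inl y) := by
  rw [E.ins_inl_eq_inr hK hx hxy, E.ins_inl_eq_inr hK hy hxy.symm, Sym2.eq_swap]

/-- The first edge of the path from `u` to `w` with interior vertices `A`. -/
def firstEdge (u : V) (A : List V) (w : V) : Sym2 V := s(u, A.headD w)

theorem firstEdge_mem (u : V) (A : List V) (w : V) :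
    firstEdge u A w ∈ listEdges (u :: (A ++ [w])) := by
  cases A <;> simp [firstEdge, listEdges]

/-- The side of a cycle is constant along a path whose interior vertices avoid the cycle. -/
theorem ins_path {K : List V} (hK : IsCyc G K) {u w : V} {A : List V}
    (h : (u :: (A ++ [w])).IsChain G.Adj) (hA : A.Disjoint K) :
    (∀ x ∈ A, E.ins K (.inl x) = E.ins K (.inr (firstEdge u A w))) ∧
      ∀ e ∈ listEdges (u :: (A ++ [w])), E.ins K (.inr e) = E.ins K (.inr (firstEdge u A w)) := by
  induction A generalizing u with
  | nil => simp [listEdges, firstEdge]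
  | cons c A ih =>
    rw [List.cons_append, List.isChain_cons_cons] at h
    rw [List.disjoint_cons_left] at hA
    obtain ⟨i1, i2⟩ := ih h.2 hA.2
    have e1 : E.ins K (.inl c) = E.ins K (.inr (firstEdge u (c :: A) w)) := by
      rw [E.ins_inl_eq_inr hK hA.1 h.1.symm, Sym2.eq_swap]; rfl
    have e2 : E.ins K (.inl c) = E.ins K (.inr (firstEdge c A w)) := by
      cases A with
      | nil => exact E.ins_inl_eq_inr hK hA.1 (by simpa using h.2)
      | cons d A =>
        simp only [List.cons_append, List.isChain_cons_cons] at h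
        exact E.ins_inl_eq_inr hK hA.1 h.2.1
    constructor
    · intro x hx
      rcases List.mem_cons.1 hx with rfl | hx
      · exact e1
      · rw [i1 x hx, ← e2, e1]
    · intro e he
      simp only [List.cons_append, listEdges, List.mem_cons] at he
      rcases he with rfl | he
      · rfl
      · rw [i2 e he, ← e2, e1]

/-- Three internally disjoint paths from `u` to `w`. -/
structure IsTheta (G : SimpleGraph V) (u w : V) (A B C : List V) : Prop where
  left : IsPath G u A w
  mid : IsPath G u B w
  right : IsPath G u C w
  cycle₁ : IsCyc G (biList u A w B)
  cycle₂ : IsCyc G (biList u A w C)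
  cycle₃ : IsCyc G (biList u B w C)

theorem isTheta_of_isCyc {u w : V} {A B C : List V} (h₁ : IsCyc G (biList u A w B))
    (h₂ : IsCyc G (biList u A w C)) (h₃ : IsCyc G (biList u B w C)) : IsTheta G u w A B C :=
  ⟨(isCyc_biList.1 h₁).1, (isCyc_biList.1 h₁).2.1, (isCyc_biList.1 h₂).2.1, h₁, h₂, h₃⟩

theorem isCyc_biList_comm {u w : V} {A B : List V} (h : IsCyc G (biList u A w B)) :
    IsCyc G (biList u B w A) := by
  rw [isCyc_biList] at h ⊢
  exact ⟨h.2.1, h.1, h.2.2.1.symm, h.2.2.2.symm⟩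

theorem IsTheta.swap₁₂ {u w : V} {A B C : List V} (h : IsTheta G u w A B C) :
    IsTheta G u w B A C :=
  isTheta_of_isCyc (isCyc_biList_comm h.cycle₁) h.cycle₃ h.cycle₂

theorem IsTheta.swap₂₃ {u w : V} {A B C : List V} (h : IsTheta G u w A B C) :
    IsTheta G u w A C B :=
  isTheta_of_isCyc h.cycle₂ h.cycle₁ (isCyc_biList_comm h.cycle₃)

/-- Side of the first path with respect to the cycle formed by the two other paths. -/
noncomputable def thetaSide (u w : V) (A B C : List V) : ZMod 2 :=
  E.ins (biList u B w C) (.inr (firstEdge u A w))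

theorem thetaSide_comm (u w : V) (A B C : List V) :
    E.thetaSide u w A B C = E.thetaSide u w A C B := by
  rw [thetaSide, thetaSide, ins_biList_comm]

theorem IsTheta.disjoint {u w : V} {A B C : List V} (h : IsTheta G u w A B C) :
    A.Disjoint (biList u B w C) := by
  have h1 := (isCyc_biList.1 h.cycle₁).2.2.1
  have h2 := (isCyc_biList.1 h.cycle₂).2.2.1
  intro x hx hx'
  rw [mem_biList] at hx'
  rcases hx' with rfl | rfl | hx' | hx'
  · exact h.left.notMem_left hx
  · exact h.left.notMem_right hx
  · exact h1 hx hx'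
  · exact h2 hx hx'

theorem IsTheta.ins_vertex {u w : V} {A B C : List V} (h : IsTheta G u w A B C) {x : V}
    (hx : x ∈ A) : E.ins (biList u B w C) (.inl x) = E.thetaSide u w A B C :=
  (E.ins_path h.cycle₃ h.left.isChain h.disjoint).1 x hx

theorem IsTheta.ins_edge {u w : V} {A B C : List V} (h : IsTheta G u w A B C) {e : Sym2 V}
    (he : e ∈ listEdges (u :: (A ++ [w]))) :
    E.ins (biList u B w C) (.inr e) = E.thetaSide u w A B C :=
  (E.ins_path h.cycle₃ h.left.isChain h.disjoint).2 e he

theorem IsTheta.parity {u w : V} {A B C : List V} (h : IsTheta G u w A B C) :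
    E.thetaSide u w A B C + E.thetaSide u w B A C + E.thetaSide u w C A B = 1 := by
  have form : ∀ A : List V, ∃ c s, A ++ [w] = c :: s ∧ c = A.headD w ∧ s.getLastD c = w := by
    intro A
    cases A with
    | nil => exact ⟨w, [], rfl, rfl, rfl⟩
    | cons c A => exact ⟨c, A ++ [w], rfl, rfl, by simp⟩
  have hd : ∀ {A B : List V}, IsCyc G (biList u A w B) → A.headD w ≠ B.headD w := by
    intro A B h
    obtain ⟨h1, h2, h3, h4⟩ := isCyc_biList.1 h
    have := h1.notMem_right
    have := h2.notMem_right
    cases A <;> cases B <;> simp_all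
    · grind
    · exact fun h => h3.1.1 h.symm
  obtain ⟨c₁, s₁, e₁, f₁, g₁⟩ := form A
  obtain ⟨c₂, s₂, e₂, f₂, g₂⟩ := form B
  obtain ⟨c₃, s₃, e₃, f₃, g₃⟩ := form C
  have hA := h.left
  have hB := h.mid
  have hC := h.right
  have := E.theta_parity (a := u) (b := w) c₁ c₂ c₃ s₁ s₂ s₃ (e₁ ▸ hA.isChain) (e₂ ▸ hB.isChain)
    (e₃ ▸ hC.isChain) (by rw [f₁, f₂]; exact hd h.cycle₁) (by rw [f₁, f₃]; exact hd h.cycle₂)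
    (by rw [f₂, f₃]; exact hd h.cycle₃) (e₁ ▸ (List.nodup_cons.1 hA.nodup).1)
    (e₂ ▸ (List.nodup_cons.1 hB.nodup).1) (e₃ ▸ (List.nodup_cons.1 hC.nodup).1) g₁ g₂ g₃
  rw [← this]
  simp only [thetaSide, ins_biList, pathTurn, firstEdge, e₁, e₂, e₃, f₁, f₂, f₃]

/-- The edges of a theta graph. -/
theorem IsTheta.exists_notMem {u w : V} {A B C : List V} (h : IsTheta G u w A B C)
    {e : Sym2 V} (he : e ∈ listEdges (u :: (A ++ [w]))) :
    ∃ a l, closedList (biList u B w C) = a :: l ∧ l.getLastD a = a ∧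
      ∀ f ∈ listEdges (a :: l), (f ∈ listEdges (u :: (B ++ [w])) ∨ f ∈ listEdges (u :: (C ++ [w]))) ∧
        f ≠ e := by
  refine ⟨u, B ++ w :: C.reverse ++ [u], rfl, by rw [List.getLastD_concat], fun f hf => ?_⟩
  have hf' : f ∈ cycleEdges (biList u B w C) := hf
  rw [mem_cycleEdges_biList] at hf'
  refine ⟨hf', ?_⟩
  have key : ∀ {B : List V}, IsCyc G (biList u A w B) → f ∈ listEdges (u :: (B ++ [w])) → f ≠ e := by
    rintro B h hf rfl
    obtain ⟨h1, h2, h3, h4⟩ := isCyc_biList.1 h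
    have hx : ∀ x ∈ f, x = u ∨ x = w := by
      intro x hx
      have i1 := mem_of_mem_listEdges he hx
      have i2 := mem_of_mem_listEdges hf hx
      simp only [List.mem_cons, List.mem_append] at i1 i2
      have := @h3 x
      tauto
    have hfe : f = s(u, w) := by
      have hadj := adj_of_mem_listEdges h1.isChain he
      induction f with
      | _ a b =>
        have := hx a (by simp)
        have := hx b (by simp)
        have : a ≠ b := G.ne_of_adj hadj
        grind [Sym2.eq_swap]
    subst hfe
    rw [eq_nil_of_ends_mem_listEdges h1.nodup he, eq_nil_of_ends_mem_listEdges h2.nodup hf] at h4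
    simp at h4
  rcases hf' with hf' | hf'
  · exact key h.cycle₁ hf'
  · exact key h.cycle₂ hf'

theorem IsTheta.exists_outer [Finite V] {u w : V} {A B C : List V} (h : IsTheta G u w A B C) :
    E.thetaSide u w A B C = 0 ∨ E.thetaSide u w B A C = 0 ∨ E.thetaSide u w C A B = 0 := by
  obtain ⟨e, he, H⟩ := E.exists_outer_edge (F := {e | e ∈ listEdges (u :: (A ++ [w])) ∨
    e ∈ listEdges (u :: (B ++ [w])) ∨ e ∈ listEdges (u :: (C ++ [w]))}) (by
      rintro e (he | he | he)
      · exact adj_of_mem_listEdges h.left.isChain he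
      · exact adj_of_mem_listEdges h.mid.isChain he
      · exact adj_of_mem_listEdges h.right.isChain he) ⟨_, Or.inl (firstEdge_mem _ _ _)⟩
  rcases he with he | he | he
  · left
    obtain ⟨a, l, h1, h2, h3⟩ := h.exists_notMem he
    rw [← h.ins_edge E he, ins, h1]
    exact H a l h2 fun f hf => ⟨Or.inr (h3 f hf).1, (h3 f hf).2⟩
  · right; left
    obtain ⟨a, l, h1, h2, h3⟩ := h.swap₁₂.exists_notMem he
    rw [← h.swap₁₂.ins_edge E he, ins, h1]
    exact H a l h2 fun f hf => ⟨(h3 f hf).1.imp_right Or.inr, (h3 f hf).2⟩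
  · right; right
    obtain ⟨a, l, h1, h2, h3⟩ := h.swap₂₃.swap₁₂.exists_notMem he
    rw [← h.swap₂₃.swap₁₂.ins_edge E he, ins, h1]
    exact H a l h2 fun f hf => ⟨(h3 f hf).1.imp_right Or.inl, (h3 f hf).2⟩

/-- Each point off a theta graph lies in a face bounded by one of its paths. -/
theorem IsTheta.face [Finite V] {u w : V} {A B C : List V} (h : IsTheta G u w A B C)
    {z : V ⊕ Sym2 V} (hz : ∀ e, e ∈ listEdges (u :: (A ++ [w])) ∨
    e ∈ listEdges (u :: (B ++ [w])) ∨ e ∈ listEdges (u :: (C ++ [w])) → 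
      E.point z ∉ Set.range (E.edgeCurve e)) :
    E.ins (biList u B w C) z = E.thetaSide u w A B C ∨
      E.ins (biList u A w C) z = E.thetaSide u w B A C ∨
        E.ins (biList u A w B) z = E.thetaSide u w C A B := by
  obtain ⟨e, he, H⟩ := E.exists_face_edge (F := {e | e ∈ listEdges (u :: (A ++ [w])) ∨
    e ∈ listEdges (u :: (B ++ [w])) ∨ e ∈ listEdges (u :: (C ++ [w]))}) (by
      rintro e (he | he | he)
      · exact adj_of_mem_listEdges h.left.isChain he
      · exact adj_of_mem_listEdges h.mid.isChain he
      · exact adj_of_mem_listEdges h.right.isChain he) ⟨_, Or.inl (firstEdge_mem _ _ _)⟩ hz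
  rcases he with he | he | he
  · left
    obtain ⟨a, l, h1, h2, h3⟩ := h.exists_notMem he
    rw [← h.ins_edge E he, ins, ins, h1]
    exact H a l h2 fun f hf => ⟨Or.inr (h3 f hf).1, (h3 f hf).2⟩
  · right; left
    obtain ⟨a, l, h1, h2, h3⟩ := h.swap₁₂.exists_notMem he
    rw [← h.swap₁₂.ins_edge E he, ins, ins, h1]
    exact H a l h2 fun f hf => ⟨(h3 f hf).1.imp_right Or.inr, (h3 f hf).2⟩
  · right; right
    obtain ⟨a, l, h1, h2, h3⟩ := h.swap₂₃.swap₁₂.exists_notMem he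
    rw [← h.swap₂₃.swap₁₂.ins_edge E he, ins, ins, h1]
    exact H a l h2 fun f hf => ⟨(h3 f hf).1.imp_right Or.inl, (h3 f hf).2⟩

end PlaneEmbedding

namespace PlaneEmbedding

variable {V : Type} {G : SimpleGraph V} (E : PlaneEmbedding G)

theorem IsTheta.exact [Finite V] {u w : V} {A B C : List V} (h : IsTheta G u w A B C) :
    (E.thetaSide u w A B C = 1 ∧ E.thetaSide u w B A C = 0 ∧ E.thetaSide u w C A B = 0) ∨
    (E.thetaSide u w A B C = 0 ∧ E.thetaSide u w B A C = 1 ∧ E.thetaSide u w C A B = 0) ∨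
    (E.thetaSide u w A B C = 0 ∧ E.thetaSide u w B A C = 0 ∧ E.thetaSide u w C A B = 1) := by
  have h1 := h.parity E
  have h2 := h.exists_outer E
  generalize E.thetaSide u w A B C = a at *
  generalize E.thetaSide u w B A C = b at *
  generalize E.thetaSide u w C A B = c at *
  revert a b c
  decide

theorem ins_edge_of_path {D : List V} (hD : IsCyc G D) {v d : V} {A : List V}
    (h : IsPath G v A d) (hv : v ∉ D) (hA : A.Disjoint D) {e : Sym2 V}
    (he : e ∈ listEdges (v :: (A ++ [d]))) : E.ins D (.inr e) = E.ins D (.inl v) := by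
  rw [(E.ins_path hD h.isChain hA).2 e he]
  have : G.Adj v (A.headD d) := adj_of_mem_listEdges h.isChain (firstEdge_mem v A d)
  rw [E.ins_inl_eq_inr hD hv this]
  rfl

theorem mem_of_mem_cycleEdges {K : List V} {e : Sym2 V} (he : e ∈ cycleEdges K) {x : V}
    (hx : x ∈ e) : x ∈ K := by
  have := mem_of_mem_listEdges he hx
  rw [closedList, List.mem_append] at this
  exact this.elim id List.mem_of_mem_take

theorem adj_of_mem_cycleEdges {K : List V} (hK : IsCyc G K) {e : Sym2 V} (he : e ∈ cycleEdges K) :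
    e ∈ G.edgeSet := adj_of_mem_listEdges hK.isChain he

theorem exists_cyc_biList {K : List V} (hK : IsCyc G K) {u w : V} (hu : u ∈ K) (hw : w ∈ K)
    (h : u ≠ w) : ∃ A B, IsCyc G (biList u A w B) ∧ (∀ z, E.ins (biList u A w B) z = E.ins K z) ∧
      (∀ x, x ∈ biList u A w B ↔ x ∈ K) ∧ (∀ e, e ∈ cycleEdges (biList u A w B) ↔ e ∈ cycleEdges K) ∧
      K.length = A.length + B.length + 2 := by
  obtain ⟨A, B, l₁, l₂, rfl, h2⟩ := exists_biList hu hw h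
  refine ⟨A, B, h2 ▸ hK.rotate, fun z => by rw [← h2, ins_rotate], fun x => by
    rw [← h2, List.mem_append, List.mem_append, or_comm], fun e => by
    rw [← h2, mem_cycleEdges_rotate], ?_⟩
  rw [← length_biList (u := u) (w := w), ← h2]
  simp [add_comm]

theorem closedList_form {K : List V} (hK : IsCyc G K) :
    ∃ a l, closedList K = a :: l ∧ l.getLastD a = a := by
  obtain ⟨h1, -, -⟩ := hK
  cases K with
  | nil => simp at h1
  | cons a l => exact ⟨a, l ++ [a], by simp, by simp⟩

/-- A cycle meeting `K` at most at one vertex `d`, with no edge outside `K`, has `v ∈ K` outside. -/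
theorem ins_eq_zero_of_touch [Finite V] {K D : List V} (hK : IsCyc G K) (hD : IsCyc G D)
    (hDK : ∀ e ∈ cycleEdges D, e ∈ cycleEdges K ∨ E.ins K (.inr e) = 1) {v d : V} (hv : v ∈ K)
    (hvD : v ∉ D) (hd : d ∈ K) (hdv : d ≠ v) (hmeet : ∀ x ∈ D, x ∈ K → x = d) :
    E.ins D (.inl v) = 0 := by
  have hdis : ∀ e ∈ cycleEdges D, e ∉ cycleEdges K := by
    intro e he he'
    have hadj := adj_of_mem_cycleEdges hD he
    induction e with
    | _ x y =>
      have h1 := hmeet x (mem_of_mem_cycleEdges he (by simp)) (mem_of_mem_cycleEdges he' (by simp))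
      have h2 := hmeet y (mem_of_mem_cycleEdges he (by simp)) (mem_of_mem_cycleEdges he' (by simp))
      exact G.ne_of_adj hadj (h1.trans h2.symm)
  obtain ⟨a, l, hal, hla⟩ := closedList_form hD
  obtain ⟨b, m, hbm, hmb⟩ := closedList_form hK
  obtain ⟨e, he, H⟩ := E.exists_outer_edge (F := {e | e ∈ cycleEdges D ∨ e ∈ cycleEdges K}) (by
    rintro e (he | he)
    · exact adj_of_mem_cycleEdges hD he
    · exact adj_of_mem_cycleEdges hK he) (by
      obtain ⟨A, B, h1, h2, h3, h4, -⟩ := E.exists_cyc_biList hK hd hv hdv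
      exact ⟨firstEdge d A v, Or.inr ((h4 _).1 (mem_cycleEdges_biList.2
        (Or.inl (firstEdge_mem _ _ _))))⟩)
  rcases he with he | he
  · exfalso
    have h0 : E.ins K (.inr e) = 0 := by
      rw [ins, hbm]
      refine H b m hmb fun f hf => ?_
      rw [← hbm] at hf
      exact ⟨Or.inr hf, fun h => hdis e he (h ▸ hf)⟩
    rcases hDK e he with h | h
    · exact hdis e he h
    · rw [h0] at h; exact absurd h (by decide)
  · have h0 : E.ins D (.inr e) = 0 := by
      rw [ins, hal]
      refine H a l hla fun f hf => ?_
      rw [← hal] at hf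
      exact ⟨Or.inl hf, fun h => hdis f hf (h ▸ he)⟩
    obtain ⟨A, B, h1, h2, h3, h4, -⟩ := E.exists_cyc_biList hK hv hd hdv.symm
    obtain ⟨i1, i2, -, -⟩ := isCyc_biList.1 h1
    rw [← h0]
    rw [← h4, mem_cycleEdges_biList] at he
    rcases he with he | he
    · refine (E.ins_edge_of_path hD i1 hvD (fun x hx hxD => ?_) he).symm
      obtain rfl := hmeet x hxD ((h3 x).1 (by simp [hx]))
      exact i1.notMem_right hx
    · refine (E.ins_edge_of_path hD i2 hvD (fun x hx hxD => ?_) he).symm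
      obtain rfl := hmeet x hxD ((h3 x).1 (by simp [hx]))
      exact i2.notMem_right hx

theorem exists_potential {κ : List V} (hκ : κ.Nodup) (z : V ⊕ Sym2 V) :
    ∃ φ : V → ZMod 2, ∀ α k β k' γ, κ = α ++ k :: (β ++ k' :: γ) →
      E.pathTurn k β k' z = φ k + φ k' := by
  classical
  refine ⟨fun k => E.walkTurn (κ.takeWhile (fun x => decide (x ≠ k)) ++ [k]) z, ?_⟩
  have tw : ∀ α k γ, κ = α ++ k :: γ → κ.takeWhile (fun x => decide (x ≠ k)) = α := by
    rintro α k γ rfl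
    rw [List.takeWhile_append_of_pos]
    · simp
    · intro x hx
      rw [List.nodup_append] at hκ
      simpa using hκ.2.2 x hx k (by simp)
  intro α k β k' γ h
  simp only
  have h' := E.walkTurn_append α k (β ++ [k']) z
  rw [tw α k _ h, tw (α ++ k :: β) k' γ (by simp [h]), List.append_assoc, List.cons_append, h',
    pathTurn]
  linear_combination (-E.walkTurn (α ++ [k]) z) * zmod_two

theorem cycleEdges_eq_nil_or {u w : V} {A B : List V} (h : IsCyc G (biList u A w B))
    (he : s(u, w) ∈ cycleEdges (biList u A w B)) : A = [] ∨ B = [] := by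
  obtain ⟨h1, h2, -, -⟩ := isCyc_biList.1 h
  exact (mem_cycleEdges_biList.1 he).imp (eq_nil_of_ends_mem_listEdges h1.nodup)
    (eq_nil_of_ends_mem_listEdges h2.nodup)

/-- A path inside a cycle `K` with ends on `K` is homotopic, with respect to a vertex `v` of `K`,
to the arc of `K` avoiding `v`. -/
theorem pathTurn_eq_of_inside [Finite V] {v k k' : V} {α β γ R : List V}
    (hK : IsCyc G (v :: (α ++ k :: (β ++ k' :: γ)))) (hR : IsPath G k R k')
    (hRK : R.Disjoint (v :: (α ++ k :: (β ++ k' :: γ))))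
    (hin : ∀ e ∈ listEdges (k :: (R ++ [k'])), e ∈ cycleEdges (v :: (α ++ k :: (β ++ k' :: γ))) ∨
      E.ins (v :: (α ++ k :: (β ++ k' :: γ))) (.inr e) = 1) :
    E.pathTurn k R k' (.inl v) = E.pathTurn k β k' (.inl v) := by
  set K := v :: (α ++ k :: (β ++ k' :: γ)) with hKdef
  set T := α.reverse ++ v :: γ.reverse with hT
  have e1 : K = (v :: α) ++ (k :: (β ++ k' :: γ)) := by simp [hKdef]
  have e2 : (k :: (β ++ k' :: γ)) ++ (v :: α) = biList k β k' T := by simp [biList, hT]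
  have hK' : IsCyc G (biList k β k' T) := by rw [← e2]; exact IsCyc.rotate (e1 ▸ hK)
  have hins : ∀ z, E.ins K z = E.ins (biList k β k' T) z := fun z => by
    rw [e1, ins_rotate, e2]
  have hedge : ∀ e, e ∈ cycleEdges K ↔ e ∈ cycleEdges (biList k β k' T) := fun e => by
    rw [e1, mem_cycleEdges_rotate, e2]
  have hvT : v ∈ T := by simp [hT]
  have hTne : T ≠ [] := List.ne_nil_of_mem hvT
  have hRb : R.Disjoint β := fun x hx hx' => hRK hx (by simp [hKdef, hx'])
  have hRT : R.Disjoint T := fun x hx hx' => hRK hx (by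
    simp only [hT, List.mem_append, List.mem_reverse, List.mem_cons] at hx'
    simp only [hKdef, List.mem_append, List.mem_cons]
    tauto)
  by_cases hempty : R = [] ∧ β = []
  · rw [hempty.1, hempty.2]
  obtain ⟨hb, ht, hbT, -⟩ := isCyc_biList.1 hK'
  have hθ : IsTheta G k k' R β T := isTheta_of_isCyc
    (isCyc_biList.2 ⟨hR, hb, hRb, by tauto⟩) (isCyc_biList.2 ⟨hR, ht, hRT, Or.inr hTne⟩) hK'
  have hfe : firstEdge k R k' ∉ cycleEdges K := by
    intro h
    by_cases hRn : R = []
    · subst hRn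
      rw [hedge] at h
      rcases cycleEdges_eq_nil_or hK' h with h | h
      · exact hempty ⟨rfl, h⟩
      · exact hTne h
    · obtain ⟨c, R, rfl⟩ := List.exists_cons_of_ne_nil hRn
      exact hRK (a := c) (by simp) (mem_of_mem_cycleEdges h (by simp [firstEdge]))
  have h1 : E.thetaSide k k' R β T = 1 := by
    have := (hin _ (firstEdge_mem _ _ _)).resolve_left hfe
    rwa [hins] at this
  have h3 : E.thetaSide k k' T R β = 0 := by
    have := hθ.exact E
    rw [h1] at this
    simp only [thetaSide_comm] at this ⊢
    simp at this
    exact this.2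
  have := hθ.swap₂₃.swap₁₂.ins_vertex E hvT
  rw [h3, ins_biList] at this
  linear_combination this - E.pathTurn k β k' (.inl v) * zmod_two

theorem walkTurn_eq_potential [Finite V] {v : V} {κ : List V} (hK : IsCyc G (v :: κ))
    {φ : V → ZMod 2} (hφ : ∀ α k β k' γ, κ = α ++ k :: (β ++ k' :: γ) →
      E.pathTurn k β k' (.inl v) = φ k + φ k') (n : ℕ) (k : V) (l : List V) (hn : l.length ≤ n)
    (hnd : (k :: l).Nodup) (hch : (k :: l).IsChain G.Adj) (hv : v ∉ k :: l)
    (hin : ∀ e ∈ listEdges (k :: l), e ∈ cycleEdges (v :: κ) ∨ E.ins (v :: κ) (.inr e) = 1)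
    (hk : k ∈ κ) (hl : l.getLastD k ∈ κ) :
    E.walkTurn (k :: l) (.inl v) = φ k + φ (l.getLastD k) := by
  classical
  induction n generalizing k l with
  | zero =>
    obtain rfl : l = [] := List.length_eq_zero_iff.1 (by omega)
    simp only [walkTurn, chainSum_singleton, List.getLastD_nil]
    linear_combination (-φ k) * zmod_two
  | succ n ih =>
    by_cases hnil : l = []
    · subst hnil
      simp only [walkTurn, chainSum_singleton, List.getLastD_nil]
      linear_combination (-φ k) * zmod_two
    obtain ⟨R, k', l', rfl, hk', hR⟩ : ∃ R k' l', l = R ++ k' :: l' ∧ k' ∈ κ ∧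
        ∀ x ∈ R, x ∉ κ := by
      have hex : ∃ x ∈ l, x ∈ κ := by
        obtain ⟨m, a, rfl⟩ := (List.eq_nil_or_concat l).resolve_left hnil
        rw [List.concat_eq_append, List.getLastD_concat] at hl
        exact ⟨a, by simp, hl⟩
      clear hin hch hnd hv hnil ih hn hl
      induction l with
      | nil => simp at hex
      | cons a l ih =>
        by_cases ha : a ∈ κ
        · exact ⟨[], a, l, rfl, ha, by simp⟩
        · obtain ⟨R, k', l', rfl, h1, h2⟩ := ih (by simpa [ha] using hex)
          exact ⟨a :: R, k', l', rfl, h1, by simpa [ha] using h2⟩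
    have hsplit : E.walkTurn (k :: (R ++ k' :: l')) (.inl v) =
        E.pathTurn k R k' (.inl v) + E.walkTurn (k' :: l') (.inl v) :=
      E.walkTurn_append (k :: R) k' l' _
    have hsub := listEdges_append (k :: R) k' l'
    simp only [List.cons_append] at hsub
    rw [hsub] at hin
    have hch' : (k :: R ++ k' :: l').IsChain G.Adj := hch
    rw [List.isChain_split] at hch'
    have hlast : (R ++ k' :: l').getLastD k = l'.getLastD k' := by
      rcases List.eq_nil_or_concat l' with rfl | ⟨m, a, rfl⟩
      · simp
      · have e : R ++ k' :: m.concat a = (R ++ k' :: m) ++ [a] := by simp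
        rw [e, List.getLastD_concat, List.concat_eq_append, List.getLastD_concat]
    have hpath : IsPath G k R k' := ⟨by
      refine hnd.sublist ?_
      simp, hch'.1⟩
    have hseg : E.pathTurn k R k' (.inl v) = φ k + φ k' := by
      have hkk : k ≠ k' := hpath.ne
      have key : ∀ {k k' R}, IsPath G k R k' → k ∈ κ → k' ∈ κ → (∀ x ∈ R, x ∉ κ) → v ∉ R →
          (∀ e ∈ listEdges (k :: (R ++ [k'])), 
            e ∈ cycleEdges (v :: κ) ∨ E.ins (v :: κ) (.inr e) = 1) →
          (∃ α β γ, κ = α ++ k :: (β ++ k' :: γ)) → E.pathTurn k R k' (.inl v) = φ k + φ k' := by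
        rintro k k' R hp hk hk' hR hvR hin ⟨α, β, γ, rfl⟩
        rw [E.pathTurn_eq_of_inside hK hp ?_ hin, hφ α k β k' γ rfl]
        intro x hx hx'
        rcases List.mem_cons.1 hx' with rfl | hx'
        · exact hvR hx
        · exact hR x hx hx'
      have hvR : v ∉ R := fun h => hv (by simp [h])
      have hin1 := fun e he => hin e (List.mem_append_left _ he)
      obtain ⟨α, m, hα⟩ := List.append_of_mem hk
      have : k' ∈ α ∨ k' ∈ m := by
        rw [hα] at hk'
        simpa [hkk.symm] using hk'
      rcases this with h | h
      · obtain ⟨α', β, rfl⟩ := List.append_of_mem h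
        rw [← pathTurn_reverse, add_comm]
        refine key (isPath_comm hpath) hk' hk (by simpa using hR) (by simpa using hvR) ?_
          ⟨α', β, m, by simp [hα]⟩
        intro e he
        refine hin1 e ?_
        rw [← mem_listEdges_reverse]
        simpa using he
      · obtain ⟨β, γ, rfl⟩ := List.append_of_mem h
        exact key hpath hk hk' hR hvR hin1 ⟨α, β, γ, hα⟩
    rw [hsplit, hlast, hseg, ih k' l' (by simp at hn; omega) 
      (hnd.sublist (by simp)) hch'.2 (fun h => hv (by simp at h ⊢; tauto))
      (fun e he => hin e (List.mem_append_right _ he)) hk' (hlast ▸ hl)]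
    linear_combination φ k' * zmod_two

/-- A cycle drawn within the closed disc of `K` does not enclose vertices of `K`. -/
theorem ins_eq_zero_of_within [Finite V] {K D : List V} (hK : IsCyc G K) (hD : IsCyc G D)
    (hDK : ∀ e ∈ cycleEdges D, e ∈ cycleEdges K ∨ E.ins K (.inr e) = 1) {v : V} (hv : v ∈ K)
    (hvD : v ∉ D) : E.ins D (.inl v) = 0 := by
  by_cases h : ∃ k ∈ D, ∃ k' ∈ D, k ∈ K ∧ k' ∈ K ∧ k ≠ k'
  · obtain ⟨k, hk, k', hk', hkK, hkK', hne⟩ := h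
    obtain ⟨l₁, l₂, rfl⟩ := List.append_of_mem hv
    have e1 : ∀ e, e ∈ cycleEdges (l₁ ++ v :: l₂) ↔ e ∈ cycleEdges (v :: (l₂ ++ l₁)) := fun e => by
      rw [mem_cycleEdges_rotate]; rfl
    have e2 : ∀ z, E.ins (l₁ ++ v :: l₂) z = E.ins (v :: (l₂ ++ l₁)) z := fun z => by
      rw [ins_rotate]; rfl
    have hK' : IsCyc G (v :: (l₂ ++ l₁)) := hK.rotate
    have hmem : ∀ x ∈ D, x ∈ l₁ ++ v :: l₂ → x ∈ l₂ ++ l₁ := by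
      intro x hx h
      have : x ≠ v := fun h => hvD (h ▸ hx)
      simp only [List.mem_append, List.mem_cons] at h ⊢
      tauto
    simp only [e1, e2] at hDK
    obtain ⟨φ, hφ⟩ := E.exists_potential (List.nodup_cons.1 hK'.nodup).2 (.inl v)
    obtain ⟨A, B, h1, h2, h3, h4, -⟩ := E.exists_cyc_biList hD hk hk' hne
    obtain ⟨i1, i2, -, -⟩ := isCyc_biList.1 h1
    rw [← h2, ins_biList]
    simp only [← h4, mem_cycleEdges_biList] at hDK
    rw [← h3, mem_biList] at hvD
    have j1 := E.walkTurn_eq_potential hK' hφ _ k (A ++ [k']) le_rfl i1.nodup i1.isChain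
      (by simp; tauto) (fun e he => hDK e (Or.inl he)) (hmem _ hk hkK) (by simpa using hmem _ hk' hkK')
    have j2 := E.walkTurn_eq_potential hK' hφ _ k (B ++ [k']) le_rfl i2.nodup i2.isChain
      (by simp; tauto) (fun e he => hDK e (Or.inr he)) (hmem _ hk hkK) (by simpa using hmem _ hk' hkK')
    rw [List.getLastD_concat] at j1 j2
    rw [pathTurn, pathTurn, j1, j2]
    linear_combination (φ k + φ k') * zmod_two
  · push Not at h
    obtain ⟨d, hd, hdv, hm⟩ : ∃ d ∈ K, d ≠ v ∧ ∀ x ∈ D, x ∈ K → x = d := by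
      by_cases h' : ∃ d ∈ D, d ∈ K
      · obtain ⟨d, hd, hdK⟩ := h'
        exact ⟨d, hdK, fun h => hvD (h ▸ hd), fun x hx hxK => h x hx d hd hxK hdK⟩
      · push Not at h'
        obtain ⟨d, hd, hdv⟩ : ∃ d ∈ K, d ≠ v := by
          have h1 := hK.three_le
          have h2 := hK.nodup
          rcases K with _ | ⟨a, _ | ⟨b, K⟩⟩
          · simp at h1
          · simp at h1
          · by_cases ha : a = v
            · refine ⟨b, by simp, ?_⟩
              subst ha
              simp at h2
              exact fun h => h2.1.1 h.symm
            · exact ⟨a, by simp, ha⟩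
        exact ⟨d, hd, hdv, fun x hx hxK => absurd hxK (h' x hx)⟩
    exact E.ins_eq_zero_of_touch hK hD hDK hv hvD hd hdv hm

end PlaneEmbedding

open scoped Classical in
/-- Connectedness of the subgraph induced on `S`, in terms of cuts. -/
def Conn {V : Type} (G : SimpleGraph V) (S : Finset V) : Prop :=
  ∀ T ⊆ S, T.Nonempty → (∀ x ∈ T, ∀ y ∈ S, G.Adj x y → y ∈ T) → S ⊆ T

open scoped Classical in
/-- The subgraph induced on `H` is connected and has no cut vertex. -/
def NoCut {V : Type} (G : SimpleGraph V) (H : Finset V) : Prop :=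
  ∀ u ∈ H, Conn G (H.erase u)

section paths

variable {V : Type} {G : SimpleGraph V}

theorem exists_isPath {x y : V} {W : Set V} (hxW : x ∈ W) (hxy : x ≠ y)
    (h : Relation.ReflTransGen (fun a b => G.Adj a b ∧ b ∈ W) x y) :
    ∃ A, IsPath G x A y ∧ ∀ a ∈ A, a ∈ W := by
  have key : y ∈ W ∧ (y = x ∨ ∃ A, IsPath G y A x ∧ ∀ a ∈ A, a ∈ W) := by
    clear hxy
    induction h with
    | refl => exact ⟨hxW, Or.inl rfl⟩
    | @tail b c _ hbc ih =>
      refine ⟨hbc.2, ?_⟩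
      by_cases hcx : c = x
      · exact Or.inl hcx
      right
      obtain ⟨hbW, rfl | ⟨A, hA, hAW⟩⟩ := ih
      · exact ⟨[], isPath_nil hbc.1.symm, by simp⟩
      · by_cases hcA : c ∈ A
        · obtain ⟨A₁, A₂, rfl⟩ := List.append_of_mem hcA
          have h1 := hA.nodup
          have h2 := hA.isChain
          simp only [List.append_assoc, List.cons_append] at h1 h2
          refine ⟨A₂, ⟨h1.sublist ?_, (h2.tail).right_of_append⟩,
            fun a ha => hAW a (by simp [ha])⟩
          exact (List.sublist_append_right A₁ _).trans (List.sublist_cons_self _ _)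
        · refine ⟨b :: A, ⟨?_, ?_⟩, by simpa [hbW] using hAW⟩
          · have := hA.nodup
            simp only [List.cons_append, List.nodup_cons, List.mem_cons, List.mem_append] at this ⊢
            have := hbc.1.ne
            simp only [List.not_mem_nil, or_false] at *
            tauto
          · simp only [List.cons_append, List.isChain_cons_cons]
            exact ⟨hbc.1.symm, hA.isChain⟩
  obtain ⟨-, h | ⟨A, hA, hAW⟩⟩ := key
  · exact absurd h.symm hxy
  · exact ⟨A.reverse, isPath_comm hA, by simpa using hAW⟩

open scoped Classical in
theorem Conn.reach [Fintype V] {S : Finset V} (hS : Conn G S) {x y : V} (hx : x ∈ S) (hy : y ∈ S) :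
    Relation.ReflTransGen (fun a b => G.Adj a b ∧ b ∈ S) x y := by
  have := hS (S.filter fun y => Relation.ReflTransGen (fun a b => G.Adj a b ∧ b ∈ S) x y)
    (Finset.filter_subset _ _) ⟨x, by simpa using ⟨hx, .refl⟩⟩ (by
      intro a ha b hb hab
      rw [Finset.mem_filter] at ha ⊢
      exact ⟨hb, ha.2.tail ⟨hab, hb⟩⟩) hy
  exact (Finset.mem_filter.1 this).2

open scoped Classical in
theorem NoCut.exists_adj {H : Finset V} (hH : NoCut G H) (hcard : 3 ≤ H.card) {v u : V}
    (hv : v ∈ H) : ∃ a ∈ H, a ≠ u ∧ G.Adj v a := by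
  by_contra! hcon
  obtain ⟨u', hu', huv, hu⟩ : ∃ u' ∈ H, u' ≠ v ∧ ∀ a ∈ H, a ≠ u' → ¬ G.Adj v a := by
    by_cases hu : u ∈ H ∧ u ≠ v
    · exact ⟨u, hu.1, hu.2, hcon⟩
    · obtain ⟨u', hu', hne⟩ := Finset.exists_mem_ne (show 1 < H.card by omega) v
      refine ⟨u', hu', hne, fun a ha _ hva => hcon a ha ?_ hva⟩
      rintro rfl
      exact hu ⟨ha, hva.ne'⟩
  have := hH u' hu' {v} (by simpa using ⟨huv.symm, hv⟩) (by simp) (by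
    intro x hx y hy hxy
    rw [Finset.mem_singleton] at hx
    subst hx
    rw [Finset.mem_erase] at hy
    exact absurd hxy (hu y hy.2 hy.1))
  have := Finset.card_le_card this
  rw [Finset.card_erase_of_mem hu'] at this
  simp at this
  omega

open scoped Classical in
theorem NoCut.exists_isCyc [Fintype V] {H : Finset V} (hH : NoCut G H) (hcard : 3 ≤ H.card) :
    ∃ K, IsCyc G K ∧ ∀ x ∈ K, x ∈ H := by
  obtain ⟨v, hv⟩ := Finset.card_pos.1 (show 0 < H.card by omega)
  obtain ⟨a, ha, -, hva⟩ := hH.exists_adj hcard (u := v) hv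
  obtain ⟨b, hb, hba, hvb⟩ := hH.exists_adj hcard (u := a) hv
  have ha' : a ∈ H.erase v := by simpa using ⟨hva.ne', ha⟩
  obtain ⟨A, hA, hAH⟩ := exists_isPath (W := {x | x ∈ H.erase v}) ha' hba.symm
    ((hH v hv).reach ha' (by simpa using ⟨hvb.ne', hb⟩))
  refine ⟨biList a A b [v], isCyc_biList.2 ⟨hA, ⟨?_, ?_⟩, ?_, by simp⟩, ?_⟩
  · simpa using ⟨⟨hva.ne', hba.symm⟩, hvb.ne⟩
  · simpa using ⟨hva.symm, hvb⟩
  · intro x hx hx'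
    simp only [List.mem_singleton] at hx'
    subst hx'
    simpa using hAH _ hx
  · intro x hx
    rw [mem_biList] at hx
    rcases hx with rfl | rfl | hx | hx
    · exact ha
    · exact hb
    · exact Finset.mem_of_mem_erase (hAH x hx)
    · simp only [List.mem_singleton] at hx; exact hx ▸ hv

end paths

namespace PlaneEmbedding

variable {V : Type} {G : SimpleGraph V} (E : PlaneEmbedding G)

/-- A vertex of `H` lying inside no cycle of `H`. -/
def Outer (H : Finset V) (v : V) : Prop :=
  v ∈ H ∧ ∀ K, IsCyc G K → (∀ x ∈ K, x ∈ H) → v ∉ K → E.ins K (.inl v) = 0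

open scoped Classical in
/-- The vertices of `H` in the closed disc bounded by a cycle. -/
noncomputable def disc (H : Finset V) (K : List V) : Finset V :=
  H.filter fun x => x ∈ K ∨ E.ins K (.inl x) = 1

theorem mem_disc {H : Finset V} {K : List V} {x : V} :
    x ∈ E.disc H K ↔ x ∈ H ∧ (x ∈ K ∨ E.ins K (.inl x) = 1) := by
  simp [disc]

theorem disc_subset {H : Finset V} {K : List V} : E.disc H K ⊆ H := by
  intro x hx
  exact (E.mem_disc.1 hx).1

theorem zmod_two_cases (a : ZMod 2) : a = 0 ∨ a = 1 := by
  revert a; decide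

theorem Outer.mono {H H' : Finset V} {v : V} (h : E.Outer H v) (hs : H' ⊆ H) (hv : v ∈ H') :
    E.Outer H' v :=
  ⟨hv, fun K hK hKH hvK => h.2 K hK (fun x hx => hs (hKH x hx)) hvK⟩

/-- Deleting an outer vertex exposes its neighbours. -/
theorem Outer.of_adj {H H' : Finset V} {s y : V} (h : E.Outer H s) (hs : H' ⊆ H) (hsH : s ∉ H')
    (hy : y ∈ H') (hsy : G.Adj s y) : E.Outer H' y := by
  refine ⟨hy, fun K hK hKH hyK => ?_⟩
  have hsK : s ∉ K := fun h => hsH (hKH s h)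
  rw [← E.ins_adj hK hsK hyK hsy]
  exact h.2 K hK (fun x hx => hs (hKH x hx)) hsK

/-- A vertex joined to an outer vertex of `H` outside `H'` is outer in `H'`. -/
theorem Outer.of_conn {H H' S : Finset V} {z v : V} (h : E.Outer H z) (hs : H' ⊆ H) (hv : v ∈ H')
    (hS : Conn G S) (hz : z ∈ S) (hvS : v ∈ S) (hSH : ∀ x ∈ S, x ∈ H' → x = v) :
    E.Outer H' v := by
  classical
  refine ⟨hv, fun K hK hKH hvK => ?_⟩
  have hSK : ∀ x ∈ S, x ∉ K := fun x hx hxK => hvK (hSH x hx (hKH x hxK) ▸ hxK)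
  have := hS (S.filter fun x => E.ins K (.inl x) = 0) (Finset.filter_subset _ _)
    ⟨z, Finset.mem_filter.2 ⟨hz, h.2 K hK (fun x hx => hs (hKH x hx)) (hSK z hz)⟩⟩ (by
      intro x hx y hy hxy
      rw [Finset.mem_filter] at hx ⊢
      exact ⟨hy, by rw [← E.ins_adj hK (hSK x hx.1) (hSK y hy) hxy, hx.2]⟩) hvS
  exact (Finset.mem_filter.1 this).2

theorem exists_outer [Finite V] {H : Finset V} (hH : H.Nonempty) : ∃ v, E.Outer H v := by
  by_cases hF : {e : Sym2 V | e ∈ G.edgeSet ∧ ∀ x ∈ e, x ∈ H}.Nonempty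
  · obtain ⟨e, he, h⟩ := E.exists_outer_edge (fun e he => he.1) hF
    induction e with
    | _ x y =>
      have hxy : G.Adj x y := he.1
      refine ⟨x, he.2 x (by simp), fun K hK hKH hxK => ?_⟩
      rw [E.ins_inl_eq_inr hK hxK hxy]
      obtain ⟨a, l, hal, hla⟩ := closedList_form hK
      rw [ins, hal]
      refine h a l hla fun f hf => ?_
      rw [← hal] at hf
      refine ⟨⟨adj_of_mem_cycleEdges hK hf, fun z hz => hKH z (mem_of_mem_cycleEdges hf hz)⟩, ?_⟩
      rintro rfl
      exact hxK (mem_of_mem_cycleEdges hf (by simp))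
  · obtain ⟨v, hv⟩ := hH
    refine ⟨v, hv, fun K hK hKH _ => absurd ?_ hF⟩
    obtain ⟨h1, h2, h3⟩ := hK
    rcases K with _ | ⟨a, _ | ⟨b, K⟩⟩
    · simp at h1
    · simp at h1
    · simp only [closedList_cons, List.cons_append, List.isChain_cons_cons] at h3
      refine ⟨s(a, b), h3.1, fun x hx => ?_⟩
      rcases Sym2.mem_iff.1 hx with rfl | rfl <;> exact hKH _ (by simp)

theorem IsTheta.edge_notMem {u w : V} {A B C : List V} (h : IsTheta G u w A B C)
    {e : Sym2 V} (he : e ∈ listEdges (u :: (A ++ [w]))) : e ∉ cycleEdges (biList u B w C) := by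
  intro hf
  obtain ⟨a, l, h1, -, h3⟩ := h.exists_notMem he
  rw [cycleEdges, h1] at hf
  exact (h3 e hf).2 rfl

/-- The vertices of an induced cycle are outer in its disc. -/
theorem outer_disc [Finite V] {H : Finset V} {K : List V} (hK : IsCyc G K)
    (hind : ∀ x ∈ K, ∀ y ∈ K, G.Adj x y → s(x, y) ∈ cycleEdges K) {v : V} (hv : v ∈ K)
    (hvH : v ∈ H) : E.Outer (E.disc H K) v := by
  refine ⟨E.mem_disc.2 ⟨hvH, Or.inl hv⟩, fun D hD hDH hvD => ?_⟩
  refine E.ins_eq_zero_of_within hK hD (fun e he => ?_) hv hvD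
  have hadj := adj_of_mem_cycleEdges hD he
  have hmem : ∀ x ∈ e, x ∈ K ∨ E.ins K (.inl x) = 1 := fun x hx =>
    (E.mem_disc.1 (hDH x (mem_of_mem_cycleEdges he hx))).2
  induction e with
  | _ x y =>
    by_cases hx : x ∈ K
    · by_cases hy : y ∈ K
      · exact Or.inl (hind x hx y hy hadj)
      · right
        rw [Sym2.eq_swap, ← E.ins_inl_eq_inr hK hy (SimpleGraph.Adj.symm hadj)]
        exact (hmem y (by simp)).resolve_left hy
    · right
      rw [← E.ins_inl_eq_inr hK hx hadj]
      exact (hmem x (by simp)).resolve_left hx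

/-- The cycle `C` bounds the outer face of the subgraph induced on `H`. -/
structure IsOuterCycle (H : Finset V) (C : List V) : Prop where
  isCyc : IsCyc G C
  subset : ∀ x ∈ C, x ∈ H
  ins_vertex : ∀ x ∈ H, x ∉ C → E.ins C (.inl x) = 1
  ins_edge : ∀ x ∈ H, ∀ y ∈ H, G.Adj x y → s(x, y) ∉ cycleEdges C → E.ins C (.inr s(x, y)) = 1
  outer : ∀ x ∈ C, E.Outer H x

theorem IsOuterCycle.mem_of_outer {H : Finset V} {C : List V} (h : E.IsOuterCycle H C) {v : V}
    (hv : E.Outer H v) : v ∈ C := by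
  by_contra hvC
  have h1 := h.ins_vertex v hv.1 hvC
  rw [hv.2 C h.isCyc h.subset hvC] at h1
  exact absurd h1 (by decide)

/-- The edges spanned by `H` in the closed disc bounded by a cycle. -/
def discEdges (H : Finset V) (C : List V) : Set (Sym2 V) :=
  {e | (e ∈ G.edgeSet ∧ ∀ x ∈ e, x ∈ H) ∧ (e ∈ cycleEdges C ∨ E.ins C (.inr e) = 1)}

theorem discEdges_lt [Finite V] {H : Finset V} {a b : V} {A B Q : List V}
    (h : IsTheta G a b Q A B) (hsub : ∀ x ∈ biList a Q b B, x ∈ H)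
    (hA : E.thetaSide a b A Q B = 1) :
    E.discEdges H (biList a A b B) < E.discEdges H (biList a Q b B) := by
  have hQ : E.thetaSide a b Q A B = 0 := by
    have := h.exact E
    rw [hA] at this
    simp at this
    exact this.1
  have hB : E.thetaSide a b B Q A = 0 := by
    have := h.exact E
    rw [hA] at this
    simp at this
    exact this.2
  have hlt : ¬ E.discEdges H (biList a Q b B) ⊆ E.discEdges H (biList a A b B) := by
    intro hs
    have hfe := firstEdge_mem a Q b
    have := (hs (a := firstEdge a Q b) ⟨⟨adj_of_mem_listEdges h.left.isChain hfe, fun x hx =>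
      hsub x (mem_of_mem_cycleEdges (mem_cycleEdges_biList.2 (Or.inl hfe)) hx)⟩,
        Or.inl (mem_cycleEdges_biList.2 (Or.inl hfe))⟩).2
    rcases this with h' | h'
    · exact h.edge_notMem hfe h'
    · rw [h.ins_edge E hfe, hQ] at h'
      exact absurd h' (by decide)
  refine lt_of_le_not_ge ?_ hlt
  rintro e ⟨heH, he⟩
  refine ⟨heH, ?_⟩
  by_cases heQ : e ∈ listEdges (a :: (Q ++ [b]))
  · exact Or.inl (mem_cycleEdges_biList.2 (Or.inl heQ))
  by_cases heB : e ∈ listEdges (a :: (B ++ [b]))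
  · exact Or.inl (mem_cycleEdges_biList.2 (Or.inr heB))
  right
  by_cases heA : e ∈ listEdges (a :: (A ++ [b]))
  · rw [h.swap₁₂.ins_edge E heA, hA]
  have hC := he.resolve_left (by rw [mem_cycleEdges_biList]; tauto)
  have hface := h.face E (z := .inr e) (by
    have hadj : ∀ {A}, IsPath G a A b → e ∉ listEdges (a :: (A ++ [b])) →
        ∀ f ∈ listEdges (a :: (A ++ [b])), E.point (.inr e) ∉ Set.range (E.edgeCurve f) := by
      rintro A hA he f hf
      exact E.inr_notMem_range heH.1 (adj_of_mem_listEdges hA.isChain hf)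
        (fun h => he (h ▸ hf))
    rintro f (hf | hf | hf)
    · exact hadj h.left heQ f hf
    · exact hadj h.mid heA f hf
    · exact hadj h.right heB f hf)
  rw [hC, hQ, hA, hB] at hface
  rcases hface with h' | h' | h'
  · exact absurd h' (by decide)
  · exact h'
  · rw [ins_biList] at h' hC ⊢
    linear_combination h' + hC - E.pathTurn a A b (.inr e) * zmod_two

theorem exists_discEdges_lt [Finite V] {H : Finset V} {C Q : List V} (hC : IsCyc G C)
    (hCH : ∀ x ∈ C, x ∈ H) {a b : V} (ha : a ∈ C) (hb : b ∈ C) (hQ : IsPath G a Q b)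
    (hQC : Q.Disjoint C) (hQH : ∀ x ∈ Q, x ∈ H) (hne : Q = [] → s(a, b) ∉ cycleEdges C)
    (hout : E.ins C (.inr (firstEdge a Q b)) = 0) :
    ∃ C', IsCyc G C' ∧ (∀ x ∈ C', x ∈ H) ∧ E.discEdges H C < E.discEdges H C' := by
  obtain ⟨A, B, h1, h2, h3, h4, -⟩ := E.exists_cyc_biList hC ha hb hQ.ne
  have hD : E.discEdges H C = E.discEdges H (biList a A b B) := by
    ext e
    simp only [discEdges, h2, h4]
  obtain ⟨hA, hB, hAB, hABne⟩ := isCyc_biList.1 h1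
  have hmem : ∀ x, x = a ∨ x = b ∨ x ∈ A ∨ x ∈ B → x ∈ C := fun x hx =>
    (h3 x).1 (mem_biList.2 hx)
  have hnil : Q = [] → A ≠ [] ∧ B ≠ [] := by
    intro hQn
    have := hne hQn
    rw [← h4, mem_cycleEdges_biList] at this
    constructor <;> rintro rfl <;> simp [listEdges] at this
  have hθ : IsTheta G a b Q A B := isTheta_of_isCyc
    (isCyc_biList.2 ⟨hQ, hA, fun x hx hx' => hQC hx (hmem x (by tauto)), by tauto⟩)
    (isCyc_biList.2 ⟨hQ, hB, fun x hx hx' => hQC hx (hmem x (by tauto)), by tauto⟩) h1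
  have h0 : E.thetaSide a b Q A B = 0 := by rw [thetaSide, h2, hout]
  rcases hθ.exact E with h | h | h
  · rw [h0] at h; exact absurd h.1 (by decide)
  · refine ⟨_, hθ.cycle₂, ?_, ?_⟩
    · intro x hx
      rw [mem_biList] at hx
      by_cases hxQ : x ∈ Q
      · exact hQH x hxQ
      · exact hCH x (hmem x (by tauto))
    · rw [hD]
      refine E.discEdges_lt hθ ?_ h.2.1
      intro x hx
      rw [mem_biList] at hx
      by_cases hxQ : x ∈ Q
      · exact hQH x hxQ
      · exact hCH x (hmem x (by tauto))
  · have hD' : E.discEdges H C = E.discEdges H (biList a B b A) := by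
      rw [hD]
      ext e
      simp only [discEdges, E.ins_biList_comm a A b B, mem_cycleEdges_biList, Set.mem_ofPred_eq]
      exact and_congr_right fun _ => or_congr_left or_comm
    have hsub : ∀ x ∈ biList a Q b A, x ∈ H := by
      intro x hx
      rw [mem_biList] at hx
      by_cases hxQ : x ∈ Q
      · exact hQH x hxQ
      · exact hCH x (hmem x (by tauto))
    refine ⟨_, hθ.cycle₁, hsub, ?_⟩
    rw [hD']
    exact E.discEdges_lt hθ.swap₂₃ hsub h.2.2

open scoped Classical in
/-- A vertex outside a cycle `C` is on a path outside `C` between two vertices of `C`. -/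
theorem exists_path_outside [Fintype V] {H : Finset V} (hH : NoCut G H) {C : List V}
    (hC : IsCyc G C) (hCH : ∀ x ∈ C, x ∈ H) {x : V} (hx : x ∈ H) (hxC : x ∉ C)
    (hx0 : E.ins C (.inl x) = 0) :
    ∃ a b Q, a ∈ C ∧ b ∈ C ∧ IsPath G a Q b ∧ Q.Disjoint C ∧ (∀ x ∈ Q, x ∈ H) ∧ Q ≠ [] ∧
      E.ins C (.inr (firstEdge a Q b)) = 0 := by
  set r : V → V → Prop := fun a b => G.Adj a b ∧ b ∈ {b | b ∈ H ∧ b ∉ C} with hr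
  have hT : ∀ t, Relation.ReflTransGen r x t → t ∈ H ∧ t ∉ C ∧ E.ins C (.inl t) = 0 ∧
      Relation.ReflTransGen r t x := by
    intro t ht
    induction ht with
    | refl => exact ⟨hx, hxC, hx0, .refl⟩
    | @tail b c _ hbc ih =>
      refine ⟨hbc.2.1, hbc.2.2, ?_, .head ⟨hbc.1.symm, ih.1, ih.2.1⟩ ih.2.2.2⟩
      rw [← E.ins_adj hC ih.2.1 hbc.2.2 hbc.1, ih.2.2.1]
  have hatt : ∀ c ∈ C, ∃ t a, Relation.ReflTransGen r x t ∧ a ∈ C ∧ a ≠ c ∧ G.Adj t a := by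
    intro c hc
    by_contra! hcon
    have hsub := hH c (hCH c hc) (H.filter fun t => Relation.ReflTransGen r x t) (by
        intro t ht
        rw [Finset.mem_filter] at ht
        exact Finset.mem_erase.2 ⟨fun h => (hT t ht.2).2.1 (h ▸ hc), ht.1⟩)
      ⟨x, Finset.mem_filter.2 ⟨hx, .refl⟩⟩ (by
        intro t ht y hy hty
        rw [Finset.mem_filter] at ht ⊢
        rw [Finset.mem_erase] at hy
        refine ⟨hy.2, ?_⟩
        by_cases hyC : y ∈ C
        · exact absurd hty (hcon t y ht.2 hyC hy.1)
        · exact ht.2.tail ⟨hty, hy.2, hyC⟩)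
    obtain ⟨c', hc', hne⟩ : ∃ c' ∈ C, c' ≠ c := by
      by_contra! hall
      have h1 := hC.three_le
      have h2 := hC.nodup
      rcases C with _ | ⟨a, _ | ⟨b, C⟩⟩
      · simp at h1
      · simp at h1
      · have ha := hall a (by simp)
        have hb := hall b (by simp)
        simp [ha, hb] at h2
    have := hsub (Finset.mem_erase.2 ⟨hne, hCH c' hc'⟩)
    exact (hT c' (Finset.mem_filter.1 this).2).2.1 hc'
  obtain ⟨c, hc⟩ : ∃ c, c ∈ C := List.exists_mem_of_ne_nil _ (by
    rintro rfl; have := hC.three_le; simp at this)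
  obtain ⟨t₁, a, ht₁, ha, -, hta⟩ := hatt c hc
  obtain ⟨t₂, b, ht₂, hb, hba, htb⟩ := hatt a ha
  obtain ⟨i1, i2, i3, i4⟩ := hT t₁ ht₁
  obtain ⟨j1, j2, j3, j4⟩ := hT t₂ ht₂
  have hfirst : ∀ Q, E.ins C (.inr (firstEdge a (t₁ :: Q) b)) = 0 := by
    intro Q
    have := E.ins_inl_eq_inr hC i2 hta
    rw [firstEdge, List.headD_cons, Sym2.eq_swap, ← this, i3]
  have hat : a ≠ t₁ := fun h => i2 (h ▸ ha)
  have hbt : b ≠ t₁ := fun h => i2 (h ▸ hb)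
  have hat' : a ≠ t₂ := fun h => j2 (h ▸ ha)
  have hbt' : b ≠ t₂ := fun h => j2 (h ▸ hb)
  by_cases h12 : t₁ = t₂
  · subst h12
    refine ⟨a, b, [t₁], ha, hb, ⟨by simp; tauto, by simp; exact ⟨hta.symm, htb⟩⟩, ?_, ?_, by simp,
      hfirst []⟩
    · simpa using i2
    · simpa using i1
  · obtain ⟨A, hA, hAW⟩ := exists_isPath (W := {b | b ∈ H ∧ b ∉ C}) ⟨i1, i2⟩ h12 (i4.trans ht₂)
    refine ⟨a, b, t₁ :: (A ++ [t₂]), ha, hb, ⟨?_, ?_⟩, ?_, ?_, by simp, hfirst _⟩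
    · have hn := hA.nodup
      have haA : a ∉ A := fun h => (hAW a h).2 ha
      have hbA : b ∉ A := fun h => (hAW b h).2 hb
      simp only [List.cons_append, List.append_assoc, List.nodup_cons, List.nodup_append,
        List.mem_append, List.mem_cons, List.not_mem_nil, or_false] at hn ⊢
      grind
    · have hn := hA.isChain
      have e : a :: (t₁ :: (A ++ [t₂]) ++ [b]) = (a :: t₁ :: A) ++ t₂ :: [b] := by simp
      rw [e, List.isChain_split]
      simp only [List.cons_append, List.isChain_cons_cons, List.isChain_singleton, and_true]
      exact ⟨⟨hta.symm, hn⟩, htb⟩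
    · intro y hy hyC
      simp only [List.mem_cons, List.mem_append, List.not_mem_nil, or_false] at hy
      rcases hy with rfl | hy | rfl
      · exact i2 hyC
      · exact (hAW y hy).2 hyC
      · exact j2 hyC
    · intro y hy
      simp only [List.mem_cons, List.mem_append, List.not_mem_nil, or_false] at hy
      rcases hy with rfl | hy | rfl
      · exact i1
      · exact (hAW y hy).1
      · exact j1

theorem exists_isOuterCycle [Fintype V] {H : Finset V} (hH : NoCut G H) (hcard : 3 ≤ H.card) :
    ∃ C, E.IsOuterCycle H C := by
  obtain ⟨K, hK, hKH⟩ := hH.exists_isCyc hcard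
  obtain ⟨S, ⟨⟨C, hC, hCH, rfl⟩, hmax⟩⟩ := (Set.toFinite
    {S | ∃ C, IsCyc G C ∧ (∀ x ∈ C, x ∈ H) ∧ E.discEdges H C = S}).exists_maximal
      ⟨_, K, hK, hKH, rfl⟩
  have hmax' : ∀ C', IsCyc G C' → (∀ x ∈ C', x ∈ H) → ¬ E.discEdges H C < E.discEdges H C' :=
    fun C' h1 h2 h3 => h3.not_ge (hmax ⟨C', h1, h2, rfl⟩ h3.le)
  have hvert : ∀ x ∈ H, x ∉ C → E.ins C (.inl x) = 1 := by
    intro x hx hxC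
    refine (zmod_two_cases _).resolve_left fun h0 => ?_
    obtain ⟨a, b, Q, h1, h2, h3, h4, h5, h6, h7⟩ := E.exists_path_outside hH hC hCH hx hxC h0
    obtain ⟨C', i1, i2, i3⟩ := E.exists_discEdges_lt hC hCH h1 h2 h3 h4 h5
      (fun h => absurd h h6) h7
    exact hmax' C' i1 i2 i3
  have hedge : ∀ x ∈ H, ∀ y ∈ H, G.Adj x y → s(x, y) ∉ cycleEdges C →
      E.ins C (.inr s(x, y)) = 1 := by
    intro x hx y hy hxy he
    by_cases hxC : x ∈ C
    · by_cases hyC : y ∈ C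
      · refine (zmod_two_cases _).resolve_left fun h0 => ?_
        obtain ⟨C', i1, i2, i3⟩ := E.exists_discEdges_lt hC hCH hxC hyC (isPath_nil hxy)
          (by simp) (by simp) (fun _ => he) h0
        exact hmax' C' i1 i2 i3
      · rw [Sym2.eq_swap, ← E.ins_inl_eq_inr hC hyC hxy.symm]
        exact hvert y hy hyC
    · rw [← E.ins_inl_eq_inr hC hxC hxy]
      exact hvert x hx hxC
  refine ⟨C, hC, hCH, hvert, hedge, fun v hv => ⟨hCH v hv, fun D hD hDH hvD => ?_⟩⟩
  refine E.ins_eq_zero_of_within hC hD (fun e he => ?_) hv hvD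
  have hadj := adj_of_mem_cycleEdges hD he
  have hmem : ∀ x ∈ e, x ∈ H := fun x hx => hDH x (mem_of_mem_cycleEdges he hx)
  induction e with
  | _ x y =>
    by_cases h : s(x, y) ∈ cycleEdges C
    · exact Or.inl h
    · exact Or.inr (hedge x (hmem x (by simp)) y (hmem y (by simp)) hadj h)

end PlaneEmbedding

section lists

variable {V : Type} {G : SimpleGraph V}

theorem exists_append_of_mem_listEdges {l : List V} {x y : V} (h : s(x, y) ∈ listEdges l) :
    ∃ l₁ l₂, l = l₁ ++ x :: y :: l₂ ∨ l = l₁ ++ y :: x :: l₂ := by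
  induction l with
  | nil => simp [listEdges] at h
  | cons a l ih =>
    cases l with
    | nil => simp [listEdges] at h
    | cons b l =>
      simp only [listEdges, List.mem_cons] at h
      rcases h with h | h
      · rcases Sym2.eq_iff.1 h with ⟨rfl, rfl⟩ | ⟨rfl, rfl⟩
        · exact ⟨[], l, Or.inl rfl⟩
        · exact ⟨[], l, Or.inr rfl⟩
      · obtain ⟨l₁, l₂, h | h⟩ := ih h
        · exact ⟨a :: l₁, l₂, Or.inl (by rw [h]; rfl)⟩
        · exact ⟨a :: l₁, l₂, Or.inr (by rw [h]; rfl)⟩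

theorem crossing_listEdges {l₁ l₂ : List V} (hn : (l₁ ++ l₂).Nodup) {x y : V}
    (h : s(x, y) ∈ listEdges (l₁ ++ l₂)) (hx : x ∈ l₁) (hy : y ∈ l₂) :
    ∃ s t, l₁ = s ++ [x] ∧ l₂ = y :: t := by
  rw [List.nodup_append] at hn
  obtain ⟨m₁, m₂, h | h⟩ := exists_append_of_mem_listEdges h
  · rw [List.append_eq_append_iff] at h
    rcases h with ⟨a, h1, h2⟩ | ⟨a, h1, h2⟩
    · subst h1 h2
      exact absurd rfl (hn.2.2 x hx x (by simp))
    · rcases a with _ | ⟨c, _ | ⟨d, a⟩⟩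
      · simp only [List.append_nil, List.nil_append] at h1 h2
        subst h1 h2
        exact absurd rfl (hn.2.2 x hx x (by simp))
      · simp only [List.cons_append, List.nil_append, List.cons.injEq] at h2
        obtain ⟨rfl, rfl⟩ := h2
        exact ⟨m₁, m₂, h1, rfl⟩
      · simp only [List.cons_append, List.cons.injEq] at h2
        obtain ⟨rfl, rfl, rfl⟩ := h2
        exact absurd rfl (hn.2.2 y (by simp [h1]) y hy)
  · rw [List.append_eq_append_iff] at h
    rcases h with ⟨a, h1, h2⟩ | ⟨a, h1, h2⟩
    · subst h1 h2
      exact absurd rfl (hn.2.2 x hx x (by simp))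
    · rcases a with _ | ⟨c, a⟩
      · simp only [List.append_nil, List.nil_append] at h1 h2
        subst h1 h2
        exact absurd rfl (hn.2.2 x hx x (by simp))
      · simp only [List.cons_append, List.cons.injEq] at h2
        obtain ⟨rfl, -⟩ := h2
        exact absurd rfl (hn.2.2 y (by simp [h1]) y hy)

/-- A cycle cut into two lists has only two edges between these. -/
theorem crossing {l₁ l₂ : List V} (hn : (l₁ ++ l₂).Nodup) {x y : V}
    (h : s(x, y) ∈ cycleEdges (l₁ ++ l₂)) (hx : x ∈ l₁) (hy : y ∈ l₂) :
    (∃ s t, l₁ = s ++ [x] ∧ l₂ = y :: t) ∨ ∃ s t, l₁ = x :: s ∧ l₂ = t ++ [y] := by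
  rcases l₁ with _ | ⟨a, l₁⟩
  · simp at hx
  rcases List.eq_nil_or_concat l₂ with rfl | ⟨t, b, rfl⟩
  · simp at hy
  rw [List.concat_eq_append] at *
  have e : closedList (a :: l₁ ++ (t ++ [b])) = (a :: l₁ ++ t) ++ b :: [a] := by simp
  rw [cycleEdges, e, listEdges_append, List.mem_append] at h
  rcases h with h | h
  · left
    rw [List.append_assoc] at h
    exact crossing_listEdges hn h hx hy
  · right
    simp only [listEdges, List.mem_singleton] at h
    rw [List.nodup_append] at hn
    rcases Sym2.eq_iff.1 h with ⟨rfl, rfl⟩ | ⟨rfl, rfl⟩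
    · exact absurd rfl (hn.2.2 x hx x (by simp))
    · exact ⟨l₁, t, rfl, rfl⟩

/-- Every cycle has length at least five. -/
def GirthGeFive (G : SimpleGraph V) : Prop := ∀ K, IsCyc G K → 5 ≤ K.length

theorem GirthGeFive.no_triangle (hG : GirthGeFive G) {a b c : V} (h₁ : G.Adj a b)
    (h₂ : G.Adj b c) (h₃ : G.Adj c a) : False := by
  have := hG [a, b, c] ⟨by simp, by simp [h₁.ne, h₂.ne, h₃.ne'], by simp [h₁, h₂, h₃]⟩
  simp at this

theorem GirthGeFive.no_square (hG : GirthGeFive G) {a b c d : V} (h₁ : G.Adj a b)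
    (h₂ : G.Adj b c) (h₃ : G.Adj c d) (h₄ : G.Adj d a) (hac : a ≠ c) (hbd : b ≠ d) : False := by
  have := hG [a, b, c, d] ⟨by simp, by simp [h₁.ne, h₂.ne, h₃.ne, h₄.ne', hac, hbd],
    by simp [h₁, h₂, h₃, h₄]⟩
  simp at this

theorem isPath_append {u v w : V} {A B : List V} :
    IsPath G u (A ++ v :: B) w ↔ IsPath G u A v ∧ IsPath G v B w ∧ u ≠ w ∧ u ∉ B ∧ w ∉ A ∧
      A.Disjoint B := by
  have hc : (u :: (A ++ v :: B ++ [w])).IsChain G.Adj ↔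
      (u :: (A ++ [v])).IsChain G.Adj ∧ (v :: (B ++ [w])).IsChain G.Adj := by
    rw [List.append_assoc, List.cons_append, ← List.cons_append, List.isChain_split,
      List.cons_append]
  constructor
  · rintro ⟨h1, h2⟩
    rw [hc] at h2
    simp only [List.append_assoc, List.cons_append, List.nodup_cons, List.nodup_append,
      List.mem_append, List.mem_cons, List.not_mem_nil, or_false] at h1
    refine ⟨⟨?_, h2.1⟩, ⟨?_, h2.2⟩, ?_⟩ <;>
    simp only [List.nodup_cons, List.nodup_append, List.mem_append, List.mem_cons,
      List.not_mem_nil, or_false, List.Disjoint] <;> grind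
  · rintro ⟨⟨h1, h2⟩, ⟨h3, h4⟩, h5, h6, h7, h8⟩
    refine ⟨?_, hc.2 ⟨h2, h4⟩⟩
    simp only [List.append_assoc, List.cons_append, List.nodup_cons, List.nodup_append,
      List.mem_append, List.mem_cons, List.not_mem_nil, or_false, List.Disjoint] at *
    grind

theorem isPath_singleton {u v w : V} (h₁ : G.Adj u v) (h₂ : G.Adj v w) (h : u ≠ w) :
    IsPath G u [v] w :=
  ⟨by simp [h₁.ne, h₂.ne, h], by simp [h₁, h₂]⟩

theorem isCyc_biList_singleton {u w y : V} {A : List V} (hA : IsPath G u A w) (hu : G.Adj y u)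
    (hw : G.Adj y w) (hy : y ∉ A) : IsCyc G (biList u A w [y]) :=
  isCyc_biList.2 ⟨hA, isPath_singleton hu.symm hw hA.ne, by simpa using hy, by simp⟩

theorem nine_le_of_isPath (hG : GirthGeFive G) {a b c y : V} {A A' B : List V}
    (hA : IsPath G a (A ++ c :: A') b) (hB : IsPath G a B b) (hyA : y ∉ A) (hyA' : y ∉ A')
    (hyB : y ∉ B) (ha : G.Adj y a) (hb : G.Adj y b) (hc : G.Adj y c) :
    9 ≤ (A ++ c :: A').length + B.length + 2 := by
  obtain ⟨h1, h2, -⟩ := isPath_append.1 hA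
  have i1 := hG _ (isCyc_biList_singleton h1 ha hc hyA)
  have i2 := hG _ (isCyc_biList_singleton h2 hc hb hyA')
  have i3 := hG _ (isCyc_biList_singleton hB ha hb hyB)
  simp at i1 i2 i3 ⊢
  omega

end lists

namespace PlaneEmbedding

variable {V : Type} {G : SimpleGraph V} (E : PlaneEmbedding G)

/-- A cycle with three common neighbours with a vertex outside has length at least nine. -/
theorem nine_le_length {V : Type} {G : SimpleGraph V} (E : PlaneEmbedding G) (hG : GirthGeFive G) {K : List V} (hK : IsCyc G K) {a b c y : V}
    (hy : y ∉ K) (ha : a ∈ K) (hb : b ∈ K) (hc : c ∈ K) (hab : a ≠ b) (hac : a ≠ c)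
    (hbc : b ≠ c) (hya : G.Adj y a) (hyb : G.Adj y b) (hyc : G.Adj y c) : 9 ≤ K.length := by
  obtain ⟨A, B, h1, -, h3, -, h5⟩ := E.exists_cyc_biList hK ha hb hab
  rw [← h3, mem_biList] at hc
  have hy' : ¬ (y = a ∨ y = b ∨ y ∈ A ∨ y ∈ B) := by rwa [← mem_biList, h3]
  push Not at hy'
  obtain ⟨hA, hB, -⟩ := isCyc_biList.1 h1
  rw [h5]
  rcases hc with rfl | rfl | hc | hc
  · exact absurd rfl hac
  · exact absurd rfl hbc
  · obtain ⟨A₁, A₂, rfl⟩ := List.append_of_mem hc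
    have hyA : y ∉ A₁ ∧ y ∉ A₂ := by have := hy'.2.2.1; simp at this; tauto
    exact nine_le_of_isPath hG hA hB hyA.1 hyA.2 hy'.2.2.2 hya hyb hyc
  · obtain ⟨A₁, A₂, rfl⟩ := List.append_of_mem hc
    have hyA : y ∉ A₁ ∧ y ∉ A₂ := by have := hy'.2.2.2; simp at this; tauto
    have := nine_le_of_isPath hG hB hA hyA.1 hyA.2 hy'.2.2.1 hya hyb hyc
    omega

/-- Some path of a theta is inside the cycle formed by the two other paths. -/
theorem IsTheta.false_of_empty [Finite V] {u w a b c : V} {A B C : List V}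
    (h : IsTheta G u w A B C) (ha : a ∈ A) (hb : b ∈ B) (hc : c ∈ C)
    (h₁ : E.ins (biList u B w C) (.inl a) = 0) (h₂ : E.ins (biList u A w C) (.inl b) = 0)
    (h₃ : E.ins (biList u A w B) (.inl c) = 0) : False := by
  rw [h.ins_vertex E ha] at h₁
  rw [h.swap₁₂.ins_vertex E hb] at h₂
  have h4 := h.swap₂₃.swap₁₂.ins_vertex E hc
  rw [h₃] at h4
  have := h.exact E
  rw [h₁, h₂, ← h4] at this
  simp at this

variable {E}

theorem IsOuterCycle.congr {H : Finset V} {C C' : List V} (h : E.IsOuterCycle H C)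
    (hC : IsCyc G C') (h₁ : ∀ z, E.ins C' z = E.ins C z) (h₂ : ∀ x, x ∈ C' ↔ x ∈ C)
    (h₃ : ∀ e, e ∈ cycleEdges C' ↔ e ∈ cycleEdges C) : E.IsOuterCycle H C' where
  isCyc := hC
  subset x hx := h.subset x ((h₂ x).1 hx)
  ins_vertex x hx hxC := by rw [h₁]; exact h.ins_vertex x hx (by rwa [← h₂])
  ins_edge x hx y hy hxy he := by rw [h₁]; exact h.ins_edge x hx y hy hxy (by rwa [← h₃])
  outer x hx := h.outer x ((h₂ x).1 hx)

variable (E)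

/-- The path `Q` splits the disc of the outer cycle formed by the paths `A` and `B`. -/
structure IsSplit (H : Finset V) (u : V) (A : List V) (w : V) (B Q : List V) : Prop where
  cycle : E.IsOuterCycle H (biList u A w B)
  left_ne : A ≠ []
  right_ne : B ≠ []
  path : IsPath G u Q w
  subset : ∀ x ∈ Q, x ∈ H
  disjoint : Q.Disjoint (biList u A w B)

variable {E}

namespace IsSplit

variable {H : Finset V} {u w : V} {A B Q : List V}

theorem symm (h : E.IsSplit H u A w B Q) : E.IsSplit H u B w A Q where
  cycle := h.cycle.congr (isCyc_biList_comm h.cycle.isCyc) (fun z => by rw [E.ins_biList_comm])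
    (fun x => by simp only [mem_biList]; tauto)
    (fun e => by simp only [mem_cycleEdges_biList]; exact or_comm)
  left_ne := h.right_ne
  right_ne := h.left_ne
  path := h.path
  subset := h.subset
  disjoint x hx hx' := h.disjoint hx (by rw [mem_biList] at hx' ⊢; tauto)

theorem theta (h : E.IsSplit H u A w B Q) : IsTheta G u w Q A B := by
  obtain ⟨hA, hB, -⟩ := isCyc_biList.1 h.cycle.isCyc
  refine isTheta_of_isCyc (isCyc_biList.2 ⟨h.path, hA, fun x hx hx' => h.disjoint hx ?_,
    Or.inr h.left_ne⟩) (isCyc_biList.2 ⟨h.path, hB, fun x hx hx' => h.disjoint hx ?_,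
    Or.inr h.right_ne⟩) h.cycle.isCyc
  · simp [hx']
  · simp [hx']

theorem mem (h : E.IsSplit H u A w B Q) {x : V} (hx : x = u ∨ x = w ∨ x ∈ A ∨ x ∈ B ∨ x ∈ Q) :
    x ∈ H := by
  by_cases hxQ : x ∈ Q
  · exact h.subset x hxQ
  · exact h.cycle.subset x (mem_biList.2 (by tauto))

theorem notMem_left (h : E.IsSplit H u A w B Q) {x : V} (hx : x ∈ A) : x ∉ biList u Q w B :=
  fun hmem => h.theta.swap₁₂.disjoint hx hmem

/-- The first arc is outside the cycle formed by the other arc and the path. -/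
theorem ins_left (h : E.IsSplit H u A w B Q) {x : V} (hx : x ∈ A) :
    E.ins (biList u Q w B) (.inl x) = 0 :=
  (h.cycle.outer x (by simp [hx])).2 _ h.theta.cycle₂
    (fun y hy => h.mem (by rw [mem_biList] at hy; tauto)) (h.notMem_left hx)

theorem ins_add (_h : E.IsSplit H u A w B Q) (z : V ⊕ Sym2 V) :
    E.ins (biList u Q w A) z + E.ins (biList u Q w B) z = E.ins (biList u A w B) z := by
  simp only [ins_biList]
  linear_combination E.pathTurn u Q w z * zmod_two

theorem ins_eq (h : E.IsSplit H u A w B Q) {x : V} (hx : x ∈ H) (hxC : x ∉ biList u A w B) :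
    E.ins (biList u Q w A) (.inl x) + E.ins (biList u Q w B) (.inl x) = 1 := by
  rw [h.ins_add, h.cycle.ins_vertex x hx hxC]

theorem mem_or (h : E.IsSplit H u A w B Q) {x : V} (hx : x ∈ H) :
    x ∈ E.disc H (biList u Q w A) ∨ x ∈ E.disc H (biList u Q w B) := by
  simp only [mem_disc]
  by_cases hxC : x ∈ biList u A w B
  · simp only [mem_biList] at *
    tauto
  · have := h.ins_eq hx hxC
    rcases zmod_two_cases (E.ins (biList u Q w B) (.inl x)) with h1 | h1
    · rw [h1, add_zero] at this
      exact Or.inl ⟨hx, Or.inr this⟩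
    · exact Or.inr ⟨hx, Or.inr h1⟩

theorem mem_inter (h : E.IsSplit H u A w B Q) {x : V} (h₁ : x ∈ E.disc H (biList u Q w A))
    (h₂ : x ∈ E.disc H (biList u Q w B)) : x = u ∨ x = w ∨ x ∈ Q := by
  rw [mem_disc] at h₁ h₂
  by_cases hA : x ∈ A
  · rcases h₂.2 with h3 | h3
    · exact absurd h3 (h.notMem_left hA)
    · rw [h.ins_left hA] at h3
      exact absurd h3 (by decide)
  by_cases hB : x ∈ B
  · rcases h₁.2 with h3 | h3
    · exact absurd h3 (h.symm.notMem_left hB)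
    · rw [h.symm.ins_left hB] at h3
      exact absurd h3 (by decide)
  by_contra hcon
  push Not at hcon
  have := h.ins_eq h₁.1 (by rw [mem_biList]; tauto)
  rw [h₁.2.resolve_left (by rw [mem_biList]; tauto),
    h₂.2.resolve_left (by rw [mem_biList]; tauto)] at this
  exact absurd this (by decide)

theorem not_adj (h : E.IsSplit H u A w B Q) {x y : V} (h₁ : x ∈ E.disc H (biList u Q w A))
    (h₂ : x ∉ E.disc H (biList u Q w B)) (h₃ : y ∈ E.disc H (biList u Q w B))
    (h₄ : y ∉ E.disc H (biList u Q w A)) : ¬ G.Adj x y := by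
  intro hxy
  rw [mem_disc] at h₁ h₂ h₃ h₄
  have hx : x ∉ biList u Q w B ∧ E.ins (biList u Q w B) (.inl x) = 0 := by
    have := zmod_two_cases (E.ins (biList u Q w B) (.inl x)); tauto
  have hy : y ∉ biList u Q w A ∧ E.ins (biList u Q w A) (.inl y) = 0 := by
    have := zmod_two_cases (E.ins (biList u Q w A) (.inl y)); tauto
  have hxA : x ∈ A := by
    rcases h₁.2 with h5 | h5
    · have := hx.1
      rw [mem_biList] at this h5
      tauto
    · by_contra hxA
      have h6 := hx.1
      rw [mem_biList] at h6
      rw [E.ins_adj h.theta.cycle₁ (by rw [mem_biList]; tauto) hy.1 hxy, hy.2] at h5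
      exact absurd h5 (by decide)
  have hyB : y ∈ B := by
    rcases h₃.2 with h5 | h5
    · have := hy.1
      rw [mem_biList] at this h5
      tauto
    · by_contra hyB
      have h6 := hy.1
      rw [mem_biList] at h6
      rw [← E.ins_adj h.theta.cycle₂ hx.1 (by rw [mem_biList]; tauto) hxy, hx.2] at h5
      exact absurd h5 (by decide)
  have hC : s(x, y) ∉ cycleEdges (biList u A w B) := by
    rw [mem_cycleEdges_biList]
    have h5 := hx.1
    have h6 := hy.1
    rw [mem_biList] at h5 h6
    rintro (he | he)
    · have := mem_of_mem_listEdges he (v := y) (by simp)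
      simp only [List.mem_cons, List.mem_append, List.not_mem_nil, or_false] at this
      clear * - this h6
      tauto
    · have := mem_of_mem_listEdges he (v := x) (by simp)
      simp only [List.mem_cons, List.mem_append, List.not_mem_nil, or_false] at this
      clear * - this h5
      tauto
  have h7 := h.cycle.ins_edge x h₁.1 y h₃.1 hxy hC
  rw [← h.ins_add, ← E.ins_inl_eq_inr h.theta.cycle₂ hx.1 hxy, hx.2, Sym2.eq_swap,
    ← E.ins_inl_eq_inr h.theta.cycle₁ hy.1 hxy.symm, hy.2] at h7
  exact absurd h7 (by decide)

theorem outer [Finite V] (h : E.IsSplit H u A w B Q)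
    (hC : ∀ x ∈ biList u A w B, ∀ y ∈ biList u A w B, G.Adj x y → 
      s(x, y) ∈ cycleEdges (biList u A w B))
    (hQ : ∀ x ∈ Q, ∀ y, y = u ∨ y = w ∨ y ∈ Q → G.Adj x y → s(x, y) ∈ listEdges (u :: (Q ++ [w])))
    {v : V} (hv : v ∈ biList u Q w B) : E.Outer (E.disc H (biList u Q w B)) v := by
  have hvH : v ∈ H := h.mem (by rw [mem_biList] at hv; tauto)
  refine ⟨E.mem_disc.2 ⟨hvH, Or.inl hv⟩, fun D hD hDH hvD => ?_⟩
  refine E.ins_eq_zero_of_within h.theta.cycle₂ hD (fun e he => ?_) hv hvD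
  have hadj := adj_of_mem_cycleEdges hD he
  have hmem : ∀ x ∈ e, x ∈ H ∧ (x ∈ biList u Q w B ∨ E.ins (biList u Q w B) (.inl x) = 1) :=
    fun x hx => E.mem_disc.1 (hDH x (mem_of_mem_cycleEdges he hx))
  have key : ∀ x ∈ Q, ∀ y ∈ biList u Q w B, G.Adj x y →
      s(x, y) ∈ cycleEdges (biList u Q w B) ∨ E.ins (biList u Q w B) (.inr s(x, y)) = 1 := by
    intro x hx y hy hxy
    by_cases hyB : y ∈ B
    · right
      rw [← h.cycle.ins_edge x (h.subset x hx) y (h.mem (by tauto)) hxy (fun he =>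
        h.disjoint hx (mem_of_mem_cycleEdges he (by simp))), ← h.ins_add, Sym2.eq_swap,
        ← E.ins_inl_eq_inr h.theta.cycle₁ (h.symm.notMem_left hyB) hxy.symm,
        h.symm.ins_left hyB, zero_add]
    · rw [mem_biList] at hy
      exact Or.inl (mem_cycleEdges_biList.2 (Or.inl (hQ x hx y (by tauto) hxy)))
  induction e with
  | _ x y =>
    by_cases hx : x ∈ biList u Q w B
    · by_cases hy : y ∈ biList u Q w B
      · by_cases hxQ : x ∈ Q
        · exact key x hxQ y hy hadj
        by_cases hyQ : y ∈ Q
        · rw [Sym2.eq_swap]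
          exact key y hyQ x hx (SimpleGraph.Adj.symm hadj)
        left
        have hA := h.notMem_left (x := x)
        have hA' := h.notMem_left (x := y)
        have := hC x (by rw [mem_biList] at hx ⊢; tauto) y (by rw [mem_biList] at hy ⊢; tauto) hadj
        rw [mem_cycleEdges_biList] at this ⊢
        refine this.elim (fun he => ?_) Or.inr
        have hx' := mem_of_mem_listEdges he (v := x) (by simp)
        have hy' := mem_of_mem_listEdges he (v := y) (by simp)
        simp only [List.mem_cons, List.mem_append, List.not_mem_nil, or_false] at hx' hy'
        have hne := SimpleGraph.Adj.ne hadj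
        have huw : s(x, y) = s(u, w) := by
          have h1 : x = u ∨ x = w := by tauto
          have h2 : y = u ∨ y = w := by tauto
          rcases h1 with rfl | rfl <;> rcases h2 with rfl | rfl <;> simp_all
        rw [huw] at he
        exact absurd (eq_nil_of_ends_mem_listEdges
          (isCyc_biList.1 h.cycle.isCyc).1.nodup he) h.left_ne
      · right
        rw [Sym2.eq_swap, ← E.ins_inl_eq_inr h.theta.cycle₂ hy (SimpleGraph.Adj.symm hadj)]
        exact (hmem y (by simp)).2.resolve_left hy
    · right
      rw [← E.ins_inl_eq_inr h.theta.cycle₂ hx hadj]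
      exact (hmem x (by simp)).2.resolve_left hx

end IsSplit

end PlaneEmbedding

section conn

open scoped Classical

variable {V : Type} {G : SimpleGraph V}

theorem conn_empty : Conn G ∅ := fun _ _ _ _ => by simp

theorem conn_singleton (v : V) : Conn G {v} := by
  intro T hT ⟨x, hx⟩ _
  have := hT hx
  simp only [Finset.mem_singleton] at this
  simpa [this] using hx

theorem Conn.union {X Y : Finset V} (hX : Conn G X) (hY : Conn G Y) {z : V} (hzX : z ∈ X)
    (hzY : z ∈ Y) : Conn G (X ∪ Y) := by
  intro T hT ⟨t, ht⟩ hc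
  have hXT : (∃ x ∈ X, x ∈ T) → X ⊆ T := fun ⟨x, hx, hxT⟩ => (hX (T ∩ X) Finset.inter_subset_right
    ⟨x, by simp [hx, hxT]⟩ (fun a ha b hb hab => by
      rw [Finset.mem_inter] at ha ⊢
      exact ⟨hc a ha.1 b (by simp [hb]) hab, hb⟩)).trans Finset.inter_subset_left
  have hYT : (∃ x ∈ Y, x ∈ T) → Y ⊆ T := fun ⟨x, hx, hxT⟩ => (hY (T ∩ Y) Finset.inter_subset_right
    ⟨x, by simp [hx, hxT]⟩ (fun a ha b hb hab => by
      rw [Finset.mem_inter] at ha ⊢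
      exact ⟨hc a ha.1 b (by simp [hb]) hab, hb⟩)).trans Finset.inter_subset_left
  rcases Finset.mem_union.1 (hT ht) with h | h
  · have h1 := hXT ⟨t, h, ht⟩
    exact Finset.union_subset h1 (hYT ⟨z, hzY, h1 hzX⟩)
  · have h1 := hYT ⟨t, h, ht⟩
    exact Finset.union_subset (hXT ⟨z, hzX, h1 hzY⟩) h1

theorem Conn.union_adj {X N : Finset V} (hX : Conn G X) (hN : ∀ n ∈ N, ∃ x ∈ X, G.Adj n x) :
    Conn G (X ∪ N) := by
  intro T hT ⟨t, ht⟩ hc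
  obtain ⟨x, hx, hxT⟩ : ∃ x ∈ X, x ∈ T := by
    rcases Finset.mem_union.1 (hT ht) with h | h
    · exact ⟨t, h, ht⟩
    · obtain ⟨x, hx, htx⟩ := hN t h
      exact ⟨x, hx, hc t ht x (by simp [hx]) htx⟩
  have hXT : X ⊆ T := (hX (T ∩ X) Finset.inter_subset_right
    ⟨x, by simp [hx, hxT]⟩ (fun a ha b hb hab => by
      rw [Finset.mem_inter] at ha ⊢
      exact ⟨hc a ha.1 b (by simp [hb]) hab, hb⟩)).trans Finset.inter_subset_left
  refine Finset.union_subset hXT fun n hn => ?_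
  obtain ⟨y, hy, hny⟩ := hN n hn
  exact hc y (hXT hy) n (by simp [hn]) hny.symm

theorem Conn.insert {X : Finset V} (hX : Conn G X) {n x : V} (hx : x ∈ X) (h : G.Adj n x) :
    Conn G (insert n X) := by
  rw [Finset.insert_eq, Finset.union_comm]
  exact hX.union_adj (by simpa using ⟨x, hx, h⟩)

theorem conn_of_isChain {l : List V} (h : l.IsChain G.Adj) : Conn G l.toFinset := by
  induction l with
  | nil => exact conn_empty
  | cons a l ih =>
    cases l with
    | nil => simpa using conn_singleton a
    | cons b l =>
      rw [List.isChain_cons_cons] at h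
      rw [List.toFinset_cons]
      exact (ih h.2).insert (x := b) (by simp) h.1

/-- The subgraph induced on `H` is separated into those induced on `H₁` and `H₂`. -/
structure Separation (G : SimpleGraph V) (H H₁ H₂ : Finset V) : Prop where
  left : H₁ ⊆ H
  right : H₂ ⊆ H
  cover : ∀ x ∈ H, x ∈ H₁ ∨ x ∈ H₂
  not_adj : ∀ x ∈ H₁, x ∉ H₂ → ∀ y ∈ H₂, y ∉ H₁ → ¬ G.Adj x y

theorem Separation.symm {H H₁ H₂ : Finset V} (h : Separation G H H₁ H₂) : Separation G H H₂ H₁ where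
  left := h.right
  right := h.left
  cover x hx := (h.cover x hx).symm
  not_adj x hx hx' y hy hy' hxy := h.not_adj y hy hy' x hx hx' (SimpleGraph.Adj.symm hxy)

theorem Separation.conn {H H₁ H₂ P : Finset V} (h : Separation G H H₁ H₂) (hP : Conn G P) (hPH : P ⊆ H)
    (hcl : ∀ x ∈ P, x ∈ H₁ → x ∈ H₂ → ∀ y ∈ P, y ∈ H₁ → y ∈ H₂ → x ≠ y → G.Adj x y) :
    Conn G (P ∩ H₁) := by
  intro T hT ⟨t, ht⟩ hc
  have hT' : ∀ x ∈ T, x ∈ P ∧ x ∈ H₁ := fun x hx => Finset.mem_inter.1 (hT hx)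
  by_cases hTH : ∃ s ∈ T, s ∈ H₂
  · obtain ⟨s, hsT, hs⟩ := hTH
    have hS : ∀ x ∈ P, x ∈ H₁ → x ∈ H₂ → x ∈ T := by
      intro x hx hx1 hx2
      by_cases hxs : s = x
      · exact hxs ▸ hsT
      · exact hc s hsT x (by simp [hx, hx1]) (hcl s (hT' s hsT).1 (hT' s hsT).2 hs x hx hx1 hx2 hxs)
    have := hP (T ∪ P ∩ H₂) (Finset.union_subset (fun x hx => (hT' x hx).1)
      Finset.inter_subset_left) ⟨t, by simp [ht]⟩ (by
        intro x hx y hy hxy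
        by_cases hy2 : y ∈ H₂
        · simp [hy, hy2]
        have hy1 := (h.cover y (hPH hy)).resolve_right hy2
        rw [Finset.mem_union] at hx ⊢
        left
        have hx : x ∈ T := by
          rcases hx with hx | hx
          · exact hx
          · rw [Finset.mem_inter] at hx
            by_cases hx1 : x ∈ H₁
            · exact hS x hx.1 hx1 hx.2
            · exact absurd hxy.symm (h.not_adj y hy1 hy2 x hx.2 hx1)
        exact hc x hx y (by simp [hy, hy1]) hxy)
    intro x hx
    rw [Finset.mem_inter] at hx
    rcases Finset.mem_union.1 (this hx.1) with h1 | h1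
    · exact h1
    · exact hS x hx.1 hx.2 (Finset.mem_inter.1 h1).2
  · push Not at hTH
    refine Finset.inter_subset_left.trans (hP T (fun x hx => (hT' x hx).1) ⟨t, ht⟩ ?_)
    intro x hx y hy hxy
    by_cases hy1 : y ∈ H₁
    · exact hc x hx y (by simp [hy, hy1]) hxy
    · exact absurd hxy (h.not_adj x (hT' x hx).2 (hTH x hx) y
        ((h.cover y (hPH hy)).resolve_left hy1) hy1)

/-- The subgraph induced on `H` has a proper colouring from the lists `L`. -/
def ListColorable (G : SimpleGraph V) (H : Finset V) (L : V → Finset ℕ) : Prop :=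
  ∃ φ : V → ℕ, (∀ v ∈ H, φ v ∈ L v) ∧ ∀ u ∈ H, ∀ v ∈ H, G.Adj u v → φ u ≠ φ v

theorem Separation.listColorable {H H₁ H₂ : Finset V} (h : Separation G H H₁ H₂) {L : V → Finset ℕ}
    {φ₁ φ₂ : V → ℕ} (h₁ : ∀ v ∈ H₁, φ₁ v ∈ L v)
    (h₁' : ∀ u ∈ H₁, ∀ v ∈ H₁, G.Adj u v → φ₁ u ≠ φ₁ v) (h₂ : ∀ v ∈ H₂, φ₂ v ∈ L v)
    (h₂' : ∀ u ∈ H₂, ∀ v ∈ H₂, G.Adj u v → φ₂ u ≠ φ₂ v)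
    (hS : ∀ v ∈ H₁, v ∈ H₂ → φ₂ v = φ₁ v) : ListColorable G H L := by
  refine ⟨fun v => if v ∈ H₁ then φ₁ v else φ₂ v, fun v hv => ?_, fun u hu v hv huv => ?_⟩
  · dsimp only
    split_ifs with hv1
    · exact h₁ v hv1
    · exact h₂ v ((h.cover v hv).resolve_left hv1)
  · dsimp only
    have hc := h.cover u hu
    have hc' := h.cover v hv
    have hne := h.not_adj u
    have hne' := h.not_adj v
    split_ifs with hu1 hv1 hv1
    · exact h₁' u hu1 v hv1 huv
    · by_cases hu2 : u ∈ H₂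
      · rw [← hS u hu1 hu2]
        exact h₂' u hu2 v (hc'.resolve_left hv1) huv
      · exact absurd huv (hne hu1 hu2 v (hc'.resolve_left hv1) hv1)
    · by_cases hv2 : v ∈ H₂
      · rw [← hS v hv1 hv2]
        exact h₂' u (hc.resolve_left hu1) v hv2 huv
      · exact absurd huv.symm (hne' hv1 hv2 u (hc.resolve_left hu1) hu1)
    · exact h₂' u (hc.resolve_left hu1) v (hc'.resolve_left hv1) huv

end conn

section config

open scoped Classical

variable {V : Type} {G : SimpleGraph V}

/-- Lists on `H` such that the set `P` of outer vertices is essentially precoloured and the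
vertices with lists of size two are in an independent set `A` of outer vertices. -/
structure PlaneEmbedding.Config (E : PlaneEmbedding G) (H P A : Finset V) (L : V → Finset ℕ) :
    Prop where
  conn : Conn G P
  card_le : P.card ≤ 6
  outer : ∀ v ∈ P, E.Outer H v
  outer' : ∀ v ∈ A, E.Outer H v
  disjoint : ∀ v ∈ A, v ∉ P
  indep : ∀ u ∈ A, ∀ v ∈ A, ¬ G.Adj u v
  not_adj : ∀ u ∈ A, ∀ v ∈ P, ¬ G.Adj u v
  nonempty : ∀ v ∈ P, (L v).Nonempty
  list_disjoint : ∀ u ∈ P, ∀ v ∈ P, G.Adj u v → Disjoint (L u) (L v)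
  two_le : ∀ v ∈ H, v ∉ P → 2 ≤ (L v).card
  three_le : ∀ v ∈ H, v ∉ P → v ∉ A → 3 ≤ (L v).card

/-- All configurations on `H` are colourable. -/
def PlaneEmbedding.Claim (E : PlaneEmbedding G) (H : Finset V) : Prop :=
  ∀ P A L, E.Config H P A L → ListColorable G H L

/-- A minimal configuration without a colouring. -/
structure PlaneEmbedding.MinCE (E : PlaneEmbedding G) (H P A : Finset V) (L : V → Finset ℕ) :
    Prop extends E.Config H P A L where
  girth : GirthGeFive G
  ih : ∀ H' ⊂ H, E.Claim H'
  card_eq_one : ∀ v ∈ P, (L v).card = 1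
  card_eq_two : ∀ v ∈ A, (L v).card = 2
  exists_mem : P.Nonempty
  not_colorable : ¬ ListColorable G H L

variable {E : PlaneEmbedding G} {H P A : Finset V} {L : V → Finset ℕ}

theorem PlaneEmbedding.Config.mono (h : E.Config H P A L) {H' P' : Finset V} (hH : H' ⊆ H)
    (hP : P' ⊆ P) (hPH : P' ⊆ H') (hPH' : ∀ v ∈ P, v ∈ H' → v ∈ P') (hc : Conn G P') :
    E.Config H' P' (A ∩ H') L where
  conn := hc
  card_le := (Finset.card_le_card hP).trans h.card_le
  outer v hv := (h.outer v (hP hv)).mono E hH (hPH hv)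
  outer' v hv := (h.outer' v (Finset.mem_of_mem_inter_left hv)).mono E hH
    (Finset.mem_of_mem_inter_right hv)
  disjoint v hv hv' := h.disjoint v (Finset.mem_of_mem_inter_left hv) (hP hv')
  indep u hu v hv := h.indep u (Finset.mem_of_mem_inter_left hu) v
    (Finset.mem_of_mem_inter_left hv)
  not_adj u hu v hv := h.not_adj u (Finset.mem_of_mem_inter_left hu) v (hP hv)
  nonempty v hv := h.nonempty v (hP hv)
  list_disjoint u hu v hv := h.list_disjoint u (hP hu) v (hP hv)
  two_le v hv hvP := h.two_le v (hH hv) fun hv' => hvP (hPH' v hv' hv)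
  three_le v hv hvP hvA := h.three_le v (hH hv) (fun hv' => hvP (hPH' v hv' hv))
    fun hv' => hvA (Finset.mem_inter.2 ⟨hv', hv⟩)

namespace PlaneEmbedding.MinCE

theorem subset (h : E.MinCE H P A L) : P ⊆ H := fun v hv => (h.outer v hv).1

theorem subset' (h : E.MinCE H P A L) : A ⊆ H := fun v hv => (h.outer' v hv).1

/-- Low degree vertices can be deleted. -/
theorem card_le_degree (h : E.MinCE H P A L) {v : V} (hv : v ∈ H) (hvP : v ∉ P) :
    (L v).card ≤ (H.filter (G.Adj v)).card := by
  by_contra! hlt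
  have hP : P ⊆ H.erase v := fun x hx =>
    Finset.mem_erase.2 ⟨fun hxv => hvP (hxv ▸ hx), h.subset hx⟩
  obtain ⟨φ, h1, h2⟩ := h.ih _ (Finset.erase_ssubset hv) _ _ _
    (h.toConfig.mono (Finset.erase_subset v H) (Finset.Subset.refl P) hP (fun _ hx _ => hx) h.conn)
  obtain ⟨c, hc, hc'⟩ := Finset.exists_mem_notMem_of_card_lt_card
    (Finset.card_image_le.trans_lt hlt : ((H.filter (G.Adj v)).image φ).card < _)
  have hc'' : ∀ u ∈ H, G.Adj v u → φ u ≠ c := fun u hu huv he =>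
    hc' (Finset.mem_image.2 ⟨u, Finset.mem_filter.2 ⟨hu, huv⟩, he⟩)
  refine h.not_colorable ⟨Function.update φ v c, fun u hu => ?_, fun u hu w hw huw => ?_⟩
  · by_cases huv : u = v
    · subst huv; simpa using hc
    · rw [Function.update_of_ne huv]
      exact h1 u (Finset.mem_erase.2 ⟨huv, hu⟩)
  · by_cases huv : u = v
    · subst huv
      rw [Function.update_self, Function.update_of_ne huw.ne']
      exact (hc'' w hw huw).symm
    · rw [Function.update_of_ne huv]
      by_cases hwv : w = v
      · subst hwv
        rw [Function.update_self]
        exact hc'' u hu huw.symm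
      · rw [Function.update_of_ne hwv]
        exact h2 u (Finset.mem_erase.2 ⟨huv, hu⟩) w (Finset.mem_erase.2 ⟨hwv, hw⟩) huw

/-- Colour one side of a separation and extend the colouring to the other side. -/
theorem extend (h : E.MinCE H P A L) {H₁ H₂ : Finset V} (hs : Separation G H H₁ H₂) (h₁ : H₁ ≠ H)
    (h₂ : H₂ ≠ H) (hS : Conn G (H₁ ∩ H₂)) (hout : ∀ s ∈ H₁, s ∈ H₂ → E.Outer H₂ s)
    (hcl : ∀ x ∈ P, x ∈ H₁ → x ∈ H₂ → ∀ y ∈ P, y ∈ H₁ → y ∈ H₂ → x ≠ y → G.Adj x y)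
    (hP : (∀ p ∈ P, p ∉ H₂) ∨ ∃ p ∈ P, p ∈ H₁ ∧ p ∈ H₂)
    (hA : ∀ a ∈ A, a ∈ H₂ → a ∉ H₁ → ∀ s ∈ H₁, s ∈ H₂ → ∀ t ∈ H₁, t ∈ H₂ → G.Adj a s →
      G.Adj a t → s = t)
    (hedge : ∀ p ∈ P, p ∈ H₂ → p ∉ H₁ → ∀ s ∈ H₁, s ∈ H₂ → s ∉ P → ¬ G.Adj p s)
    (hcard : (P ∩ H₂ ∪ H₁ ∩ H₂ ∪ A.filter fun a => a ∈ H₂ ∧ ∃ s ∈ H₁ ∩ H₂, G.Adj a s).card ≤ 6) :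
    False := by
  obtain ⟨φ₁, f1, f2⟩ := h.ih _ (hs.left.ssubset_of_ne h₁) _ _ _
    (h.toConfig.mono hs.left (P' := P ∩ H₁) Finset.inter_subset_left Finset.inter_subset_right
      (fun v hv hv' => Finset.mem_inter.2 ⟨hv, hv'⟩) (hs.conn h.conn h.subset hcl))
  set N := A.filter fun a => a ∈ H₂ ∧ ∃ s ∈ H₁ ∩ H₂, G.Adj a s with hN
  set P' := P ∩ H₂ ∪ H₁ ∩ H₂ ∪ N with hP'
  have memP' : ∀ {x}, x ∈ P' ↔ (x ∈ P ∧ x ∈ H₂) ∨ (x ∈ H₁ ∧ x ∈ H₂) ∨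
      (x ∈ A ∧ x ∈ H₂ ∧ ∃ s ∈ H₁ ∩ H₂, G.Adj x s) := by
    intro x
    rw [hP', Finset.mem_union, Finset.mem_union, Finset.mem_inter, Finset.mem_inter, hN,
      Finset.mem_filter, or_assoc]
  have hconn : Conn G P' := by
    refine Conn.union_adj ?_ ?_
    · rcases hP with hP | ⟨p, hp, hp1, hp2⟩
      · have : P ∩ H₂ = ∅ := by
          ext x
          simp only [Finset.mem_inter, Finset.notMem_empty, iff_false]
          exact fun hx => hP x hx.1 hx.2
        rw [this, Finset.empty_union]
        exact hS
      · exact (hs.symm.conn h.conn h.subset fun x hx hx1 hx2 y hy hy1 hy2 =>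
          hcl x hx hx2 hx1 y hy hy2 hy1).union hS (z := p) (by simp [hp, hp2]) (by simp [hp1, hp2])
    · intro n hn
      rw [hN, Finset.mem_filter] at hn
      obtain ⟨s, hs, hns⟩ := hn.2.2
      exact ⟨s, by rw [Finset.mem_union]; exact Or.inr hs, hns⟩
  set L₂ : V → Finset ℕ := fun v => if v ∈ H₁ then {φ₁ v} else if v ∈ A then
    (L v).filter fun c => ∀ s ∈ H₁ ∩ H₂, G.Adj v s → c ≠ φ₁ s else L v with hL₂
  have hL₁ : ∀ v ∈ H₁, L₂ v = {φ₁ v} := fun v hv => if_pos hv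
  have hLA : ∀ v ∉ H₁, v ∈ A → L₂ v = (L v).filter fun c => ∀ s ∈ H₁ ∩ H₂, G.Adj v s → c ≠ φ₁ s :=
    fun v hv hvA => by simp only [hL₂, if_neg hv, if_pos hvA]
  have hLn : ∀ v ∉ H₁, v ∉ A → L₂ v = L v :=
    fun v hv hvA => by simp only [hL₂, if_neg hv, if_neg hvA]
  have hLA' : ∀ v ∈ H₂, v ∉ P' → v ∈ A → L₂ v = L v := by
    intro v hv hvP hvA
    have hv1 : v ∉ H₁ := fun hv1 => hvP (memP'.2 (Or.inr (Or.inl ⟨hv1, hv⟩)))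
    rw [hLA v hv1 hvA, Finset.filter_true_of_mem]
    intro c _ s hs hvs
    exact absurd (memP'.2 (Or.inr (Or.inr ⟨hvA, hv, s, hs, hvs⟩))) hvP
  have hsub : ∀ v ∈ H₂, L₂ v ⊆ L v := by
    intro v hv
    by_cases hv1 : v ∈ H₁
    · rw [hL₁ v hv1]
      simpa using f1 v hv1
    · by_cases hvA : v ∈ A
      · rw [hLA v hv1 hvA]
        exact Finset.filter_subset _ _
      · rw [hLn v hv1 hvA]
  have hconf : E.Config H₂ P' ((A ∩ H₂) \ P') L₂ := by
    refine ⟨hconn, hcard, ?_, ?_, ?_, ?_, ?_, ?_, ?_, ?_, ?_⟩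
    · intro v hv
      rcases memP'.1 hv with hv | hv | hv
      · exact (h.outer v hv.1).mono E hs.right hv.2
      · exact hout v hv.1 hv.2
      · exact (h.outer' v hv.1).mono E hs.right hv.2.1
    · intro v hv
      rw [Finset.mem_sdiff, Finset.mem_inter] at hv
      exact (h.outer' v hv.1.1).mono E hs.right hv.1.2
    · intro v hv
      exact (Finset.mem_sdiff.1 hv).2
    · intro u hu v hv
      rw [Finset.mem_sdiff, Finset.mem_inter] at hu hv
      exact h.indep u hu.1.1 v hv.1.1
    · intro u hu v hv huv
      rw [Finset.mem_sdiff, Finset.mem_inter] at hu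
      rcases memP'.1 hv with hv | hv | hv
      · exact h.not_adj u hu.1.1 v hv.1 huv
      · exact hu.2 (memP'.2 (Or.inr (Or.inr ⟨hu.1.1, hu.1.2, v, Finset.mem_inter.2 hv, huv⟩)))
      · exact h.indep u hu.1.1 v hv.1 huv
    · intro v hv
      by_cases hv1 : v ∈ H₁
      · rw [hL₁ v hv1]
        simp
      by_cases hvA : v ∈ A
      · rw [hLA v hv1 hvA]
        by_cases hn : ∃ s ∈ H₁ ∩ H₂, G.Adj v s
        · obtain ⟨s, hs', hvs⟩ := hn
          rw [Finset.mem_inter] at hs'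
          obtain ⟨c, hc, hcs⟩ := Finset.exists_mem_ne (show 1 < (L v).card by
            rw [h.card_eq_two v hvA]; omega) (φ₁ s)
          refine ⟨c, Finset.mem_filter.2 ⟨hc, fun t ht hvt => ?_⟩⟩
          rw [Finset.mem_inter] at ht
          have hv2 : v ∈ H₂ := (hs.cover v (h.subset' hvA)).resolve_left hv1
          rw [← hA v hvA hv2 hv1 s hs'.1 hs'.2 t ht.1 ht.2 hvs hvt]
          exact hcs
        · push Not at hn
          rw [Finset.filter_true_of_mem fun c _ s hs hvs => absurd hvs (hn s hs)]
          exact Finset.card_pos.1 (by rw [h.card_eq_two v hvA]; omega)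
      · rw [hLn v hv1 hvA]
        rcases memP'.1 hv with hv | hv | hv
        · exact h.nonempty v hv.1
        · exact absurd hv.1 hv1
        · exact absurd hv.1 hvA
    · have key : ∀ u ∈ P', ∀ v ∈ P', v ∉ H₁ → G.Adj u v → Disjoint (L₂ u) (L₂ v) := by
        intro u hu v hv hv1 huv
        have hu2 : u ∈ H₂ := by have := memP'.1 hu; tauto
        have hv2 : v ∈ H₂ := by have := memP'.1 hv; tauto
        have hv' := (memP'.1 hv).imp_right fun h => h.resolve_left fun h => hv1 h.1
        by_cases hu1 : u ∈ H₁
        · rcases hv' with hv' | hv'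
          · by_cases huP : u ∈ P
            · exact (h.list_disjoint u huP v hv'.1 huv).mono (hsub u hu2) (hsub v hv2)
            · exact absurd huv.symm (hedge v hv'.1 hv'.2 hv1 u hu1 hu2 huP)
          · rw [hL₁ u hu1, hLA v hv1 hv'.1, Finset.disjoint_singleton_left, Finset.mem_filter]
            exact fun hc => hc.2 u (Finset.mem_inter.2 ⟨hu1, hu2⟩) huv.symm rfl
        · have hu' := (memP'.1 hu).imp_right fun h => h.resolve_left fun h => hu1 h.1
          rcases hu' with hu' | hu' <;> rcases hv' with hv' | hv'
          · exact (h.list_disjoint u hu'.1 v hv'.1 huv).mono (hsub u hu2) (hsub v hv2)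
          · exact absurd huv.symm (h.not_adj v hv'.1 u hu'.1)
          · exact absurd huv (h.not_adj u hu'.1 v hv'.1)
          · exact absurd huv (h.indep u hu'.1 v hv'.1)
      intro u hu v hv huv
      by_cases hv1 : v ∈ H₁
      · by_cases hu1 : u ∈ H₁
        · rw [hL₁ u hu1, hL₁ v hv1, Finset.disjoint_singleton]
          exact f2 u hu1 v hv1 huv
        · exact (key v hv u hu hu1 huv.symm).symm
      · exact key u hu v hv hv1 huv
    · intro v hv hvP
      have hv1 : v ∉ H₁ := fun hv1 => hvP (memP'.2 (Or.inr (Or.inl ⟨hv1, hv⟩)))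
      have hvP' : v ∉ P := fun h' => hvP (memP'.2 (Or.inl ⟨h', hv⟩))
      by_cases hvA : v ∈ A
      · rw [hLA' v hv hvP hvA]
        exact h.two_le v (hs.right hv) hvP'
      · rw [hLn v hv1 hvA]
        exact h.two_le v (hs.right hv) hvP'
    · intro v hv hvP hvA
      have hv1 : v ∉ H₁ := fun hv1 => hvP (memP'.2 (Or.inr (Or.inl ⟨hv1, hv⟩)))
      have hvP' : v ∉ P := fun h' => hvP (memP'.2 (Or.inl ⟨h', hv⟩))
      have hvA' : v ∉ A := fun h' => hvA (Finset.mem_sdiff.2 ⟨Finset.mem_inter.2 ⟨h', hv⟩, hvP⟩)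
      rw [hLn v hv1 hvA']
      exact h.three_le v (hs.right hv) hvP' hvA'
  obtain ⟨φ₂, g1, g2⟩ := h.ih _ (hs.right.ssubset_of_ne h₂) _ _ _ hconf
  refine h.not_colorable (hs.listColorable f1 f2 (fun v hv => hsub v hv (g1 v hv)) g2 ?_)
  intro v hv1 hv2
  have := g1 v hv2
  rw [hL₁ v hv1] at this
  simpa using this

/-- Colour and delete a connected set of vertices, some of which are outer. -/
theorem reduce (h : E.MinCE H P A L) {D P' : Finset V} {ψ : V → ℕ} (hDH : D ⊆ H)
    (hD : Conn G D) {z : V} (hz : z ∈ D) (hzo : E.Outer H z) (hP' : Conn G P')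
    (hcard : P'.card ≤ 6) (hout : ∀ p ∈ P', E.Outer (H \ D) p)
    (hPP : ∀ p ∈ P, p ∈ D ∨ p ∈ P') (hψ : ∀ v, v ∈ D ∨ v ∈ P' → ψ v ∈ L v)
    (hψ' : ∀ u, u ∈ D ∨ u ∈ P' → ∀ v, v ∈ D ∨ v ∈ P' → G.Adj u v → ψ u ≠ ψ v)
    (hN : ∀ t ∈ H, t ∉ D → t ∉ P' → t ∉ A → ∀ d ∈ D, ∀ d' ∈ D, G.Adj t d → G.Adj t d' → d = d')
    (hNN : ∀ t ∈ H, t ∉ D → t ∉ P' → t ∉ A → ∀ d ∈ D, G.Adj t d →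
      ∀ t' ∈ H, t' ∉ D → t' ∉ P' → t' ∉ A → ∀ d' ∈ D, G.Adj t' d' → ¬ G.Adj t t')
    (hNA : ∀ t ∈ H, t ∉ D → t ∉ P' → t ∉ A → ∀ d ∈ D, G.Adj t d →
      ∀ a ∈ A, a ∉ D → a ∉ P' → ¬ G.Adj t a)
    (hNP : ∀ t ∈ H, t ∉ D → t ∉ P' → t ∉ A → ∀ d ∈ D, G.Adj t d → ∀ p ∈ P', ¬ G.Adj t p)
    (hAP : ∀ a ∈ A, a ∉ D → a ∉ P' → ∀ p ∈ P', ¬ G.Adj a p)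
    (hAD : ∀ a ∈ A, a ∉ D → a ∉ P' → ∀ d ∈ D, G.Adj a d → ψ d ∉ L a) : False := by
  have hPH : ∀ p ∈ P', p ∈ H := fun p hp => (Finset.mem_sdiff.1 (hout p hp).1).1
  set N := H.filter fun t => t ∉ D ∧ t ∉ P' ∧ t ∉ A ∧ ∃ d ∈ D, G.Adj t d with hNdef
  have memN : ∀ {t}, t ∈ N ↔ t ∈ H ∧ t ∉ D ∧ t ∉ P' ∧ t ∉ A ∧ ∃ d ∈ D, G.Adj t d :=
    Finset.mem_filter
  set A' := A \ (D ∪ P') ∪ N with hA'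
  have memA' : ∀ {t}, t ∈ A' ↔ (t ∈ A ∧ t ∉ D ∧ t ∉ P') ∨ t ∈ N := by
    intro t
    rw [hA', Finset.mem_union, Finset.mem_sdiff, Finset.mem_union, not_or]
  set L' : V → Finset ℕ := fun v => if v ∈ P' then {ψ v} else
    (L v).filter fun c => ∀ d ∈ D, G.Adj v d → c ≠ ψ d with hL'
  have hLP : ∀ v ∈ P', L' v = {ψ v} := fun v hv => if_pos hv
  have hLn : ∀ v ∉ P', L' v = (L v).filter fun c => ∀ d ∈ D, G.Adj v d → c ≠ ψ d :=
    fun v hv => if_neg hv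
  have hLA : ∀ v ∈ A, v ∉ D → v ∉ P' → L' v = L v := by
    intro v hv hvD hvP
    rw [hLn v hvP, Finset.filter_true_of_mem]
    rintro c hc d hd hvd rfl
    exact hAD v hv hvD hvP d hd hvd hc
  have hLr : ∀ v ∈ H, v ∉ D → v ∉ P' → v ∉ A → v ∉ N → L' v = L v := by
    intro v hv hvD hvP hvA hvN
    rw [hLn v hvP, Finset.filter_true_of_mem]
    intro c hc d hd hvd
    exact absurd (memN.2 ⟨hv, hvD, hvP, hvA, d, hd, hvd⟩) hvN
  have hnP : ∀ v, v ∉ D → v ∉ P' → v ∉ P := fun v h1 h2 h3 => (hPP v h3).elim h1 h2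
  have hLN : ∀ v ∈ N, 2 ≤ (L' v).card := by
    intro v hv
    obtain ⟨h1, h2, h3, h4, d, hd, hvd⟩ := memN.1 hv
    have : (L v).erase (ψ d) ⊆ L' v := by
      intro c hc
      rw [Finset.mem_erase] at hc
      rw [hLn v h3, Finset.mem_filter]
      refine ⟨hc.2, fun d' hd' hvd' => ?_⟩
      rw [← hN v h1 h2 h3 h4 d hd d' hd' hvd hvd']
      exact hc.1
    have h5 := Finset.card_le_card this
    have h6 := h.three_le v h1 (hnP v h2 h3) h4
    have h7 := Finset.pred_card_le_card_erase (s := L v) (a := ψ d)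
    omega
  have hconf : E.Config (H \ D) P' A' L' := by
    refine ⟨hP', hcard, hout, ?_, ?_, ?_, ?_, ?_, ?_, ?_, ?_⟩
    · intro v hv
      rcases memA'.1 hv with hv | hv
      · exact (h.outer' v hv.1).mono E Finset.sdiff_subset
          (Finset.mem_sdiff.2 ⟨h.subset' hv.1, hv.2.1⟩)
      · obtain ⟨h1, h2, h3, h4, d, hd, hvd⟩ := memN.1 hv
        refine hzo.of_conn E Finset.sdiff_subset (Finset.mem_sdiff.2 ⟨h1, h2⟩) (hD.insert hd hvd)
          (Finset.mem_insert_of_mem hz) (Finset.mem_insert_self _ _) fun x hx hx' => ?_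
        exact (Finset.mem_insert.1 hx).resolve_right (Finset.mem_sdiff.1 hx').2
    · intro v hv
      rcases memA'.1 hv with hv | hv
      · exact hv.2.2
      · exact (memN.1 hv).2.2.1
    · intro u hu v hv huv
      rcases memA'.1 hu with hu | hu <;> rcases memA'.1 hv with hv | hv
      · exact h.indep u hu.1 v hv.1 huv
      · obtain ⟨h1, h2, h3, h4, d, hd, hvd⟩ := memN.1 hv
        exact hNA v h1 h2 h3 h4 d hd hvd u hu.1 hu.2.1 hu.2.2 huv.symm
      · obtain ⟨h1, h2, h3, h4, d, hd, hvd⟩ := memN.1 hu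
        exact hNA u h1 h2 h3 h4 d hd hvd v hv.1 hv.2.1 hv.2.2 huv
      · obtain ⟨h1, h2, h3, h4, d, hd, hvd⟩ := memN.1 hu
        obtain ⟨i1, i2, i3, i4, d', hd', hvd'⟩ := memN.1 hv
        exact hNN u h1 h2 h3 h4 d hd hvd v i1 i2 i3 i4 d' hd' hvd' huv
    · intro u hu v hv huv
      rcases memA'.1 hu with hu | hu
      · exact hAP u hu.1 hu.2.1 hu.2.2 v hv huv
      · obtain ⟨h1, h2, h3, h4, d, hd, hvd⟩ := memN.1 hu
        exact hNP u h1 h2 h3 h4 d hd hvd v hv huv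
    · intro v hv
      rw [hLP v hv]
      simp
    · intro u hu v hv huv
      rw [hLP u hu, hLP v hv, Finset.disjoint_singleton]
      exact hψ' u (Or.inr hu) v (Or.inr hv) huv
    · intro v hv hvP
      rw [Finset.mem_sdiff] at hv
      by_cases hvA : v ∈ A
      · rw [hLA v hvA hv.2 hvP]
        exact h.two_le v hv.1 (hnP v hv.2 hvP)
      by_cases hvN : v ∈ N
      · exact hLN v hvN
      · rw [hLr v hv.1 hv.2 hvP hvA hvN]
        exact h.two_le v hv.1 (hnP v hv.2 hvP)
    · intro v hv hvP hvA'
      rw [Finset.mem_sdiff] at hv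
      rw [memA', not_or] at hvA'
      have hvA : v ∉ A := fun hvA => hvA'.1 ⟨hvA, hv.2, hvP⟩
      rw [hLr v hv.1 hv.2 hvP hvA hvA'.2]
      exact h.three_le v hv.1 (hnP v hv.2 hvP) hvA
  obtain ⟨φ, f1, f2⟩ := h.ih _ (Finset.sdiff_ssubset hDH ⟨z, hz⟩) _ _ _ hconf
  have key : ∀ u ∈ D, ∀ v ∈ H, v ∉ D → G.Adj u v → ψ u ≠ φ v := by
    intro u hu v hv hvD huv
    have := f1 v (Finset.mem_sdiff.2 ⟨hv, hvD⟩)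
    by_cases hvP : v ∈ P'
    · rw [hLP v hvP, Finset.mem_singleton] at this
      rw [this]
      exact hψ' u (Or.inl hu) v (Or.inr hvP) huv
    · rw [hLn v hvP, Finset.mem_filter] at this
      exact (this.2 u hu huv.symm).symm
  refine h.not_colorable ⟨fun v => if v ∈ D then ψ v else φ v, fun v hv => ?_,
    fun u hu v hv huv => ?_⟩
  · dsimp only
    split_ifs with hvD
    · exact hψ v (Or.inl hvD)
    · have := f1 v (Finset.mem_sdiff.2 ⟨hv, hvD⟩)
      by_cases hvP : v ∈ P'
      · rw [hLP v hvP, Finset.mem_singleton] at this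
        rw [this]
        exact hψ v (Or.inr hvP)
      · rw [hLn v hvP, Finset.mem_filter] at this
        exact this.1
  · dsimp only
    split_ifs with huD hvD hvD
    · exact hψ' u (Or.inl huD) v (Or.inl hvD) huv
    · exact key u huD v hv hvD huv
    · exact (key v hvD u hu huD huv.symm).symm
    · exact f2 u (Finset.mem_sdiff.2 ⟨hu, huD⟩) v (Finset.mem_sdiff.2 ⟨hv, hvD⟩) huv

end PlaneEmbedding.MinCE

end config

section separations

open scoped Classical

variable {V : Type} {G : SimpleGraph V}

theorem conn_of_clique {S : Finset V} (h : ∀ x ∈ S, ∀ y ∈ S, x ≠ y → G.Adj x y) : Conn G S := by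
  intro T hT ⟨t, ht⟩ hc x hx
  by_cases hxt : t = x
  · exact hxt ▸ ht
  · exact hc t ht x hx (h t (hT ht) x hx hxt)

theorem Conn.exists_adj_adj {S : Finset V} (hS : Conn G S) (hcard : S.card ≤ 3) {x y : V}
    (hx : x ∈ S) (hy : y ∈ S) (hxy : x ≠ y) :
    G.Adj x y ∨ ∃ z ∈ S, G.Adj x z ∧ G.Adj z y := by
  by_contra! hcon
  have := hS (S.filter fun z => z = x ∨ G.Adj x z) (Finset.filter_subset _ _)
    ⟨x, by simp [hx]⟩ (by
      intro t ht w hw htw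
      rw [Finset.mem_filter] at ht ⊢
      refine ⟨hw, ?_⟩
      by_contra! hwx
      have htx : G.Adj x t := by
        rcases ht.2 with rfl | h
        · exact absurd htw hwx.2
        · exact h
      have hwy : w ≠ y := by
        rintro rfl
        exact hcon.2 t ht.1 htx htw
      have hty : t ≠ y := by
        rintro rfl
        exact hcon.1 htx
      have hsub : ({x, y, t, w} : Finset V) ⊆ S := by
        intro z hz
        simp only [Finset.mem_insert, Finset.mem_singleton] at hz
        rcases hz with rfl | rfl | rfl | rfl
        exacts [hx, hy, ht.1, hw]
      have h4 : ({x, y, t, w} : Finset V).card = 4 := by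
        rw [Finset.card_insert_of_notMem, Finset.card_insert_of_notMem,
          Finset.card_insert_of_notMem, Finset.card_singleton]
        · simpa using htw.ne
        · simpa using ⟨hty.symm, hwy.symm⟩
        · simpa using ⟨hxy, htx.ne, hwx.1.symm⟩
      have := Finset.card_le_card hsub
      omega) hy
  rw [Finset.mem_filter] at this
  rcases this.2 with h | h
  · exact hxy h.symm
  · exact hcon.1 h

theorem Separation.notMem_of_conn {H H₁ H₂ P : Finset V} (h : Separation G H H₁ H₂)
    (hP : Conn G P) (hPH : P ⊆ H) (hS : ∀ x ∈ H₁, x ∈ H₂ → x ∉ P) {p : V} (hp : p ∈ P)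
    (hp₂ : p ∉ H₂) : ∀ x ∈ P, x ∉ H₂ := by
  intro x hx hx2
  refine hp₂ (Finset.mem_inter.1 (hP (P ∩ H₂) Finset.inter_subset_left
    ⟨x, Finset.mem_inter.2 ⟨hx, hx2⟩⟩ (fun a ha b hb hab => ?_) hp)).2
  rw [Finset.mem_inter] at ha ⊢
  refine ⟨hb, ?_⟩
  by_contra hb2
  exact h.not_adj b ((h.cover b (hPH hb)).resolve_right hb2) hb2 a ha.2
    (fun ha1 => hS a ha1 ha.2 ha.1) hab.symm

theorem IsCyc.exists_nbrs {C : List V} (hC : IsCyc G C) {v : V} (hv : v ∈ C) :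
    ∃ x y, ∀ z, s(v, z) ∈ cycleEdges C → z = x ∨ z = y := by
  obtain ⟨C₁, C₂, rfl⟩ := List.append_of_mem hv
  have hn : ([v] ++ (C₂ ++ C₁)).Nodup := by simpa using hC.rotate.nodup
  rcases List.eq_nil_or_concat (C₂ ++ C₁) with h0 | ⟨t, b, h0⟩
  · have := hC.three_le
    rw [List.append_eq_nil_iff] at h0
    simp [h0.1, h0.2] at this
  refine ⟨(C₂ ++ C₁).headD v, b, fun z hz => ?_⟩
  have he := (mem_cycleEdges_rotate (l₁ := C₁) (l₂ := v :: C₂)).1 hz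
  have hzmem : z ∈ C₂ ++ C₁ := by
    have h1 := PlaneEmbedding.mem_of_mem_cycleEdges he (x := z) (by simp)
    have h2 := (PlaneEmbedding.adj_of_mem_cycleEdges hC hz)
    have h3 : z ≠ v := (SimpleGraph.Adj.ne h2).symm
    simp only [List.cons_append, List.mem_cons] at h1
    exact h1.resolve_left h3
  rcases crossing (l₁ := [v]) hn he (by simp) hzmem with ⟨s, t, -, h2⟩ | ⟨s, t, -, h2⟩
  · left; rw [h2]; rfl
  · right
    rw [h2, List.concat_eq_append] at h0
    have := List.append_inj_right' h0 rfl
    simpa using this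

namespace PlaneEmbedding

variable {E : PlaneEmbedding G} {H P A : Finset V} {L : V → Finset ℕ}

theorem IsOuterCycle.exists_isSplit {C Q : List V} (hC : E.IsOuterCycle H C) {u w : V}
    (hu : u ∈ C) (hw : w ∈ C) (huw : s(u, w) ∉ cycleEdges C) (hQ : IsPath G u Q w)
    (hQH : ∀ x ∈ Q, x ∈ H) (hQC : Q.Disjoint C) :
    ∃ A B, E.IsSplit H u A w B Q ∧ (∀ x, x ∈ biList u A w B ↔ x ∈ C) ∧
      ∀ e, e ∈ cycleEdges (biList u A w B) ↔ e ∈ cycleEdges C := by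
  obtain ⟨A, B, h1, h2, h3, h4, -⟩ := E.exists_cyc_biList hC.isCyc hu hw hQ.ne
  refine ⟨A, B, ⟨hC.congr h1 h2 h3 h4, ?_, ?_, hQ, hQH, fun x hx hx' => hQC hx ((h3 x).1 hx')⟩,
    h3, h4⟩
  · rintro rfl
    exact huw ((h4 _).1 (mem_cycleEdges_biList.2 (Or.inl (by simp [listEdges]))))
  · rintro rfl
    exact huw ((h4 _).1 (mem_cycleEdges_biList.2 (Or.inr (by simp [listEdges]))))

namespace IsSplit

variable {u w : V} {B C Q : List V}

theorem separation (h : E.IsSplit H u B w C Q) :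
    Separation G H (E.disc H (biList u Q w B)) (E.disc H (biList u Q w C)) where
  left := E.disc_subset
  right := E.disc_subset
  cover _ hx := h.mem_or hx
  not_adj _ h1 h2 _ h3 h4 := h.not_adj h1 h2 h3 h4

theorem mem_disc (h : E.IsSplit H u B w C Q) {x : V} (hx : x = u ∨ x = w ∨ x ∈ Q) :
    x ∈ E.disc H (biList u Q w B) :=
  E.mem_disc.2 ⟨h.mem (by tauto), Or.inl (mem_biList.2 (by tauto))⟩

theorem notMem_disc (h : E.IsSplit H u B w C Q) {x : V} (hx : x ∈ B) :
    x ∉ E.disc H (biList u Q w C) := by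
  rw [E.mem_disc, h.ins_left hx]
  have := h.notMem_left hx
  have h01 : (0 : ZMod 2) ≠ 1 := by decide
  tauto

theorem disc_ne (h : E.IsSplit H u B w C Q) : E.disc H (biList u Q w C) ≠ H := by
  intro he
  obtain ⟨x, hx⟩ := List.exists_mem_of_ne_nil _ h.left_ne
  refine h.notMem_disc hx ?_
  rw [he]
  exact h.mem (by tauto)

end IsSplit

/-- A separation at a vertex or an edge whose second side can be coloured last. -/
structure GoodSep (E : PlaneEmbedding G) (H P H₁ H₂ : Finset V) : Prop
    extends Separation G H H₁ H₂ where
  ne₁ : H₁ ≠ H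
  ne₂ : H₂ ≠ H
  card_le : (H₁ ∩ H₂).card ≤ 2
  clique : ∀ x ∈ H₁, x ∈ H₂ → ∀ y ∈ H₁, y ∈ H₂ → x ≠ y → G.Adj x y
  not_subset : ∃ s ∈ H₁, s ∈ H₂ ∧ s ∉ P
  outer : ∀ s ∈ H₁, s ∈ H₂ → E.Outer H₂ s
  side : (∀ p ∈ P, p ∉ H₂) ∨ (∃ p ∈ P, p ∈ H₁ ∧ p ∈ H₂) ∧ (P ∩ H₂).card ≤ 3

namespace MinCE

theorem eq_or_eq (h : E.MinCE H P A L) {H₁ H₂ : Finset V} (hs : Separation G H H₁ H₂)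
    (hS : ∀ x ∈ H₁, x ∈ H₂ → x ∈ P)
    (hcl : ∀ x ∈ H₁, x ∈ H₂ → ∀ y ∈ H₁, y ∈ H₂ → x ≠ y → G.Adj x y) : H₁ = H ∨ H₂ = H := by
  by_contra! hne
  have key : ∀ {H₁ H₂}, Separation G H H₁ H₂ → H₁ ≠ H →
      (∀ x ∈ H₁, x ∈ H₂ → ∀ y ∈ H₁, y ∈ H₂ → x ≠ y → G.Adj x y) → ListColorable G H₁ L :=
    fun hs h₁ hcl => h.ih _ (hs.left.ssubset_of_ne h₁) _ _ _
      (h.toConfig.mono hs.left (P' := P ∩ _) Finset.inter_subset_left Finset.inter_subset_right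
      (fun v hv hv' => Finset.mem_inter.2 ⟨hv, hv'⟩) (hs.conn h.conn h.subset
        fun x _ hx1 hx2 y _ hy1 hy2 => hcl x hx1 hx2 y hy1 hy2))
  obtain ⟨φ₁, f1, f2⟩ := key hs hne.1 hcl
  obtain ⟨φ₂, g1, g2⟩ := key hs.symm hne.2 fun x hx1 hx2 y hy1 hy2 => hcl x hx2 hx1 y hy2 hy1
  refine h.not_colorable (hs.listColorable f1 f2 g1 g2 fun v hv1 hv2 => ?_)
  exact Finset.card_le_one.1 (h.card_eq_one v (hS v hv1 hv2)).le _ (g1 v hv2) _ (f1 v hv1)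

theorem conn_self (h : E.MinCE H P A L) : Conn G H := by
  intro T hT ⟨t, ht⟩ hc
  by_contra hne
  have hs : Separation G H T (H \ T) := by
    refine ⟨hT, Finset.sdiff_subset, fun x hx => ?_, fun x hx _ y hy hy' hxy => ?_⟩
    · rw [Finset.mem_sdiff]; tauto
    · rw [Finset.mem_sdiff] at hy
      exact hy.2 (hc x hx y hy.1 hxy)
  rcases h.eq_or_eq hs (fun x hx hx' => absurd hx (Finset.mem_sdiff.1 hx').2)
    (fun x hx hx' => absurd hx (Finset.mem_sdiff.1 hx').2) with h1 | h1
  · exact hne h1.ge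
  · have := hT ht
    rw [← h1, Finset.mem_sdiff] at this
    exact this.2 ht

/-- A part of the graph hanging on a cut vertex and missing some vertex of `P`. -/
theorem goodSep_of_cut (h : E.MinCE H P A L) {u : V} {T : Finset V} (hu : u ∈ H)
    (hT : T ⊆ H.erase u) (hT₀ : T.Nonempty) (hc : ∀ x ∈ T, ∀ y ∈ H, y ≠ u → G.Adj x y → y ∈ T)
    (hne : insert u T ≠ H) {p : V} (hp : p ∈ P) (hpT : p ∉ T) :
    E.GoodSep H P (H \ T) (insert u T) := by
  have huT : u ∉ T := fun hu' => absurd (hT hu') (by simp)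
  have hs : Separation G H (H \ T) (insert u T) := by
    refine ⟨Finset.sdiff_subset, ?_, ?_, ?_⟩
    · exact Finset.insert_subset hu (hT.trans (Finset.erase_subset _ _))
    · intro x hx
      rw [Finset.mem_sdiff, Finset.mem_insert]
      tauto
    · intro x hx hx' y hy hy' hxy
      rw [Finset.mem_sdiff] at hx hy'
      rw [Finset.mem_insert, not_or] at hx'
      have hyT : y ∈ T := by
        rcases Finset.mem_insert.1 hy with rfl | hy
        · exact absurd ⟨hu, huT⟩ hy'
        · exact hy
      exact hx.2 (hc y hyT x hx.1 hx'.1 hxy.symm)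
  have hS : ∀ x ∈ H \ T, x ∈ insert u T → x = u := fun x hx hx' =>
    (Finset.mem_insert.1 hx').resolve_right (Finset.mem_sdiff.1 hx).2
  have hcl : ∀ x ∈ H \ T, x ∈ insert u T → ∀ y ∈ H \ T, y ∈ insert u T → x ≠ y → G.Adj x y :=
    fun x hx hx' y hy hy' hxy => absurd ((hS x hx hx').trans (hS y hy hy').symm) hxy
  have hne₁ : H \ T ≠ H := by
    intro he
    obtain ⟨t, ht⟩ := hT₀
    have := Finset.mem_of_mem_erase (hT ht)
    rw [← he, Finset.mem_sdiff] at this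
    exact this.2 ht
  have huP : u ∉ P := by
    intro huP
    exact (h.eq_or_eq hs (fun x hx hx' => hS x hx hx' ▸ huP) hcl).elim hne₁ hne
  refine ⟨hs, hne₁, hne, ?_, hcl, ⟨u, by simp [hu, huT], by simp, huP⟩, ?_, Or.inl ?_⟩
  · refine (Finset.card_le_card (t := {u}) fun x hx => ?_).trans (by simp)
    rw [Finset.mem_inter] at hx
    simpa using hS x hx.1 hx.2
  · intro s hs1 hs2
    obtain rfl := hS s hs1 hs2
    have hconn := hs.conn h.conn_self (Finset.Subset.refl H)
      fun x _ hx1 hx2 y _ hy1 hy2 => hcl x hx1 hx2 y hy1 hy2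
    exact (h.outer p hp).of_conn E hs.right hs2 hconn (by simp [h.subset hp, hpT]) (by simp [hu, huT])
      fun x hx hx' => hS x (Finset.mem_of_mem_inter_right hx) hx'
  · refine hs.notMem_of_conn h.conn h.subset (fun x hx hx' => hS x hx hx' ▸ huP) hp ?_
    rw [Finset.mem_insert, not_or]
    exact ⟨fun he => huP (he ▸ hp), hpT⟩

theorem noCut_of_cut {u : V} {S : Finset V}
    (h : ∀ T ⊆ S.erase u, T.Nonempty → (∀ x ∈ T, ∀ y ∈ S.erase u, G.Adj x y → y ∈ T) →
      (S.erase u \ T).Nonempty → (∀ x ∈ S.erase u \ T, ∀ y ∈ S.erase u, G.Adj x y →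
      y ∈ S.erase u \ T) → False) : Conn G (S.erase u) := by
  intro T hT hT0 hc
  by_contra hne
  refine h T hT hT0 hc (Finset.sdiff_nonempty.2 hne) fun x hx y hy hxy => ?_
  rw [Finset.mem_sdiff] at hx ⊢
  exact ⟨hy, fun hyT => hx.2 (hc y hyT x hx.1 hxy.symm)⟩

theorem exists_notMem (h : E.MinCE H P A L) : ∃ v ∈ H, v ∉ P := by
  by_contra! hcon
  have hne : ∀ v ∈ H, ∃ c, c ∈ L v := fun v hv => h.nonempty v (hcon v hv)
  choose! φ hφ using hne
  refine h.not_colorable ⟨φ, hφ, fun u hu v hv huv he => ?_⟩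
  have := h.list_disjoint u (hcon u hu) v (hcon v hv) huv
  exact Finset.disjoint_left.1 this (hφ u hu) (he ▸ hφ v hv)

variable [Fintype V]

theorem goodSep_false (h : E.MinCE H P A L) {H₁ H₂ : Finset V} (hg : E.GoodSep H P H₁ H₂) :
    False := by
  induction hn : H₂.card using Nat.strong_induction_on generalizing H₁ H₂ with
  | _ n ih =>
  subst hn
  obtain ⟨s, hs1, hs2, hsP⟩ := hg.not_subset
  have hnc : NoCut G H₂ := by
    intro u hu
    have hlt : ∀ T ⊆ H₂.erase u, (∀ x ∈ T, ∀ y ∈ H₂.erase u, G.Adj x y → y ∈ T) →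
        (H₂.erase u \ T).Nonempty → T.Nonempty → (∀ x ∈ T, x ∉ H₁) → False := by
      intro T hT hc hT' hT0 hTH
      obtain ⟨t, ht⟩ := hT'
      rw [Finset.mem_sdiff, Finset.mem_erase] at ht
      have hsub : insert u T ⊂ H₂ := by
        refine Finset.ssubset_iff_subset_ne.2
          ⟨Finset.insert_subset hu (hT.trans (Finset.erase_subset _ _)), fun he => ?_⟩
        have := ht.1.2
        rw [← he, Finset.mem_insert] at this
        exact this.elim ht.1.1 ht.2
      obtain ⟨p, hp, hpT⟩ : ∃ p ∈ P, p ∉ T := by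
        rcases hg.side with h1 | ⟨⟨p, hp, hp1, -⟩, -⟩
        · obtain ⟨p, hp⟩ := h.exists_mem
          exact ⟨p, hp, fun hpT => h1 p hp (Finset.mem_of_mem_erase (hT hpT))⟩
        · exact ⟨p, hp, fun hpT => hTH p hpT hp1⟩
      refine ih _ (Finset.card_lt_card hsub) (h.goodSep_of_cut (hg.right hu) (hT.trans
        (Finset.erase_subset_erase _ hg.right)) hT0 ?_
        (fun he => (hsub.trans_subset hg.right).ne he) hp hpT) rfl
      intro x hx y hy hyu hxy
      by_cases hy2 : y ∈ H₂
      · exact hc x hx y (Finset.mem_erase.2 ⟨hyu, hy2⟩) hxy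
      · exact absurd hxy.symm (hg.not_adj y ((hg.cover y hy).resolve_right hy2) hy2 x
          (Finset.mem_of_mem_erase (hT hx)) (hTH x hx))
    refine noCut_of_cut fun T hT hT0 hc hT' hc' => ?_
    by_cases hTH : ∀ x ∈ T, x ∉ H₁
    · exact hlt T hT hc hT' hT0 hTH
    push Not at hTH
    obtain ⟨t, ht, ht1⟩ := hTH
    refine hlt _ Finset.sdiff_subset hc' (by rwa [Finset.sdiff_sdiff_eq_self hT]) hT' ?_
    intro x hx hx1
    rw [Finset.mem_sdiff, Finset.mem_erase] at hx
    refine hx.2 (hc t ht x (Finset.mem_erase.2 hx.1) (hg.clique t ht1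
      (Finset.mem_of_mem_erase (hT ht)) x hx1 hx.1.2 ?_))
    rintro rfl
    exact hx.2 ht
  set M : V → Finset V := fun v => A.filter fun a => a ∈ H₂ ∧ a ∉ H₁ ∧ G.Adj v a with hM
  have hM2 : ∀ v ∈ H₁, v ∈ H₂ → v ∉ P → (M v).card ≤ 2 := by
    intro v hv1 hv2 hvP
    by_contra! hlt
    have hsub : M v ⊆ H₂ := fun a ha => (Finset.mem_filter.1 ha).2.1
    obtain ⟨C, hC⟩ := E.exists_isOuterCycle hnc (by have := Finset.card_le_card hsub; omega)
    have hvC := hC.mem_of_outer E (hg.outer v hv1 hv2)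
    obtain ⟨x, y, hxy⟩ := hC.isCyc.exists_nbrs hvC
    obtain ⟨a, ha, hax, hay⟩ : ∃ a ∈ M v, a ≠ x ∧ a ≠ y := by
      by_contra! hcon
      have : M v ⊆ {x, y} := by
        intro a ha
        simp only [Finset.mem_insert, Finset.mem_singleton]
        by_cases hax : a = x
        · exact Or.inl hax
        · exact Or.inr (hcon a ha hax)
      have := (Finset.card_le_card this).trans Finset.card_le_two
      omega
    simp only [hM, Finset.mem_filter] at ha
    obtain ⟨haA, ha2, ha1, hva⟩ := ha
    have haP := h.disjoint a haA
    have hao := (h.outer' a haA).mono E hg.right ha2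
    obtain ⟨B, D, hsp, hmem, -⟩ := hC.exists_isSplit hvC (hC.mem_of_outer E hao)
      (fun he => (hxy a he).elim hax hay) (isPath_nil hva) (by simp) (by simp)
    have main : ∀ {B D}, E.IsSplit H₂ v B a D [] →
        (∀ z ∈ H₁, z ∈ H₂ → z ∉ D) → False := by
      intro B D hsp hD
      have hHD : E.disc H₂ (biList v [] a D) ⊆ H₂ := E.disc_subset
      have hdv : v ∈ E.disc H₂ (biList v [] a D) := hsp.symm.mem_disc (by simp)
      have hda : a ∈ E.disc H₂ (biList v [] a D) := hsp.symm.mem_disc (by simp)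
      have hH1 : ∀ z ∈ H₁, z ∈ E.disc H₂ (biList v [] a D) → z = v := by
        intro z hz hzD
        have hz2 := hHD hzD
        have := hC.mem_of_outer E (hg.outer z hz hz2)
        by_contra hzv
        have hzC : z ∈ biList v B a D := hsp.cycle.mem_of_outer E (hg.outer z hz hz2)
        rw [mem_biList] at hzC
        have hza : z ≠ a := fun he => ha1 (he ▸ hz)
        have hzB : z ∉ B := fun hzB => hsp.notMem_disc hzB hzD
        have := hD z hz hz2
        tauto
      have hinter : ∀ z ∈ H₁ ∪ E.disc H₂ (biList v [] a B), z ∈ E.disc H₂ (biList v [] a D) →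
          z = v ∨ z = a := by
        intro z hz hzD
        rcases Finset.mem_union.1 hz with hz | hz
        · exact Or.inl (hH1 z hz hzD)
        · have := hsp.mem_inter hz hzD
          simpa using this
      have hs' : Separation G H (H₁ ∪ E.disc H₂ (biList v [] a B))
          (E.disc H₂ (biList v [] a D)) := by
        refine ⟨Finset.union_subset hg.left (E.disc_subset.trans hg.right), hHD.trans hg.right,
          fun z hz => ?_, fun z hz hz' y hy hy' hzy => ?_⟩
        · rw [Finset.mem_union]
          rcases hg.cover z hz with h1 | h1
          · exact Or.inl (Or.inl h1)
          · rcases hsp.mem_or h1 with h2 | h2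
            · exact Or.inl (Or.inr h2)
            · exact Or.inr h2
        · rw [Finset.mem_union, not_or] at hy'
          by_cases hz2 : z ∈ H₂
          · exact hsp.not_adj ((hsp.mem_or hz2).resolve_right hz') hz' hy hy'.2 hzy
          · exact hg.not_adj z ((hg.cover z (Finset.mem_of_subset (Finset.union_subset hg.left
              (E.disc_subset.trans hg.right)) hz)).resolve_right hz2) hz2 y (hHD hy) hy'.1 hzy
      have hnotin : ∀ z, z = v ∨ z = a → z ∉ P := by
        rintro z (rfl | rfl)
        exacts [hvP, haP]
      have hlt : E.disc H₂ (biList v [] a D) ⊂ H₂ := hHD.ssubset_of_ne hsp.disc_ne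
      refine ih _ (Finset.card_lt_card hlt) ⟨hs', ?_, fun he => ?_, ?_, ?_, ⟨v, by simp [hv1], hdv,
        hvP⟩, ?_, Or.inl ?_⟩ rfl
      · intro he
        obtain ⟨d, hd⟩ := List.exists_mem_of_ne_nil _ hsp.right_ne
        have hd' : d ∈ H₂ := hsp.mem (by simp [hd])
        have := hg.right hd'
        rw [← he, Finset.mem_union] at this
        rcases this with h1 | h1
        · exact hD d h1 hd' hd
        · exact hsp.symm.notMem_disc hd h1
      · exact (hlt.trans_subset hg.right).ne he
      · refine (Finset.card_le_card (t := {v, a}) fun z hz => ?_).trans Finset.card_le_two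
        rw [Finset.mem_inter] at hz
        simpa using hinter z hz.1 hz.2
      · intro z hz hz' y hy hy' hzy
        rcases hinter z hz hz' with rfl | rfl <;> rcases hinter y hy hy' with rfl | rfl
        · exact absurd rfl hzy
        · exact hva
        · exact hva.symm
        · exact absurd rfl hzy
      · intro z hz hz'
        rcases hinter z hz hz' with rfl | rfl
        · exact (hg.outer z hv1 hv2).mono E hHD hz'
        · exact hao.mono E hHD hz'
      · rcases hg.side with h1 | ⟨⟨p, hp, hp1, -⟩, -⟩
        · exact fun p hp hp' => h1 p hp (hHD hp')
        · exact hs'.notMem_of_conn h.conn h.subset (fun z hz hz' => hnotin z (hinter z hz hz')) hp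
            fun hp' => hnotin p (Or.inl (hH1 p hp1 hp')) hp
    by_cases hD : ∀ z ∈ H₁, z ∈ H₂ → z ∉ D
    · exact main hsp hD
    push Not at hD
    obtain ⟨z, hz1, hz2, hzD⟩ := hD
    refine main hsp.symm fun y hy1 hy2 hyB => ?_
    obtain ⟨hB, hD, hBD, -⟩ := isCyc_biList.1 hsp.cycle.isCyc
    have h3 : ({v, z, y} : Finset V).card = 3 := by
      rw [Finset.card_insert_of_notMem, Finset.card_insert_of_notMem, Finset.card_singleton]
      · rw [Finset.mem_singleton]
        rintro rfl
        exact hBD hyB hzD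
      · simp only [Finset.mem_insert, Finset.mem_singleton]
        rintro (rfl | rfl)
        · exact hD.notMem_left hzD
        · exact hB.notMem_left hyB
    have hsub : ({v, z, y} : Finset V) ⊆ H₁ ∩ H₂ := by
      intro x hx
      simp only [Finset.mem_insert, Finset.mem_singleton] at hx
      rw [Finset.mem_inter]
      rcases hx with rfl | rfl | rfl
      exacts [⟨hv1, hv2⟩, ⟨hz1, hz2⟩, ⟨hy1, hy2⟩]
    have := Finset.card_le_card hsub
    have := hg.card_le
    omega
  refine h.extend hg.toSeparation hg.ne₁ hg.ne₂ (conn_of_clique fun x hx y hy => ?_) hg.outer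
    (fun x _ hx1 hx2 y _ hy1 hy2 => hg.clique x hx1 hx2 y hy1 hy2) (hg.side.imp_right And.left)
    ?_ ?_ ?_
  · rw [Finset.mem_inter] at hx hy
    exact hg.clique x hx.1 hx.2 y hy.1 hy.2
  · intro a haA ha2 ha1 s hs1 hs2 t ht1 ht2 has hat
    by_contra hst
    exact h.girth.no_triangle has (hg.clique s hs1 hs2 t ht1 ht2 hst) hat.symm
  · intro p hp hp2 hp1 s hs1 hs2 hsP hps
    rcases hg.side with h1 | ⟨⟨p₀, hp₀, hp₀1, hp₀2⟩, hcard⟩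
    · exact h1 p hp hp2
    have hconn := hg.symm.conn h.conn h.subset fun x _ hx1 hx2 y _ hy1 hy2 =>
      hg.clique x hx2 hx1 y hy2 hy1
    have hne : p ≠ p₀ := fun he => hp1 (he ▸ hp₀1)
    have hsp : G.Adj p₀ s := hg.clique p₀ hp₀1 hp₀2 s hs1 hs2 fun he => hsP (he ▸ hp₀)
    rcases hconn.exists_adj_adj hcard (Finset.mem_inter.2 ⟨hp, hp2⟩) (Finset.mem_inter.2
      ⟨hp₀, hp₀2⟩) hne with h1 | ⟨z, hz, h1, h2⟩
    · exact h.girth.no_triangle h1 hsp hps.symm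
    · refine h.girth.no_square h1 h2 hsp hps.symm hne ?_
      rintro rfl
      exact hsP (Finset.mem_inter.1 hz).1
  · have hsub : (P ∩ H₂ ∪ H₁ ∩ H₂ ∪ A.filter fun a => a ∈ H₂ ∧ ∃ s ∈ H₁ ∩ H₂, G.Adj a s) ⊆
        (P ∩ H₂ ∪ H₁ ∩ H₂) ∪ ((H₁ ∩ H₂) \ P).biUnion M := by
      intro x hx
      by_cases hx1 : x ∈ P ∩ H₂ ∪ H₁ ∩ H₂
      · exact Finset.mem_union_left _ hx1
      have hx2 := (Finset.mem_filter.1 ((Finset.mem_union.1 hx).resolve_left hx1))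
      refine Finset.mem_union_right _ (Finset.mem_biUnion.2 ?_)
      obtain ⟨hxA, hxH, t, ht, hxt⟩ := hx2
      refine ⟨t, Finset.mem_sdiff.2 ⟨ht, fun htP => h.not_adj x hxA t htP hxt⟩,
        Finset.mem_filter.2 ⟨hxA, hxH, fun hxH1 => hx1 ?_, hxt.symm⟩⟩
      exact Finset.mem_union_right _ (Finset.mem_inter.2 ⟨hxH1, hxH⟩)
    refine (Finset.card_le_card hsub).trans ((Finset.card_union_le _ _).trans ?_)
    have hb : (((H₁ ∩ H₂) \ P).biUnion M).card ≤ ((H₁ ∩ H₂) \ P).card * 2 :=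
      Finset.card_biUnion_le_card_mul _ _ _ fun v hv => by
        rw [Finset.mem_sdiff, Finset.mem_inter] at hv
        exact hM2 v hv.1.1 hv.1.2 hv.2
    have hcard := hg.card_le
    have hle : ((H₁ ∩ H₂) \ P).card ≤ (H₁ ∩ H₂).card := Finset.card_le_card Finset.sdiff_subset
    rcases hg.side with h1 | ⟨⟨p, hp, hp1, hp2⟩, h3⟩
    · have : P ∩ H₂ = ∅ := by
        ext x
        simp only [Finset.mem_inter, Finset.notMem_empty, iff_false]
        exact fun hx => h1 x hx.1 hx.2
      rw [this, Finset.empty_union]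
      omega
    · have hlt : ((H₁ ∩ H₂) \ P).card < (H₁ ∩ H₂).card := by
        refine Finset.card_lt_card (Finset.ssubset_iff_subset_ne.2 ⟨Finset.sdiff_subset, fun he =>
          ?_⟩)
        have : p ∈ H₁ ∩ H₂ := Finset.mem_inter.2 ⟨hp1, hp2⟩
        rw [← he, Finset.mem_sdiff] at this
        exact this.2 hp
      have hun : P ∩ H₂ ∪ H₁ ∩ H₂ ⊆ P ∩ H₂ ∪ (H₁ ∩ H₂) \ P := by
        intro x hx
        simp only [Finset.mem_union, Finset.mem_inter, Finset.mem_sdiff] at hx ⊢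
        tauto
      have := (Finset.card_le_card hun).trans (Finset.card_union_le _ _)
      omega

theorem noCut (h : E.MinCE H P A L) : NoCut G H := by
  intro u hu
  refine noCut_of_cut fun T hT hT0 hc hT' hc' => ?_
  obtain ⟨t, ht⟩ := hT0
  obtain ⟨t', ht'⟩ := hT'
  obtain ⟨p, hp⟩ := h.exists_mem
  have hcl : ∀ {T : Finset V}, (∀ x ∈ T, ∀ y ∈ H.erase u, G.Adj x y → y ∈ T) →
      ∀ x ∈ T, ∀ y ∈ H, y ≠ u → G.Adj x y → y ∈ T :=
    fun hc x hx y hy hyu hxy => hc x hx y (Finset.mem_erase.2 ⟨hyu, hy⟩) hxy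
  by_cases hpT : p ∈ T
  · refine h.goodSep_false (h.goodSep_of_cut hu Finset.sdiff_subset ⟨t', ht'⟩ (hcl hc') ?_ hp
      (fun h' => (Finset.mem_sdiff.1 h').2 hpT))
    intro he
    have h1 := Finset.mem_erase.1 (hT ht)
    have h2 := h1.2
    rw [← he, Finset.mem_insert, Finset.mem_sdiff] at h2
    exact h2.elim h1.1 fun h3 => h3.2 ht
  · refine h.goodSep_false (h.goodSep_of_cut hu hT ⟨t, ht⟩ (hcl hc) ?_ hp hpT)
    intro he
    rw [Finset.mem_sdiff, Finset.mem_erase] at ht'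
    have h2 := ht'.1.2
    rw [← he, Finset.mem_insert] at h2
    exact h2.elim ht'.1.1 ht'.2

theorem exists_outerCycle (h : E.MinCE H P A L) : ∃ C, E.IsOuterCycle H C := by
  refine E.exists_isOuterCycle h.noCut ?_
  obtain ⟨v, hv, hvP⟩ := h.exists_notMem
  have h1 := h.two_le v hv hvP
  have h2 := h.card_le_degree hv hvP
  have h3 : H.filter (G.Adj v) ⊆ H.erase v := by
    intro x hx
    rw [Finset.mem_filter] at hx
    exact Finset.mem_erase.2 ⟨hx.2.ne', hx.1⟩
  have h4 := Finset.card_le_card h3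
  rw [Finset.card_erase_of_mem hv] at h4
  omega

/-- The outer cycle has no chords. -/
theorem chordless (h : E.MinCE H P A L) {C : List V} (hC : E.IsOuterCycle H C) {x y : V}
    (hx : x ∈ C) (hy : y ∈ C) (hxy : G.Adj x y) : s(x, y) ∈ cycleEdges C := by
  by_contra hne
  obtain ⟨B, D, hsp, -, -⟩ := hC.exists_isSplit hx hy hne (isPath_nil hxy) (by simp) (by simp)
  have hcl : ∀ z ∈ E.disc H (biList x [] y B), z ∈ E.disc H (biList x [] y D) →
      z = x ∨ z = y := fun z h1 h2 => by simpa using hsp.mem_inter h1 h2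
  have hcl' : ∀ z, z = x ∨ z = y → ∀ t, t = x ∨ t = y → z ≠ t → G.Adj z t := by
    rintro z (rfl | rfl) t (rfl | rfl) hzt
    exacts [absurd rfl hzt, hxy, hxy.symm, absurd rfl hzt]
  by_cases hP : x ∈ P ∧ y ∈ P
  · refine (h.eq_or_eq hsp.separation (fun z h1 h2 => ?_) fun z h1 h2 t h3 h4 hzt =>
      hcl' z (hcl z h1 h2) t (hcl t h3 h4) hzt).elim hsp.symm.disc_ne hsp.disc_ne
    rcases hcl z h1 h2 with rfl | rfl
    exacts [hP.1, hP.2]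
  have main : ∀ {B D}, E.IsSplit H x B y D [] →
      ((∀ p ∈ P, p ∉ E.disc H (biList x [] y D)) ∨ (x ∈ P ∨ y ∈ P) ∧
      (P ∩ E.disc H (biList x [] y D)).card ≤ 3) → False := by
    intro B D hsp hside
    have hcl : ∀ z ∈ E.disc H (biList x [] y B), z ∈ E.disc H (biList x [] y D) →
        z = x ∨ z = y := fun z h1 h2 => by simpa using hsp.mem_inter h1 h2
    refine h.goodSep_false (H₁ := E.disc H (biList x [] y B)) (H₂ := E.disc H (biList x [] y D))
      ⟨hsp.separation, hsp.symm.disc_ne, hsp.disc_ne, ?_, fun z h1 h2 t h3 h4 hzt =>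
      hcl' z (hcl z h1 h2) t (hcl t h3 h4) hzt, ?_, ?_, ?_⟩
    · refine (Finset.card_le_card (t := {x, y}) fun z hz => ?_).trans Finset.card_le_two
      rw [Finset.mem_inter] at hz
      simpa using hcl z hz.1 hz.2
    · by_cases hxP : x ∈ P
      · exact ⟨y, hsp.mem_disc (by simp), hsp.symm.mem_disc (by simp), fun h' => hP ⟨hxP, h'⟩⟩
      · exact ⟨x, hsp.mem_disc (by simp), hsp.symm.mem_disc (by simp), hxP⟩
    · intro z h1 h2
      rcases hcl z h1 h2 with rfl | rfl
      · exact (hC.outer z hx).mono E E.disc_subset h2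
      · exact (hC.outer z hy).mono E E.disc_subset h2
    · refine hside.imp_right fun ⟨h1, h2⟩ => ⟨?_, h2⟩
      rcases h1 with h1 | h1
      · exact ⟨x, h1, hsp.mem_disc (by simp), hsp.symm.mem_disc (by simp)⟩
      · exact ⟨y, h1, hsp.mem_disc (by simp), hsp.symm.mem_disc (by simp)⟩
  by_cases hP' : x ∈ P ∨ y ∈ P
  · have hle : (P ∩ E.disc H (biList x [] y B)).card + (P ∩ E.disc H (biList x [] y D)).card ≤
        7 := by
      rw [← Finset.card_union_add_card_inter]
      have h1 : (P ∩ E.disc H (biList x [] y B) ∪ P ∩ E.disc H (biList x [] y D)).card ≤ 6 :=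
        (Finset.card_le_card (Finset.union_subset Finset.inter_subset_left
          Finset.inter_subset_left)).trans h.card_le
      have h2 : (P ∩ E.disc H (biList x [] y B) ∩ (P ∩ E.disc H (biList x [] y D))).card ≤ 1 := by
        rw [Finset.card_le_one]
        intro a ha b hb
        simp only [Finset.mem_inter] at ha hb
        by_contra hab
        rcases hcl a ha.1.2 ha.2.2 with rfl | rfl <;> rcases hcl b hb.1.2 hb.2.2 with rfl | rfl
        · exact hab rfl
        · exact hP ⟨ha.1.1, hb.1.1⟩
        · exact hP ⟨hb.1.1, ha.1.1⟩
        · exact hab rfl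
      omega
    by_cases h3 : (P ∩ E.disc H (biList x [] y D)).card ≤ 3
    · exact main hsp (Or.inr ⟨hP', h3⟩)
    · exact main hsp.symm (Or.inr ⟨hP', by omega⟩)
  · push Not at hP'
    have hS : ∀ z, z = x ∨ z = y → z ∉ P := by
      rintro z (rfl | rfl)
      exacts [hP'.1, hP'.2]
    obtain ⟨p, hp⟩ := h.exists_mem
    by_cases hpD : p ∈ E.disc H (biList x [] y D)
    · refine main hsp.symm (Or.inl (hsp.separation.symm.notMem_of_conn h.conn h.subset
        (fun z h1 h2 => hS z (hcl z h2 h1)) hp fun hpB => hS p (hcl p hpB hpD) hp))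
    · exact main hsp (Or.inl (hsp.separation.notMem_of_conn h.conn h.subset
        (fun z h1 h2 => hS z (hcl z h1 h2)) hp hpD))

end MinCE

end PlaneEmbedding

end separations

section separatingCycles

open scoped Classical

variable {V : Type} {G : SimpleGraph V}

namespace PlaneEmbedding

variable {E : PlaneEmbedding G} {H P A : Finset V} {L : V → Finset ℕ}

theorem ins_biList_add (E : PlaneEmbedding G) (u : V) (A : List V) (w : V) (B Q : List V)
    (z : V ⊕ Sym2 V) :
    E.ins (biList u Q w A) z + E.ins (biList u Q w B) z = E.ins (biList u A w B) z := by
  simp only [ins_biList]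
  linear_combination E.pathTurn u Q w z * zmod_two

namespace MinCE

theorem notMem_of_ins (h : E.MinCE H P A L) {K : List V} (hK : IsCyc G K) (hKH : ∀ x ∈ K, x ∈ H)
    {y : V} (hyK : y ∉ K) (hy : E.ins K (.inl y) = 1) : y ∉ P ∧ y ∉ A := by
  constructor <;> intro hyP
  · have := (h.outer y hyP).2 K hK hKH hyK
    rw [hy] at this
    exact absurd this (by decide)
  · have := (h.outer' y hyP).2 K hK hKH hyK
    rw [hy] at this
    exact absurd this (by decide)

theorem exists_three_nbrs (h : E.MinCE H P A L) {y : V} (hyH : y ∈ H) (hyP : y ∉ P)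
    (hyA : y ∉ A) : ∃ a b c, a ∈ H ∧ b ∈ H ∧ c ∈ H ∧ G.Adj y a ∧ G.Adj y b ∧ G.Adj y c ∧
      a ≠ b ∧ a ≠ c ∧ b ≠ c := by
  have := (h.three_le y hyH hyP hyA).trans (h.card_le_degree hyH hyP)
  obtain ⟨a, ha, b, hb, c, hc, hab, hac, hbc⟩ := Finset.two_lt_card.1 this
  rw [Finset.mem_filter] at ha hb hc
  exact ⟨a, b, c, ha.1, hb.1, hc.1, ha.2, hb.2, hc.2, hab, hac, hbc⟩

theorem false_of_unique (h : E.MinCE H P A L) {K : List V} (hK : IsCyc G K)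
    (hKH : ∀ x ∈ K, x ∈ H) (hlen : K.length ≤ 8) {y : V} (hyH : y ∈ H) (hyK : y ∉ K)
    (hy : E.ins K (.inl y) = 1) (huniq : ∀ z ∈ H, z ∉ K → E.ins K (.inl z) = 1 → z = y) :
    False := by
  obtain ⟨hyP, hyA⟩ := h.notMem_of_ins hK hKH hyK hy
  obtain ⟨a, b, c, ha, hb, hc, hya, hyb, hyc, hab, hac, hbc⟩ := h.exists_three_nbrs hyH hyP hyA
  have key : ∀ z ∈ H, G.Adj y z → z ∈ K := by
    intro z hz hyz
    by_contra hzK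
    exact hyz.ne' (huniq z hz hzK (by rw [← E.ins_adj hK hyK hzK hyz, hy]))
  have := E.nine_le_length h.girth hK hyK (key a ha hya) (key b hb hyb) (key c hc hyc) hab hac
    hbc hya hyb hyc
  omega

/-- Cycles of length at most eight have an empty interior. -/
theorem ins_eq_zero [Finite V] (h : E.MinCE H P A L) {K : List V} (hK : IsCyc G K)
    (hKH : ∀ x ∈ K, x ∈ H) (hlen : K.length ≤ 8) {p : V} (hp : p ∈ H) (hpK : p ∉ K) :
    E.ins K (.inl p) = 0 := by
  induction hn : K.length using Nat.strong_induction_on generalizing K p with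
  | _ n ih =>
  subst hn
  refine (zmod_two_cases _).resolve_right fun hins => ?_
  have hind : ∀ x ∈ K, ∀ y ∈ K, G.Adj x y → s(x, y) ∈ cycleEdges K := by
    intro x hx y hy hxy
    by_contra hne
    obtain ⟨B, D, h1, h2, h3, h4, h5⟩ := E.exists_cyc_biList hK hx hy hxy.ne
    have hB : B ≠ [] := by
      rintro rfl
      exact hne ((h4 _).1 (mem_cycleEdges_biList.2 (Or.inl (by simp [listEdges]))))
    have hD : D ≠ [] := by
      rintro rfl
      exact hne ((h4 _).1 (mem_cycleEdges_biList.2 (Or.inr (by simp [listEdges]))))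
    obtain ⟨hB', hD', -, -⟩ := isCyc_biList.1 h1
    have hBl := List.length_pos_of_ne_nil hB
    have hDl := List.length_pos_of_ne_nil hD
    have hmem : ∀ z, z = x ∨ z = y ∨ z ∈ B ∨ z ∈ D → z ∈ K := by
      intro z hz
      rw [← h3]; simpa [or_assoc] using hz
    have e1 := ih _ (by rw [length_biList]; simp; omega)
      (isCyc_biList.2 ⟨isPath_nil hxy, hB', by simp, Or.inr hB⟩) (p := p)
      (fun z hz => hKH z (hmem z (by simp at hz; tauto))) (by rw [length_biList]; simp; omega) hp
      (fun hz => hpK (hmem p (by simp at hz; tauto))) rfl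
    have e2 := ih _ (by rw [length_biList]; simp; omega)
      (isCyc_biList.2 ⟨isPath_nil hxy, hD', by simp, Or.inr hD⟩) (p := p)
      (fun z hz => hKH z (hmem z (by simp at hz; tauto))) (by rw [length_biList]; simp; omega) hp
      (fun hz => hpK (hmem p (by simp at hz; tauto))) rfl
    have := E.ins_biList_add x B y D [] (.inl p)
    rw [e1, e2, h2, hins] at this
    exact absurd this (by decide)
  have htwo : ∀ y ∈ H, y ∉ K → E.ins K (.inl y) = 1 → ∀ a ∈ K, ∀ b ∈ K, G.Adj y a → G.Adj y b →
      a = b := by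
    intro y hyH hyK hy a ha b hb hya hyb
    by_contra hab
    obtain ⟨B, D, h1, h2, h3, h4, h5⟩ := E.exists_cyc_biList hK ha hb hab
    obtain ⟨hB', hD', hBD, -⟩ := isCyc_biList.1 h1
    have hmem : ∀ z, z = a ∨ z = b ∨ z ∈ B ∨ z ∈ D → z ∈ K := by
      intro z hz
      rw [← h3]; simpa [or_assoc] using hz
    have hyB : y ∉ B := fun h => hyK (hmem y (by tauto))
    have hyD : y ∉ D := fun h => hyK (hmem y (by tauto))
    have cB := isCyc_biList_singleton hB' hya hyb hyB
    have cD := isCyc_biList_singleton hD' hya hyb hyD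
    have lB := h.girth _ cB
    have lD := h.girth _ cD
    rw [length_biList] at lB lD
    simp only [List.length_singleton] at lB lD
    refine h.false_of_unique hK hKH hlen hyH hyK hy fun z hz hzK hz1 => ?_
    by_contra hzy
    have e1 := ih _ (by rw [length_biList]; simp; omega) cB (p := z)
      (fun x hx => by
        simp only [mem_biList, List.mem_singleton] at hx
        rcases hx with rfl | rfl | hx | rfl
        exacts [hKH _ ha, hKH _ hb, hKH _ (hmem _ (by tauto)), hyH])
      (by rw [length_biList]; simp; omega) hz
      (fun hx => by
        simp only [mem_biList, List.mem_singleton] at hx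
        rcases hx with rfl | rfl | hx | rfl
        exacts [hzK ha, hzK hb, hzK (hmem _ (by tauto)), hzy rfl]) rfl
    have e2 := ih _ (by rw [length_biList]; simp; omega) cD (p := z)
      (fun x hx => by
        simp only [mem_biList, List.mem_singleton] at hx
        rcases hx with rfl | rfl | hx | rfl
        exacts [hKH _ ha, hKH _ hb, hKH _ (hmem _ (by tauto)), hyH])
      (by rw [length_biList]; simp; omega) hz
      (fun hx => by
        simp only [mem_biList, List.mem_singleton] at hx
        rcases hx with rfl | rfl | hx | rfl
        exacts [hzK ha, hzK hb, hzK (hmem _ (by tauto)), hzy rfl]) rfl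
    have := E.ins_biList_add a B b D [y] (.inl z)
    rw [E.ins_biList_comm a [y] b B, E.ins_biList_comm a [y] b D, e1, e2, h2, hz1] at this
    exact absurd this (by decide)
  obtain ⟨a, b, R, rfl⟩ : ∃ a b R, K = a :: b :: R := by
    have := hK.three_le
    match K, this with
    | a :: b :: R, _ => exact ⟨a, b, R, rfl⟩
  set K := a :: b :: R with hKdef
  set D := E.disc H K with hDdef
  set I := H.filter fun x => x ∉ K ∧ E.ins K (.inl x) = 1 with hI
  have memI : ∀ {x}, x ∈ I ↔ x ∈ H ∧ x ∉ K ∧ E.ins K (.inl x) = 1 := Finset.mem_filter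
  have hIP : ∀ x ∈ I, x ∉ P ∧ x ∉ A := fun x hx =>
    h.notMem_of_ins hK hKH (memI.1 hx).2.1 (memI.1 hx).2.2
  have hsep : Separation G H (H \ I) D := by
    refine ⟨Finset.sdiff_subset, E.disc_subset, fun x hx => ?_, fun x hx hxD y hy hyI hxy => ?_⟩
    · rw [Finset.mem_sdiff, memI, E.mem_disc]
      by_cases hxK : x ∈ K
      · simp [hx, hxK]
      · by_cases h1 : E.ins K (.inl x) = 1 <;> simp [hx, hxK, h1]
    · have hyI' : y ∈ I := by
        by_contra h'
        exact hyI (Finset.mem_sdiff.2 ⟨E.disc_subset hy, h'⟩)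
      have h1 := memI.1 hyI'
      rw [E.mem_disc] at hxD
      have hxH := (Finset.mem_sdiff.1 hx).1
      push Not at hxD
      have h2 := hxD hxH
      have := E.ins_adj hK h2.1 h1.2.1 hxy
      exact h2.2 (this.trans h1.2.2)
  have hpI : p ∈ I := memI.2 ⟨hp, hpK, hins⟩
  obtain ⟨φ₁, f1, f2⟩ := h.ih _ (Finset.sdiff_ssubset (Finset.filter_subset _ _) ⟨p, hpI⟩) _ _ _
    (h.toConfig.mono Finset.sdiff_subset (Finset.Subset.refl P)
      (fun x hx => Finset.mem_sdiff.2 ⟨h.subset hx, fun hxI => (hIP x hxI).1 hx⟩)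
      (fun _ hx _ => hx) h.conn)
  have hKI : ∀ x ∈ K, x ∈ H \ I := fun x hx =>
    Finset.mem_sdiff.2 ⟨hKH x hx, fun hxI => (memI.1 hxI).2.1 hx⟩
  have hKD : ∀ x ∈ K, x ∈ D := fun x hx => E.mem_disc.2 ⟨hKH x hx, Or.inl hx⟩
  have hDI : ∀ x ∈ D, x ∉ K → x ∈ I := fun x hx hxK => by
    rw [E.mem_disc] at hx
    exact memI.2 ⟨hx.1, hxK, hx.2.resolve_left hxK⟩
  have haK : a ∈ K := by simp [hKdef]
  have hbK : b ∈ K := by simp [hKdef]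
  have hRK : ∀ x ∈ R, x ∈ K := fun x hx => by simp [hKdef, hx]
  have hKR : ∀ x ∈ K, x ≠ a → x ≠ b → x ∈ R := fun x hx hxa hxb => by
    simpa [hKdef, hxa, hxb] using hx
  have hnd := hK.nodup
  rw [hKdef] at hnd
  simp only [List.nodup_cons, List.mem_cons, not_or] at hnd
  have habadj : G.Adj a b := by
    have := hK.isChain
    rw [hKdef] at this
    exact (List.isChain_cons_cons.1 this).1
  have hRchain : R.IsChain G.Adj := by
    have := hK.isChain
    rw [hKdef, closedList_cons] at this
    exact (this.tail.tail : List.IsChain G.Adj (R ++ [a])).left_of_append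
  set D' := (D.erase a).erase b with hD'
  have memD' : ∀ {x}, x ∈ D' ↔ x ∈ D ∧ x ≠ a ∧ x ≠ b := by
    intro x; simp [hD']; tauto
  have hD'D : D' ⊆ D := fun x hx => (memD'.1 hx).1
  set L₂ : V → Finset ℕ := fun v => if v ∈ K then {φ₁ v} else
    (L v).filter fun c => (G.Adj v a → c ≠ φ₁ a) ∧ (G.Adj v b → c ≠ φ₁ b) with hL₂
  have hLK : ∀ v ∈ K, L₂ v = {φ₁ v} := fun v hv => if_pos hv
  have hLn : ∀ v ∉ K, L₂ v = (L v).filter fun c => (G.Adj v a → c ≠ φ₁ a) ∧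
    (G.Adj v b → c ≠ φ₁ b) := fun v hv => if_neg hv
  set N := I.filter fun v => G.Adj v a ∨ G.Adj v b with hN
  have memN : ∀ {x}, x ∈ N ↔ x ∈ I ∧ (G.Adj x a ∨ G.Adj x b) := Finset.mem_filter
  have hconf : E.Config D' R.toFinset N L₂ := by
    refine ⟨conn_of_isChain hRchain, ?_, ?_, ?_, ?_, ?_, ?_, ?_, ?_, ?_, ?_⟩
    · refine R.toFinset_card_le.trans ?_
      simp [hKdef] at hlen
      omega
    · intro v hv
      rw [List.mem_toFinset] at hv
      refine (E.outer_disc hK hind (hRK v hv) (hKH v (hRK v hv))).mono E hD'D (memD'.2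
        ⟨hKD v (hRK v hv), ?_, ?_⟩)
      · rintro rfl; exact hnd.1.2 hv
      · rintro rfl; exact hnd.2.1 hv
    · intro v hv
      have hv' := memN.1 hv
      have hvI := memI.1 hv'.1
      have hvD : v ∈ D' := memD'.2 ⟨E.mem_disc.2 ⟨hvI.1, Or.inr hvI.2.2⟩,
        fun h => hvI.2.1 (h ▸ haK), fun h => hvI.2.1 (h ▸ hbK)⟩
      rcases hv'.2 with hva | hvb
      · exact (E.outer_disc hK hind haK (hKH a haK)).of_adj E hD'D (fun h => (memD'.1 h).2.1 rfl)
          hvD hva.symm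
      · exact (E.outer_disc hK hind hbK (hKH b hbK)).of_adj E hD'D (fun h => (memD'.1 h).2.2 rfl)
          hvD hvb.symm
    · intro v hv hvR
      exact (memI.1 (memN.1 hv).1).2.1 (hRK v (List.mem_toFinset.1 hvR))
    · intro u hu v hv huv
      rw [memN] at hu hv
      have hua : u ≠ a := fun h => (memI.1 hu.1).2.1 (h ▸ haK)
      have hub : u ≠ b := fun h => (memI.1 hu.1).2.1 (h ▸ hbK)
      have hva : v ≠ a := fun h => (memI.1 hv.1).2.1 (h ▸ haK)
      have hvb : v ≠ b := fun h => (memI.1 hv.1).2.1 (h ▸ hbK)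
      rcases hu.2 with hu | hu <;> rcases hv.2 with hv | hv
      · exact h.girth.no_triangle huv hv hu.symm
      · exact h.girth.no_square huv hv habadj.symm hu.symm hub hva
      · exact h.girth.no_square huv hv habadj hu.symm hua hvb
      · exact h.girth.no_triangle huv hv hu.symm
    · intro u hu v hv huv
      rw [memN, memI] at hu
      have hvR := List.mem_toFinset.1 hv
      rcases hu.2 with hu' | hu'
      · have := htwo u hu.1.1 hu.1.2.1 hu.1.2.2 v (hRK v hvR) a haK huv hu'
        exact hnd.1.2 (this ▸ hvR)
      · have := htwo u hu.1.1 hu.1.2.1 hu.1.2.2 v (hRK v hvR) b hbK huv hu'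
        exact hnd.2.1 (this ▸ hvR)
    · intro v hv
      rw [hLK v (hRK v (List.mem_toFinset.1 hv))]
      simp
    · intro u hu v hv huv
      have hu' := hRK u (List.mem_toFinset.1 hu)
      have hv' := hRK v (List.mem_toFinset.1 hv)
      rw [hLK u hu', hLK v hv', Finset.disjoint_singleton]
      exact f2 u (hKI u hu') v (hKI v hv') huv
    · intro v hv hvR
      have hv' := memD'.1 hv
      have hvK : v ∉ K := fun hvK => hvR (List.mem_toFinset.2 (hKR v hvK hv'.2.1 hv'.2.2))
      have hvI := hDI v hv'.1 hvK
      have h3 := h.three_le v (memI.1 hvI).1 (hIP v hvI).1 (hIP v hvI).2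
      rw [hLn v hvK]
      by_cases hva : G.Adj v a
      · have hvb : ¬ G.Adj v b := fun hvb => h.girth.no_triangle hva habadj hvb.symm
        have : (L v).erase (φ₁ a) ⊆ (L v).filter fun c => (G.Adj v a → c ≠ φ₁ a) ∧
            (G.Adj v b → c ≠ φ₁ b) := by
          intro c hc
          rw [Finset.mem_erase] at hc
          exact Finset.mem_filter.2 ⟨hc.2, fun _ => hc.1, fun h => absurd h hvb⟩
        have h4 := Finset.card_le_card this
        have h5 := Finset.pred_card_le_card_erase (s := L v) (a := φ₁ a)
        omega
      · have : (L v).erase (φ₁ b) ⊆ (L v).filter fun c => (G.Adj v a → c ≠ φ₁ a) ∧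
            (G.Adj v b → c ≠ φ₁ b) := by
          intro c hc
          rw [Finset.mem_erase] at hc
          exact Finset.mem_filter.2 ⟨hc.2, fun h => absurd h hva, fun _ => hc.1⟩
        have h4 := Finset.card_le_card this
        have h5 := Finset.pred_card_le_card_erase (s := L v) (a := φ₁ b)
        omega
    · intro v hv hvR hvN
      have hv' := memD'.1 hv
      have hvK : v ∉ K := fun hvK => hvR (List.mem_toFinset.2 (hKR v hvK hv'.2.1 hv'.2.2))
      have hvI := hDI v hv'.1 hvK
      have h3 := h.three_le v (memI.1 hvI).1 (hIP v hvI).1 (hIP v hvI).2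
      rw [memN] at hvN
      have hva : ¬ G.Adj v a := fun h => hvN ⟨hvI, Or.inl h⟩
      have hvb : ¬ G.Adj v b := fun h => hvN ⟨hvI, Or.inr h⟩
      rw [hLn v hvK, Finset.filter_true_of_mem]
      · exact h3
      · exact fun c _ => ⟨fun h => absurd h hva, fun h => absurd h hvb⟩
  have hDH : D' ⊂ H := by
    refine (Finset.ssubset_iff_of_subset (hD'D.trans E.disc_subset)).2 ⟨a, hKH a haK, fun h => ?_⟩
    exact (memD'.1 h).2.1 rfl
  obtain ⟨φ₂, g1, g2⟩ := h.ih _ hDH _ _ _ hconf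
  have g3 : ∀ v ∈ K, v ∈ D' → φ₂ v = φ₁ v := by
    intro v hv hvD
    have := g1 v hvD
    rwa [hLK v hv, Finset.mem_singleton] at this
  have g4 : ∀ v ∈ D, v ∉ K → φ₂ v ∈ L v ∧ (G.Adj v a → φ₂ v ≠ φ₁ a) ∧
      (G.Adj v b → φ₂ v ≠ φ₁ b) := by
    intro v hv hvK
    have := g1 v (memD'.2 ⟨hv, fun h => hvK (h ▸ haK), fun h => hvK (h ▸ hbK)⟩)
    rwa [hLn v hvK, Finset.mem_filter] at this
  refine h.not_colorable (hsep.listColorable (φ₁ := φ₁) (φ₂ := fun v => if v ∈ K then φ₁ v else φ₂ v)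
    f1 f2 ?_ ?_ ?_)
  · intro v hv
    split_ifs with hvK
    · exact f1 v (hKI v hvK)
    · exact (g4 v hv hvK).1
  · have key : ∀ u ∈ K, ∀ v ∈ D, v ∉ K → G.Adj u v → φ₁ u ≠ φ₂ v := by
      intro u hu v hv hvK huv
      by_cases hua : u = a
      · subst hua
        exact ((g4 v hv hvK).2.1 huv.symm).symm
      by_cases hub : u = b
      · subst hub
        exact ((g4 v hv hvK).2.2 huv.symm).symm
      have hu' : u ∈ D' := memD'.2 ⟨hKD u hu, hua, hub⟩
      rw [← g3 u hu hu']
      exact g2 u hu' v (memD'.2 ⟨hv, fun h => hvK (h ▸ haK), fun h => hvK (h ▸ hbK)⟩) huv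
    intro u hu v hv huv
    split_ifs with huK hvK hvK
    · exact f2 u (hKI u huK) v (hKI v hvK) huv
    · exact key u huK v hv hvK huv
    · exact (key v hvK u hu huK huv.symm).symm
    · exact g2 u (memD'.2 ⟨hu, fun h => huK (h ▸ haK), fun h => huK (h ▸ hbK)⟩) v
        (memD'.2 ⟨hv, fun h => hvK (h ▸ haK), fun h => hvK (h ▸ hbK)⟩) huv
  · intro v hv hvD
    have : v ∈ K := by
      by_contra hvK
      exact (Finset.mem_sdiff.1 hv).2 (hDI v hvD hvK)
    simp [this]

end MinCE

end PlaneEmbedding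

end separatingCycles

section frames

open scoped Classical

variable {V : Type} {G : SimpleGraph V}

namespace PlaneEmbedding

variable {E : PlaneEmbedding G} {H P A : Finset V} {L : V → Finset ℕ}

theorem IsOuterCycle.rotate {l₁ l₂ : List V} (h : E.IsOuterCycle H (l₁ ++ l₂)) :
    E.IsOuterCycle H (l₂ ++ l₁) :=
  h.congr h.isCyc.rotate (fun z => E.ins_rotate _ _ z)
    (fun x => by simp only [List.mem_append, or_comm]) fun _ => mem_cycleEdges_rotate

theorem IsOuterCycle.comm {u w : V} {B D : List V} (h : E.IsOuterCycle H (biList u B w D)) :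
    E.IsOuterCycle H (biList u D w B) :=
  h.congr (isCyc_biList_comm h.isCyc) (fun z => by rw [E.ins_biList_comm])
    (fun x => by simp only [mem_biList]; tauto) fun e => by
      rw [mem_cycleEdges_biList, mem_cycleEdges_biList, or_comm]

/-- The outer cycle of `H` is `pl` followed by `wl`, where `pl` spans `P`. -/
structure Frame (E : PlaneEmbedding G) (H P : Finset V) (pl wl : List V) : Prop where
  cycle : E.IsOuterCycle H (pl ++ wl)
  mem_iff : ∀ x, x ∈ P ↔ x ∈ pl
  left_ne : pl ≠ []
  right_ne : wl ≠ []

namespace Frame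

variable {pl wl : List V}

theorem notMem (h : E.Frame H P pl wl) {x : V} (hx : x ∈ wl) : x ∉ P := fun hxP =>
  List.disjoint_of_nodup_append h.cycle.isCyc.nodup ((h.mem_iff x).1 hxP) hx

theorem mem_right (h : E.Frame H P pl wl) {x : V} (hx : x ∈ pl ++ wl) (hxP : x ∉ P) : x ∈ wl :=
  (List.mem_append.1 hx).resolve_left fun hx => hxP ((h.mem_iff x).2 hx)

theorem reverse (h : E.Frame H P pl wl) : E.Frame H P pl.reverse wl.reverse := by
  obtain ⟨p, l, rfl⟩ := List.exists_cons_of_ne_nil h.left_ne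
  rcases List.eq_nil_or_concat wl with rfl | ⟨t, w, rfl⟩
  · exact absurd rfl h.right_ne
  refine ⟨?_, fun x => by rw [h.mem_iff, List.mem_reverse], by simp, by simp⟩
  have h1 : E.IsOuterCycle H (biList p (l ++ t) w []) := by simpa [biList] using h.cycle
  have h2 : E.IsOuterCycle H ([p] ++ (w :: t.reverse ++ l.reverse)) := by
    simpa [biList] using h1.comm
  have h3 : E.IsOuterCycle H ((w :: t.reverse) ++ (l.reverse ++ [p])) := by simpa using h2.rotate
  simpa using h3.rotate

theorem length_left (h : E.Frame H P pl wl) : pl.length = P.card := by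
  have : P = pl.toFinset := by
    ext x; rw [h.mem_iff, List.mem_toFinset]
  rw [this, List.toFinset_card_of_nodup h.cycle.isCyc.nodup.of_append_left]

theorem isChain_left (h : E.Frame H P pl wl) : pl.IsChain G.Adj := by
  obtain ⟨p, l, rfl⟩ := List.exists_cons_of_ne_nil h.left_ne
  have := h.cycle.isCyc.isChain
  simp only [List.cons_append, closedList_cons, List.append_assoc] at this
  rw [← List.cons_append] at this
  exact this.left_of_append

end Frame

theorem IsOuterCycle.adj_left {u w b : V} {B D : List V} (h : E.IsOuterCycle H (biList u B w D))
    (hch : ∀ x ∈ biList u B w D, ∀ y ∈ biList u B w D, G.Adj x y →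
      s(x, y) ∈ cycleEdges (biList u B w D)) (hb : b ∈ D) (hub : G.Adj u b) :
    ∃ t, D = b :: t := by
  have hn := h.isCyc.nodup
  have he := hch u (by simp) b (by simp [hb]) hub
  have hform : biList u B w D = (u :: (B ++ [w])) ++ D.reverse := by simp [biList]
  rw [hform] at hn he
  rcases crossing hn he (by simp) (by simpa using hb) with ⟨s, t, h1, -⟩ | ⟨s, t, -, h2⟩
  · exfalso
    rw [← List.cons_append] at h1
    have h3 := List.append_inj_right' h1 rfl
    have h4 := (isCyc_biList.1 h.isCyc).1.ne
    simp only [List.cons.injEq, and_true] at h3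
    exact h4 h3.symm
  · exact ⟨t.reverse, by rw [← List.reverse_reverse D, h2]; simp⟩

theorem IsOuterCycle.adj_right {u w b : V} {B D : List V} (h : E.IsOuterCycle H (biList u B w D))
    (hch : ∀ x ∈ biList u B w D, ∀ y ∈ biList u B w D, G.Adj x y →
      s(x, y) ∈ cycleEdges (biList u B w D)) (hb : b ∈ D) (hwb : G.Adj w b) :
    ∃ t, D = t ++ [b] := by
  have hn := h.isCyc.nodup
  have he := hch w (by simp) b (by simp [hb]) hwb
  have hform : biList u B w D = (u :: (B ++ [w])) ++ D.reverse := by simp [biList]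
  rw [hform] at hn he
  rcases crossing hn he (by simp) (by simpa using hb) with ⟨s, t, -, h2⟩ | ⟨s, t, h1, -⟩
  · exact ⟨t.reverse, by rw [← List.reverse_reverse D, h2]; simp⟩
  · exfalso
    have h4 := (isCyc_biList.1 h.isCyc).1.ne
    simp only [List.cons.injEq] at h1
    exact h4 h1.1

/-- A path through `Q` cutting off an empty region. -/
theorem IsSplit.mem_disc_of_empty {u w : V} {B D Q : List V} (hs : E.IsSplit H u B w D Q)
    (he : ∀ z ∈ H, z ∉ biList u Q w B → E.ins (biList u Q w B) (.inl z) = 0) {t : V}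
    (ht : t ∈ H) (htB : t ∉ B) : t ∈ E.disc H (biList u Q w D) := by
  rcases hs.mem_or ht with h1 | h1
  · by_cases h2 : t ∈ biList u Q w B
    · refine hs.symm.mem_disc ?_
      simp only [mem_biList] at h2
      tauto
    · have := (E.mem_disc.1 h1).2.resolve_left h2
      rw [he t ht h2] at this
      exact absurd this (by decide)
  · exact h1

theorem IsSplit.not_adj_of_empty {u w : V} {B D Q : List V} (hs : E.IsSplit H u B w D Q)
    (he : ∀ z ∈ H, z ∉ biList u Q w B → E.ins (biList u Q w B) (.inl z) = 0) {d t : V}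
    (hd : d ∈ B) (ht : t ∈ H) (htB : t ∉ B) (htu : t ≠ u) (htw : t ≠ w) (htQ : t ∉ Q) :
    ¬ G.Adj d t := by
  refine hs.not_adj (E.mem_disc.2 ⟨hs.mem (by tauto), Or.inl (by simp [hd])⟩)
    (hs.notMem_disc hd) (hs.mem_disc_of_empty he ht htB) fun h => ?_
  rcases hs.mem_inter h (hs.mem_disc_of_empty he ht htB) with h | h | h
  exacts [htu h, htw h, htQ h]

namespace MinCE

theorem nine_le [Finite V] (h : E.MinCE H P A L) {C : List V} (hC : E.IsOuterCycle H C)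
    (hch : ∀ x ∈ C, ∀ y ∈ C, G.Adj x y → s(x, y) ∈ cycleEdges C) : 9 ≤ C.length := by
  by_contra! hlt
  have hHC : ∀ x ∈ H, x ∈ C := by
    intro x hx
    by_contra hxC
    have := hC.ins_vertex x hx hxC
    rw [h.ins_eq_zero hC.isCyc hC.subset (by omega) hx hxC] at this
    exact absurd this (by decide)
  have hA : ∀ v ∈ H, v ∉ P → v ∈ A := by
    intro v hv hvP
    by_contra hvA
    obtain ⟨a, b, c, ha, hb, hc, hva, hvb, hvc, hab, hac, hbc⟩ := h.exists_three_nbrs hv hvP hvA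
    obtain ⟨x, y, hxy⟩ := hC.isCyc.exists_nbrs (hHC v hv)
    have h1 := hxy a (hch v (hHC v hv) a (hHC a ha) hva)
    have h2 := hxy b (hch v (hHC v hv) b (hHC b hb) hvb)
    have h3 := hxy c (hch v (hHC v hv) c (hHC c hc) hvc)
    grind
  obtain ⟨v, hv, hvP⟩ := h.exists_notMem
  have h1 := (h.two_le v hv hvP).trans (h.card_le_degree hv hvP)
  obtain ⟨z, hz⟩ := Finset.card_pos.1 (show 0 < (H.filter (G.Adj v)).card by omega)
  rw [Finset.mem_filter] at hz
  by_cases hzP : z ∈ P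
  · exact h.not_adj v (hA v hv hvP) z hzP hz.2
  · exact h.indep v (hA v hv hvP) z (hA z hz.1 hzP) hz.2

theorem exists_frame [Fintype V] (h : E.MinCE H P A L) : ∃ pl wl, E.Frame H P pl wl := by
  obtain ⟨C, hC⟩ := h.exists_outerCycle
  have hch : ∀ x ∈ C, ∀ y ∈ C, G.Adj x y → s(x, y) ∈ cycleEdges C := fun x hx y hy hxy =>
    h.chordless hC hx hy hxy
  have h9 := h.nine_le hC hch
  obtain ⟨v, hvC, hvP⟩ : ∃ v ∈ C, v ∉ P := by
    by_contra! hcon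
    have h1 : C.toFinset ⊆ P := fun x hx => hcon x (List.mem_toFinset.1 hx)
    have h2 := Finset.card_le_card h1
    rw [List.toFinset_card_of_nodup hC.isCyc.nodup] at h2
    have := h.card_le
    omega
  obtain ⟨C₁, C₂, rfl⟩ := List.append_of_mem hvC
  have hK : E.IsOuterCycle H ((C₂ ++ C₁) ++ [v]) := by
    have : E.IsOuterCycle H ((C₁ ++ [v]) ++ C₂) := by simpa using hC
    simpa using this.rotate
  have hpC : ∃ p ∈ C₂ ++ C₁, p ∈ P := by
    obtain ⟨p, hp⟩ := h.exists_mem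
    refine ⟨p, ?_, hp⟩
    have h1 := hK.mem_of_outer E (h.outer p hp)
    rw [List.mem_append] at h1
    refine h1.resolve_right fun h2 => ?_
    rw [List.mem_singleton] at h2
    exact hvP (h2 ▸ hp)
  obtain ⟨D₁, p, D₂, hD, hp, hD₁⟩ : ∃ D₁ p D₂, C₂ ++ C₁ = D₁ ++ p :: D₂ ∧ p ∈ P ∧
      ∀ x ∈ D₁, x ∉ P := by
    generalize C₂ ++ C₁ = D at hpC
    induction D with
    | nil => simp at hpC
    | cons a D ih =>
      by_cases ha : a ∈ P
      · exact ⟨[], a, D, rfl, ha, by simp⟩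
      · obtain ⟨p, hp, hpP⟩ := hpC
        obtain ⟨D₁, q, D₂, rfl, hq, hD₁⟩ := ih ⟨p, (List.mem_cons.1 hp).resolve_left
          (fun e => ha (e ▸ hpP)), hpP⟩
        exact ⟨a :: D₁, q, D₂, rfl, hq, by simpa using ⟨ha, hD₁⟩⟩
  rw [hD] at hK
  have hF : E.IsOuterCycle H (p :: D₂ ++ ([v] ++ D₁)) := by
    have : E.IsOuterCycle H (D₁ ++ ((p :: D₂) ++ [v])) := by simpa using hK
    simpa using this.rotate
  have hlast : ∀ x ∈ [v] ++ D₁, x ∉ P := by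
    intro x hx
    simp only [List.cons_append, List.nil_append, List.mem_cons] at hx
    rcases hx with rfl | hx
    exacts [hvP, hD₁ x hx]
  generalize hWdef : [v] ++ D₁ = W at hF hlast
  have hW : W ≠ [] := by simp [← hWdef]
  obtain ⟨R, W', hR, hR1, hR2, hR3⟩ : ∃ R W', p :: D₂ ++ W = (p :: R) ++ W' ∧ (∀ x ∈ R, x ∈ P) ∧
      (∀ x ∈ W'.head?, x ∉ P) ∧ ∃ t, W' = t ++ W := by
    clear hF hK hD hC hch h9
    induction D₂ generalizing p with
    | nil =>
      refine ⟨[], W, rfl, by simp, ?_, [], rfl⟩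
      intro x hx
      exact hlast x (List.mem_of_mem_head? hx)
    | cons a D ih =>
      by_cases ha : a ∈ P
      · obtain ⟨R, W', h1, h2, h3, h4⟩ := ih a ha
        refine ⟨a :: R, W', by simpa using h1, by simpa using ⟨ha, h2⟩, h3, h4⟩
      · exact ⟨[], a :: D ++ W, rfl, by simp, by simpa using ha, a :: D, rfl⟩
  obtain ⟨t, rfl⟩ := hR3
  rw [hR] at hF
  refine ⟨p :: R, t ++ W, hF, fun x => ⟨fun hx => ?_, fun hx => ?_⟩, by simp, by simp [hW]⟩
  · have hsub : (p :: R).toFinset ⊆ P := by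
      intro y hy
      rw [List.mem_toFinset, List.mem_cons] at hy
      rcases hy with rfl | hy
      exacts [hp, hR1 y hy]
    refine List.mem_toFinset.1 (h.conn _ hsub ⟨p, by simp⟩ (fun a ha b hb hab => ?_) hx)
    by_contra hbR
    rw [List.mem_toFinset] at ha hbR
    have hbC := hF.mem_of_outer E (h.outer b hb)
    have hbW : b ∈ t ++ W := (List.mem_append.1 hbC).resolve_left hbR
    have he := h.chordless hF (x := a) (y := b) (by rw [List.mem_append]; exact Or.inl ha) hbC hab
    rcases crossing hF.isCyc.nodup he ha hbW with ⟨s, r, -, h2⟩ | ⟨s, r, -, h2⟩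
    · exact hR2 b (by rw [h2]; rfl) hb
    · rcases List.eq_nil_or_concat W with rfl | ⟨W₁, c, rfl⟩
      · exact hW rfl
      · rw [List.concat_eq_append, ← List.append_assoc] at h2
        have := List.append_inj_right' h2 rfl
        simp only [List.cons.injEq, and_true] at this
        exact hlast c (by simp) (this ▸ hb)
  · rcases List.mem_cons.1 hx with rfl | hx
    exacts [hp, hR1 x hx]

set_option maxHeartbeats 400000 in
/-- There is no short path inside the outer cycle that cuts off few vertices of `P`. -/
theorem split [Fintype V] (h : E.MinCE H P A L) {u w : V} {B D Q : List V}
    (hs : E.IsSplit H u D w B Q) (huw : u ∉ P ∨ w ∉ P)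
    (hP : (∀ p ∈ B, p ∉ P) ∨ u ∈ P ∨ w ∈ P) (hQ : ∀ x ∈ Q, ∀ y ∈ B, y ∈ P ∨ y ∈ A → ¬ G.Adj x y)
    (hu : u ∉ P → ∀ y ∈ B, y ∈ P → ¬ G.Adj u y) (hw : w ∉ P → ∀ y ∈ B, y ∈ P → ¬ G.Adj w y)
    (hA : ∀ a ∈ B, a ∈ A → G.Adj a u → ¬ G.Adj a w)
    (hind : ∀ x ∈ Q, ∀ y, y = u ∨ y = w ∨ y ∈ Q → G.Adj x y → s(x, y) ∈ listEdges (u :: (Q ++ [w])))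
    (hcard : Q.length + (B.filter (· ∈ P)).length + (if u ∈ P then 0 else 1) +
      (if w ∈ P then 0 else 1) ≤ 4) : False := by
  have hch : ∀ x ∈ biList u D w B, ∀ y ∈ biList u D w B, G.Adj x y →
      s(x, y) ∈ cycleEdges (biList u D w B) := fun x hx y hy hxy => h.chordless hs.cycle hx hy hxy
  have hinter : ∀ {x}, x ∈ E.disc H (biList u Q w D) → x ∈ E.disc H (biList u Q w B) →
      x = u ∨ x = w ∨ x ∈ Q := fun h1 h2 => hs.mem_inter h1 h2
  have hint1 : ∀ {x}, x = u ∨ x = w ∨ x ∈ Q → x ∈ E.disc H (biList u Q w D) := hs.mem_disc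
  have houter : ∀ {x}, E.Outer H x → x ∈ E.disc H (biList u Q w B) → x = u ∨ x = w ∨ x ∈ B := by
    intro x hx hxB
    have hxC := hs.cycle.mem_of_outer E hx
    rw [mem_biList] at hxC
    rcases hxC with h1 | h1 | h1 | h1
    · exact Or.inl h1
    · exact Or.inr (Or.inl h1)
    · exact absurd hxB (hs.notMem_disc h1)
    · exact Or.inr (Or.inr h1)
  have houter' : ∀ {x}, E.Outer H x → x ∉ Q := fun hx hxQ =>
    hs.disjoint hxQ (hs.cycle.mem_of_outer E hx)
  have hY : ∀ {x}, E.Outer H x → x ∈ E.disc H (biList u Q w B) →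
      x ∉ E.disc H (biList u Q w D) → x ∈ B := by
    intro x hx hxB hxD
    rcases houter hx hxB with h1 | h1 | h1
    · exact absurd (hint1 (Or.inl h1)) hxD
    · exact absurd (hint1 (Or.inr (Or.inl h1))) hxD
    · exact h1
  have hQA : ∀ a ∈ A, a ∈ B → ∀ s, s = u ∨ s = w ∨ s ∈ Q → G.Adj a s → s = u ∨ s = w := by
    intro a ha haB s hs' has
    rcases hs' with h1 | h1 | h1
    exacts [Or.inl h1, Or.inr h1, absurd has.symm (hQ s h1 a haB (Or.inr ha))]
  have hBD : ∀ a ∈ B, a ∉ E.disc H (biList u Q w D) := fun a ha => hs.symm.notMem_disc ha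
  have hAu : ∃ S : Finset V, S.card ≤ (if u ∈ P then 0 else 1) ∧
      ∀ a ∈ A, a ∈ B → G.Adj a u → a ∈ S := by
    split_ifs with huP
    · exact ⟨∅, by simp, fun a ha _ hau => absurd hau (h.not_adj a ha u huP)⟩
    · by_cases hex : ∃ a ∈ B, G.Adj u a
      · obtain ⟨a, ha, hua⟩ := hex
        refine ⟨{a}, by simp, fun b _ hb hbu => ?_⟩
        obtain ⟨t, ht⟩ := hs.cycle.adj_left hch ha hua
        obtain ⟨t', ht'⟩ := hs.cycle.adj_left hch hb hbu.symm
        rw [ht, List.cons.injEq] at ht'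
        simp [ht'.1]
      · exact ⟨∅, by simp, fun a _ ha hau => absurd ⟨a, ha, hau.symm⟩ hex⟩
  have hAw : ∃ S : Finset V, S.card ≤ (if w ∈ P then 0 else 1) ∧
      ∀ a ∈ A, a ∈ B → G.Adj a w → a ∈ S := by
    split_ifs with hwP
    · exact ⟨∅, by simp, fun a ha _ haw => absurd haw (h.not_adj a ha w hwP)⟩
    · by_cases hex : ∃ a ∈ B, G.Adj w a
      · obtain ⟨a, ha, hua⟩ := hex
        refine ⟨{a}, by simp, fun b _ hb hbu => ?_⟩
        obtain ⟨t, ht⟩ := hs.cycle.adj_right hch ha hua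
        obtain ⟨t', ht'⟩ := hs.cycle.adj_right hch hb hbu.symm
        rw [ht] at ht'
        have := List.append_inj_right' ht' rfl
        simp only [List.cons.injEq, and_true] at this
        simp [this]
      · exact ⟨∅, by simp, fun a _ ha hau => absurd ⟨a, ha, hau.symm⟩ hex⟩
  obtain ⟨Su, hSu, hSu'⟩ := hAu
  obtain ⟨Sw, hSw, hSw'⟩ := hAw
  refine h.extend hs.separation hs.symm.disc_ne hs.disc_ne ?_ ?_ ?_ ?_ ?_ ?_ ?_
  · have : E.disc H (biList u Q w D) ∩ E.disc H (biList u Q w B) =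
        (u :: (Q ++ [w])).toFinset := by
      ext x
      simp only [Finset.mem_inter, List.mem_toFinset, List.mem_cons, List.mem_append,
        List.not_mem_nil, or_false]
      refine ⟨fun hx => (hinter hx.1 hx.2).imp_right Or.symm, fun hx => ?_⟩
      have hx' := hx.imp_right Or.symm
      exact ⟨hint1 hx', hs.symm.mem_disc hx'⟩
    rw [this]
    exact conn_of_isChain hs.path.isChain
  · intro s hs1 hs2
    refine hs.outer hch hind ?_
    rw [mem_biList]
    rcases hinter hs1 hs2 with h1 | h1 | h1
    exacts [Or.inl h1, Or.inr (Or.inl h1), Or.inr (Or.inr (Or.inl h1))]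
  · intro x hx hx1 hx2 y hy hy1 hy2 hxy
    have h1 := hinter hx1 hx2
    have h2 := hinter hy1 hy2
    have h3 := houter' (h.outer x hx)
    have h4 := houter' (h.outer y hy)
    rcases h1 with rfl | rfl | h1
    · rcases h2 with rfl | rfl | h2
      · exact absurd rfl hxy
      · exact absurd huw (by simp [hx, hy])
      · exact absurd h2 h4
    · rcases h2 with rfl | rfl | h2
      · exact absurd huw (by simp [hx, hy])
      · exact absurd rfl hxy
      · exact absurd h2 h4
    · exact absurd h1 h3
  · by_cases huP : u ∈ P
    · exact Or.inr ⟨u, huP, hint1 (Or.inl rfl), hs.symm.mem_disc (Or.inl rfl)⟩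
    by_cases hwP : w ∈ P
    · exact Or.inr ⟨w, hwP, hint1 (Or.inr (Or.inl rfl)), hs.symm.mem_disc (Or.inr (Or.inl rfl))⟩
    refine Or.inl fun p hp hpB => ?_
    rcases houter (h.outer p hp) hpB with rfl | rfl | h1
    exacts [huP hp, hwP hp, (hP.resolve_right (by simp [huP, hwP])) p h1 hp]
  · intro a ha ha2 ha1 s hs1 hs2 t ht1 ht2 has hat
    have haB := hY (h.outer' a ha) ha2 ha1
    rcases hQA a ha haB s (hinter hs1 hs2) has with rfl | rfl <;>
      rcases hQA a ha haB t (hinter ht1 ht2) hat with rfl | rfl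
    · rfl
    · exact absurd hat (hA a haB ha has)
    · exact absurd has (hA a haB ha hat)
    · rfl
  · intro p hp hp2 hp1 s hs1 hs2 hsP hps
    have hpB := hY (h.outer p hp) hp2 hp1
    rcases hinter hs1 hs2 with rfl | rfl | hsQ
    exacts [hu hsP p hpB hp hps.symm, hw hsP p hpB hp hps.symm, hQ s hsQ p hpB (Or.inl hp) hps.symm]
  · have hsub : P ∩ E.disc H (biList u Q w B) ∪ E.disc H (biList u Q w D) ∩
        E.disc H (biList u Q w B) ∪ A.filter (fun a => a ∈ E.disc H (biList u Q w B) ∧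
        ∃ s ∈ E.disc H (biList u Q w D) ∩ E.disc H (biList u Q w B), G.Adj a s) ⊆
        ((u :: (Q ++ [w])) ++ B.filter (· ∈ P)).toFinset ∪ (Su ∪ Sw) := by
      intro x hx
      simp only [Finset.mem_union, Finset.mem_inter, Finset.mem_filter] at hx
      simp only [Finset.mem_union, List.mem_toFinset, List.mem_append, List.mem_cons,
        List.not_mem_nil, or_false, List.mem_filter, decide_eq_true_eq]
      rcases hx with (⟨hx1, hx2⟩ | ⟨hx1, hx2⟩) | ⟨hx1, hx2, s, hs', hxs⟩
      · rcases houter (h.outer x hx1) hx2 with h1 | h1 | h1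
        · exact Or.inl (Or.inl (Or.inl h1))
        · exact Or.inl (Or.inl (Or.inr (Or.inr h1)))
        · exact Or.inl (Or.inr ⟨h1, hx1⟩)
      · rcases hinter hx1 hx2 with h1 | h1 | h1
        · exact Or.inl (Or.inl (Or.inl h1))
        · exact Or.inl (Or.inl (Or.inr (Or.inr h1)))
        · exact Or.inl (Or.inl (Or.inr (Or.inl h1)))
      · rcases houter (h.outer' x hx1) hx2 with h1 | h1 | h1
        · exact Or.inl (Or.inl (Or.inl h1))
        · exact Or.inl (Or.inl (Or.inr (Or.inr h1)))
        · right
          rcases hQA x hx1 h1 s (hinter hs'.1 hs'.2) hxs with rfl | rfl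
          · exact Or.inl (hSu' x hx1 h1 hxs)
          · exact Or.inr (hSw' x hx1 h1 hxs)
    refine (Finset.card_le_card hsub).trans ((Finset.card_union_le _ _).trans ?_)
    have h1 := List.toFinset_card_le ((u :: (Q ++ [w])) ++ B.filter (· ∈ P))
    have h2 := Finset.card_union_le Su Sw
    simp only [List.length_append, List.length_cons, List.length_nil] at h1
    omega

end MinCE

end PlaneEmbedding

end frames

section chords

open scoped Classical

variable {V : Type} {G : SimpleGraph V}

theorem List.exists_two_mem {α : Type*} {l : List α} {a b : α} (ha : a ∈ l) (hb : b ∈ l)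
    (hab : a ≠ b) : ∃ s t r, l = s ++ a :: (t ++ b :: r) ∨ l = s ++ b :: (t ++ a :: r) := by
  obtain ⟨s, t, rfl⟩ := List.append_of_mem ha
  rw [List.mem_append, List.mem_cons] at hb
  rcases hb with hb | hb | hb
  · obtain ⟨s₁, s₂, rfl⟩ := List.append_of_mem hb
    exact ⟨s₁, s₂, t, Or.inr (by simp)⟩
  · exact absurd hb.symm hab
  · obtain ⟨t₁, t₂, rfl⟩ := List.append_of_mem hb
    exact ⟨s, t₁, t₂, Or.inl rfl⟩

theorem isPath_of_append {s t r : List V} {a b : V} (hn : (s ++ a :: (t ++ b :: r)).Nodup)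
    (hc : (s ++ a :: (t ++ b :: r)).IsChain G.Adj) : IsPath G a t b := by
  have hform : s ++ a :: (t ++ b :: r) = s ++ ((a :: (t ++ [b])) ++ r) := by simp
  rw [hform] at hn hc
  exact ⟨hn.of_append_right.of_append_left, hc.right_of_append.left_of_append⟩

theorem GirthGeFive.two_le_length (hG : GirthGeFive G) {t : List V} {a b x : V}
    (h : IsPath G a t b) (hx : x ∉ t) (ha : G.Adj x a) (hb : G.Adj x b) : 2 ≤ t.length := by
  have := hG _ (isCyc_biList_singleton h ha hb hx)
  rw [length_biList] at this
  simp at this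
  omega

namespace PlaneEmbedding

variable {E : PlaneEmbedding G} {H P A : Finset V} {L : V → Finset ℕ} {pl wl : List V}

theorem Frame.isChain (h : E.Frame H P pl wl) : (pl ++ wl).IsChain G.Adj := by
  obtain ⟨p, l, rfl⟩ := List.exists_cons_of_ne_nil h.left_ne
  have := h.cycle.isCyc.isChain
  rw [List.cons_append, closedList_cons, ← List.cons_append] at this
  exact this.left_of_append

theorem IsOuterCycle.isSplit_singleton (hG : GirthGeFive G) {u w x : V} {B D : List V}
    (h : E.IsOuterCycle H (biList u D w B)) (hx : x ∈ H) (hxC : x ∉ biList u D w B)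
    (hxu : G.Adj x u) (hxw : G.Adj x w) : E.IsSplit H u D w B [x] := by
  obtain ⟨h1, h2, -, -⟩ := isCyc_biList.1 h.isCyc
  refine ⟨h, ?_, ?_, isPath_singleton hxu.symm hxw h1.ne, by simpa using hx, by simpa using hxC⟩
  · rintro rfl
    exact hG.no_triangle hxu h1.adj hxw.symm
  · rintro rfl
    exact hG.no_triangle hxu h2.adj hxw.symm

theorem listEdges_singleton {u w x : V} : ∀ z ∈ [x], ∀ y, y = u ∨ y = w ∨ y ∈ [x] → G.Adj z y →
    s(z, y) ∈ listEdges (u :: ([x] ++ [w])) := by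
  intro z hz y hy hzy
  rw [List.mem_singleton] at hz
  subst hz
  rcases hy with rfl | rfl | hy
  · simp [listEdges, Sym2.eq_swap]
  · simp [listEdges]
  · rw [List.mem_singleton] at hy
    exact absurd hy.symm hzy.ne

namespace MinCE

theorem empty_of_split [Finite V] (h : E.MinCE H P A L) {u w : V} {B D Q : List V}
    (hs : E.IsSplit H u B w D Q) (hl : Q.length + B.length ≤ 6) :
    ∀ z ∈ H, z ∉ biList u Q w B → E.ins (biList u Q w B) (.inl z) = 0 := fun z hz hzK =>
  h.ins_eq_zero hs.theta.cycle₁ (fun x hx => hs.mem (by rw [mem_biList] at hx; tauto))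
    (by rw [length_biList]; omega) hz hzK

theorem false_of_biList [Fintype V] (h : E.MinCE H P A L) {u w x : V} {B D : List V}
    (hC : E.IsOuterCycle H (biList u D w B)) (hB : ∀ b ∈ B, b ∉ P) (hu : u ∉ P) (hw : w ∉ P)
    (hx : x ∈ H) (hxC : x ∉ biList u D w B) (hxu : G.Adj x u) (hxw : G.Adj x w) : False := by
  induction hn : B.length using Nat.strong_induction_on generalizing B D w with
  | _ n ih =>
  subst hn
  by_cases hex : ∃ b ∈ B, G.Adj x b
  · obtain ⟨b, hb, hxb⟩ := hex
    obtain ⟨B₁, B₂, rfl⟩ := List.append_of_mem hb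
    have hform : biList u D w (B₁ ++ b :: B₂) = biList u (D ++ w :: B₂.reverse) b B₁ := by
      simp [biList]
    rw [hform] at hC hxC
    exact ih _ (by simp) hC (fun y hy => hB y (by simp [hy])) (hB b hb) hxC hxb rfl
  · push Not at hex
    have hs := hC.isSplit_singleton h.girth hx hxC hxu hxw
    refine h.split hs (Or.inl hu) (Or.inl hB) ?_ (fun _ y hy hyP => absurd hyP (hB y hy))
      (fun _ y hy hyP => absurd hyP (hB y hy)) ?_ listEdges_singleton ?_
    · intro z hz y hy _
      rw [List.mem_singleton] at hz
      exact hz ▸ hex y hy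
    · intro a ha _ hau haw
      refine h.girth.no_square hxu hau.symm haw hxw.symm ?_ hs.path.ne
      rintro rfl
      exact hxC (by simp [ha])
    · have : B.filter (· ∈ P) = [] := by simpa using hB
      simp [this, hu, hw]

/-- An interior vertex has at most one neighbour on the outer cycle outside `P`. -/
theorem eq_of_right [Fintype V] (h : E.MinCE H P A L) (hf : E.Frame H P pl wl) {u w x : V}
    (hx : x ∈ H) (hxC : x ∉ pl ++ wl) (hu : u ∈ wl) (hw : w ∈ wl) (hxu : G.Adj x u)
    (hxw : G.Adj x w) : u = w := by
  by_contra huw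
  have key : ∀ {u w s t r}, wl = s ++ u :: (t ++ w :: r) → G.Adj x u → G.Adj x w → False := by
    intro u w s t r hwl hxu hxw
    have hC : E.IsOuterCycle H ((pl ++ s) ++ (u :: (t ++ w :: r))) := by simpa [hwl] using hf.cycle
    have hC' : E.IsOuterCycle H (biList u (r ++ pl ++ s).reverse w t) := by
      have : E.IsOuterCycle H (biList u t w (r ++ pl ++ s).reverse) := by
        simpa [biList] using hC.rotate
      exact this.comm
    refine h.false_of_biList hC' (fun b hb => hf.notMem (by simp [hwl, hb]))
      (hf.notMem (by simp [hwl])) (hf.notMem (by simp [hwl])) hx ?_ hxu hxw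
    rw [hwl] at hxC
    simp at hxC ⊢
    tauto
  obtain ⟨s, t, r, h1 | h1⟩ := List.exists_two_mem hu hw huw
  exacts [key h1 hxu hxw, key h1 hxw hxu]

/-- An interior vertex has at most one neighbour in `P`. -/
theorem eq_of_left [Fintype V] (h : E.MinCE H P A L) (hf : E.Frame H P pl wl) {u w x : V}
    (hx : x ∈ H) (hxC : x ∉ pl ++ wl) (hu : u ∈ pl) (hw : w ∈ pl) (hxu : G.Adj x u)
    (hxw : G.Adj x w) : u = w := by
  by_contra huw
  have hnd : pl.Nodup := hf.cycle.isCyc.nodup.of_append_left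
  have hlen : pl.length ≤ 6 := hf.length_left.trans_le h.card_le
  have hxpl : x ∉ pl := fun h => hxC (List.mem_append.2 (Or.inl h))
  have hgap : ∀ {s t r : List V} {a b}, pl = s ++ a :: (t ++ b :: r) → G.Adj x a → G.Adj x b →
      2 ≤ t.length := by
    intro s t r a b hpl hxa hxb
    exact h.girth.two_le_length (isPath_of_append (hpl ▸ hnd) (hpl ▸ hf.isChain_left))
      (fun hxt => hxpl (by simp [hpl, hxt])) hxa hxb
  have key : ∀ {u w α β γ}, pl = α ++ u :: (β ++ w :: γ) → G.Adj x u → G.Adj x w → False := by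
    clear huw hxu hxw hu hw u w
    intro u w α β γ hpl hxu hxw
    have hβ2 := hgap hpl hxu hxw
    have hthird : ∀ p ∈ pl, G.Adj x p → p = u ∨ p = w := by
      intro p hp hxp
      by_contra! hne
      rw [hpl] at hp
      simp only [List.mem_append, List.mem_cons, hne.1, hne.2, false_or] at hp
      rw [hpl] at hlen
      rcases hp with hp | hp | hp
      · obtain ⟨α₁, α₂, rfl⟩ := List.append_of_mem hp
        have := hgap (s := α₁) (a := p) (t := α₂) (b := u) (r := β ++ w :: γ) (by simp [hpl]) hxp hxu
        simp at hlen
        omega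
      · obtain ⟨β₁, β₂, rfl⟩ := List.append_of_mem hp
        have h1 := hgap (s := α) (a := u) (t := β₁) (b := p) (r := β₂ ++ w :: γ) (by simp [hpl])
          hxu hxp
        have h2 := hgap (s := α ++ u :: β₁) (a := p) (t := β₂) (b := w) (r := γ) (by simp [hpl])
          hxp hxw
        simp at hlen
        omega
      · obtain ⟨γ₁, γ₂, rfl⟩ := List.append_of_mem hp
        have := hgap (s := α ++ u :: β) (a := w) (t := γ₁) (b := p) (r := γ₂) (by simp [hpl]) hxw hxp
        simp at hlen
        omega
    have hC : E.IsOuterCycle H (biList u β w (γ ++ wl ++ α).reverse) := by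
      have : E.IsOuterCycle H (α ++ (u :: (β ++ w :: γ) ++ wl)) := by simpa [hpl] using hf.cycle
      simpa [biList] using this.rotate
    have hxK : x ∉ biList u β w (γ ++ wl ++ α).reverse := by
      rw [hpl] at hxC
      simp at hxC ⊢
      tauto
    have hs := hC.isSplit_singleton h.girth hx hxK hxu hxw
    have he := h.empty_of_split hs (by rw [hpl] at hlen; simp at hlen ⊢; omega)
    have hpP : ∀ {p}, p ∈ P ↔ p ∈ α ∨ p = u ∨ p ∈ β ∨ p = w ∨ p ∈ γ := by
      intro p; rw [hf.mem_iff, hpl]; simp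
    have huP : u ∈ P := hpP.2 (Or.inr (Or.inl rfl))
    have hwP : w ∈ P := hpP.2 (Or.inr (Or.inr (Or.inr (Or.inl rfl))))
    have hnd' := hnd
    rw [hpl] at hnd'
    have hβα : ∀ b ∈ β, b ∉ α ∧ b ≠ u ∧ b ≠ w ∧ b ∉ γ := by
      intro b hb
      simp only [List.nodup_append, List.nodup_cons, List.mem_append, List.mem_cons] at hnd'
      grind
    have hxP : x ∉ P := fun h => hxpl ((hf.mem_iff x).1 h)
    have hAC : ∀ a ∈ A, a ∈ wl := fun a ha =>
      hf.mem_right (hf.cycle.mem_of_outer E (h.outer' a ha)) (h.disjoint a ha)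
    have hxA : x ∉ A := fun h => hxC (List.mem_append.2 (Or.inr (hAC x h)))
    choose! c hc using fun p (hp : p ∈ P) => h.nonempty p hp
    obtain ⟨cx, hcx, hcx'⟩ := Finset.exists_mem_notMem_of_card_lt_card
      (show ({c u, c w} : Finset ℕ).card < (L x).card from
        Finset.card_le_two.trans_lt (h.three_le x hx hxP hxA))
    have hcu : cx ≠ c u := fun e => hcx' (by simp [e])
    have hcw : cx ≠ c w := fun e => hcx' (by simp [e])
    have hca : ∀ a ∈ A, ∃ ca, ca ∈ L a ∧ ca ≠ cx := by
      intro a ha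
      obtain ⟨ca, h1, h2⟩ := Finset.exists_mem_notMem_of_card_lt_card
        (show ({cx} : Finset ℕ).card < (L a).card by rw [h.card_eq_two a ha]; simp)
      exact ⟨ca, h1, by simpa using h2⟩
    choose! d hd hd' using hca
    set N := A.filter (G.Adj x) with hN
    have memN : ∀ {y}, y ∈ N ↔ y ∈ A ∧ G.Adj x y := Finset.mem_filter
    have hNcard : N.card ≤ 1 := Finset.card_le_one.2 fun a ha b hb => by
      rw [memN] at ha hb
      exact h.eq_of_right hf hx hxC (hAC a ha.1) (hAC b hb.1) ha.2 hb.2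
    set M := α ++ u :: x :: w :: γ with hM
    have memM : ∀ {y}, y ∈ M.toFinset ∪ N ↔ (y ∈ M ∨ (y ∈ A ∧ G.Adj x y)) := by
      intro y; rw [Finset.mem_union, List.mem_toFinset, memN]
    have hMP : ∀ {y}, y ∈ M → y ∈ P ∨ y = x := by
      intro y hy
      rw [hpP]
      simp [hM] at hy
      tauto
    have hPM : ∀ {y}, y ∈ P → y ∈ β ∨ y ∈ M := by
      intro y hy
      rw [hpP] at hy
      simp [hM]
      tauto
    have hxM : x ∈ M := by simp [hM]
    have hMβ : ∀ {y}, y ∈ M → y ∉ β := by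
      intro y hy hyβ
      have h1 := hβα y hyβ
      have h2 : x ∉ β := fun h => hxP (hpP.2 (Or.inr (Or.inr (Or.inl h))))
      simp only [hM, List.mem_append, List.mem_cons] at hy
      rcases hy with hy | rfl | rfl | rfl | hy
      exacts [h1.1 hy, h1.2.1 rfl, h2 hyβ, h1.2.2.1 rfl, h1.2.2.2 hy]
    have hMchain : M.IsChain G.Adj := by
      have h1 := hf.isChain_left
      have h2 : pl = (α ++ [u]) ++ (β ++ (w :: γ)) := by simp [hpl]
      rw [h2] at h1
      have h3 := h1.left_of_append
      have h4 := h1.right_of_append.right_of_append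
      have : M = (α ++ [u]) ++ (x :: w :: γ) := by simp [hM]
      rw [this, List.isChain_append]
      refine ⟨h3, List.isChain_cons_cons.2 ⟨hxw, h4⟩, ?_⟩
      intro a ha b hb
      simp at ha hb
      subst ha hb
      exact hxu.symm
    have hβchain : β.IsChain G.Adj := by
      have h1 := hf.isChain_left
      have h2 : pl = (α ++ [u]) ++ (β ++ (w :: γ)) := by simp [hpl]
      rw [h2] at h1
      exact h1.right_of_append.left_of_append
    obtain ⟨z, hz⟩ := List.exists_mem_of_ne_nil β hs.left_ne
    have hβP : ∀ {y}, y ∈ β → y ∈ P := fun hy => hpP.2 (Or.inr (Or.inr (Or.inl hy)))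
    have hno : ∀ t ∈ H, t ∉ β.toFinset → t ∉ M.toFinset ∪ N → ∀ d ∈ β.toFinset, ¬ G.Adj t d := by
      intro t ht htβ htM d hd htd
      rw [List.mem_toFinset] at htβ hd
      have htM' : t ∉ M := fun h => htM (memM.2 (Or.inl h))
      simp only [hM, List.mem_append, List.mem_cons, not_or] at htM'
      exact hs.not_adj_of_empty he hd ht htβ htM'.2.1 htM'.2.2.2.1 (by simpa using htM'.2.2.1)
        htd.symm
    set ψ : V → ℕ := fun v => if v = x then cx else if v ∈ P then c v else d v with hψdef
    have hψx : ψ x = cx := if_pos rfl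
    have hψP : ∀ p ∈ P, ψ p = c p := fun p hp => by
      simp only [hψdef]
      rw [if_neg (show ¬ p = x from fun e => hxP (e ▸ hp)), if_pos hp]
    have hψA : ∀ a ∈ A, ψ a = d a := fun a ha => by
      simp only [hψdef]
      rw [if_neg (show ¬ a = x from fun e => hxA (e ▸ ha)), if_neg (h.disjoint a ha)]
    have hcases : ∀ {v}, v ∈ β.toFinset ∨ v ∈ M.toFinset ∪ N → v ∈ P ∨ v = x ∨
        (v ∈ A ∧ G.Adj x v) := by
      intro v hv
      rw [List.mem_toFinset, memM] at hv
      rcases hv with hv | hv | hv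
      · exact Or.inl (hβP hv)
      · rcases hMP hv with h1 | h1
        exacts [Or.inl h1, Or.inr (Or.inl h1)]
      · exact Or.inr (Or.inr hv)
    have hxp : ∀ p ∈ P, G.Adj x p → cx ≠ c p := by
      intro p hp hxp
      rcases hthird p ((hf.mem_iff p).1 hp) hxp with rfl | rfl
      exacts [hcu, hcw]
    refine h.reduce (D := β.toFinset) (P' := M.toFinset ∪ N) (ψ := ψ) (z := z)
      (fun y hy => h.subset (hβP (List.mem_toFinset.1 hy))) (conn_of_isChain hβchain)
      (List.mem_toFinset.2 hz) (h.outer z (hβP hz)) ?_ ?_ ?_ ?_ ?_ ?_ ?_ ?_ ?_ ?_ ?_ ?_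
    · exact (conn_of_isChain hMchain).union_adj fun n hn =>
        ⟨x, List.mem_toFinset.2 hxM, (memN.1 hn).2.symm⟩
    · have h1 := Finset.card_union_le M.toFinset N
      have h2 := M.toFinset_card_le
      rw [hpl] at hlen
      simp at hlen
      have h3 : M.length = α.length + γ.length + 3 := by simp [hM]; omega
      omega
    · intro p hp
      rw [memM] at hp
      rcases hp with hp | hp
      · rcases hMP hp with h1 | rfl
        · exact (h.outer p h1).mono E Finset.sdiff_subset (Finset.mem_sdiff.2
            ⟨h.subset h1, fun h => hMβ hp (List.mem_toFinset.1 h)⟩)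
        · have h1 := hs.outer (fun x hx y hy hxy => h.chordless hC hx hy hxy) listEdges_singleton
            (v := p) (by simp)
          refine h1.mono E (fun t ht => ?_) (Finset.mem_sdiff.2
            ⟨hx, fun h => hMβ hp (List.mem_toFinset.1 h)⟩)
          rw [Finset.mem_sdiff, List.mem_toFinset] at ht
          exact hs.mem_disc_of_empty he ht.1 ht.2
      · exact (h.outer' p hp.1).mono E Finset.sdiff_subset (Finset.mem_sdiff.2
            ⟨h.subset' hp.1, fun h' => h.disjoint p hp.1 (hβP (List.mem_toFinset.1 h'))⟩)
    · intro p hp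
      rw [List.mem_toFinset, memM]
      rcases hPM hp with h1 | h1
      exacts [Or.inl h1, Or.inr (Or.inl h1)]
    · intro v hv
      rcases hcases hv with h1 | rfl | h1
      · rw [hψP v h1]; exact hc v h1
      · rw [hψx]; exact hcx
      · rw [hψA v h1.1]; exact hd v h1.1
    · intro a ha b hb hab
      rcases hcases ha with h1 | rfl | h1 <;> rcases hcases hb with h2 | rfl | h2
      · rw [hψP a h1, hψP b h2]
        exact fun e => Finset.disjoint_left.1 (h.list_disjoint a h1 b h2 hab) (hc a h1)
          (e ▸ hc b h2)
      · rw [hψP a h1, hψx]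
        exact (hxp a h1 hab.symm).symm
      · exact absurd hab.symm (h.not_adj b h2.1 a h1)
      · rw [hψP b h2, hψx]
        exact hxp b h2 hab
      · exact absurd hab (G.loopless.irrefl _)
      · rw [hψx, hψA b h2.1]
        exact (hd' b h2.1).symm
      · exact absurd hab (h.not_adj a h1.1 b h2)
      · rw [hψx, hψA a h1.1]
        exact hd' a h1.1
      · exact absurd hab (h.indep a h1.1 b h2.1)
    · exact fun t ht htD htP _ d hd _ _ htd => absurd htd (hno t ht htD htP d hd)
    · exact fun t ht htD htP _ d hd htd => absurd htd (hno t ht htD htP d hd)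
    · exact fun t ht htD htP _ d hd htd => absurd htd (hno t ht htD htP d hd)
    · exact fun t ht htD htP _ d hd htd => absurd htd (hno t ht htD htP d hd)
    · intro a ha haD haP p hp hap
      rw [memM] at hp
      rcases hp with hp | hp
      · rcases hMP hp with h1 | rfl
        · exact h.not_adj a ha p h1 hap
        · exact haP (memM.2 (Or.inr ⟨ha, hap.symm⟩))
      · exact h.indep a ha p hp.1 hap
    · exact fun a ha _ _ d hd had => absurd had
        (h.not_adj a ha d (hβP (List.mem_toFinset.1 hd)))
  obtain ⟨s, t, r, h1 | h1⟩ := List.exists_two_mem hu hw huw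
  exacts [key h1 hxu hxw, key h1 hxw hxu]

theorem false_of_three [Fintype V] (h : E.MinCE H P A L) (hf : E.Frame H P pl wl) {a b c x : V}
    (hx : x ∈ H) (hxC : x ∉ pl ++ wl) (ha : a ∈ pl ++ wl) (hb : b ∈ pl ++ wl) (hc : c ∈ pl ++ wl)
    (hab : a ≠ b) (hac : a ≠ c) (hbc : b ≠ c) (hxa : G.Adj x a) (hxb : G.Adj x b)
    (hxc : G.Adj x c) : False := by
  rw [List.mem_append] at ha hb hc
  rcases ha with ha | ha <;> rcases hb with hb | hb <;> rcases hc with hc | hc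
  · exact hab (h.eq_of_left hf hx hxC ha hb hxa hxb)
  · exact hab (h.eq_of_left hf hx hxC ha hb hxa hxb)
  · exact hac (h.eq_of_left hf hx hxC ha hc hxa hxc)
  · exact hbc (h.eq_of_right hf hx hxC hb hc hxb hxc)
  · exact hbc (h.eq_of_left hf hx hxC hb hc hxb hxc)
  · exact hac (h.eq_of_right hf hx hxC ha hc hxa hxc)
  · exact hab (h.eq_of_right hf hx hxC ha hb hxa hxb)
  · exact hab (h.eq_of_right hf hx hxC ha hb hxa hxb)

theorem three_le_of_chord [Fintype V] (h : E.MinCE H P A L) {u w x : V} {α β γ δ : List V}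
    (hf : E.Frame H P (γ ++ w :: δ) (α ++ u :: β)) (hx : x ∈ H)
    (hxC : x ∉ (γ ++ w :: δ) ++ (α ++ u :: β)) (hxu : G.Adj x u) (hxw : G.Adj x w)
    (hα : α ≠ []) : 3 ≤ δ.length := by
  by_contra! hlt
  have hC : E.IsOuterCycle H (biList u (β ++ γ) w (δ ++ α).reverse) := by
    have : E.IsOuterCycle H ((γ ++ w :: δ ++ α) ++ (u :: β)) := by simpa using hf.cycle
    simpa [biList] using this.rotate
  have hs := hC.isSplit_singleton h.girth hx (by simp at hxC ⊢; tauto) hxu hxw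
  have hnd := hf.cycle.isCyc.nodup
  have huP : u ∉ P := hf.notMem (by simp)
  have hwP : w ∈ P := (hf.mem_iff w).2 (by simp)
  refine h.split hs (Or.inl huP) (Or.inr (Or.inr hwP)) ?_ ?_ (fun hw => absurd hwP hw) ?_
    listEdges_singleton ?_
  · intro z hz y hy hyPA hzy
    rw [List.mem_singleton] at hz
    subst hz
    rw [List.mem_reverse, List.mem_append] at hy
    rcases hyPA with hyP | hyA
    · have := h.eq_of_left hf hx hxC ((hf.mem_iff y).1 hyP) ((hf.mem_iff w).1 hwP) hzy hxw
      subst this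
      simp only [List.nodup_append, List.nodup_cons, List.mem_append, List.mem_cons] at hnd
      grind
    · have hyw := hf.mem_right (x := y) (by simp; tauto) (h.disjoint y hyA)
      have := h.eq_of_right hf hx hxC hyw (by simp) hzy hxu
      subst this
      simp only [List.nodup_append, List.nodup_cons, List.mem_append, List.mem_cons] at hnd
      grind
  · intro _ y hy hyP huy
    obtain ⟨t, ht⟩ := hC.adj_left (fun x hx y hy hxy => h.chordless hC hx hy hxy) hy huy
    rcases List.eq_nil_or_concat α with rfl | ⟨α', a, rfl⟩
    · exact hα rfl
    · simp at ht
      exact hf.notMem (x := a) (by simp) (ht.1 ▸ hyP)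
  · intro a ha _ hau haw
    refine h.girth.no_square hxu hau.symm haw hxw.symm ?_ hs.path.ne
    rintro rfl
    exact hs.disjoint (a := x) (by simp) (by simp only [mem_biList]; tauto)
  · have h1 : α.filter (· ∈ P) = [] := by
      simp only [List.filter_eq_nil_iff, decide_eq_true_eq]
      exact fun a ha => hf.notMem (by simp [ha])
    have h2 := List.length_filter_le (· ∈ P) δ
    rw [List.filter_reverse, List.length_reverse, List.filter_append, h1, List.append_nil,
      if_neg huP, if_pos hwP]
    simp only [List.length_singleton]
    omega

/-- The exceptional positions of an interior vertex with two neighbours on the outer cycle. -/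
theorem chord_cases [Fintype V] (h : E.MinCE H P A L) (hf : E.Frame H P pl wl) {u w x : V}
    (hwl : 2 ≤ wl.length) (hx : x ∈ H) (hxC : x ∉ pl ++ wl) (hu : u ∈ wl) (hw : w ∈ pl)
    (hxu : G.Adj x u) (hxw : G.Adj x w) :
    (∃ a b c d e β, pl = [a, b, c, w, d, e] ∧ wl = u :: β) ∨
      ∃ a b c d e α, pl = [a, b, w, c, d, e] ∧ wl = α ++ [u] := by
  obtain ⟨α, β, rfl⟩ := List.append_of_mem hu
  obtain ⟨γ, δ, rfl⟩ := List.append_of_mem hw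
  have h1 := h.three_le_of_chord hf hx hxC hxu hxw
  have hfr : E.Frame H P (δ.reverse ++ w :: γ.reverse) (β.reverse ++ u :: α.reverse) := by
    simpa using hf.reverse
  have h2 := h.three_le_of_chord hfr hx (by simp at hxC ⊢; tauto) hxu hxw
  have hlen := hf.length_left.trans_le h.card_le
  have hlenr := hfr.length_left.trans_le h.card_le
  have key : ∀ {β γ δ : List V}, E.Frame H P (γ ++ w :: δ) ([] ++ u :: β) → x ∉ δ →
      2 ≤ δ.length := by
    intro β γ δ hf hxδ
    have hp : IsPath G w δ u := by
      have h3 := hf.isChain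
      have h4 := hf.cycle.isCyc.nodup
      have h5 : γ ++ w :: δ ++ ([] ++ u :: β) = γ ++ w :: (δ ++ u :: β) := by simp
      rw [h5] at h3 h4
      exact isPath_of_append h4 h3
    exact h.girth.two_le_length hp hxδ hxw hxu
  simp only [List.length_append, List.length_cons, List.length_reverse] at hlen hwl h2
  by_cases hα : α = []
  · subst hα
    have hβ : β.reverse ≠ [] := by
      rintro h0
      rw [List.reverse_eq_nil_iff] at h0
      simp [h0] at hwl
    have h3 := h2 hβ
    have h4 := key hf (fun hxδ => hxC (by simp [hxδ]))
    match γ, δ, h3, h4, hlen with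
    | [a, b, c], [d, e], _, _, _ => exact Or.inl ⟨a, b, c, d, e, β, by simp, by simp⟩
    | _ :: _ :: _ :: _ :: _, _ :: _ :: _, _, _, hl => simp at hl; omega
    | _ :: _ :: _ :: _, _ :: _ :: _ :: _, _, _, hl => simp at hl; omega
  · have h3 := h1 hα
    by_cases hβ : β = []
    · subst hβ
      have h4 := key (β := α.reverse) (γ := δ.reverse) (δ := γ.reverse) (by simpa using hfr)
        (fun hxγ => hxC (by simp at hxγ; simp [hxγ]))
      rw [List.length_reverse] at h4
      match γ, δ, h3, h4, hlen with
      | [a, b], [c, d, e], _, _, _ => exact Or.inr ⟨a, b, c, d, e, α, by simp, by simp⟩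
      | _ :: _ :: _, _ :: _ :: _ :: _ :: _, _, _, hl => simp at hl; omega
      | _ :: _ :: _ :: _, _ :: _ :: _ :: _, _, _, hl => simp at hl; omega
    · have := h2 (by simpa using hβ)
      omega

end MinCE

end PlaneEmbedding

end chords

section crossings

open scoped Classical

variable {V : Type} {G : SimpleGraph V}

theorem exists_coloring_of_two_le {L : V → Finset ℕ} {l : List V} (hn : l.Nodup)
    (hL : ∀ v ∈ l, 2 ≤ (L v).card) :
    ∃ ψ : V → ℕ, (∀ v ∈ l, ψ v ∈ L v) ∧ l.IsChain fun u v => ψ u ≠ ψ v := by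
  induction l with
  | nil => exact ⟨fun _ => 0, by simp, List.isChain_nil⟩
  | cons a l ih =>
    obtain ⟨ha, hn⟩ := List.nodup_cons.1 hn
    obtain ⟨ψ, h1, h2⟩ := ih hn fun v hv => hL v (List.mem_cons_of_mem _ hv)
    obtain ⟨x, hx, hx'⟩ := Finset.exists_mem_notMem_of_card_lt_card
      (show (Finset.image ψ (l.take 1).toFinset).card < (L a).card from
        (Finset.card_image_le.trans ((List.toFinset_card_le _).trans (by simp))).trans_lt
          (hL a (List.mem_cons_self ..)))
    have hval : ∀ v ∈ l, Function.update ψ a x v = ψ v := fun v hv =>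
      Function.update_of_ne (show v ≠ a from fun e => ha (e ▸ hv)) _ _
    refine ⟨Function.update ψ a x, ?_, ?_⟩
    · intro v hv
      rcases List.mem_cons.1 hv with rfl | hv
      · rwa [Function.update_self]
      · rw [hval v hv]
        exact h1 v hv
    · cases l with
      | nil => exact List.isChain_singleton _
      | cons b l =>
        refine List.isChain_cons_cons.2 ⟨?_, h2.imp_of_mem_imp fun u v hu hv huv => ?_⟩
        · rw [Function.update_self, hval b (List.mem_cons_self ..)]
          rintro rfl
          exact hx' (by simp)
        · rwa [hval u hu, hval v hv]

theorem ne_of_mem_listEdges {ψ : V → ℕ} {l : List V} (hl : l.IsChain fun u v => ψ u ≠ ψ v)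
    {u v : V} (h : s(u, v) ∈ listEdges l) : ψ u ≠ ψ v := by
  induction l with
  | nil => simp [listEdges] at h
  | cons a l ih =>
    cases l with
    | nil => simp [listEdges] at h
    | cons b l =>
      rw [List.isChain_cons_cons] at hl
      rw [listEdges, List.mem_cons, Sym2.eq_iff] at h
      rcases h with (⟨rfl, rfl⟩ | ⟨rfl, rfl⟩) | h
      exacts [hl.1, hl.1.symm, ih hl.2 h]

theorem mem_listEdges_of_append {l₁ l₂ : List V} {u v : V} (h : s(u, v) ∈ listEdges (l₁ ++ l₂))
    (hu : u ∉ l₁) (hv : v ∉ l₁) : s(u, v) ∈ listEdges l₂ := by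
  induction l₁ with
  | nil => exact h
  | cons a l₁ ih =>
    refine ih ?_ (fun h => hu (List.mem_cons_of_mem _ h)) fun h => hv (List.mem_cons_of_mem _ h)
    rw [List.cons_append] at h
    cases hl : l₁ ++ l₂ with
    | nil => simp [hl, listEdges] at h
    | cons b l =>
      rw [hl, listEdges, List.mem_cons, Sym2.eq_iff] at h
      rcases h with (⟨rfl, rfl⟩ | ⟨rfl, rfl⟩) | h
      · simp at hu
      · simp at hv
      · exact h

namespace PlaneEmbedding

variable {E : PlaneEmbedding G} {H P A : Finset V} {L : V → Finset ℕ} {pl wl : List V}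

namespace MinCE

theorem crossing_frame [Fintype V] (h : E.MinCE H P A L) (hf : E.Frame H P pl wl) {v p : V}
    (hv : v ∈ wl) (hp : p ∈ P) (hvp : G.Adj v p) :
    (∃ s t, pl = s ++ [p] ∧ wl = v :: t) ∨ ∃ s t, pl = p :: s ∧ wl = t ++ [v] := by
  have hp' := (hf.mem_iff p).1 hp
  exact crossing hf.cycle.isCyc.nodup
    (h.chordless hf.cycle (by simp [hp']) (by simp [hv]) hvp.symm) hp' hv

theorem eq_of_adj_left [Fintype V] (h : E.MinCE H P A L) (hf : E.Frame H P pl wl)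
    (hwl : 2 ≤ wl.length) {v p p' : V} (hv : v ∈ wl) (hp : p ∈ P) (hp' : p' ∈ P)
    (hvp : G.Adj v p) (hvp' : G.Adj v p') : p = p' := by
  have hnwl := hf.cycle.isCyc.nodup.of_append_right
  have hmix : ∀ {v s t}, wl = v :: s → wl = t ++ [v] → False := by
    intro v s t h1 h2
    rcases t with _ | ⟨a, t⟩
    · rw [h2] at hwl
      simp at hwl
    · rw [h2, List.cons_append] at h1
      obtain ⟨rfl, -⟩ := List.cons_eq_cons.1 h1
      rw [h2] at hnwl
      simp at hnwl
  rcases h.crossing_frame hf hv hp hvp with ⟨s, t, h1, h2⟩ | ⟨s, t, h1, h2⟩ <;>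
    rcases h.crossing_frame hf hv hp' hvp' with ⟨s', t', h3, h4⟩ | ⟨s', t', h3, h4⟩
  · rw [h1] at h3
    exact List.singleton_inj.1 (List.append_inj_right' h3 rfl)
  · exact (hmix h2 h4).elim
  · exact (hmix h4 h2).elim
  · rw [h1] at h3
    exact (List.cons_eq_cons.1 h3).1

theorem mem_listEdges_right [Fintype V] (h : E.MinCE H P A L) (hf : E.Frame H P pl wl) {u v : V}
    (hu : u ∈ wl) (hv : v ∈ wl) (huv : G.Adj u v) : s(u, v) ∈ listEdges wl := by
  have hnot : ∀ {y}, y ∈ wl → y ∉ pl := fun hy hy' => hf.notMem hy ((hf.mem_iff _).2 hy')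
  have h1 := h.chordless hf.cycle (by simp [hu]) (by simp [hv]) huv
  obtain ⟨p, l, rfl⟩ := List.exists_cons_of_ne_nil hf.left_ne
  rw [List.cons_append, cycleEdges, closedList_cons, List.append_assoc,
    ← List.cons_append] at h1
  have h2 := mem_listEdges_of_append h1 (hnot hu) (hnot hv)
  rw [← mem_listEdges_reverse, List.reverse_append] at h2
  have hne : ∀ {y}, y ∈ wl → y ∉ [p].reverse := fun hy hy' => hnot hy (by simp at hy'; simp [hy'])
  have h3 := mem_listEdges_of_append h2 (hne hu) (hne hv)
  rwa [mem_listEdges_reverse] at h3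

theorem eq_of_adj_right [Fintype V] (h : E.MinCE H P A L) {v u : V} {α β : List V}
    (hf : E.Frame H P pl (α ++ v :: β)) (hu : u ∈ α ++ v :: β) (hvu : G.Adj v u) :
    (∃ s, α = s ++ [u]) ∨ ∃ t, β = u :: t := by
  have hn := hf.cycle.isCyc.nodup.of_append_right
  have hvα : v ∉ α := fun hv => List.disjoint_of_nodup_append hn hv (List.mem_cons_self ..)
  have hvβ : v ∉ β := (List.nodup_cons.1 hn.of_append_right).1
  obtain ⟨m₁, m₂, h1 | h1⟩ := exists_append_of_mem_listEdges
    (h.mem_listEdges_right hf (by simp) hu hvu)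
  · have h2 := h1
    rw [List.append_cons_inj_of_notMem hvα hvβ] at h2
    exact Or.inr ⟨m₂, h2.2.2⟩
  · have h2 : α ++ v :: β = (m₁ ++ [u]) ++ v :: m₂ := by simp [h1]
    rw [List.append_cons_inj_of_notMem hvα hvβ] at h2
    exact Or.inl ⟨m₁, h2.1⟩

theorem exists_coloring_outer [Fintype V] (h : E.MinCE H P A L) (hf : E.Frame H P pl wl)
    (hwl : 2 ≤ wl.length) : ∃ ψ : V → ℕ, (∀ v ∈ pl ++ wl, ψ v ∈ L v) ∧
      ∀ u ∈ pl ++ wl, ∀ v ∈ pl ++ wl, G.Adj u v → ψ u ≠ ψ v := by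
  have hC := hf.cycle
  choose! c hc using fun p (hp : p ∈ P) => h.nonempty p hp
  have hnd := hC.isCyc.nodup
  have hnwl := hnd.of_append_right
  set L' : V → Finset ℕ := fun v => (L v).filter fun x => ∀ p ∈ P, G.Adj v p → x ≠ c p with hL'
  have hcard : ∀ v ∈ wl, 2 ≤ (L' v).card := by
    intro v hv
    have hvH := hC.subset v (by simp [hv])
    have hvP := hf.notMem hv
    by_cases hex : ∃ p ∈ P, G.Adj v p
    · obtain ⟨p, hp, hvp⟩ := hex
      have h3 := h.three_le v hvH hvP fun hvA => h.not_adj v hvA p hp hvp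
      have hsub : (L v).erase (c p) ⊆ L' v := fun x hx => Finset.mem_filter.2
        ⟨Finset.mem_of_mem_erase hx, fun p' hp' hvp' => by
          rw [← h.eq_of_adj_left hf hwl hv hp hp' hvp hvp']
          exact Finset.ne_of_mem_erase hx⟩
      have := Finset.card_le_card hsub
      have := Finset.pred_card_le_card_erase (s := L v) (a := c p)
      omega
    · have hall : L' v = L v := Finset.filter_true_of_mem
        fun x _ p hp hvp => (hex ⟨p, hp, hvp⟩).elim
      rw [hall]
      exact h.two_le v hvH hvP
  obtain ⟨d, hd, hdc⟩ := exists_coloring_of_two_le hnwl hcard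
  have hval : ∀ {v}, v ∈ wl → (if v ∈ P then c v else d v) = d v := fun hv =>
    if_neg (hf.notMem hv)
  have hvalP : ∀ {v}, v ∈ P → (if v ∈ P then c v else d v) = c v := fun hv => if_pos hv
  refine ⟨fun v => if v ∈ P then c v else d v, ?_, ?_⟩
  · intro v hv
    rcases List.mem_append.1 hv with hv | hv
    · have := (hf.mem_iff v).2 hv
      simpa only [hvalP this] using hc v this
    · simpa only [hval hv] using (Finset.mem_filter.1 (hd v hv)).1
  · intro u hu v hv huv
    rcases List.mem_append.1 hu with hu' | hu' <;> rcases List.mem_append.1 hv with hv' | hv'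
    · have h1 := (hf.mem_iff u).2 hu'
      have h2 := (hf.mem_iff v).2 hv'
      simp only [hvalP h1, hvalP h2]
      exact fun e => Finset.disjoint_left.1 (h.list_disjoint u h1 v h2 huv) (hc u h1)
        (e ▸ hc v h2)
    · have h1 := (hf.mem_iff u).2 hu'
      simp only [hvalP h1, hval hv']
      exact ((Finset.mem_filter.1 (hd v hv')).2 u h1 huv.symm).symm
    · have h2 := (hf.mem_iff v).2 hv'
      simp only [hvalP h2, hval hu']
      exact (Finset.mem_filter.1 (hd u hu')).2 v h2 huv
    · simp only [hval hu', hval hv']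
      exact ne_of_mem_listEdges hdc (h.mem_listEdges_right hf hu' hv' huv)

theorem eq_of_length_le [Fintype V] (h : E.MinCE H P A L) (hf : E.Frame H P pl wl)
    (hl : (pl ++ wl).length ≤ 9) {u w x : V} (hx : x ∈ H) (hxC : x ∉ pl ++ wl)
    (hu : u ∈ pl ++ wl) (hw : w ∈ pl ++ wl) (hxu : G.Adj x u) (hxw : G.Adj x w) : u = w := by
  by_contra huw
  have key : ∀ {u w s t r}, pl ++ wl = s ++ u :: (t ++ w :: r) → G.Adj x u → G.Adj x w → False := by
    clear huw hxu hxw hu hw u w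
    intro u w s t r hform hxu hxw
    have hC : E.IsOuterCycle H (biList u t w (r ++ s).reverse) := by
      have : E.IsOuterCycle H (s ++ (u :: (t ++ w :: r))) := hform ▸ hf.cycle
      simpa [biList] using this.rotate
    have hmem : ∀ {y}, y ∈ biList u t w (r ++ s).reverse ↔ y ∈ pl ++ wl := by
      intro y
      rw [hform]
      simp
      tauto
    have hs := hC.isSplit_singleton h.girth hx (mt hmem.1 hxC) hxu hxw
    have hs' := hC.comm.isSplit_singleton h.girth hx
      (fun hx => hxC (hmem.1 (by simp only [mem_biList] at hx ⊢; tauto))) hxu hxw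
    have h1 := h.girth _ hs.theta.cycle₁
    have h2 := h.girth _ hs'.theta.cycle₁
    rw [hform] at hl
    rw [length_biList] at h1 h2
    simp at h1 h2 hl
    have he := h.empty_of_split hs (by simp; omega)
    have he' := h.empty_of_split hs' (by simp; omega)
    have hall : ∀ z ∈ H, z = x ∨ z ∈ pl ++ wl := by
      intro z hz
      by_contra! hne
      have hzC := mt hmem.1 hne.2
      have h3 := he z hz (by simp only [mem_biList, List.mem_singleton] at hzC ⊢; tauto)
      have h4 := he' z hz (by simp only [mem_biList, List.mem_singleton] at hzC ⊢; tauto)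
      have h5 := E.ins_biList_add u t w (r ++ s).reverse [x] (.inl z)
      rw [h3, h4, hC.ins_vertex z hz hzC] at h5
      simp at h5
    have hxP : x ∉ P := fun h => hxC (List.mem_append.2 (Or.inl ((hf.mem_iff x).1 h)))
    have hxA : x ∉ A := fun h' => hxC (hf.cycle.mem_of_outer E (h.outer' x h'))
    obtain ⟨a, b, c, ha, hb, hc, hxa, hxb, hxc, hab, hac, hbc⟩ := h.exists_three_nbrs hx hxP hxA
    exact h.false_of_three hf hx hxC ((hall a ha).resolve_left hxa.ne')
      ((hall b hb).resolve_left hxb.ne') ((hall c hc).resolve_left hxc.ne') hab hac hbc hxa hxb hxc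
  obtain ⟨s, t, r, h1 | h1⟩ := List.exists_two_mem hu hw huw
  exacts [key h1 hxu hxw, key h1 hxw hxu]

theorem exists_link [Fintype V] (h : E.MinCE H P A L) {d₁ d₂ d₃ : V} {R : List V} {ψ : V → ℕ}
    (hC : E.IsOuterCycle H (d₁ :: d₂ :: d₃ :: R)) (hR : R.length = 6)
    (hψ : ∀ v ∈ d₁ :: d₂ :: d₃ :: R, ψ v ∈ L v)
    (hψ' : ∀ u ∈ d₁ :: d₂ :: d₃ :: R, ∀ v ∈ d₁ :: d₂ :: d₃ :: R, G.Adj u v → ψ u ≠ ψ v)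
    (hno : ∀ x ∈ H, x ∉ d₁ :: d₂ :: d₃ :: R → ∀ u ∈ d₁ :: d₂ :: d₃ :: R,
      ∀ w ∈ d₁ :: d₂ :: d₃ :: R, G.Adj x u → G.Adj x w → u = w) :
    ∃ x ∈ H, ∃ y ∈ H, x ∉ d₁ :: d₂ :: d₃ :: R ∧ y ∉ d₁ :: d₂ :: d₃ :: R ∧ G.Adj x d₁ ∧ G.Adj y d₃ ∧
      G.Adj x y := by
  by_contra! hlink
  have hmem : ∀ {v}, v ∈ d₁ :: d₂ :: d₃ :: R ↔
      (v ∈ [d₁, d₂, d₃].toFinset ∨ v ∈ R.toFinset) := by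
    intro v
    simp [or_assoc]
  have hnot : ∀ {v}, v ∉ [d₁, d₂, d₃].toFinset → v ∉ R.toFinset → v ∉ d₁ :: d₂ :: d₃ :: R :=
    fun h1 h2 h3 => (hmem.1 h3).elim h1 h2
  have hPC : ∀ {v}, E.Outer H v → v ∈ [d₁, d₂, d₃].toFinset ∨ v ∈ R.toFinset :=
    fun hv => hmem.1 (hC.mem_of_outer E hv)
  have hAC : ∀ a ∈ A, a ∉ [d₁, d₂, d₃].toFinset → a ∉ R.toFinset → False := fun a ha h1 h2 =>
    (hPC (h.outer' a ha)).elim h1 h2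
  have hchain := hC.isCyc.isChain
  rw [closedList_cons] at hchain
  have h12 : G.Adj d₁ d₂ := by simp at hchain; exact hchain.1
  have h23 : G.Adj d₂ d₃ := by simp at hchain; exact hchain.2.1
  have hch1 : [d₁, d₂, d₃].IsChain G.Adj := by simp [h12, h23]
  have hch2 : R.IsChain G.Adj := by
    have : d₁ :: (d₂ :: d₃ :: R ++ [d₁]) = [d₁, d₂, d₃] ++ (R ++ [d₁]) := by simp
    rw [this] at hchain
    exact hchain.right_of_append.left_of_append
  have hnd := hC.isCyc.nodup
  refine h.reduce (D := [d₁, d₂, d₃].toFinset) (P' := R.toFinset) (ψ := ψ) (z := d₁)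
    (fun y hy => hC.subset y (hmem.2 (Or.inl hy))) (conn_of_isChain hch1) (by simp)
    (hC.outer d₁ (by simp)) (conn_of_isChain hch2) (R.toFinset_card_le.trans hR.le) ?_
    (fun p hp => hPC (h.outer p hp)) (fun v hv => hψ v (hmem.2 hv))
    (fun u hu v hv => hψ' u (hmem.2 hu) v (hmem.2 hv)) ?_ ?_
    (fun _ _ _ _ _ _ _ _ a ha haD haP => (hAC a ha haD haP).elim) ?_
    (fun a ha haD haP => (hAC a ha haD haP).elim) (fun a ha haD haP => (hAC a ha haD haP).elim)
  · intro p hp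
    have hpC := hmem.2 (Or.inr hp)
    refine (hC.outer p hpC).mono E Finset.sdiff_subset
      (Finset.mem_sdiff.2 ⟨hC.subset p hpC, fun hpD => ?_⟩)
    rw [List.mem_toFinset] at hp hpD
    have : d₁ :: d₂ :: d₃ :: R = [d₁, d₂, d₃] ++ R := rfl
    rw [this] at hnd
    exact List.disjoint_of_nodup_append hnd hpD hp
  · exact fun t ht htD htP _ d hd d' hd' htd htd' =>
      hno t ht (hnot htD htP) d (hmem.2 (Or.inl hd)) d' (hmem.2 (Or.inl hd')) htd htd'
  · intro t ht htD htP _ d hd htd t' ht' htD' htP' _ d' hd' htd' htt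
    have hdis : ∀ {a b : V}, a ∈ [d₁, d₂, d₃].toFinset → b ∉ [d₁, d₂, d₃].toFinset → a ≠ b :=
      fun h1 h2 e => h2 (e ▸ h1)
    have hsq : G.Adj d d' → False := fun hdd =>
      h.girth.no_square htd hdd htd'.symm htt.symm (hdis hd' htD).symm (hdis hd htD')
    have hcon := hlink t ht t' ht' (hnot htD htP) (hnot htD' htP')
    have hcon' := hlink t' ht' t ht (hnot htD' htP') (hnot htD htP)
    simp only [List.mem_toFinset, List.mem_cons, List.not_mem_nil, or_false] at hd hd'
    rcases hd with rfl | rfl | rfl <;> rcases hd' with rfl | rfl | rfl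
    · exact h.girth.no_triangle htd htd'.symm htt.symm
    · exact hsq h12
    · exact hcon htd htd' htt
    · exact hsq h12.symm
    · exact h.girth.no_triangle htd htd'.symm htt.symm
    · exact hsq h23
    · exact hcon' htd' htd htt.symm
    · exact hsq h23.symm
    · exact h.girth.no_triangle htd htd'.symm htt.symm
  · intro t ht htD htP _ d hd htd p hp htp
    refine List.disjoint_of_nodup_append (l₁ := [d₁, d₂, d₃]) hnd (a := p) ?_
      (List.mem_toFinset.1 hp)
    rw [← hno t ht (hnot htD htP) d (hmem.2 (Or.inl hd)) p (hmem.2 (Or.inr hp)) htd htp]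
    exact List.mem_toFinset.1 hd

theorem ten_le [Fintype V] (h : E.MinCE H P A L) (hf : E.Frame H P pl wl) :
    10 ≤ (pl ++ wl).length := by
  by_contra! hlt
  have hch := fun {x y} (hx : x ∈ pl ++ wl) (hy : y ∈ pl ++ wl) (hxy : G.Adj x y) =>
    h.chordless hf.cycle hx hy hxy
  have h9 : (pl ++ wl).length = 9 := by
    have := h.nine_le hf.cycle fun x hx y hy hxy => hch hx hy hxy
    omega
  have hpl := hf.length_left.trans_le h.card_le
  obtain ⟨ψ, hψ, hψ'⟩ := h.exists_coloring_outer hf (by rw [List.length_append] at h9; omega)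
  have hno := fun x hx hxC u hu w hw => h.eq_of_length_le hf h9.le (x := x) (u := u) (w := w)
    hx hxC hu hw
  have hC := hf.cycle
  revert hC hψ hψ' hno
  generalize pl ++ wl = C at h9
  intro hψ hψ' hno hC
  obtain ⟨d₁, d₂, d₃, d₄, R, rfl⟩ : ∃ d₁ d₂ d₃ d₄ R, C = d₁ :: d₂ :: d₃ :: d₄ :: R :=
    match C, h9 with
    | d₁ :: d₂ :: d₃ :: d₄ :: R, _ => ⟨d₁, d₂, d₃, d₄, R, rfl⟩
  obtain ⟨x, hx, y, hy, hxC, hyC, hx1, hy3, hxy⟩ := h.exists_link hC (by simpa using h9) hψ hψ' hno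
  have hC' : E.IsOuterCycle H (d₂ :: d₃ :: d₄ :: (R ++ [d₁])) := by
    simpa using IsOuterCycle.rotate (l₁ := [d₁]) hC
  have hmem : ∀ {v}, v ∈ d₂ :: d₃ :: d₄ :: (R ++ [d₁]) ↔ v ∈ d₁ :: d₂ :: d₃ :: d₄ :: R := by
    intro v
    simp
    tauto
  obtain ⟨x', hx', -, -, hxC', -, hx2, -⟩ := h.exists_link hC' (by simpa using h9)
    (fun v hv => hψ v (hmem.1 hv)) (fun u hu v hv => hψ' u (hmem.1 hu) v (hmem.1 hv))
    (fun x hx hxC u hu w hw => hno x hx (mt hmem.2 hxC) u (hmem.1 hu) w (hmem.1 hw))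
  rw [hmem] at hxC'
  have hs : E.IsSplit H d₁ [d₂] d₃ (d₄ :: R).reverse [x, y] := by
    have hnd := hC.isCyc.nodup
    refine ⟨by simpa [biList] using hC, by simp, by simp, ⟨?_, ?_⟩, ?_, ?_⟩
    · simp at hnd hxC hyC ⊢
      exact ⟨⟨Ne.symm hxC.1, Ne.symm hyC.1, hnd.1.2.1⟩, ⟨hxy.ne, hxC.2.2.1⟩, hyC.2.2.1⟩
    · simp [hx1.symm, hxy, hy3]
    · simp [hx, hy]
    · intro z hz
      simp at hz hxC hyC ⊢
      grind
  refine hs.not_adj_of_empty (h.empty_of_split hs (by simp)) (d := d₂) (t := x') (by simp) hx'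
    ?_ ?_ ?_ ?_ hx2.symm
  · simp at hxC' ⊢
    tauto
  · rintro rfl
    simp at hxC'
  · rintro rfl
    simp at hxC'
  · intro hxQ
    simp only [List.mem_cons, List.not_mem_nil, or_false] at hxQ
    rcases hxQ with rfl | rfl
    · exact (hC.isCyc.nodup |> fun hnd => by simp at hnd; grind : d₁ ≠ d₂)
        (hno x' hx' hxC d₁ (by simp) d₂ (by simp) hx1 hx2)
    · exact (hC.isCyc.nodup |> fun hnd => by simp at hnd; grind : d₂ ≠ d₃)
        (hno x' hx' hyC d₂ (by simp) d₃ (by simp) hx2 hy3)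

end MinCE

end PlaneEmbedding

end crossings

section deletion

open scoped Classical

variable {V : Type} {G : SimpleGraph V}

/-- The vertex `t`, free of constraints, has the neighbour `d` in the set `D`. -/
structure Touches (G : SimpleGraph V) (H P A D : Finset V) (t d : V) : Prop where
  mem : t ∈ H
  notMem : t ∉ D
  notMem_left : t ∉ P
  notMem_right : t ∉ A
  mem' : d ∈ D
  adj : G.Adj t d

namespace PlaneEmbedding

variable {E : PlaneEmbedding G} {H P A : Finset V} {L : V → Finset ℕ} {pl wl : List V}

namespace MinCE

/-- Colour and delete a connected set `D` of vertices off the precoloured path. -/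
theorem false_of_deletion [Fintype V] (h : E.MinCE H P A L) {w : V}
    (hf : E.Frame H P pl (w :: wl)) (hwl : wl ≠ []) {D : Finset V} {ψ : V → ℕ} (hDH : D ⊆ H)
    (hD : Conn G D) (hwD : w ∈ D) (hDP : ∀ d ∈ D, d ∉ P) (hψ : ∀ v, v ∈ D ∨ v ∈ P → ψ v ∈ L v)
    (hψ' : ∀ u, u ∈ D ∨ u ∈ P → ∀ v, v ∈ D ∨ v ∈ P → G.Adj u v → ψ u ≠ ψ v)
    (hN : ∀ t d d', Touches G H P A D t d → Touches G H P A D t d' → d = d')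
    (hNN : ∀ t d t' d', Touches G H P A D t d → Touches G H P A D t' d' → ¬ G.Adj t t')
    (hNA : ∀ t d, Touches G H P A D t d → ∀ a ∈ A, a ∉ D → ¬ G.Adj t a)
    (hAD : ∀ a ∈ A, a ∉ D → ∀ d ∈ D, G.Adj a d → ψ d ∉ L a)
    (hbad : ∀ z d γ p δ, Touches G H P A D z d → G.Adj z p → pl = γ ++ p :: δ →
      z ∉ pl ++ w :: wl ∧ δ ≠ [] ∧ ∃ T : List V, (∀ x ∈ T, x ∈ D ∧ x ∉ pl ++ w :: wl) ∧
        T.length + δ.length ≤ 5 ∧ IsPath G w (T ++ [z]) p ∧ ∀ x ∈ T ++ [z], ∀ y,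
          y = w ∨ y = p ∨ y ∈ T ++ [z] → G.Adj x y → s(x, y) ∈ listEdges (w :: (T ++ [z] ++ [p])))
    (htie : ∀ z d z' d' p, Touches G H P A D z d → Touches G H P A D z' d' → p ∈ P → G.Adj z p →
      G.Adj z' p → z = z') : False := by
  have hwC : w ∈ pl ++ w :: wl := by simp
  by_cases hex : ∃ n : ℕ, ∃ z d γ p δ, Touches G H P A D z d ∧ G.Adj z p ∧ pl = γ ++ p :: δ ∧
    γ.length = n
  swap
  · refine h.reduce (P' := P) hDH hD hwD (hf.cycle.outer w hwC) h.conn h.card_le ?_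
      (fun p hp => Or.inr hp) hψ hψ'
      (fun t ht htD htP htA d hd d' hd' htd htd' =>
        hN t d d' ⟨ht, htD, htP, htA, hd, htd⟩ ⟨ht, htD, htP, htA, hd', htd'⟩)
      (fun t ht htD htP htA d hd htd t' ht' htD' htP' htA' d' hd' htd' =>
        hNN t d t' d' ⟨ht, htD, htP, htA, hd, htd⟩ ⟨ht', htD', htP', htA', hd', htd'⟩)
      (fun t ht htD htP htA d hd htd a ha haD _ => hNA t d ⟨ht, htD, htP, htA, hd, htd⟩ a ha haD)
      ?_ (fun a ha _ _ p hp => h.not_adj a ha p hp)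
      (fun a ha haD _ d hd => hAD a ha haD d hd)
    · exact fun p hp => (h.outer p hp).mono E Finset.sdiff_subset
        (Finset.mem_sdiff.2 ⟨h.subset hp, fun hpD => hDP p hpD hp⟩)
    · intro t ht htD htP htA d hd htd p hp htp
      obtain ⟨γ, δ, hpl⟩ := List.append_of_mem ((hf.mem_iff p).1 hp)
      exact hex ⟨γ.length, t, d, γ, p, δ, ⟨ht, htD, htP, htA, hd, htd⟩, htp, hpl, rfl⟩
  obtain ⟨z, d, γ, p, δ, hz, hzp, hpl, hlen⟩ := Nat.find_spec hex
  have hmin : ∀ t d', Touches G H P A D t d' → ∀ q ∈ γ, ¬ G.Adj t q := by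
    intro t d' ht q hq htq
    obtain ⟨γ₁, γ₂, rfl⟩ := List.append_of_mem hq
    refine Nat.find_min hex (m := γ₁.length) ?_
      ⟨t, d', γ₁, q, γ₂ ++ p :: δ, ht, htq, by simp [hpl], rfl⟩
    rw [← hlen]
    simp
  clear hlen
  obtain ⟨hzC, hδ, T, hT, hTlen, hpath, hind⟩ := hbad z d γ p δ hz hzp hpl
  have hC : E.IsOuterCycle H (biList w δ.reverse p (wl ++ γ)) := by
    apply IsOuterCycle.comm
    have : E.IsOuterCycle H (γ ++ p :: δ ++ w :: wl) := hpl ▸ hf.cycle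
    simpa [biList] using this.rotate
  have hmemC : ∀ {x}, x ∈ biList w δ.reverse p (wl ++ γ) → x ∈ pl ++ w :: wl := by
    intro x hx
    rw [hpl]
    simp at hx ⊢
    tauto
  have hs : E.IsSplit H w δ.reverse p (wl ++ γ) (T ++ [z]) := by
    refine ⟨hC, by simpa using hδ, by simp [hwl], hpath, ?_, ?_⟩
    · intro x hx
      rcases List.mem_append.1 hx with hx | hx
      · exact hDH (hT x hx).1
      · rw [List.mem_singleton.1 hx]
        exact hz.mem
    · intro x hx hxC
      rcases List.mem_append.1 hx with hx | hx
      · exact (hT x hx).2 (hmemC hxC)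
      · exact hzC (List.mem_singleton.1 hx ▸ hmemC hxC)
  have he := h.empty_of_split hs (by simp; omega)
  have hnd : (γ ++ p :: δ).Nodup := hpl ▸ hf.cycle.isCyc.nodup.of_append_left
  have hpP : ∀ {x}, x ∈ P ↔ x ∈ γ ∨ x = p ∨ x ∈ δ := by
    intro x
    rw [hf.mem_iff, hpl]
    simp
  have hδP : ∀ {x}, x ∈ δ → x ∈ P := fun hx => hpP.2 (Or.inr (Or.inr hx))
  have hpp : p ∈ P := hpP.2 (Or.inr (Or.inl rfl))
  have hzγ : ∀ q ∈ P, G.Adj z q → q = p := fun q hq hzq =>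
    h.eq_of_left hf hz.mem hzC ((hf.mem_iff q).1 hq) ((hf.mem_iff p).1 hpp) hzq hzp
  have hzd : ∀ e ∈ D, G.Adj z e → e = d := fun e he hze =>
    hN z e d ⟨hz.mem, hz.notMem, hz.notMem_left, hz.notMem_right, he, hze⟩ hz
  have hno : ∀ t ∈ H, t ∉ D → t ≠ p → t ≠ z → t ∉ δ → ∀ e ∈ δ, ¬ G.Adj t e := by
    intro t ht htD htp htz htδ e hed hte
    refine hs.not_adj_of_empty he (List.mem_reverse.2 hed) ht (by simpa using htδ)
      (show t ≠ w from fun e => htD (e ▸ hwD)) htp ?_ hte.symm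
    intro htT
    rcases List.mem_append.1 htT with h1 | h1
    exacts [htD (hT t h1).1, htz (List.mem_singleton.1 h1)]
  obtain ⟨cz, hcz, hcz'⟩ := Finset.exists_mem_notMem_of_card_lt_card
    (show ({ψ d, ψ p} : Finset ℕ).card < (L z).card from
      Finset.card_le_two.trans_lt (h.three_le z hz.mem hz.notMem_left hz.notMem_right))
  have hczd : cz ≠ ψ d := fun e => hcz' (by simp [e])
  have hczp : cz ≠ ψ p := fun e => hcz' (by simp [e])
  have hval : ∀ {v}, v ∈ D ∨ v ∈ P → Function.update ψ z cz v = ψ v := fun {v} hv =>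
    Function.update_of_ne (show v ≠ z from fun e => hv.elim (fun h1 => hz.notMem (e ▸ h1))
      (fun h1 => hz.notMem_left (e ▸ h1))) _ _
  have hval' : Function.update ψ z cz z = cz := Function.update_self ..
  have hzne : ∀ {v}, v ∈ D ∨ v ∈ P → G.Adj z v → cz ≠ ψ v := by
    intro v hv hzv
    rcases hv with hv | hv
    · rwa [hzd v hv hzv]
    · rwa [hzγ v hv hzv]
  have memD : ∀ {x}, x ∈ D ∪ δ.toFinset ↔ x ∈ D ∨ x ∈ δ := by simp
  have memP : ∀ {x}, x ∈ (γ ++ [p, z]).toFinset ↔ x ∈ γ ∨ x = p ∨ x = z := by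
    intro x
    simp
    tauto
  have hcases : ∀ {v}, v ∈ D ∪ δ.toFinset ∨ v ∈ (γ ++ [p, z]).toFinset → v = z ∨ v ∈ D ∨ v ∈ P := by
    intro v hv
    rw [memD, memP] at hv
    rw [hpP]
    tauto
  have hchain : (γ ++ p :: δ).IsChain G.Adj := hpl ▸ hf.isChain_left
  have hP'P : ∀ {x}, x ∈ (γ ++ [p, z]).toFinset → x = z ∨ (x ∈ P ∧ x ∉ δ) := by
    intro x hx
    rw [memP] at hx
    rcases hx with hx | rfl | rfl
    · exact Or.inr ⟨hpP.2 (Or.inl hx), fun h' => List.disjoint_of_nodup_append hnd hx (by simp [h'])⟩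
    · exact Or.inr ⟨hpp, (List.nodup_cons.1 hnd.of_append_right).1⟩
    · exact Or.inl rfl
  have htouch : ∀ {t e}, t ∈ H → t ∉ D ∪ δ.toFinset → t ∉ (γ ++ [p, z]).toFinset → t ∉ A →
      e ∈ D ∪ δ.toFinset → G.Adj t e → Touches G H P A D t e := by
    intro t e ht htD htP htA he' hte
    rw [memD] at htD he'
    rw [memP] at htP
    push Not at htD htP
    refine ⟨ht, htD.1, ?_, htA, he'.resolve_right fun h' => ?_, hte⟩
    · rw [hpP]
      tauto
    · exact hno t ht htD.1 htP.2.1 htP.2.2 htD.2 e h' hte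
  refine h.reduce (D := D ∪ δ.toFinset) (P' := (γ ++ [p, z]).toFinset) (ψ := Function.update ψ z cz)
    (z := w) ?_ ?_ (memD.2 (Or.inl hwD)) (hf.cycle.outer w hwC) (conn_of_isChain ?_) ?_ ?_ ?_ ?_ ?_
    ?_ ?_ ?_ ?_ ?_ ?_
  · exact Finset.union_subset hDH fun x hx => h.subset (hδP (List.mem_toFinset.1 hx))
  · obtain ⟨δ', q, rfl⟩ := (List.eq_nil_or_concat δ).resolve_left hδ
    have hc : (q :: w :: wl).IsChain G.Adj := by
      have h1 := hf.isChain
      have : pl ++ w :: wl = (γ ++ p :: δ') ++ q :: w :: wl := by simp [hpl]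
      rw [this] at h1
      exact h1.right_of_append
    have hqw : G.Adj q w := (List.isChain_cons_cons.1 hc).1
    have h1 : Conn G (insert q D) := hD.insert hwD hqw
    have h2 : (D ∪ (δ' ++ [q]).toFinset) = insert q D ∪ (δ' ++ [q]).toFinset := by
      ext x
      simp
    rw [List.concat_eq_append, h2]
    refine h1.union (conn_of_isChain ?_) (z := q) (by simp) (by simp)
    have h3 : γ ++ p :: (δ' ++ [q]) = (γ ++ [p]) ++ (δ' ++ [q]) := by simp
    rw [List.concat_eq_append, h3] at hchain
    exact hchain.right_of_append
  · have h3 : γ ++ p :: δ = (γ ++ [p]) ++ δ := by simp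
    rw [h3] at hchain
    have h4 : γ ++ [p, z] = (γ ++ [p]) ++ [z] := by simp
    rw [h4, List.isChain_append]
    refine ⟨hchain.left_of_append, by simp, ?_⟩
    intro a ha b hb
    simp at ha hb
    subst ha hb
    exact hzp.symm
  · have h1 := hf.length_left.trans_le h.card_le
    have h2 := List.length_pos_iff.2 hδ
    rw [hpl] at h1
    refine (List.toFinset_card_le _).trans ?_
    simp at h1 ⊢
    omega
  · intro q hq
    have hqD : q ∉ D ∪ δ.toFinset := by
      rw [memD]
      rcases hP'P hq with rfl | hq'
      · exact fun h' => h'.elim hz.notMem fun h' => hz.notMem_left (hδP h')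
      · exact fun h' => h'.elim (fun h' => hDP q h' hq'.1) hq'.2
    rcases hP'P hq with rfl | hq'
    · have h1 := hs.outer (fun x hx y hy hxy => h.chordless hC hx hy hxy) hind (v := q) (by simp)
      refine h1.mono E (fun t ht => ?_) (Finset.mem_sdiff.2 ⟨hz.mem, hqD⟩)
      rw [Finset.mem_sdiff, memD] at ht
      exact hs.mem_disc_of_empty he ht.1 fun h' => ht.2 (Or.inr (List.mem_reverse.1 h'))
    · exact (h.outer q hq'.1).mono E Finset.sdiff_subset
        (Finset.mem_sdiff.2 ⟨h.subset hq'.1, hqD⟩)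
  · intro q hq
    rw [memD, memP]
    rw [hpP] at hq
    tauto
  · intro v hv
    rcases hcases hv with rfl | hv
    · rwa [hval']
    · rw [hval hv]
      exact hψ v hv
  · intro u hu v hv huv
    rcases hcases hu with rfl | hu' <;> rcases hcases hv with rfl | hv'
    · exact absurd huv (G.irrefl)
    · rw [hval', hval hv']
      exact hzne hv' huv
    · rw [hval', hval hu']
      exact (hzne hu' huv.symm).symm
    · rw [hval hu', hval hv']
      exact hψ' u hu' v hv' huv
  · exact fun t ht htD htP htA d hd d' hd' htd htd' =>
      hN t d d' (htouch ht htD htP htA hd htd) (htouch ht htD htP htA hd' htd')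
  · exact fun t ht htD htP htA d hd htd t' ht' htD' htP' htA' d' hd' htd' =>
      hNN t d t' d' (htouch ht htD htP htA hd htd) (htouch ht' htD' htP' htA' hd' htd')
  · exact fun t ht htD htP htA d hd htd a ha haD _ =>
      hNA t d (htouch ht htD htP htA hd htd) a ha fun h' => haD (memD.2 (Or.inl h'))
  · intro t ht htD htP htA e he' hte q hq htq
    have h1 := htouch ht htD htP htA he' hte
    rw [memP] at hq htP
    rcases hq with hq | rfl | rfl
    · exact hmin t e h1 q hq htq
    · exact htP (Or.inr (Or.inr (htie t e z d q h1 hz hpp htq hzp)))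
    · exact hNN t e q d h1 hz htq
  · intro a ha haD _ q hq haq
    rcases hP'P hq with rfl | hq'
    · exact hNA q d hz a ha (fun h' => haD (memD.2 (Or.inl h'))) haq.symm
    · exact h.not_adj a ha q hq'.1 haq
  · intro a ha haD _ e he' hae
    rw [memD] at haD he'
    push Not at haD
    have heD := he'.resolve_right fun h' => h.not_adj a ha e (hδP h') hae
    rw [hval (Or.inl heD)]
    exact hAD a ha haD.1 e heD hae

end MinCE

end PlaneEmbedding

end deletion

section links

open scoped Classical

variable {V : Type} {G : SimpleGraph V}

namespace PlaneEmbedding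

variable {E : PlaneEmbedding G} {H P A : Finset V} {L : V → Finset ℕ} {pl wl : List V}

namespace MinCE

theorem head_notMem (h : E.MinCE H P A L) {v : V} (hf : E.Frame H P pl (v :: wl)) : v ∉ A := by
  intro hv
  have h1 := hf.isChain
  rcases List.eq_nil_or_concat pl with rfl | ⟨s, p, rfl⟩
  · exact hf.left_ne rfl
  · have h2 : s.concat p ++ v :: wl = s ++ p :: v :: wl := by simp
    rw [h2] at h1
    exact h.not_adj v hv p ((hf.mem_iff p).2 (by simp))
      (List.isChain_cons_cons.1 h1.right_of_append).1.symm

theorem last_notMem (h : E.MinCE H P A L) {v : V} (hf : E.Frame H P pl (wl ++ [v])) : v ∉ A :=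
  h.head_notMem (wl := wl.reverse) (by simpa using hf.reverse)

/-- Two vertices of the outer cycle off the precoloured path with a common neighbour in `P`. -/
theorem notMem_of_chord [Fintype V] (h : E.MinCE H P A L) (hf : E.Frame H P pl wl) {u w x : V}
    (hwl : 2 ≤ wl.length) (hx : x ∈ H) (hxC : x ∉ pl ++ wl) (hu : u ∈ wl) (hw : w ∈ pl)
    (hxu : G.Adj x u) (hxw : G.Adj x w) : u ∉ A := by
  rcases h.chord_cases hf hwl hx hxC hu hw hxu hxw with ⟨_, _, _, _, _, _, -, rfl⟩ |
    ⟨_, _, _, _, _, _, -, rfl⟩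
  exacts [h.head_notMem hf, h.last_notMem hf]

theorem false_of_link_right [Fintype V] (h : E.MinCE H P A L) {u a s t : V} {α β₁ β₂ : List V}
    (hf : E.Frame H P pl (α ++ u :: (β₁ ++ a :: β₂))) (hs : s ∈ H) (ht : t ∈ H)
    (hsC : s ∉ pl ++ (α ++ u :: (β₁ ++ a :: β₂))) (htC : t ∉ pl ++ (α ++ u :: (β₁ ++ a :: β₂)))
    (ha : a ∈ A) (hsu : G.Adj s u) (hst : G.Adj s t) (hta : G.Adj t a) : False := by
  have hnd := hf.cycle.isCyc.nodup
  have hnu : u ∉ β₁ ++ a :: β₂ := (List.nodup_cons.1 hnd.of_append_right.of_append_right).1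
  have hna := hnd.of_append_right.of_append_right.of_cons
  have hua : u ≠ a := by
    rintro rfl
    simp at hnu
  have haβ : a ∉ β₁ := fun h => List.disjoint_of_nodup_append hna h (List.mem_cons_self ..)
  have huP : u ∉ P := hf.notMem (by simp)
  have haP : a ∉ P := hf.notMem (by simp)
  have hsw : ∀ {y}, y ∈ α ++ u :: (β₁ ++ a :: β₂) → G.Adj s y → y = u := fun hy hsy =>
    h.eq_of_right hf hs hsC hy (by simp) hsy hsu
  have htw : ∀ {y}, y ∈ α ++ u :: (β₁ ++ a :: β₂) → G.Adj t y → y = a := fun hy hty =>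
    h.eq_of_right hf ht htC hy (by simp) hty hta
  have hsa : s ≠ a := by
    rintro rfl
    simp at hsC
  have htu : t ≠ u := by
    rintro rfl
    simp at htC
  have hsu' : s ≠ u := hsu.ne
  rcases List.eq_nil_or_concat β₁ with rfl | ⟨β, b, hb⟩
  · have hchain := hf.isChain.right_of_append.right_of_append
    have h1 : G.Adj u a := (List.isChain_cons_cons.1 hchain).1
    exact h.girth.no_square hsu h1 hta.symm hst.symm hsa htu.symm
  have hC : E.IsOuterCycle H (biList u (β₂ ++ pl ++ α).reverse a β₁) := by
    apply IsOuterCycle.comm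
    have : E.IsOuterCycle H ((pl ++ α) ++ (u :: (β₁ ++ a :: β₂))) := by simpa using hf.cycle
    simpa [biList] using this.rotate
  have hβP : ∀ {y}, y ∈ β₁ → y ∉ P := fun hy => hf.notMem (by simp [hy])
  have hsp : E.IsSplit H u (β₂ ++ pl ++ α).reverse a β₁ [s, t] := by
    refine ⟨hC, by simp [hf.left_ne], by simp [hb], ⟨?_, ?_⟩, by simp [hs, ht], ?_⟩
    · simp
      exact ⟨⟨hsu'.symm, htu.symm, hua⟩, ⟨hst.ne, hsa⟩, hta.ne⟩
    · simp [hsu.symm, hst, hta]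
    · intro x hx hxC
      simp only [List.mem_cons, List.not_mem_nil, or_false] at hx
      rcases hx with rfl | rfl
      · apply hsC
        simp at hxC ⊢
        tauto
      · apply htC
        simp at hxC ⊢
        tauto
  refine h.split hsp (Or.inl huP) (Or.inl fun p hp => hβP hp) ?_
    (fun _ y hy hyP => absurd hyP (hβP hy)) (fun _ y hy hyP => absurd hyP (hβP hy))
    (fun b _ hb _ hba => h.indep b hb a ha hba) ?_ ?_
  · intro x hx y hy _ hxy
    simp only [List.mem_cons, List.not_mem_nil, or_false] at hx
    rcases hx with rfl | rfl
    · have := hsw (by simp [hy]) hxy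
      subst this
      simp [hy] at hnu
    · have := htw (by simp [hy]) hxy
      subst this
      exact haβ hy
  · intro x hx y hy hxy
    simp only [List.mem_cons, List.not_mem_nil, or_false] at hx hy
    rcases hx with rfl | rfl
    · rcases hy with rfl | rfl | rfl | rfl
      · simp [listEdges]
      · exact absurd (hsw (by simp) hxy).symm hua
      · exact absurd hxy G.irrefl
      · simp [listEdges]
    · rcases hy with rfl | rfl | rfl | rfl
      · exact absurd (htw (by simp) hxy) hua
      · simp [listEdges]
      · simp [listEdges]
      · exact absurd hxy G.irrefl
  · have h1 : β₁.filter (· ∈ P) = [] := by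
      simp only [List.filter_eq_nil_iff, decide_eq_true_eq]
      exact fun y hy => hβP hy
    rw [h1, if_neg huP, if_neg haP]
    simp

theorem false_of_link_left [Fintype V] (h : E.MinCE H P A L) {u p s z : V} {α β γ δ : List V}
    (hf : E.Frame H P (γ ++ p :: δ) (α ++ u :: β)) (hwl : 2 ≤ (α ++ u :: β).length) (hs : s ∈ H)
    (hz : z ∈ H) (hsC : s ∉ (γ ++ p :: δ) ++ (α ++ u :: β))
    (hzC : z ∉ (γ ++ p :: δ) ++ (α ++ u :: β)) (hsu : G.Adj s u) (hsz : G.Adj s z)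
    (hzp : G.Adj z p) (hsγ : ∀ y ∈ γ, ¬ G.Adj s y) (huγ : ∀ y ∈ γ, ¬ G.Adj u y)
    (hγ : γ.length ≤ 1) (hβ : β ≠ []) (hδ : δ ≠ []) : False := by
  have hnd := hf.cycle.isCyc.nodup
  have huP : u ∉ P := hf.notMem (by simp)
  have hpP : p ∈ P := (hf.mem_iff p).2 (by simp)
  have hup : u ≠ p := fun e => huP (e ▸ hpP)
  have huβ : u ∉ β := (List.nodup_cons.1 hnd.of_append_right.of_append_right).1
  have hpγ : p ∉ γ := fun h' =>
    List.disjoint_of_nodup_append hnd.of_append_left h' (List.mem_cons_self ..)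
  have hβP : ∀ {y}, y ∈ β → y ∉ P := fun hy => hf.notMem (by simp [hy])
  have hsp' : s ≠ p := by
    rintro rfl
    simp at hsC
  have hzu : z ≠ u := by
    rintro rfl
    simp at hzC
  have hC : E.IsOuterCycle H (biList u (δ ++ α).reverse p (β ++ γ)) := by
    apply IsOuterCycle.comm
    have : E.IsOuterCycle H ((γ ++ p :: δ ++ α) ++ (u :: β)) := by simpa using hf.cycle
    simpa [biList] using this.rotate
  have hAw : ∀ {y}, y ∈ A → y ∈ β ++ γ → y ∈ α ++ u :: β := fun {y} hyA hy =>
    hf.mem_right (by simp at hy ⊢; tauto) (h.disjoint y hyA)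
  have hsp : E.IsSplit H u (δ ++ α).reverse p (β ++ γ) [s, z] := by
    refine ⟨hC, by simp [hδ], by simp [hβ], ⟨?_, ?_⟩, by simp [hs, hz], ?_⟩
    · simp
      exact ⟨⟨hsu.ne', hzu.symm, hup⟩, ⟨hsz.ne, hsp'⟩, hzp.ne⟩
    · simp [hsu.symm, hsz, hzp]
    · intro x hx hxC
      simp only [List.mem_cons, List.not_mem_nil, or_false] at hx
      rcases hx with rfl | rfl
      · apply hsC
        simp at hxC ⊢
        tauto
      · apply hzC
        simp at hxC ⊢
        tauto
  refine h.split hsp (Or.inl huP) (Or.inr (Or.inr hpP)) ?_ ?_ (fun hp => absurd hpP hp)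
    (fun a _ ha _ hap => h.not_adj a ha p hpP hap) ?_ ?_
  · intro x hx y hy hyPA hxy
    simp only [List.mem_cons, List.not_mem_nil, or_false] at hx
    rcases hx with rfl | rfl
    · rcases hyPA with hyP | hyA
      · exact (List.mem_append.1 hy).elim (fun h1 => hβP h1 hyP) fun h1 => hsγ y h1 hxy
      · have := h.eq_of_right hf hs hsC (hAw hyA hy) (by simp) hxy hsu
        subst this
        exact (List.mem_append.1 hy).elim huβ fun h1 => huP ((hf.mem_iff y).2 (by simp [h1]))
    · rcases hyPA with hyP | hyA
      · have := h.eq_of_left hf hz hzC ((hf.mem_iff y).1 hyP) (by simp) hxy hzp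
        subst this
        exact (List.mem_append.1 hy).elim (fun h1 => hβP h1 hyP) hpγ
      · exact h.notMem_of_chord hf hwl hz hzC (hAw hyA hy) (by simp) hxy hzp hyA
  · intro _ y hy hyP
    exact huγ y ((List.mem_append.1 hy).resolve_left fun h1 => hβP h1 hyP)
  · intro x hx y hy hxy
    simp only [List.mem_cons, List.not_mem_nil, or_false] at hx hy
    rcases hx with rfl | rfl
    · rcases hy with rfl | rfl | rfl | rfl
      · simp [listEdges]
      · exact (h.girth.no_triangle hsz hzp hxy.symm).elim
      · exact absurd hxy G.irrefl
      · simp [listEdges]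
    · rcases hy with rfl | rfl | rfl | rfl
      · exact (h.girth.no_triangle hsz hxy hsu.symm).elim
      · simp [listEdges]
      · simp [listEdges]
      · exact absurd hxy G.irrefl
  · have h1 : β.filter (· ∈ P) = [] := by
      simp only [List.filter_eq_nil_iff, decide_eq_true_eq]
      exact fun y hy => hβP hy
    have h2 := List.length_filter_le (· ∈ P) γ
    rw [List.filter_append, h1, List.nil_append, if_neg huP, if_pos hpP]
    simp only [List.length_cons, List.length_nil]
    omega

/-- Three internally disjoint short paths cannot share their ends. -/
theorem false_of_paths [Finite V] (h : E.MinCE H P A L) {u w : V} {Q R S : List V}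
    (h₁ : IsPath G u Q w) (h₂ : IsPath G u R w) (h₃ : IsPath G u S w) (hQR : Q.Disjoint R)
    (hQS : Q.Disjoint S) (hRS : R.Disjoint S) (hQ : Q ≠ []) (hR : R ≠ []) (hS : S ≠ [])
    (hH : ∀ x, x = u ∨ x = w ∨ x ∈ Q ∨ x ∈ R ∨ x ∈ S → x ∈ H) (hl₁ : Q.length + R.length ≤ 6)
    (hl₂ : Q.length + S.length ≤ 6) (hl₃ : R.length + S.length ≤ 6) : False := by
  have hth : IsTheta G u w Q R S := isTheta_of_isCyc
    (isCyc_biList.2 ⟨h₁, h₂, hQR, Or.inl hQ⟩) (isCyc_biList.2 ⟨h₁, h₃, hQS, Or.inl hQ⟩)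
    (isCyc_biList.2 ⟨h₂, h₃, hRS, Or.inl hR⟩)
  obtain ⟨a, ha⟩ := List.exists_mem_of_ne_nil Q hQ
  obtain ⟨b, hb⟩ := List.exists_mem_of_ne_nil R hR
  obtain ⟨c, hc⟩ := List.exists_mem_of_ne_nil S hS
  refine hth.false_of_empty E ha hb hc
    (h.ins_eq_zero hth.cycle₃ ?_ (by simp; omega) (hH a (by tauto)) fun h' => hth.disjoint ha h')
    (h.ins_eq_zero hth.cycle₂ ?_ (by simp; omega) (hH b (by tauto))
      fun h' => hth.swap₁₂.disjoint hb h')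
    (h.ins_eq_zero hth.cycle₁ ?_ (by simp; omega) (hH c (by tauto))
      fun h' => hth.swap₂₃.swap₁₂.disjoint hc h') <;>
  · intro x hx
    rw [mem_biList] at hx
    exact hH x (by tauto)

theorem false_of_second_notMem [Fintype V] (h : E.MinCE H P A L) {p w₁ w₂ : V} {γ β : List V}
    (hf : E.Frame H P (γ ++ [p]) (w₁ :: w₂ :: β)) (hw : w₂ ∉ A)
    (hγ : γ = [] → ∀ α x y, w₁ :: w₂ :: β = α ++ [x, y] → x ∉ A) : False := by
  have hnd := hf.cycle.isCyc.nodup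
  have hpP : p ∈ P := (hf.mem_iff p).2 (by simp)
  have hPγ : ∀ {x}, x ∈ P ↔ x ∈ γ ∨ x = p := by
    intro x
    rw [hf.mem_iff]
    simp
  have hpγ : p ∉ γ := fun h' =>
    List.disjoint_of_nodup_append hnd.of_append_left h' (List.mem_cons_self ..)
  have hwl : 2 ≤ (w₁ :: w₂ :: β).length := by simp
  choose! c hc using fun p (hp : p ∈ P) => h.nonempty p hp
  have hvP : ∀ {v}, v ∈ ({p} : Finset V) ∨ v ∈ γ.toFinset → v ∈ P := by
    intro v hv
    rw [hPγ]
    simpa [or_comm] using hv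
  have hwA : ∀ {a}, a ∈ A → a ∈ w₁ :: w₂ :: β := fun {a} ha =>
    hf.mem_right (hf.cycle.mem_of_outer E (h.outer' a ha)) (h.disjoint a ha)
  have hwt : ∀ {t}, t ∉ ({p} : Finset V) → t ∉ γ.toFinset →
      t ∈ (γ ++ [p]) ++ (w₁ :: w₂ :: β) → t ∈ w₁ :: w₂ :: β := fun {t} h1 h2 h3 =>
    hf.mem_right h3 fun h4 => by
      rw [Finset.mem_singleton] at h1
      rw [List.mem_toFinset] at h2
      exact (hPγ.1 h4).elim h2 h1
  refine h.reduce (D := {p}) (P' := γ.toFinset) (ψ := c) (z := p)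
    (by simpa using h.subset hpP) (conn_singleton p) (by simp) (h.outer p hpP)
    (conn_of_isChain hf.isChain_left.left_of_append) ?_ ?_ ?_ (fun v hv => hc v (hvP hv)) ?_ ?_ ?_
    ?_ ?_ (fun a ha _ _ q hq => h.not_adj a ha q (hvP (Or.inr hq)))
    (fun a ha _ _ q hq haq => absurd haq (h.not_adj a ha q (hvP (Or.inl hq))))
  · have h1 := hf.length_left.trans_le h.card_le
    refine (List.toFinset_card_le _).trans ?_
    simp at h1
    omega
  · intro q hq
    refine (h.outer q (hvP (Or.inr hq))).mono E Finset.sdiff_subset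
      (Finset.mem_sdiff.2 ⟨h.subset (hvP (Or.inr hq)), fun h' => ?_⟩)
    rw [Finset.mem_singleton.1 h', List.mem_toFinset] at hq
    exact hpγ hq
  · intro q hq
    rw [hPγ] at hq
    simpa [or_comm] using hq
  · intro u hu v hv huv e
    exact Finset.disjoint_left.1 (h.list_disjoint u (hvP hu) v (hvP hv) huv) (hc u (hvP hu))
      (e ▸ hc v (hvP hv))
  · intro t _ _ _ _ d hd d' hd' _ _
    rw [Finset.mem_singleton.1 hd, Finset.mem_singleton.1 hd']
  · intro t _ _ _ _ d hd htd t' _ _ _ _ d' hd' htd' htt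
    rw [Finset.mem_singleton] at hd hd'
    subst hd hd'
    exact h.girth.no_triangle htd htd'.symm htt.symm
  · intro t ht htD htP htA d hd htd a ha _ _ hta
    rw [Finset.mem_singleton] at hd
    subst hd
    by_cases htC : t ∈ (γ ++ [d]) ++ (w₁ :: w₂ :: β)
    · have htw := hwt htD htP htC
      rcases h.crossing_frame hf htw hpP htd with ⟨s, r, -, h1⟩ | ⟨s, r, h1, h2⟩
      · obtain ⟨rfl, -⟩ := List.cons_eq_cons.1 h1
        rcases h.eq_of_adj_right (α := []) hf (hwA ha) hta with ⟨s, h2⟩ | ⟨s, h2⟩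
        · simp at h2
        · obtain ⟨rfl, -⟩ := List.cons_eq_cons.1 h2
          exact hw ha
      · have hγ0 : γ = [] := by
          rcases γ with _ | ⟨g, γ⟩
          · rfl
          · obtain ⟨rfl, -⟩ := List.cons_eq_cons.1 h1
            simp at hpγ
        have hf' := hf
        rw [h2] at hf'
        rcases h.eq_of_adj_right (β := []) hf' (h2 ▸ hwA ha) hta with ⟨s', h3⟩ | ⟨s', h3⟩
        · exact hγ hγ0 s' a t (by rw [h2, h3]; simp) ha
        · simp at h3
    · exact h.notMem_of_chord hf hwl ht htC (hwA ha) (by simp) hta htd ha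
  · intro t ht htD htP htA d hd htd q hq htq
    rw [Finset.mem_singleton] at hd
    subst hd
    have hqd : q = d := by
      by_cases htC : t ∈ (γ ++ [d]) ++ (w₁ :: w₂ :: β)
      · exact h.eq_of_adj_left hf hwl (hwt htD htP htC) (hvP (Or.inr hq)) hpP htq htd
      · exact h.eq_of_left hf ht htC ((hf.mem_iff q).1 (hvP (Or.inr hq))) (by simp) htq htd
    rw [hqd, List.mem_toFinset] at hq
    exact hpγ hq

end MinCE

end PlaneEmbedding

end links

section pentagons

open scoped Classical

variable {V : Type} {G : SimpleGraph V}

/-- Any two vertices of `D` are at distance at most two within `D`. -/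
def IsClose (G : SimpleGraph V) (D : Finset V) : Prop :=
  ∀ d ∈ D, ∀ d' ∈ D, d = d' ∨ G.Adj d d' ∨ ∃ e ∈ D, G.Adj d e ∧ G.Adj e d'

theorem Touches.eq {H P A D : Finset V} (hG : GirthGeFive G) (hD : IsClose G D) {t d d' : V}
    (h : Touches G H P A D t d) (h' : Touches G H P A D t d') : d = d' := by
  rcases hD d h.mem' d' h'.mem' with h1 | h1 | ⟨e, he, h1, h2⟩
  · exact h1
  · exact (hG.no_triangle h.adj h1 h'.adj.symm).elim
  · by_contra hne
    exact hG.no_square h.adj h1 h2 h'.adj.symm (show t ≠ e from fun e' => h.notMem (e' ▸ he)) hne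

theorem Touches.not_adj {H P A D : Finset V} (hG : GirthGeFive G) {t d t' d' : V}
    (h : Touches G H P A D t d) (h' : Touches G H P A D t' d') (htt : G.Adj t t') :
    d ≠ d' ∧ ¬ G.Adj d d' := by
  refine ⟨?_, fun hdd => ?_⟩
  · rintro rfl
    exact hG.no_triangle h.adj h'.adj.symm htt.symm
  · exact hG.no_square h.adj hdd h'.adj.symm htt.symm
      (show t ≠ d' from fun e => h.notMem (e ▸ h'.mem'))
      (show d ≠ t' from fun e => h'.notMem (e ▸ h.mem'))

theorem isClose_of_pentagon {a b c d e : V} (hab : G.Adj a b) (hbc : G.Adj b c) (hcd : G.Adj c d)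
    (hde : G.Adj d e) (hea : G.Adj e a) : IsClose G [a, b, c, d, e].toFinset := by
  intro u hu v hv
  simp only [List.mem_toFinset, List.mem_cons, List.not_mem_nil, or_false] at hu hv
  rcases hu with rfl | rfl | rfl | rfl | rfl <;> rcases hv with rfl | rfl | rfl | rfl | rfl <;>
  simp [hab, hbc, hcd, hde, hea, hab.symm, hbc.symm, hcd.symm, hde.symm, hea.symm]

namespace PlaneEmbedding

variable {E : PlaneEmbedding G} {H P A : Finset V} {L : V → Finset ℕ} {pl wl : List V}

namespace MinCE

theorem false_of_pentagon [Finite V] (h : E.MinCE H P A L) {a b c d e t t' : V}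
    (hn : [a, b, c, d, e].Nodup) (hab : G.Adj a b) (hbc : G.Adj b c) (hcd : G.Adj c d)
    (hde : G.Adj d e) (hea : G.Adj e a) (hH : ∀ x ∈ [a, b, c, d, e], x ∈ H) (ht : t ∈ H)
    (ht' : t' ∈ H) (htD : t ∉ [a, b, c, d, e]) (htD' : t' ∉ [a, b, c, d, e]) (hta : G.Adj t a)
    (htc : G.Adj t' c) (htt : G.Adj t t') : False := by
  simp only [List.mem_cons, List.not_mem_nil, or_false, not_or, forall_eq_or_imp, forall_eq,
    List.nodup_cons, List.nodup_nil] at hn hH htD htD'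
  have htt' := htt.ne
  refine h.false_of_paths (u := a) (w := c) (Q := [b]) (R := [e, d]) (S := [t, t'])
    ⟨?_, by simp [hab, hbc]⟩ ⟨?_, by simp [hea.symm, hde.symm, hcd.symm]⟩
    ⟨?_, by simp [hta.symm, htt, htc]⟩ ?_ ?_ ?_ (by simp) (by simp) (by simp) ?_ (by simp)
    (by simp) (by simp)
  · simp
    tauto
  · simp
    grind
  · simp
    grind
  · simp
    grind
  · simp
    grind
  · simp
    grind
  · simp
    grind

theorem false_of_pentagon' [Finite V] (h : E.MinCE H P A L) {a b c d e t t' u v : V}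
    (hn : [a, b, c, d, e].Nodup) (hab : G.Adj a b) (hbc : G.Adj b c) (hcd : G.Adj c d)
    (hde : G.Adj d e) (hea : G.Adj e a) (hH : ∀ x ∈ [a, b, c, d, e], x ∈ H)
    (ht : Touches G H P A [a, b, c, d, e].toFinset t u)
    (ht' : Touches G H P A [a, b, c, d, e].toFinset t' v) (htt : G.Adj t t') : False := by
  obtain ⟨huv, hadj⟩ := ht.not_adj h.girth ht' htt
  have key : ∀ {l : List V}, List.Perm l [a, b, c, d, e] → l.Nodup ∧ (∀ x ∈ l, x ∈ H) ∧ t ∉ l ∧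
      t' ∉ l := fun hl => ⟨hl.nodup_iff.2 hn, fun x hx => hH x (hl.mem_iff.1 hx),
    fun h1 => ht.notMem (List.mem_toFinset.2 (hl.mem_iff.1 h1)),
    fun h1 => ht'.notMem (List.mem_toFinset.2 (hl.mem_iff.1 h1))⟩
  have main : ∀ {a' b' c' d' e'}, List.Perm [a', b', c', d', e'] [a, b, c, d, e] → G.Adj a' b' →
      G.Adj b' c' → G.Adj c' d' → G.Adj d' e' → G.Adj e' a' →
      (u = a' ∧ v = c') ∨ (u = c' ∧ v = a') → False := by
    intro a' b' c' d' e' hl h1 h2 h3 h4 h5 huv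
    obtain ⟨k1, k2, k3, k4⟩ := key hl
    rcases huv with ⟨rfl, rfl⟩ | ⟨rfl, rfl⟩
    · exact h.false_of_pentagon k1 h1 h2 h3 h4 h5 k2 ht.mem ht'.mem k3 k4 ht.adj ht'.adj htt
    · exact h.false_of_pentagon k1 h1 h2 h3 h4 h5 k2 ht'.mem ht.mem k4 k3 ht'.adj ht.adj htt.symm
  have hu := ht.mem'
  have hv := ht'.mem'
  simp only [List.mem_toFinset, List.mem_cons, List.not_mem_nil, or_false] at hu hv
  have p1 := List.perm_append_comm (l₁ := [b, c, d, e]) (l₂ := [a])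
  have p2 := List.perm_append_comm (l₁ := [c, d, e]) (l₂ := [a, b])
  have p3 := List.perm_append_comm (l₁ := [d, e]) (l₂ := [a, b, c])
  have p4 := List.perm_append_comm (l₁ := [e]) (l₂ := [a, b, c, d])
  have m0 := main (List.Perm.refl _) hab hbc hcd hde hea
  have m1 := main p1 hbc hcd hde hea hab
  have m2 := main p2 hcd hde hea hab hbc
  have m3 := main p3 hde hea hab hbc hcd
  have m4 := main p4 hea hab hbc hcd hde
  clear main p1 p2 p3 p4 key hn hH
  rcases hu with rfl | rfl | rfl | rfl | rfl <;> rcases hv with rfl | rfl | rfl | rfl | rfl <;>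
  first
  | exact huv rfl
  | exact m0 (Or.inl ⟨rfl, rfl⟩)
  | exact m1 (Or.inl ⟨rfl, rfl⟩)
  | exact m2 (Or.inl ⟨rfl, rfl⟩)
  | exact m3 (Or.inl ⟨rfl, rfl⟩)
  | exact m4 (Or.inl ⟨rfl, rfl⟩)
  | exact m0 (Or.inr ⟨rfl, rfl⟩)
  | exact m1 (Or.inr ⟨rfl, rfl⟩)
  | exact m2 (Or.inr ⟨rfl, rfl⟩)
  | exact m3 (Or.inr ⟨rfl, rfl⟩)
  | exact m4 (Or.inr ⟨rfl, rfl⟩)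
  | exact hadj hab
  | exact hadj hbc
  | exact hadj hcd
  | exact hadj hde
  | exact hadj hea
  | exact hadj hab.symm
  | exact hadj hbc.symm
  | exact hadj hcd.symm
  | exact hadj hde.symm
  | exact hadj hea.symm

/-- `chord_cases` for a chord at a vertex different from the last one. -/
theorem eq_of_chord [Fintype V] (h : E.MinCE H P A L) {w p d z : V} {γ δ l R : List V}
    (hf : E.Frame H P (γ ++ p :: δ) (w :: (l ++ R))) (hR : R ≠ []) (hz : z ∈ H)
    (hzC : z ∉ (γ ++ p :: δ) ++ w :: (l ++ R)) (hd : d ∈ w :: l) (hzd : G.Adj z d)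
    (hzp : G.Adj z p) : d = w ∧ γ.length = 3 ∧ δ.length = 2 := by
  have hnd := hf.cycle.isCyc.nodup
  obtain ⟨R, r, rfl⟩ := (List.eq_nil_or_concat R).resolve_left hR
  rw [List.concat_eq_append] at *
  have hn1 := hnd.of_append_left
  have hp : p ∉ γ := fun h' => List.disjoint_of_nodup_append hn1 h' (List.mem_cons_self ..)
  have hdw : d ∈ w :: (l ++ (R ++ [r])) := by
    simp only [List.mem_cons, List.mem_append] at hd ⊢
    tauto
  rcases h.chord_cases hf (by simp; omega) hz hzC hdw (by simp) hzd hzp with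
    ⟨a, b, c, e, f, β, h1, h2⟩ | ⟨a, b, c, e, f, α, -, h2⟩
  · refine ⟨(List.cons_eq_cons.1 h2).1.symm, ?_⟩
    have h3 : γ ++ p :: δ = [a, b, c] ++ p :: [e, f] := h1
    have hp' : p ∉ δ := (List.nodup_cons.1 hn1.of_append_right).1
    rw [List.append_cons_inj_of_notMem hp hp'] at h3
    obtain ⟨rfl, -, rfl⟩ := h3
    simp
  · have h3 : (w :: (l ++ R)) ++ [r] = α ++ [d] := by simpa using h2
    have h4 := List.singleton_inj.1 (List.append_inj_right' h3 rfl)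
    subst h4
    have h5 : ((w :: l) ++ (R ++ [r])).Nodup := by simpa using hnd.of_append_right
    exact (List.disjoint_of_nodup_append h5 hd (by simp)).elim

theorem eq_of_adj [Fintype V] (h : E.MinCE H P A L) {w p d : V} {l R : List V}
    (hf : E.Frame H P pl (w :: (l ++ R))) (hR : R ≠ []) (hp : p ∈ P) (hd : d ∈ w :: l)
    (hdp : G.Adj d p) : d = w := by
  obtain ⟨R, r, rfl⟩ := (List.eq_nil_or_concat R).resolve_left hR
  rw [List.concat_eq_append] at *
  have hdw : d ∈ w :: (l ++ (R ++ [r])) := by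
    simp only [List.mem_cons, List.mem_append] at hd ⊢
    tauto
  rcases h.crossing_frame hf hdw hp hdp with ⟨s, t, -, h2⟩ | ⟨s, t, -, h2⟩
  · exact (List.cons_eq_cons.1 h2).1.symm
  · have h3 : (w :: (l ++ R)) ++ [r] = t ++ [d] := by simpa using h2
    have h4 := List.singleton_inj.1 (List.append_inj_right' h3 rfl)
    subst h4
    have h5 : ((w :: l) ++ (R ++ [r])).Nodup := by
      simpa using hf.cycle.isCyc.nodup.of_append_right
    exact (List.disjoint_of_nodup_append h5 hd (by simp)).elim

/-- Colour and delete an initial segment of the outer cycle after the precoloured path. -/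
theorem false_of_initial_deletion [Fintype V] (h : E.MinCE H P A L) {w : V} {l R : List V}
    (hf : E.Frame H P pl (w :: (l ++ R))) (hR : R ≠ []) {ψ : V → ℕ}
    (hψ : ∀ v, v ∈ (w :: l).toFinset ∨ v ∈ P → ψ v ∈ L v)
    (hψ' : ∀ u, u ∈ (w :: l).toFinset ∨ u ∈ P → ∀ v, v ∈ (w :: l).toFinset ∨ v ∈ P → G.Adj u v →
      ψ u ≠ ψ v)
    (hclose : IsClose G (w :: l).toFinset)
    (hNN : ∀ t d t' d', Touches G H P A (w :: l).toFinset t d →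
      Touches G H P A (w :: l).toFinset t' d' → ¬ G.Adj t t')
    (hNA : ∀ t d, Touches G H P A (w :: l).toFinset t d → ∀ a ∈ A, a ∉ (w :: l).toFinset →
      ¬ G.Adj t a)
    (hAD : ∀ a ∈ A, a ∉ (w :: l).toFinset → ∀ d ∈ (w :: l).toFinset, G.Adj a d → ψ d ∉ L a)
    (hC : ∀ t d, Touches G H P A (w :: l).toFinset t d → ∀ p ∈ P, G.Adj t p →
      t ∉ pl ++ w :: (l ++ R)) : False := by
  have hmem : ∀ {v}, v ∈ (w :: l).toFinset → v ∈ w :: (l ++ R) := by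
    intro v hv
    simp at hv ⊢
    tauto
  have hch : ∀ {z d γ p δ}, Touches G H P A (w :: l).toFinset z d → G.Adj z p →
      pl = γ ++ p :: δ → d = w ∧ γ.length = 3 ∧ δ.length = 2 := by
    intro z d γ p δ hz hzp hpl
    have hp : p ∈ P := (hf.mem_iff p).2 (by simp [hpl])
    have hzC := hC z d hz p hp hzp
    subst hpl
    exact h.eq_of_chord hf hR hz.mem hzC (List.mem_toFinset.1 hz.mem') hz.adj hzp
  have hwchain : (w :: l).IsChain G.Adj := by
    have := hf.isChain.right_of_append
    rw [← List.cons_append] at this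
    exact this.left_of_append
  refine h.false_of_deletion hf (by simp [hR]) (D := (w :: l).toFinset) (ψ := ψ)
    (fun v hv => hf.cycle.subset v (List.mem_append.2 (Or.inr (hmem hv)))) (conn_of_isChain hwchain)
    (by simp) (fun d hd => hf.notMem (hmem hd)) hψ hψ' (fun t d d' h1 h2 => h1.eq h.girth hclose h2)
    hNN hNA hAD ?_ ?_
  · intro z d γ p δ hz hzp hpl
    obtain ⟨rfl, h2, h3⟩ := hch hz hzp hpl
    have hp : p ∈ P := (hf.mem_iff p).2 (by simp [hpl])
    have hdp : d ≠ p := fun e => hf.notMem (hmem hz.mem') (e ▸ hp)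
    refine ⟨hC z d hz p hp hzp, ?_, [], by simp, by simp; omega,
      isPath_singleton hz.adj.symm hzp hdp, listEdges_singleton⟩
    rintro rfl
    simp at h3
  · intro z d z' d' p hz hz' hp hzp hzp'
    obtain ⟨γ, δ, hpl⟩ := List.append_of_mem ((hf.mem_iff p).1 hp)
    obtain ⟨rfl, -, -⟩ := hch hz hzp hpl
    obtain ⟨rfl, -, -⟩ := hch hz' hzp' hpl
    by_contra hne
    exact h.girth.no_square hz.adj hz'.adj.symm hzp' hzp.symm hne
      fun e => hf.notMem (hmem hz.mem') (e ▸ hp)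

end MinCE

end PlaneEmbedding

end pentagons

section initialSegments

open scoped Classical

variable {V : Type} {G : SimpleGraph V}

namespace PlaneEmbedding

variable {E : PlaneEmbedding G} {H P A : Finset V} {L : V → Finset ℕ} {pl wl : List V}

namespace MinCE

theorem mem_right_of_mem (h : E.MinCE H P A L) (hf : E.Frame H P pl wl) {a : V} (ha : a ∈ A) :
    a ∈ wl :=
  hf.mem_right (hf.cycle.mem_of_outer E (h.outer' a ha)) (h.disjoint a ha)

theorem false_of_fourth_notMem [Fintype V] (h : E.MinCE H P A L) {w₁ w₂ w₃ w₄ : V} {R : List V}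
    (hf : E.Frame H P pl (w₁ :: w₂ :: w₃ :: w₄ :: R)) (h2 : w₂ ∈ A) (h4 : w₄ ∉ A) : False := by
  have hf' : E.Frame H P pl (w₁ :: ([w₂] ++ w₃ :: w₄ :: R)) := hf
  obtain ⟨ψ, hψ, hψ'⟩ := h.exists_coloring_outer hf (by simp)
  have hch := hf.isChain.right_of_append
  simp only [List.isChain_cons_cons] at hch
  have h12 := hch.1
  have h23 := hch.2.1
  have hv : ∀ {v}, v ∈ (w₁ :: [w₂]).toFinset ∨ v ∈ P → v ∈ pl ++ w₁ :: w₂ :: w₃ :: w₄ :: R := by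
    intro v hv
    rw [hf.mem_iff] at hv
    simp at hv ⊢
    tauto
  have hclose : IsClose G (w₁ :: [w₂]).toFinset := by
    intro u hu v hv
    simp only [List.mem_toFinset, List.mem_cons, List.not_mem_nil, or_false] at hu hv
    rcases hu with rfl | rfl <;> rcases hv with rfl | rfl <;> simp [h12, h12.symm]
  have hn1 := h.head_notMem hf
  have hn3 : w₃ ∉ A := fun h3 => h.indep w₂ h2 w₃ h3 h23
  have hw1 : ∀ {t}, t ∈ w₁ :: w₂ :: w₃ :: w₄ :: R → G.Adj w₁ t → t = w₂ := by
    intro t ht h1t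
    rcases h.eq_of_adj_right (α := []) hf ht h1t with ⟨s, e⟩ | ⟨s, e⟩
    · simp at e
    · exact (List.cons_eq_cons.1 e).1.symm
  have hw2 : ∀ {t}, t ∈ w₁ :: w₂ :: w₃ :: w₄ :: R → G.Adj w₂ t → t = w₁ ∨ t = w₃ := by
    intro t ht h2t
    rcases h.eq_of_adj_right (α := [w₁]) hf ht h2t with ⟨s, e⟩ | ⟨s, e⟩
    · exact Or.inl (List.singleton_inj.1 (List.append_inj_right' (s₁ := []) e rfl)).symm
    · exact Or.inr (List.cons_eq_cons.1 e).1.symm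
  have hw3 : ∀ {t}, t ∈ w₁ :: w₂ :: w₃ :: w₄ :: R → G.Adj w₃ t → t = w₂ ∨ t = w₄ := by
    intro t ht h3t
    rcases h.eq_of_adj_right (α := [w₁, w₂]) hf ht h3t with ⟨s, e⟩ | ⟨s, e⟩
    · exact Or.inl (List.singleton_inj.1 (List.append_inj_right' (s₁ := [w₁]) e rfl)).symm
    · exact Or.inr (List.cons_eq_cons.1 e).1.symm
  have hA : ∀ {a}, a ∈ A → a ∉ (w₁ :: [w₂]).toFinset → a ≠ w₁ ∧ a ≠ w₂ ∧ a ≠ w₃ ∧ a ≠ w₄ := by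
    intro a ha haD
    simp at haD
    exact ⟨haD.1, haD.2, fun e => hn3 (e ▸ ha), fun e => h4 (e ▸ ha)⟩
  have htC : ∀ {t d}, Touches G H P A (w₁ :: [w₂]).toFinset t d →
      t ∈ pl ++ w₁ :: w₂ :: w₃ :: w₄ :: R → t = w₃ := by
    intro t d ht htC
    have htw := hf.mem_right htC ht.notMem_left
    have htD := ht.notMem
    have hd := ht.mem'
    simp at htD hd
    rcases hd with rfl | rfl
    · exact absurd (hw1 htw ht.adj.symm) htD.2
    · exact (hw2 htw ht.adj.symm).resolve_left htD.1
  refine h.false_of_initial_deletion hf' (by simp) (ψ := ψ) (fun v hv' => hψ v (hv hv'))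
    (fun u hu v hv' huv => hψ' u (hv hu) v (hv hv') huv) hclose ?_ ?_ ?_ ?_
  · intro t d t' d' ht ht' htt
    obtain ⟨k1, k2⟩ := ht.not_adj h.girth ht' htt
    have hd := ht.mem'
    have hd' := ht'.mem'
    simp at hd hd'
    rcases hd with rfl | rfl <;> rcases hd' with rfl | rfl
    exacts [k1 rfl, k2 h12, k2 h12.symm, k1 rfl]
  · intro t d ht a ha haD hta
    obtain ⟨k1, k2, k3, k4⟩ := hA ha haD
    have haw := h.mem_right_of_mem hf ha
    by_cases htw : t ∈ pl ++ w₁ :: w₂ :: w₃ :: w₄ :: R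
    · have := htC ht htw
      subst this
      exact (hw3 haw hta).elim k2 k4
    · have hd := ht.mem'
      simp only [List.mem_toFinset, List.mem_cons, List.not_mem_nil, or_false] at hd
      have := h.eq_of_right hf ht.mem htw haw (by simp; tauto) hta ht.adj
      rcases hd with rfl | rfl
      exacts [k1 this, k2 this]
  · intro a ha haD d hd had
    obtain ⟨k1, k2, k3, k4⟩ := hA ha haD
    have haw := h.mem_right_of_mem hf ha
    simp only [List.mem_toFinset, List.mem_cons, List.not_mem_nil, or_false] at hd
    rcases hd with rfl | rfl
    · exact (k2 (hw1 haw had.symm)).elim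
    · exact ((hw2 haw had.symm).elim k1 k3).elim
  · intro t d ht p hp htp htw
    have := htC ht htw
    subst this
    have hf3 : E.Frame H P pl (w₁ :: ([w₂, t] ++ w₄ :: R)) := hf
    have := h.eq_of_adj hf3 (by simp) hp (by simp) htp
    have hnd := hf.cycle.isCyc.nodup.of_append_right
    simp [this] at hnd

/-- A colouring of the precoloured path and the three vertices after it which is compatible
with the list of the fourth one. -/
theorem exists_coloring_three [Fintype V] (h : E.MinCE H P A L) {w₁ w₂ w₃ w₄ : V} {R : List V}
    (hf : E.Frame H P pl (w₁ :: w₂ :: w₃ :: w₄ :: R)) (h2 : w₂ ∈ A) (h4 : w₄ ∈ A) :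
    ∃ ψ : V → ℕ, (∀ v, v ∈ (w₁ :: [w₂, w₃]).toFinset ∨ v ∈ P → ψ v ∈ L v) ∧
      (∀ u, u ∈ (w₁ :: [w₂, w₃]).toFinset ∨ u ∈ P → ∀ v, v ∈ (w₁ :: [w₂, w₃]).toFinset ∨ v ∈ P →
        G.Adj u v → ψ u ≠ ψ v) ∧ ψ w₃ ∉ L w₄ := by
  have hf' : E.Frame H P pl (w₁ :: ([w₂, w₃] ++ w₄ :: R)) := hf
  have hch := hf.isChain.right_of_append
  simp only [List.isChain_cons_cons] at hch
  have h12 := hch.1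
  have h23 := hch.2.1
  have hnd := hf.cycle.isCyc.nodup.of_append_right
  simp only [List.nodup_cons, List.mem_cons, not_or] at hnd
  have hn1 := h.head_notMem hf
  have hn3 : w₃ ∉ A := fun h3 => h.indep w₂ h2 w₃ h3 h23
  have h13 : ¬ G.Adj w₁ w₃ := fun h13 => h.girth.no_triangle h12 h23 h13.symm
  have hwP : ∀ {v}, v ∈ [w₁, w₂, w₃] → v ∉ P := by
    intro v hv
    refine hf.notMem ?_
    simp at hv ⊢
    tauto
  have hH : ∀ {v}, v ∈ [w₁, w₂, w₃] → v ∈ H := by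
    intro v hv
    refine hf.cycle.subset v ?_
    simp at hv ⊢
    tauto
  choose! c hc using fun p (hp : p ∈ P) => h.nonempty p hp
  obtain ⟨q, hq⟩ : ∃ q, ∀ p ∈ P, G.Adj w₁ p → p = q := by
    by_cases hex : ∃ q ∈ P, G.Adj w₁ q
    · obtain ⟨q, hqP, hq⟩ := hex
      exact ⟨q, fun p hp h1p => h.eq_of_adj_left hf (by simp) (by simp) hp hqP h1p hq⟩
    · exact ⟨w₁, fun p hp h1p => (hex ⟨p, hp, h1p⟩).elim⟩
  have hP2 : ∀ p ∈ P, ¬ G.Adj w₂ p := fun p hp h2p =>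
    hnd.1.1 (h.eq_of_adj hf' (by simp) hp (by simp) h2p).symm
  have hP3 : ∀ p ∈ P, ¬ G.Adj w₃ p := fun p hp h3p =>
    hnd.1.2.1 (h.eq_of_adj hf' (by simp) hp (by simp) h3p).symm
  obtain ⟨c₃, hc3, hc34⟩ := Finset.exists_mem_notMem_of_card_lt_card
    (show (L w₄).card < (L w₃).card by
      have := h.three_le w₃ (hH (by simp)) (hwP (by simp)) hn3
      rw [h.card_eq_two w₄ h4]
      omega)
  obtain ⟨c₂, hc2, hc23⟩ := Finset.exists_mem_notMem_of_card_lt_card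
    (show ({c₃} : Finset ℕ).card < (L w₂).card by rw [h.card_eq_two w₂ h2]; simp)
  obtain ⟨c₁, hc1, hc12⟩ := Finset.exists_mem_notMem_of_card_lt_card
    (show ({c₂, c q} : Finset ℕ).card < (L w₁).card from
      Finset.card_le_two.trans_lt (h.three_le w₁ (hH (by simp)) (hwP (by simp)) hn1))
  simp only [Finset.mem_insert, Finset.mem_singleton, not_or] at hc23 hc12
  set ψ : V → ℕ := fun v => if v = w₁ then c₁ else if v = w₂ then c₂ else if v = w₃ then c₃ else c v
    with hψdef
  have e1 : ψ w₁ = c₁ := if_pos rfl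
  have e2 : ψ w₂ = c₂ := by
    simp only [hψdef]
    rw [if_neg (Ne.symm hnd.1.1), if_pos trivial]
  have e3 : ψ w₃ = c₃ := by
    simp only [hψdef]
    rw [if_neg (Ne.symm hnd.1.2.1), if_neg (Ne.symm hnd.2.1.1), if_pos trivial]
  have eP : ∀ p ∈ P, ψ p = c p := by
    intro p hp
    simp only [hψdef]
    rw [if_neg (show ¬ p = w₁ from fun e => hwP (by simp) (e ▸ hp)),
      if_neg (show ¬ p = w₂ from fun e => hwP (by simp) (e ▸ hp)),
      if_neg (show ¬ p = w₃ from fun e => hwP (by simp) (e ▸ hp))]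
  have hcase : ∀ {v}, v ∈ (w₁ :: [w₂, w₃]).toFinset ∨ v ∈ P → v = w₁ ∨ v = w₂ ∨ v = w₃ ∨ v ∈ P := by
    intro v hv
    simpa [or_assoc] using hv
  refine ⟨ψ, ?_, ?_, by rwa [e3]⟩
  · intro v hv
    rcases hcase hv with rfl | rfl | rfl | hv
    · rwa [e1]
    · rwa [e2]
    · rwa [e3]
    · rw [eP v hv]
      exact hc v hv
  · have k12 : c₁ ≠ c₂ := hc12.1
    have k23 : c₂ ≠ c₃ := hc23
    have k1P : ∀ p ∈ P, G.Adj w₁ p → c₁ ≠ c p := by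
      intro p hp h1p
      rw [hq p hp h1p]
      exact hc12.2
    intro u hu v hv huv
    rcases hcase hu with rfl | rfl | rfl | hu' <;> rcases hcase hv with rfl | rfl | rfl | hv'
    · exact absurd huv G.irrefl
    · rwa [e1, e2]
    · exact absurd huv h13
    · rw [e1, eP v hv']
      exact k1P v hv' huv
    · rw [e1, e2]
      exact k12.symm
    · exact absurd huv G.irrefl
    · rwa [e2, e3]
    · exact absurd huv (hP2 v hv')
    · exact absurd huv.symm h13
    · rw [e2, e3]
      exact k23.symm
    · exact absurd huv G.irrefl
    · exact absurd huv (hP3 v hv')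
    · rw [e1, eP u hu']
      exact (k1P u hu' huv.symm).symm
    · exact absurd huv.symm (hP2 u hu')
    · exact absurd huv.symm (hP3 u hu')
    · rw [eP u hu', eP v hv']
      exact fun e => Finset.disjoint_left.1 (h.list_disjoint u hu' v hv' huv) (hc u hu')
        (e ▸ hc v hv')

theorem eq_of_adj_three [Fintype V] (h : E.MinCE H P A L) {w₁ w₂ w₃ w₄ : V} {R : List V}
    (hf : E.Frame H P pl (w₁ :: w₂ :: w₃ :: w₄ :: R)) {d t : V} (hd : d = w₁ ∨ d = w₂ ∨ d = w₃)
    (ht : t ∈ w₁ :: w₂ :: w₃ :: w₄ :: R) (hdt : G.Adj d t) :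
    t = w₁ ∨ t = w₂ ∨ t = w₃ ∨ (d = w₃ ∧ t = w₄) := by
  rcases hd with rfl | rfl | rfl
  · rcases h.eq_of_adj_right (α := []) hf ht hdt with ⟨s, e⟩ | ⟨s, e⟩
    · simp at e
    · exact Or.inr (Or.inl (List.cons_eq_cons.1 e).1.symm)
  · rcases h.eq_of_adj_right (α := [w₁]) hf ht hdt with ⟨s, e⟩ | ⟨s, e⟩
    · exact Or.inl (List.singleton_inj.1 (List.append_inj_right' (s₁ := []) e rfl)).symm
    · exact Or.inr (Or.inr (Or.inl (List.cons_eq_cons.1 e).1.symm))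
  · rcases h.eq_of_adj_right (α := [w₁, w₂]) hf ht hdt with ⟨s, e⟩ | ⟨s, e⟩
    · exact Or.inr (Or.inl (List.singleton_inj.1 (List.append_inj_right' (s₁ := [w₁]) e rfl)).symm)
    · exact Or.inr (Or.inr (Or.inr ⟨rfl, (List.cons_eq_cons.1 e).1.symm⟩))

/-- A vertex with a neighbour among the first three vertices after the precoloured path is
interior, and has no constrained neighbour. -/
theorem notMem_of_touches [Fintype V] (h : E.MinCE H P A L) {w₁ w₂ w₃ w₄ : V} {R : List V}
    (hf : E.Frame H P pl (w₁ :: w₂ :: w₃ :: w₄ :: R)) (h4 : w₄ ∈ A) {D : Finset V}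
    (hD : ∀ v, v = w₁ ∨ v = w₂ ∨ v = w₃ → v ∈ D) {t d : V} (ht : Touches G H P A D t d)
    (hd : d = w₁ ∨ d = w₂ ∨ d = w₃) :
    t ∉ pl ++ w₁ :: w₂ :: w₃ :: w₄ :: R ∧ ∀ a ∈ A, a ∉ D → ¬ G.Adj t a := by
  have htC : t ∉ pl ++ w₁ :: w₂ :: w₃ :: w₄ :: R := by
    intro htC
    rcases h.eq_of_adj_three hf hd (hf.mem_right htC ht.notMem_left) ht.adj.symm with
      e | e | e | ⟨-, e⟩
    · exact ht.notMem (hD t (by tauto))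
    · exact ht.notMem (hD t (by tauto))
    · exact ht.notMem (hD t (by tauto))
    · exact ht.notMem_right (e ▸ h4)
  refine ⟨htC, fun a ha haD hta => ?_⟩
  have := h.eq_of_right hf ht.mem htC (h.mem_right_of_mem hf ha) (w := d) (by
    simp only [List.mem_cons]; tauto) hta ht.adj
  exact haD (this ▸ ht.mem')

theorem exists_link_of_fourth_mem [Fintype V] (h : E.MinCE H P A L) {w₁ w₂ w₃ w₄ : V} {R : List V}
    (hf : E.Frame H P pl (w₁ :: w₂ :: w₃ :: w₄ :: R)) (h2 : w₂ ∈ A) (h4 : w₄ ∈ A) :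
    ∃ x ∈ H, ∃ y ∈ H, x ∉ pl ++ w₁ :: w₂ :: w₃ :: w₄ :: R ∧ y ∉ pl ++ w₁ :: w₂ :: w₃ :: w₄ :: R ∧
      G.Adj x w₁ ∧ G.Adj y w₃ ∧ G.Adj x y := by
  by_contra! hlink
  have hf' : E.Frame H P pl (w₁ :: ([w₂, w₃] ++ w₄ :: R)) := hf
  obtain ⟨ψ, hψ, hψ', hψ4⟩ := h.exists_coloring_three hf h2 h4
  have hch := hf.isChain.right_of_append
  simp only [List.isChain_cons_cons] at hch
  have h12 := hch.1
  have h23 := hch.2.1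
  have hmem : ∀ {v}, v ∈ (w₁ :: [w₂, w₃]).toFinset ↔ v = w₁ ∨ v = w₂ ∨ v = w₃ := by simp
  have hclose : IsClose G (w₁ :: [w₂, w₃]).toFinset := by
    intro u hu v hv
    rw [hmem] at hu hv
    rcases hu with rfl | rfl | rfl <;> rcases hv with rfl | rfl | rfl <;>
    simp [h12, h12.symm, h23, h23.symm]
  have htou := fun {t d} (ht : Touches G H P A (w₁ :: [w₂, w₃]).toFinset t d) =>
    h.notMem_of_touches hf h4 (fun v hv => hmem.2 hv) ht (hmem.1 ht.mem')
  refine h.false_of_initial_deletion hf' (by simp) hψ hψ' hclose ?_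
    (fun t d ht => (htou ht).2) ?_ (fun t d ht _ _ _ => (htou ht).1)
  · intro t d t' d' ht ht' htt
    obtain ⟨k1, k2⟩ := ht.not_adj h.girth ht' htt
    have hl1 := hlink t ht.mem t' ht'.mem (htou ht).1 (htou ht').1
    have hl2 := hlink t' ht'.mem t ht.mem (htou ht').1 (htou ht).1
    have hd := hmem.1 ht.mem'
    have hd' := hmem.1 ht'.mem'
    have a1 := ht.adj
    have a2 := ht'.adj
    rcases hd with rfl | rfl | rfl <;> rcases hd' with rfl | rfl | rfl
    exacts [k1 rfl, k2 h12, hl1 a1 a2 htt, k2 h12.symm, k1 rfl, k2 h23, hl2 a2 a1 htt.symm,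
      k2 h23.symm, k1 rfl]
  · intro a ha haD d hd had
    rw [hmem] at haD hd
    rcases h.eq_of_adj_three hf hd (h.mem_right_of_mem hf ha) had.symm with e | e | e | ⟨rfl, rfl⟩
    · exact (haD (Or.inl e)).elim
    · exact (haD (Or.inr (Or.inl e))).elim
    · exact (haD (Or.inr (Or.inr e))).elim
    · exact hψ4

end MinCE

end PlaneEmbedding

end initialSegments

section pentagonColorings

open scoped Classical

variable {V : Type} {G : SimpleGraph V}

namespace PlaneEmbedding

variable {E : PlaneEmbedding G} {H P A : Finset V} {L : V → Finset ℕ} {pl wl : List V}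

namespace MinCE

theorem not_adj_of_notMem_append [Fintype V] (h : E.MinCE H P A L) {w p : V} {γ δ l : List V}
    (hf : E.Frame H P (γ ++ p :: δ) (w :: l)) (hl : l ≠ []) : ∀ y ∈ γ, ¬ G.Adj w y := by
  intro y hy hwy
  obtain ⟨δ', q, hq⟩ := (List.eq_nil_or_concat (p :: δ)).resolve_left (by simp)
  rw [List.concat_eq_append] at hq
  have hqm : q ∈ p :: δ := by simp [hq]
  have hwq : G.Adj w q := by
    have := hf.isChain
    rw [hq, show (γ ++ (δ' ++ [q])) ++ w :: l = (γ ++ δ') ++ q :: w :: l by simp] at this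
    have := this.right_of_append
    rw [List.isChain_cons_cons] at this
    exact this.1.symm
  have := h.eq_of_adj_left hf (by
      have := List.length_pos_iff.2 hl
      simp; omega) (List.mem_cons_self ..)
    ((hf.mem_iff y).2 (List.mem_append.2 (Or.inl hy)))
    ((hf.mem_iff q).2 (List.mem_append.2 (Or.inr hqm))) hwy hwq
  exact List.disjoint_of_nodup_append hf.cycle.isCyc.nodup.of_append_left hy (this ▸ hqm)

theorem exists_coloring_pentagon [Fintype V] (h : E.MinCE H P A L) {w₁ w₂ w₃ w₄ x y : V}
    {R : List V} (hf : E.Frame H P pl (w₁ :: w₂ :: w₃ :: w₄ :: R)) (h2 : w₂ ∈ A) (h4 : w₄ ∈ A)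
    (hx : x ∈ H) (hy : y ∈ H) (hxC : x ∉ pl ++ w₁ :: w₂ :: w₃ :: w₄ :: R)
    (hyC : y ∉ pl ++ w₁ :: w₂ :: w₃ :: w₄ :: R) (hxw : G.Adj x w₁) (hyw : G.Adj y w₃)
    (hyP : ∀ p ∈ P, ¬ G.Adj y p) :
    ∃ ψ : V → ℕ, (∀ v, v ∈ [w₁, w₂, w₃, y, x].toFinset ∨ v ∈ P → ψ v ∈ L v) ∧
      (∀ u, u ∈ [w₁, w₂, w₃, y, x].toFinset ∨ u ∈ P → ∀ v,
        v ∈ [w₁, w₂, w₃, y, x].toFinset ∨ v ∈ P → G.Adj u v → ψ u ≠ ψ v) ∧ ψ w₃ ∉ L w₄ := by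
  obtain ⟨ψ, hψ, hψ', hψ4⟩ := h.exists_coloring_three hf h2 h4
  set S : Set V := {v | v ∈ (w₁ :: [w₂, w₃]).toFinset ∨ v ∈ P} with hS
  have hSC : ∀ v ∈ S, v ∈ pl ++ w₁ :: w₂ :: w₃ :: w₄ :: R := by
    intro v hv
    rw [hS, Set.mem_ofPred_eq, hf.mem_iff] at hv
    simp at hv ⊢
    tauto
  have hS1 : w₁ ∈ S := Or.inl (by simp)
  have hS3 : w₃ ∈ S := Or.inl (by simp)
  have hmem : ∀ {v}, v ∈ [w₁, w₂, w₃, y, x].toFinset ∨ v ∈ P → v = x ∨ v = y ∨ v ∈ S := by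
    intro v hv
    simp [hS] at hv ⊢
    tauto
  have hC : ∀ {v}, v ∉ pl ++ w₁ :: w₂ :: w₃ :: w₄ :: R → v ∉ P ∧ v ∉ A := fun hv =>
    ⟨fun h' => hv (List.mem_append.2 (Or.inl ((hf.mem_iff _).1 h'))),
      fun h' => hv (List.mem_append.2 (Or.inr (h.mem_right_of_mem hf h')))⟩
  obtain ⟨q, hq⟩ : ∃ q, ∀ p ∈ P, G.Adj x p → p = q := by
    by_cases hex : ∃ q ∈ P, G.Adj x q
    · obtain ⟨q, hq, hxq⟩ := hex
      exact ⟨q, fun p hp hxp => h.eq_of_left hf hx hxC ((hf.mem_iff p).1 hp) ((hf.mem_iff q).1 hq)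
        hxp hxq⟩
    · exact ⟨x, fun p hp hxp => (hex ⟨p, hp, hxp⟩).elim⟩
  obtain ⟨cx, hcx, hcx'⟩ := Finset.exists_mem_notMem_of_card_lt_card
    (show ({ψ w₁, ψ q} : Finset ℕ).card < (L x).card from
      Finset.card_le_two.trans_lt (h.three_le x hx (hC hxC).1 (hC hxC).2))
  obtain ⟨cy, hcy, hcy'⟩ := Finset.exists_mem_notMem_of_card_lt_card
    (show ({ψ w₃, cx} : Finset ℕ).card < (L y).card from
      Finset.card_le_two.trans_lt (h.three_le y hy (hC hyC).1 (hC hyC).2))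
  simp only [Finset.mem_insert, Finset.mem_singleton, not_or] at hcx' hcy'
  have hxS : ∀ v ∈ S, G.Adj x v → cx ≠ ψ v := by
    intro v hv hxv
    by_cases hvP : v ∈ P
    · rw [hq v hvP hxv]
      exact hcx'.2
    · rw [← h.eq_of_right hf hx hxC (by simp) (hf.mem_right (hSC v hv) hvP) hxw hxv]
      exact hcx'.1
  have hyS : ∀ v ∈ S, G.Adj y v → cy ≠ ψ v := by
    intro v hv hyv
    by_cases hvP : v ∈ P
    · exact (hyP v hvP hyv).elim
    · rw [← h.eq_of_right hf hy hyC (by simp) (hf.mem_right (hSC v hv) hvP) hyw hyv]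
      exact hcy'.1
  have hxy : x = y → False := by
    rintro rfl
    have := h.eq_of_right hf hx hxC (by simp) (by simp) hxw hyw
    have hn := hf.cycle.isCyc.nodup.of_append_right
    simp [this] at hn
  set χ : V → ℕ := fun v => if v = x then cx else if v = y then cy else ψ v with hχ
  have ex : χ x = cx := if_pos rfl
  have ey : χ y = cy := by
    simp only [hχ]
    rw [if_neg (show ¬ y = x from fun e => hxy e.symm), if_pos trivial]
  have eS : ∀ v ∈ S, χ v = ψ v := by
    intro v hv
    simp only [hχ]
    rw [if_neg (show ¬ v = x from fun e => hxC (e ▸ hSC v hv)),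
      if_neg (show ¬ v = y from fun e => hyC (e ▸ hSC v hv))]
  refine ⟨χ, fun v hv => ?_, fun u hu v hv huv => ?_, by rwa [eS w₃ hS3]⟩
  · rcases hmem hv with rfl | rfl | hvS
    · rwa [ex]
    · rwa [ey]
    · rw [eS v hvS]
      exact hψ v hvS
  · rcases hmem hu with rfl | rfl | huS <;> rcases hmem hv with rfl | rfl | hvS
    · exact absurd huv G.irrefl
    · rw [ex, ey]
      exact Ne.symm hcy'.2
    · rw [ex, eS v hvS]
      exact hxS v hvS huv
    · rw [ex, ey]
      exact hcy'.2
    · exact absurd huv G.irrefl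
    · rw [ey, eS v hvS]
      exact hyS v hvS huv
    · rw [ex, eS u huS]
      exact (hxS u huS huv.symm).symm
    · rw [ey, eS u huS]
      exact (hyS u huS huv.symm).symm
    · rw [eS u huS, eS v hvS]
      exact hψ' u huS v hvS huv

theorem false_of_tie [Fintype V] (h : E.MinCE H P A L) {w₁ p x y z z' : V} {γ δ l : List V}
    (hf : E.Frame H P (γ ++ p :: δ) (w₁ :: l)) (hγ : 2 ≤ γ.length) (hδ : δ ≠ [])
    (hx : x ∈ H) (hy : y ∈ H) (hz : z ∈ H) (hz' : z' ∈ H)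
    (hxC : x ∉ (γ ++ p :: δ) ++ w₁ :: l) (hyC : y ∉ (γ ++ p :: δ) ++ w₁ :: l)
    (hzC : z ∉ (γ ++ p :: δ) ++ w₁ :: l) (hzC' : z' ∉ (γ ++ p :: δ) ++ w₁ :: l)
    (hxw : G.Adj x w₁) (hxy : G.Adj x y) (hzz : z ≠ z') (hzx : z ≠ x) (hzy : z ≠ y)
    (hzx' : z' ≠ x) (hzy' : z' ≠ y) (hzp : G.Adj z p) (hzp' : G.Adj z' p)
    (hcase : (G.Adj z w₁ ∧ G.Adj z' x) ∨ (G.Adj z w₁ ∧ G.Adj z' y) ∨ (G.Adj z x ∧ G.Adj z' y)) :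
    False := by
  have hlen := hf.length_left.trans_le h.card_le
  simp only [List.length_append, List.length_cons] at hlen
  have hpath : IsPath G w₁ δ.reverse p := isPath_comm (isPath_of_append
    (s := γ) (t := δ) (r := l) (by simpa using hf.cycle.isCyc.nodup) (by simpa using hf.isChain))
  have hδr : δ.reverse.length = δ.length := List.length_reverse
  have hδr' : δ.reverse ≠ [] := by simpa using hδ
  have hδm : ∀ {v}, v ∈ δ.reverse → v ∈ (γ ++ p :: δ) ++ w₁ :: l := by
    intro v hv
    rw [List.mem_reverse] at hv
    simp [hv]
  have hmw : w₁ ∈ (γ ++ p :: δ) ++ w₁ :: l := by simp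
  have hmp : p ∈ (γ ++ p :: δ) ++ w₁ :: l := by simp
  have hH := hf.cycle.subset
  have hne : ∀ {u v}, u ∉ (γ ++ p :: δ) ++ w₁ :: l → v ∈ (γ ++ p :: δ) ++ w₁ :: l → u ≠ v :=
    fun hu hv e => hu (e ▸ hv)
  have hwp : w₁ ≠ p := hpath.ne
  have n1 := hne hxC hmw
  have n2 := hne hyC hmw
  have n3 := hne hzC hmw
  have n4 := hne hzC' hmw
  have n5 := hne hxC hmp
  have n6 := hne hyC hmp
  have n7 := hne hzC hmp
  have n8 := hne hzC' hmp
  have n9 := hxy.ne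
  have d1 : x ∉ δ := fun h' => hxC (hδm (List.mem_reverse.2 h'))
  have d2 : y ∉ δ := fun h' => hyC (hδm (List.mem_reverse.2 h'))
  have d3 : z ∉ δ := fun h' => hzC (hδm (List.mem_reverse.2 h'))
  have d4 : z' ∉ δ := fun h' => hzC' (hδm (List.mem_reverse.2 h'))
  rcases hcase with ⟨a1, a2⟩ | ⟨a1, a2⟩ | ⟨a1, a2⟩
  · refine h.false_of_paths (u := w₁) (w := p) (Q := [z]) (R := [x, z']) (S := δ.reverse)
      (isPath_singleton a1.symm hzp hwp)
      ⟨by simp [n1.symm, n4.symm, hwp, hzx'.symm, n5, n8], by simp [hxw.symm, a2.symm, hzp']⟩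
      hpath (by simp [hzx, hzz]) (by simp [d3]) (by simp [d1, d4]) (by simp) (by simp) hδr' ?_
      (by simp) (by simp; omega) (by simp; omega)
    rintro v (rfl | rfl | hv | hv | hv)
    · exact hH _ hmw
    · exact hH _ hmp
    · simp at hv
      rwa [hv]
    · simp at hv
      rcases hv with rfl | rfl <;> assumption
    · exact hH _ (hδm hv)
  · refine h.false_of_paths (u := w₁) (w := p) (Q := [z]) (R := [x, y, z']) (S := δ.reverse)
      (isPath_singleton a1.symm hzp hwp)
      ⟨by simp [n1.symm, n2.symm, n4.symm, hwp, hzx'.symm, hzy'.symm, n5, n6, n8, n9],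
        by simp [hxw.symm, hxy, a2.symm, hzp']⟩
      hpath (by simp [hzx, hzy, hzz]) (by simp [d3]) (by simp [d1, d2, d4]) (by simp) (by simp)
      hδr' ?_ (by simp) (by simp; omega) (by simp; omega)
    rintro v (rfl | rfl | hv | hv | hv)
    · exact hH _ hmw
    · exact hH _ hmp
    · simp at hv
      rwa [hv]
    · simp at hv
      rcases hv with rfl | rfl | rfl <;> assumption
    · exact hH _ (hδm hv)
  · refine h.false_of_paths (u := x) (w := p) (Q := [z]) (R := [y, z']) (S := w₁ :: δ.reverse)
      (isPath_singleton a1.symm hzp n5)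
      ⟨by simp [n9, hzx'.symm, n5, hzy'.symm, n6, n8], by simp [hxy, a2.symm, hzp']⟩
      ⟨?_, ?_⟩ (by simp [hzy, hzz]) (by simp [n3, d3]) (by simp [n2.symm, n4.symm, d2, d4]) (by simp)
      (by simp) (by simp) ?_ (by simp) (by simp; omega) (by simp; omega)
    · exact List.nodup_cons.2 ⟨by simpa [n1, n5] using d1, hpath.nodup⟩
    · exact List.isChain_cons_cons.2 ⟨hxw, hpath.isChain⟩
    rintro v (rfl | rfl | hv | hv | hv)
    · exact hx
    · exact hH _ hmp
    · simp at hv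
      rwa [hv]
    · simp at hv
      rcases hv with rfl | rfl <;> assumption
    · rcases List.mem_cons.1 hv with rfl | hv
      · exact hH _ hmw
      · exact hH _ (hδm hv)

end MinCE

end PlaneEmbedding

end pentagonColorings

section constrainedSegments

open scoped Classical

variable {V : Type} {G : SimpleGraph V}

namespace PlaneEmbedding

variable {E : PlaneEmbedding G} {H P A : Finset V} {L : V → Finset ℕ} {pl wl : List V}

namespace MinCE

set_option maxHeartbeats 2000000 in
theorem false_of_fourth_mem [Fintype V] (h : E.MinCE H P A L) {w₁ w₂ w₃ w₄ : V} {R : List V}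
    (hf : E.Frame H P pl (w₁ :: w₂ :: w₃ :: w₄ :: R)) (h2 : w₂ ∈ A) (h4 : w₄ ∈ A) : False := by
  obtain ⟨x, hx, y, hy, hxC, hyC, hxw, hyw, hxy⟩ := h.exists_link_of_fourth_mem hf h2 h4
  have hf' : E.Frame H P pl (w₁ :: ([w₂, w₃] ++ w₄ :: R)) := hf
  have hnC := hf.cycle.isCyc.nodup
  have hnw := hnC.of_append_right
  have h31 : w₃ ≠ w₁ := by
    rintro rfl
    simp at hnw
  have hyP : ∀ p ∈ P, ¬ G.Adj y p := by
    intro p hp hyp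
    obtain ⟨γ, δ, hpl⟩ := List.append_of_mem ((hf.mem_iff p).1 hp)
    rw [hpl] at hf' hyC
    exact h31 (h.eq_of_chord hf' (by simp) hy hyC (by simp) hyw hyp).1
  have hw3P : ∀ p ∈ P, ¬ G.Adj w₃ p := fun p hp hwp =>
    h31 (h.eq_of_adj hf' (by simp) hp (by simp) hwp)
  obtain ⟨ψ, hψ, hψ', hψ4⟩ := h.exists_coloring_pentagon hf h2 h4 hx hy hxC hyC hxw hyw hyP
  have hch := hf.isChain.right_of_append
  simp only [List.isChain_cons_cons] at hch
  have h12 := hch.1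
  have h23 := hch.2.1
  have hmem : ∀ {v}, v ∈ [w₁, w₂, w₃, y, x].toFinset ↔
      v = w₁ ∨ v = w₂ ∨ v = w₃ ∨ v = y ∨ v = x := by simp
  have hCn : ∀ {u v}, u ∉ pl ++ w₁ :: w₂ :: w₃ :: w₄ :: R → v ∈ pl ++ w₁ :: w₂ :: w₃ :: w₄ :: R →
      v ≠ u := fun hu hv e => hu (e ▸ hv)
  have hn : [w₁, w₂, w₃, y, x].Nodup := by
    have e1 := hCn hxC (v := w₁) (by simp)
    have e2 := hCn hxC (v := w₂) (by simp)
    have e3 := hCn hxC (v := w₃) (by simp)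
    have e4 := hCn hyC (v := w₁) (by simp)
    have e5 := hCn hyC (v := w₂) (by simp)
    have e6 := hCn hyC (v := w₃) (by simp)
    simp [h12.ne, h31.symm, h23.ne, e1, e2, e3, e4, e5, e6, hxy.ne']
  have hDH : ∀ v ∈ [w₁, w₂, w₃, y, x], v ∈ H := by
    intro v hv
    rcases hmem.1 (List.mem_toFinset.2 hv) with rfl | rfl | rfl | rfl | rfl
    · exact hf.cycle.subset _ (by simp)
    · exact hf.cycle.subset _ (by simp)
    · exact hf.cycle.subset _ (by simp)
    · exact hy
    · exact hx
  have hclose : IsClose G [w₁, w₂, w₃, y, x].toFinset :=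
    isClose_of_pentagon h12 h23 hyw.symm hxy.symm hxw
  have hxR : ∀ {v}, v ∈ w₁ :: w₂ :: w₃ :: w₄ :: R → G.Adj x v → v = w₁ := fun hv hxv =>
    h.eq_of_right hf hx hxC hv (by simp) hxv hxw
  have hyR : ∀ {v}, v ∈ w₁ :: w₂ :: w₃ :: w₄ :: R → G.Adj y v → v = w₃ := fun hv hyv =>
    h.eq_of_right hf hy hyC hv (by simp) hyv hyw
  have hN : ∀ t d d', Touches G H P A [w₁, w₂, w₃, y, x].toFinset t d →
      Touches G H P A [w₁, w₂, w₃, y, x].toFinset t d' → d = d' :=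
    fun t d d' ht ht' => ht.eq h.girth hclose ht'
  have hcase : ∀ {t d}, Touches G H P A [w₁, w₂, w₃, y, x].toFinset t d →
      (d = w₁ ∨ d = w₂ ∨ d = w₃) ∨ d = y ∨ d = x := by
    intro t d ht
    have := hmem.1 ht.mem'
    tauto
  have htC : ∀ {t d}, Touches G H P A [w₁, w₂, w₃, y, x].toFinset t d →
      t ∉ pl ++ w₁ :: w₂ :: w₃ :: w₄ :: R := by
    intro t d ht
    rcases hcase ht with hd | rfl | rfl
    · exact (h.notMem_of_touches hf h4 (fun v hv => hmem.2 (by tauto)) ht hd).1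
    · intro htC
      exact ht.notMem (hmem.2 (by
        rw [hyR (hf.mem_right htC ht.notMem_left) ht.adj.symm]
        tauto))
    · intro htC
      exact ht.notMem (hmem.2 (by
        rw [hxR (hf.mem_right htC ht.notMem_left) ht.adj.symm]
        tauto))
  have hright : ∀ {a}, a ∈ A → a ∉ [w₁, w₂, w₃, y, x].toFinset → a ∈ w₄ :: R := by
    intro a ha haD
    have := h.mem_right_of_mem hf ha
    rw [hmem] at haD
    simp only [List.mem_cons] at this ⊢
    tauto
  have key : ∀ {z d γ p δ}, Touches G H P A [w₁, w₂, w₃, y, x].toFinset z d → G.Adj z p →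
      pl = γ ++ p :: δ → (d = w₁ ∨ d = x ∨ d = y) ∧ δ ≠ [] ∧ 2 ≤ γ.length := by
    intro z d γ p δ hz hzp hpl
    have hzC := htC hz
    subst hpl
    have hpP : p ∈ P := (hf.mem_iff p).2 (by simp)
    rcases hcase hz with hd | rfl | rfl
    · obtain ⟨e1, e2, e3⟩ := h.eq_of_chord hf' (by simp) hz.mem hzC
        (by simp only [List.mem_cons, List.not_mem_nil, or_false]; exact hd) hz.adj hzp
      exact ⟨Or.inl e1, by rintro rfl; simp at e3, by omega⟩
    · have hδ : δ ≠ [] := by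
        rintro rfl
        have hpw : G.Adj p w₁ := by
          have := hf.isChain
          rw [List.append_assoc] at this
          have := this.right_of_append
          simp only [List.singleton_append, List.isChain_cons_cons] at this
          exact this.1
        have hpD : p ∉ [w₁, x, d, w₃, w₂] := by
          intro hp
          have hp' : p ∈ [w₁, w₂, w₃, d, x].toFinset := by
            simp only [List.mem_cons, List.not_mem_nil, or_false] at hp
            rw [hmem]
            tauto
          rcases hmem.1 hp' with e | e | e | e | e
          · exact hf.notMem (by simp) (e ▸ hpP)
          · exact hf.notMem (by simp) (e ▸ hpP)
          · exact hf.notMem (by simp) (e ▸ hpP)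
          · exact hyC (by simp [← e])
          · exact hxC (by simp [← e])
        refine h.false_of_pentagon (a := w₁) (b := x) (c := d) (d := w₃) (e := w₂) (t := p) (t' := z)
          ?_ hxw.symm hxy hyw h23.symm h12.symm ?_ (hf.cycle.subset _ (by simp)) hz.mem hpD ?_ hpw
          hz.adj hzp.symm
        · simp only [List.nodup_cons, List.mem_cons, List.not_mem_nil, or_false, not_or] at hn ⊢
          obtain ⟨⟨-, -, -, -⟩, ⟨-, e1, e2⟩, ⟨-, e3⟩, -⟩ := hn
          simp [h31.symm, h12.ne, h23.ne', hxy.ne, hxw.ne', hyw.ne, Ne.symm e1, Ne.symm e2, Ne.symm e3, hCn hyC (v := w₁) (by simp)]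
        · intro v hv
          refine hDH v ?_
          simp only [List.mem_cons] at hv ⊢
          tauto
        · intro hv
          refine hz.notMem (hmem.2 ?_)
          simp only [List.mem_cons, List.not_mem_nil, or_false] at hv
          tauto
      refine ⟨Or.inr (Or.inr rfl), hδ, ?_⟩
      by_contra! hγ
      exact h.false_of_link_left (α := [w₁, w₂]) (u := w₃) (β := w₄ :: R) hf (by simp) hy hz.mem hyC
        hzC hyw hz.adj.symm hzp (fun v hv => hyP v ((hf.mem_iff v).2 (by simp [hv])))
        (fun v hv => hw3P v ((hf.mem_iff v).2 (by simp [hv]))) (by omega) (by simp) hδ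
    · have hδ : δ ≠ [] := by
        rintro rfl
        have hpw : G.Adj p w₁ := by
          have := hf.isChain
          rw [List.append_assoc] at this
          have := this.right_of_append
          simp only [List.singleton_append, List.isChain_cons_cons] at this
          exact this.1
        exact h.girth.no_square hxw hpw.symm hzp.symm hz.adj
          (show d ≠ p from fun e => hxC (by simp [e])) (show w₁ ≠ z from fun e => hzC (by simp [← e]))
      refine ⟨Or.inr (Or.inl rfl), hδ, ?_⟩
      by_contra! hγ
      refine h.false_of_link_left (α := []) (u := w₁) (β := w₂ :: w₃ :: w₄ :: R) hf (by simp) hx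
        hz.mem hxC hzC hxw hz.adj.symm hzp ?_ (h.not_adj_of_notMem_append hf (by simp)) (by omega)
        (by simp) hδ
      intro v hv hxv
      obtain ⟨γ₁, γ₂, rfl⟩ := List.append_of_mem hv
      have hf2 : E.Frame H P (γ₁ ++ v :: (γ₂ ++ p :: δ)) (w₁ :: ([w₂, w₃] ++ w₄ :: R)) := by
        simpa using hf
      have := (h.eq_of_chord hf2 (by simp) hx (by simpa using hxC) (List.mem_cons_self ..) hxw hxv).2.1
      simp at hγ
      omega
  refine h.false_of_deletion hf (by simp) (D := [w₁, w₂, w₃, y, x].toFinset)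
    (fun v hv => hDH v (List.mem_toFinset.1 hv))
    (conn_of_isChain (by simp [h12, h23, hyw.symm, hxy.symm])) (by simp) ?_ hψ hψ' hN
    (fun t d t' d' ht ht' htt =>
      h.false_of_pentagon' hn h12 h23 hyw.symm hxy.symm hxw hDH ht ht' htt) ?_ ?_ ?_ ?_
  · intro d hd
    rcases hmem.1 hd with rfl | rfl | rfl | rfl | rfl
    · exact hf.notMem (by simp)
    · exact hf.notMem (by simp)
    · exact hf.notMem (by simp)
    · exact fun h' => hyC (List.mem_append.2 (Or.inl ((hf.mem_iff _).1 h')))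
    · exact fun h' => hxC (List.mem_append.2 (Or.inl ((hf.mem_iff _).1 h')))
  · intro t d ht a ha haD hta
    obtain ⟨β₁, β₂, hβ⟩ := List.append_of_mem (hright ha haD)
    have hzC := htC ht
    rcases hcase ht with hd | rfl | rfl
    · exact (h.notMem_of_touches hf h4 (fun v hv => hmem.2 (by tauto)) ht hd).2 a ha haD hta
    · rw [hβ] at hf hyC hzC
      exact h.false_of_link_right (α := [w₁, w₂]) (u := w₃) hf hy ht.mem hyC hzC ha hyw
        ht.adj.symm hta
    · rw [hβ] at hf hxC hzC
      exact h.false_of_link_right (α := []) (u := w₁) (β₁ := w₂ :: w₃ :: β₁) hf hx ht.mem hxC hzC ha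
        hxw ht.adj.symm hta
  · intro a ha haD d hd had
    have haw := h.mem_right_of_mem hf ha
    rw [hmem] at haD
    have hd' : (d = w₁ ∨ d = w₂ ∨ d = w₃) ∨ d = y ∨ d = x := by
      have := hmem.1 hd
      tauto
    rcases hd' with hd' | rfl | rfl
    · rcases h.eq_of_adj_three hf hd' haw had.symm with e | e | e | ⟨rfl, rfl⟩
      · exact (haD (Or.inl e)).elim
      · exact (haD (Or.inr (Or.inl e))).elim
      · exact (haD (Or.inr (Or.inr (Or.inl e)))).elim
      · exact hψ4
    · exact (haD (Or.inr (Or.inr (Or.inl (hyR haw had.symm))))).elim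
    · exact (haD (Or.inl (hxR haw had.symm))).elim
  · intro z d γ p δ hz hzp hpl
    obtain ⟨hd, hδ, hγ⟩ := key hz hzp hpl
    have hzC := htC hz
    have hlen := hf.length_left.trans_le h.card_le
    simp only [hpl, List.length_append, List.length_cons] at hlen
    have hpP : p ∈ P := (hf.mem_iff p).2 (by simp [hpl])
    have hpC : p ∈ pl ++ w₁ :: w₂ :: w₃ :: w₄ :: R := by simp [hpl]
    have hwC : w₁ ∈ pl ++ w₁ :: w₂ :: w₃ :: w₄ :: R := by simp
    have n1 : w₁ ≠ p := fun e => hf.notMem (by simp) (e ▸ hpP)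
    have n2 := hCn hzC hwC
    have n3 := hCn hzC hpC
    have n4 := hCn hxC hwC
    have n5 := hCn hxC hpC
    have n6 := hCn hyC hwC
    have n7 := hCn hyC hpC
    have n8 : z ≠ x := fun e => hz.notMem (hmem.2 (by tauto))
    have n9 : z ≠ y := fun e => hz.notMem (hmem.2 (by tauto))
    have hnw : ∀ {v}, v ∈ [w₁, w₂, w₃, y, x].toFinset → G.Adj z v → v = d := fun hv hzv =>
      hN z _ d ⟨hz.mem, hz.notMem, hz.notMem_left, hz.notMem_right, hv, hzv⟩ hz
    refine ⟨hzC, hδ, ?_⟩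
    rcases hd with rfl | rfl | rfl
    · refine ⟨[], by simp, by simp; omega, isPath_singleton hz.adj.symm hzp n1, ?_⟩
      intro u hu v hv huv
      simp at hu hv
      subst hu
      rcases hv with rfl | rfl | rfl
      · simp [listEdges, Sym2.eq_swap]
      · simp [listEdges]
      · exact absurd huv G.irrefl
    · refine ⟨[d], fun v hv => by rw [List.mem_singleton.1 hv]; exact ⟨hz.mem', hxC⟩, by simp; omega,
        ⟨by simp [n1, n2, n4, n5.symm, n3.symm, n8.symm], by simp [hxw.symm, hz.adj.symm, hzp]⟩, ?_⟩
      have hxp : ¬ G.Adj d p := fun e => h.girth.no_triangle e hzp.symm hz.adj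
      have hzw : ¬ G.Adj z w₁ := fun e => n4 (hnw (by simp) e)
      intro u hu v hv huv
      simp at hu hv
      rcases hu with rfl | rfl <;> rcases hv with rfl | rfl | rfl | rfl
      · simp [listEdges, Sym2.eq_swap]
      · exact absurd huv hxp
      · exact absurd huv G.irrefl
      · simp [listEdges]
      · exact absurd huv hzw
      · simp [listEdges]
      · simp [listEdges, Sym2.eq_swap]
      · exact absurd huv G.irrefl
    · refine ⟨[x, d], ?_, by simp; omega, ⟨by
        simp [n1, n2, n4, n6, n5.symm, n7.symm, n3.symm, n8.symm, n9.symm, hxy.ne], by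
        simp [hxw.symm, hxy, hz.adj.symm, hzp]⟩, ?_⟩
      · intro v hv
        simp only [List.mem_cons, List.not_mem_nil, or_false] at hv
        rcases hv with rfl | rfl
        · exact ⟨by simp, hxC⟩
        · exact ⟨by simp, hyC⟩
      have hyp : ¬ G.Adj d p := hyP p hpP
      have hxp : ¬ G.Adj x p := fun e => h.girth.no_square hxy hz.adj.symm hzp e.symm n8.symm n7.symm
      have hyw1 : ¬ G.Adj d w₁ := fun e => h31 (hyR (by simp) e).symm
      have hzw : ¬ G.Adj z w₁ := fun e => n6 (hnw (by simp) e)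
      have hzx : ¬ G.Adj z x := fun e => hxy.ne (hnw (by simp) e)
      intro u hu v hv huv
      simp at hu hv
      rcases hu with rfl | rfl | rfl <;> rcases hv with rfl | rfl | rfl | rfl | rfl
      · simp [listEdges, Sym2.eq_swap]
      · exact absurd huv hxp
      · exact absurd huv G.irrefl
      · simp [listEdges]
      · exact absurd huv.symm hzx
      · exact absurd huv hyw1
      · exact absurd huv hyp
      · simp [listEdges, Sym2.eq_swap]
      · exact absurd huv G.irrefl
      · simp [listEdges]
      · exact absurd huv hzw
      · simp [listEdges]
      · exact absurd huv hzx
      · simp [listEdges, Sym2.eq_swap]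
      · exact absurd huv G.irrefl
  · intro z d z' d' p hz hz' hp hzp hzp'
    by_contra hne
    obtain ⟨γ, δ, hpl⟩ := List.append_of_mem ((hf.mem_iff p).1 hp)
    obtain ⟨hd, hδ, hγ⟩ := key hz hzp hpl
    obtain ⟨hd', -, -⟩ := key hz' hzp' hpl
    have hzC := htC hz
    have hzC' := htC hz'
    have n1 : z ≠ x := fun e => hz.notMem (hmem.2 (by tauto))
    have n2 : z ≠ y := fun e => hz.notMem (hmem.2 (by tauto))
    have n3 : z' ≠ x := fun e => hz'.notMem (hmem.2 (by tauto))
    have n4 : z' ≠ y := fun e => hz'.notMem (hmem.2 (by tauto))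
    have hdd : d ≠ d' := by
      rintro rfl
      exact h.girth.no_square hz.adj hz'.adj.symm hzp' hzp.symm hne
        (show d ≠ p from fun e => by
          have hpC : p ∈ pl := (hf.mem_iff p).1 hp
          rcases hd with e' | e' | e'
          · exact hf.notMem (x := d) (by simp [e']) (e ▸ hp)
          · exact hxC (by simp [← e', e, hpC])
          · exact hyC (by simp [← e', e, hpC]))
    subst hpl
    have tie := h.false_of_tie hf hγ hδ hx hy hz.mem hz'.mem hxC hyC hzC hzC' hxw hxy hne n1 n2 n3 n4
      hzp hzp'
    have tie' := h.false_of_tie hf hγ hδ hx hy hz'.mem hz.mem hxC hyC hzC' hzC hxw hxy (Ne.symm hne)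
      n3 n4 n1 n2 hzp' hzp
    have a1 := hz.adj
    have a2 := hz'.adj
    rcases hd with rfl | rfl | rfl <;> rcases hd' with rfl | rfl | rfl
    · exact hdd rfl
    · exact tie (Or.inl ⟨a1, a2⟩)
    · exact tie (Or.inr (Or.inl ⟨a1, a2⟩))
    · exact tie' (Or.inl ⟨a2, a1⟩)
    · exact hdd rfl
    · exact tie (Or.inr (Or.inr ⟨a1, a2⟩))
    · exact tie' (Or.inr (Or.inl ⟨a2, a1⟩))
    · exact tie' (Or.inr (Or.inr ⟨a2, a1⟩))
    · exact hdd rfl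

end MinCE

end PlaneEmbedding

end constrainedSegments

section existence

open scoped Classical

variable {V : Type} {G : SimpleGraph V}

theorem girthGeFive_of_isCycle (hG : ∀ (v : V) (c : G.Walk v v), c.IsCycle → 5 ≤ c.length) :
    GirthGeFive G := by
  intro K hK
  obtain ⟨h3, hn, hc⟩ := hK
  rcases K with _ | ⟨a, _ | ⟨b, l⟩⟩
  · simp at h3
  · simp at h3
  rw [closedList_cons, List.cons_append, List.isChain_cons_cons] at hc
  obtain ⟨hab, hc⟩ := hc
  obtain ⟨q, hsup⟩ : ∃ q : G.Walk b a, q.support = b :: (l ++ [a]) :=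
    ⟨(SimpleGraph.Walk.ofSupport (b :: (l ++ [a])) (by simp) hc).copy rfl (by simp),
      (SimpleGraph.Walk.support_copy ..).trans (SimpleGraph.Walk.support_ofSupport ..)⟩
  have hlen : q.length = l.length + 1 := by
    have := q.length_support
    rw [hsup] at this
    simpa using this.symm
  have hcyc : (SimpleGraph.Walk.cons hab q).IsCycle := by
    rw [SimpleGraph.Walk.isCycle_iff_isPath_tail_and_le_length]
    refine ⟨?_, ?_⟩
    · rw [SimpleGraph.Walk.isPath_def, SimpleGraph.Walk.support_tail_of_not_nil _ (by simp),
        SimpleGraph.Walk.support_cons, List.tail_cons, hsup]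
      rwa [show a :: b :: l = [a] ++ (b :: l) by simp, List.nodup_append_comm] at hn
    · simp at h3
      simp [hlen]
      omega
  have := hG a _ hcyc
  simpa [hlen] using this

namespace PlaneEmbedding

variable {E : PlaneEmbedding G} {H P A : Finset V} {L : V → Finset ℕ} {pl wl : List V}

namespace MinCE

theorem false_of_second_mem [Fintype V] (h : E.MinCE H P A L) {w₁ w₂ : V} {β : List V}
    (hf : E.Frame H P pl (w₁ :: w₂ :: β)) (h2 : w₂ ∈ A) : False := by
  have h10 := h.ten_le hf
  have h6 := hf.length_left.trans_le h.card_le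
  rcases β with _ | ⟨w₃, _ | ⟨w₄, R⟩⟩
  · simp at h10
    omega
  · simp at h10
    omega
  by_cases h4 : w₄ ∈ A
  · exact h.false_of_fourth_mem hf h2 h4
  · exact h.false_of_fourth_notMem hf h2 h4

/-- There is no minimal configuration without a colouring. -/
theorem elim [Fintype V] (h : E.MinCE H P A L) : False := by
  obtain ⟨pl, wl, hf⟩ := h.exists_frame
  have h10 := h.ten_le hf
  have h6 := hf.length_left.trans_le h.card_le
  obtain ⟨γ, p, rfl⟩ := (List.eq_nil_or_concat pl).resolve_left hf.left_ne
  rw [List.concat_eq_append] at *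
  rcases wl with _ | ⟨w₁, _ | ⟨w₂, β⟩⟩
  · simp at h10 h6
    omega
  · simp at h10 h6
    omega
  by_cases h2 : w₂ ∈ A
  · exact h.false_of_second_mem hf h2
  refine h.false_of_second_notMem hf h2 ?_
  rintro - α x y hxy hx
  have hr := hf.reverse
  rw [hxy] at hr
  exact h.false_of_second_mem (w₁ := y) (β := α.reverse) (by simpa using hr) hx

end MinCE

theorem Config.listColorable_of_nonempty [Fintype V] (hG : GirthGeFive G)
    (ih : ∀ H' ⊂ H, E.Claim H') (h : E.Config H P A L) (hP : P.Nonempty) :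
    ListColorable G H L := by
  have hsub : ∀ v, ∃ S ⊆ L v, (v ∈ P → S.card = 1) ∧ (v ∉ P → v ∈ A → S.card = 2) ∧
      (v ∉ P → v ∉ A → S = L v) := by
    intro v
    by_cases hvP : v ∈ P
    · obtain ⟨c, hc⟩ := h.nonempty v hvP
      exact ⟨{c}, by simpa using hc, by simp, fun h' => (h' hvP).elim, fun h' => (h' hvP).elim⟩
    by_cases hvA : v ∈ A
    · obtain ⟨S, hS, hcard⟩ := Finset.exists_subset_card_eq (h.two_le v (h.outer' v hvA).1 hvP)
      exact ⟨S, hS, fun h' => (hvP h').elim, fun _ _ => hcard, fun _ h' => (h' hvA).elim⟩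
    · exact ⟨L v, subset_rfl, fun h' => (hvP h').elim, fun _ h' => (hvA h').elim, fun _ _ => rfl⟩
  choose L' hL' h1 h2 h3 using hsub
  by_contra hnot
  refine MinCE.elim (E := E) (H := H) (P := P) (A := A) (L := L') ?_
  refine
    { conn := h.conn
      card_le := h.card_le
      outer := h.outer
      outer' := h.outer'
      disjoint := h.disjoint
      indep := h.indep
      not_adj := h.not_adj
      nonempty := fun v hv => Finset.card_pos.1 (by rw [h1 v hv]; simp)
      list_disjoint := fun u hu v hv huv =>
        (h.list_disjoint u hu v hv huv).mono (hL' u) (hL' v)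
      two_le := fun v hv hvP => ?_
      three_le := fun v hv hvP hvA => by
        rw [h3 v hvP hvA]
        exact h.three_le v hv hvP hvA
      girth := hG
      ih := ih
      card_eq_one := h1
      card_eq_two := fun v hv => h2 v (h.disjoint v hv) hv
      exists_mem := hP
      not_colorable := ?_ }
  · by_cases hvA : v ∈ A
    · exact (h2 v hvP hvA).ge
    · rw [h3 v hvP hvA]
      exact h.two_le v hv hvP
  · rintro ⟨φ, hφ, hφ'⟩
    exact hnot ⟨φ, fun v hv => hL' v (hφ v hv), hφ'⟩

theorem Config.insert [Finite V] (h : E.Config H ∅ A L) {v : V} (hv : E.Outer H v)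
    (hvA : A.Nonempty → v ∈ A) : E.Config H {v} (A.erase v) L where
  conn := conn_singleton v
  card_le := by simp
  outer u hu := by rwa [Finset.mem_singleton.1 hu]
  outer' u hu := h.outer' u (Finset.mem_of_mem_erase hu)
  disjoint u hu hu' := Finset.ne_of_mem_erase hu (Finset.mem_singleton.1 hu')
  indep u hu w hw := h.indep u (Finset.mem_of_mem_erase hu) w (Finset.mem_of_mem_erase hw)
  not_adj u hu w hw := by
    rw [Finset.mem_singleton.1 hw]
    exact h.indep u (Finset.mem_of_mem_erase hu) v (hvA ⟨u, Finset.mem_of_mem_erase hu⟩)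
  nonempty u hu := by
    rw [Finset.mem_singleton.1 hu]
    exact Finset.card_pos.1 (two_pos.trans_le (h.two_le v hv.1 (by simp)))
  list_disjoint u hu w hw huw := by
    rw [Finset.mem_singleton.1 hu, Finset.mem_singleton.1 hw] at huw
    exact absurd huw G.irrefl
  two_le u hu _ := h.two_le u hu (by simp)
  three_le u hu huv huA := h.three_le u hu (by simp) fun h' =>
    huA (Finset.mem_erase.2 ⟨fun e => huv (Finset.mem_singleton.2 e), h'⟩)

theorem claim [Fintype V] (hG : GirthGeFive G) (H : Finset V) : E.Claim H := by
  induction H using Finset.strongInduction with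
  | H H ih =>
    intro P A L h
    rcases P.eq_empty_or_nonempty with rfl | hP
    · rcases H.eq_empty_or_nonempty with rfl | hH
      · exact ⟨fun _ => 0, by simp, by simp⟩
      obtain ⟨v, hv, hvA⟩ : ∃ v, E.Outer H v ∧ (A.Nonempty → v ∈ A) := by
        rcases A.eq_empty_or_nonempty with rfl | ⟨v, hv⟩
        · obtain ⟨v, hv⟩ := E.exists_outer hH
          exact ⟨v, hv, by simp⟩
        · exact ⟨v, h.outer' v hv, fun _ => hv⟩
      exact (h.insert hv hvA).listColorable_of_nonempty hG ih (Finset.singleton_nonempty v)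
    · exact h.listColorable_of_nonempty hG ih hP

end PlaneEmbedding

end existence

/-- Thomassen's girth-5 theorem: every planar graph with no cycle of length
less than 5 is 3-choosable. -/
theorem planar_girth5_3_choosable {V : Type} [Fintype V]
    (G : SimpleGraph V) (hplanar : G.IsPlanar)
    (hgirth : ∀ (v : V) (c : G.Walk v v), c.IsCycle → 5 ≤ c.length)
    (L : V → Finset ℕ) (hL : ∀ v, 3 ≤ (L v).card) :
    ∃ φ : V → ℕ, ProperListColoring G L φ := by
  obtain ⟨E⟩ := hplanar
  obtain ⟨φ, hφ, hφ'⟩ := E.claim (girthGeFive_of_isCycle hgirth) Finset.univ ∅ ∅ L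
    { conn := conn_empty
      card_le := by simp
      outer := by simp
      outer' := by simp
      disjoint := by simp
      indep := by simp
      not_adj := by simp
      nonempty := by simp
      list_disjoint := by simp
      two_le := fun v _ _ => (hL v).trans' (by simp)
      three_le := fun v _ _ _ => hL v }
  exact ⟨φ, fun v => hφ v (Finset.mem_univ v), fun u v => hφ' u (Finset.mem_univ u) v
    (Finset.mem_univ v)⟩
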